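/- Let n ≥ 6 be a natural number. Then for every continuous map f ∈ C(S^{4n+1}, Γ_{2n+1}⁺), the homotopy group π₆(C(S^{4n+1}, Γ_{2n+1}⁺), f) contains a subgroup isomorphic to ℤ × ℤ. -/

import Mathlib

open Topology

/-- The unit sphere `S^m ⊆ ℝ^{m+1}` centered at the origin. -/
noncomputable def Sph (m : ℕ) : Set (EuclideanSpace ℝ (Fin (m + 1))) :=
  Metric.sphere (0 : EuclideanSpace ℝ (Fin (m + 1))) 1

/-- The north pole `N = (0, …, 0, 1) ∈ S^m`. -/
noncomputable def northPole (m : ℕ) : Sph m :=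
  ⟨EuclideanSpace.single (Fin.last m) (1 : ℝ), by
    simp [Sph, EuclideanSpace.norm_single]⟩

/-- The space `Γ_n` of orthogonal complex structures on `ℝ^{2n}`: real `(2n) × (2n)` matrices
`J` (with `Fin (2n)` identified with `Fin n ⊕ Fin n`) such that `Jᵀ * J = 1` and `J * J = -1`,
with the subspace topology. -/
def Gamma (n : ℕ) : Set (Matrix (Fin n ⊕ Fin n) (Fin n ⊕ Fin n) ℝ) :=
  {J | J.transpose * J = 1 ∧ J * J = -1}

/-- The standard complex structure `J₀` on `ℝ^{2n}`, given by the block matrix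
`[[0, -1], [1, 0]]`. -/
def J0 (n : ℕ) : Matrix (Fin n ⊕ Fin n) (Fin n ⊕ Fin n) ℝ :=
  Matrix.fromBlocks 0 (-1) 1 0

theorem J0_mem (n : ℕ) : J0 n ∈ Gamma n := by
  constructor
  · simp [J0, Matrix.fromBlocks_transpose, Matrix.fromBlocks_multiply, ← Matrix.fromBlocks_one]
  · have h : (-1 : Matrix (Fin n ⊕ Fin n) (Fin n ⊕ Fin n) ℝ)
        = Matrix.fromBlocks (-1) (-0) (-0) (-1) := by
      rw [← Matrix.fromBlocks_neg, Matrix.fromBlocks_one]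
    simp [J0, Matrix.fromBlocks_multiply, h]

/-- `Γ_n⁺`: the path component of the standard complex structure `J₀` in `Γ_n`
(the homogeneous space `SO(2n)/U(n)`). -/
noncomputable def GammaPlus (n : ℕ) : Set (Gamma n) :=
  pathComponent (⟨J0 n, J0_mem n⟩ : Gamma n)

/-- `Γ_n⁺` pointed at `J₀`. -/
noncomputable def J0plus (n : ℕ) : GammaPlus n :=
  ⟨⟨J0 n, J0_mem n⟩, mem_pathComponent_self _⟩

namespace ACS
open Matrix MeasureTheory
open Metric (sphere closedBall)
open Complex (I ofRealHom)
open Real (pi smoothTransition)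
open Finset (sum_congr sum_comm smul_sum sum_mul sum_neg_distrib mul_sum sum_add_distrib sum_eq_zero sum_smul single_le_sum sum_eq_single sum_const)
open Polynomial (nthRootsFinset mem_nthRootsFinset)
open scoped ContDiff

/-- Real matrices of the size of those in `Γ_m`. -/
notation "OCMat" m:max => Matrix (Fin m ⊕ Fin m) (Fin m ⊕ Fin m) ℝ

section Newton
variable {Z : Type} [CommRing Z] [Algebra ℚ Z]

/-- Newton's recursion: the elementary symmetric functions in terms of the power sums `p`. -/
noncomputable def newton (p : ℕ → Z) : ℕ → Z
  | 0 => 1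
  | r + 1 => ((r + 1 : ℚ)⁻¹) • ∑ k : Fin (r + 1), (-1) ^ (k : ℕ) * (newton p (r - k) * p (k + 1))

@[simp] theorem newton_zero (p : ℕ → Z) : newton p 0 = 1 := by rw [newton]

theorem newton_succ (p : ℕ → Z) (r : ℕ) :
    ((r : Z) + 1) * newton p (r + 1) =
      ∑ k ∈ Finset.range (r + 1), (-1) ^ k * (newton p (r - k) * p (k + 1)) := by
  have h1 : ((r : Z) + 1) * algebraMap ℚ Z ((r + 1 : ℚ)⁻¹) = 1 := by
    rw [show ((r : Z) + 1) = algebraMap ℚ Z (r + 1) by simp, ← map_mul,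
      mul_inv_cancel₀ (by positivity), map_one]
  rw [newton, Finset.sum_range, Algebra.smul_def, ← mul_assoc, h1, one_mul]

theorem newton_unique (p : ℕ → Z) (D : ℕ → Z) (h0 : D 0 = 1)
    (h : ∀ r : ℕ, ((r : Z) + 1) * D (r + 1) =
      ∑ k ∈ Finset.range (r + 1), (-1) ^ k * (D (r - k) * p (k + 1))) (r : ℕ) :
    D r = newton p r := by
  induction r using Nat.strong_induction_on with
  | _ r ih =>
    cases r with
    | zero => simp [h0]
    | succ r =>
      have hu : IsUnit ((r : Z) + 1) := by
        rw [show ((r : Z) + 1) = algebraMap ℚ Z (r + 1) by simp]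
        exact (IsUnit.mk0 (r + 1 : ℚ) (by positivity)).map _
      apply hu.mul_left_cancel
      rw [h, newton_succ]
      refine sum_congr rfl fun k hk => ?_
      rw [ih (r - k) (by omega)]

theorem newton_congr (p q : ℕ → Z) (r : ℕ) (h : ∀ k, 1 ≤ k → k ≤ r → p k = q k) :
    newton p r = newton q r := by
  induction r using Nat.strong_induction_on with
  | _ r ih =>
    cases r with
    | zero => simp
    | succ r =>
      rw [newton, newton]
      congr 1
      refine sum_congr rfl fun k _ => ?_
      rw [ih (r - k) (by omega) (fun j h1 h2 => h j h1 (by omega)), h (k + 1) (by omega) (by omega)]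

theorem newton_add (p q : ℕ → Z) (r : ℕ) :
    newton (p + q) r = ∑ ab ∈ Finset.HasAntidiagonal.antidiagonal r, newton p ab.1 * newton q ab.2 := by
  let S : (ℕ → Z) → PowerSeries Z := fun p => PowerSeries.mk fun k => (-1) ^ k * p (k + 1)
  have key : ∀ (p : ℕ → Z), PowerSeries.derivative Z (PowerSeries.mk (newton p)) =
      S p * PowerSeries.mk (newton p) := by
    intro p
    ext r
    rw [PowerSeries.coeff_derivative, PowerSeries.coeff_mul, PowerSeries.coeff_mk,
      mul_comm, newton_succ, Finset.Nat.sum_antidiagonal_eq_sum_range_succ_mk]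
    refine sum_congr rfl fun k _ => ?_
    simp only [S, PowerSeries.coeff_mk]
    ring
  have h2 := newton_unique (p + q)
    (fun r => PowerSeries.coeff r (PowerSeries.mk (newton p) * PowerSeries.mk (newton q)))
    (by simp [PowerSeries.coeff_mul]) (by
      intro r
      have : PowerSeries.derivative Z (PowerSeries.mk (newton p) * PowerSeries.mk (newton q)) =
          S (p + q) * (PowerSeries.mk (newton p) * PowerSeries.mk (newton q)) := by
        rw [Derivation.leibniz, key, key,
          show S (p + q) = S p + S q by ext k; simp [S, mul_add]]
        simp only [smul_eq_mul]
        ring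
      have h3 := congrArg (PowerSeries.coeff r) this
      rw [PowerSeries.coeff_derivative, PowerSeries.coeff_mul (φ := S (p + q)),
        Finset.Nat.sum_antidiagonal_eq_sum_range_succ_mk] at h3
      rw [mul_comm, h3]
      refine sum_congr rfl fun k _ => ?_
      simp only [S, PowerSeries.coeff_mk]
      ring) r
  rw [← h2, PowerSeries.coeff_mul]
  simp

end Newton

section Trace
open Matrix Polynomial
variable {Z : Type} [CommRing Z] {ι : Type} [Fintype ι] [DecidableEq ι]

theorem derivative_det (A : Matrix ι ι Z[X]) :
    derivative A.det = (A.adjugate * A.map derivative).trace := by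
  have h1 : derivative A.det = ∑ i, (A.updateCol i fun j => derivative (A j i)).det := by
    simp only [det_apply, derivative_sum]
    rw [sum_comm]
    refine sum_congr rfl fun σ _ => ?_
    rw [← smul_sum, Units.smul_def, derivative_smul, ← Units.smul_def, derivative_prod_finset]
    congr 1
    refine sum_congr rfl fun i _ => ?_
    rw [← Finset.mul_prod_erase Finset.univ _ (Finset.mem_univ i), updateCol_self, mul_comm]
    congr 1
    refine Finset.prod_congr rfl fun j hj => ?_
    rw [updateCol_ne (Finset.ne_of_mem_erase hj)]
  rw [h1]
  simp only [trace, diag, mul_apply]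
  refine sum_congr rfl fun i _ => ?_
  rw [← cramer_apply, cramer_eq_adjugate_mulVec]
  rfl

theorem newton_trace_eq_zero [Algebra ℚ Z] (M : Matrix ι ι Z) (r : ℕ) (hr : Fintype.card ι < r) :
    newton (fun k => (M ^ k).trace) r = 0 := by
  set A : Matrix ι ι Z[X] := (X : Z[X]) • M.map C + (1 : Matrix ι ι Z).map C with hA
  have hdeg : A.det.natDegree ≤ Fintype.card ι := natDegree_det_X_add_C_le M 1
  have hder : A.map derivative = M.map C := by
    ext i j : 2
    by_cases h : i = j <;> simp [hA, h, Matrix.one_apply]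
  let B : ℕ → Matrix ι ι Z := fun j => A.adjugate.map fun p => p.coeff j
  have hmul : A.adjugate * A = A.det • 1 := adjugate_mul A
  have hA' : A.adjugate * A = (X : Z[X]) • (A.adjugate * M.map C) + A.adjugate := by
    rw [hA, mul_add, mul_smul_comm, Matrix.map_one _ (map_zero _) (map_one _), mul_one]
  have hcoef : ∀ (j : ℕ), (A.adjugate * M.map C).map (fun p => p.coeff j) = B j * M := by
    intro j
    ext a b
    simp [B, mul_apply, finsetSum_coeff]
  have hB0 : B 0 = A.det.coeff 0 • 1 := by
    have h := hA'.symm.trans hmul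
    ext a b
    have h2 := congrArg (fun N => (N a b : Z[X]).coeff 0) h
    simp only [Matrix.add_apply, Matrix.smul_apply, smul_eq_mul, coeff_add, mul_coeff_zero, coeff_X_zero,
      zero_mul, zero_add] at h2
    simp only [B, map_apply, h2, Matrix.smul_apply, smul_eq_mul, one_apply]
    split_ifs <;> simp
  have hBs : ∀ j, B (j + 1) = A.det.coeff (j + 1) • 1 - B j * M := by
    intro j
    have h := hA'.symm.trans hmul
    rw [← hcoef]
    ext a b
    have h2 := congrArg (fun N => (N a b : Z[X]).coeff (j + 1)) h
    simp only [Matrix.add_apply, Matrix.smul_apply, smul_eq_mul, coeff_add, coeff_X_mul] at h2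
    simp only [B, map_apply, Matrix.sub_apply, Matrix.smul_apply, smul_eq_mul]
    rw [eq_sub_iff_add_eq, add_comm, h2, one_apply, one_apply]
    split_ifs <;> simp
  have hB : ∀ j, B j = ∑ l ∈ Finset.range (j + 1), ((-1) ^ l * A.det.coeff (j - l)) • M ^ l := by
    intro j
    induction j with
    | zero => simp [hB0]
    | succ j ih =>
      rw [hBs, ih, Finset.sum_range_succ' _ (j + 1), sum_mul, sub_eq_add_neg, add_comm,
        ← sum_neg_distrib]
      congr 1
      · refine sum_congr rfl fun l _ => ?_
        rw [smul_mul_assoc, ← pow_succ, ← neg_smul, Nat.add_sub_add_right, pow_succ]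
        congr 1
        ring
      · simp
  rw [← newton_unique _ (fun r => A.det.coeff r) ?_ ?_ r]
  · exact coeff_eq_zero_of_natDegree_lt (hdeg.trans_lt hr)
  · rw [coeff_zero_eq_eval_zero, ← coe_evalRingHom, RingHom.map_det]
    rw [show (evalRingHom 0).mapMatrix A = 1 by
      ext a b
      by_cases h : a = b <;> simp [hA, h, one_apply], det_one]
  · intro r
    have h := congrArg (fun p : Z[X] => p.coeff r) (derivative_det A)
    simp only [coeff_derivative, hder] at h
    rw [mul_comm, h]
    have : (A.adjugate * M.map C).trace.coeff r = (B r * M).trace := by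
      rw [← hcoef]
      simp [trace, finsetSum_coeff]
    rw [this, hB, sum_mul, trace_sum]
    refine sum_congr rfl fun k _ => ?_
    rw [smul_mul_assoc, ← pow_succ, trace_smul, smul_eq_mul, mul_assoc]

end Trace

/-- Anticommuting generators `e` whose pairwise products come from the central ring `Z`. -/
structure OddGen {Z 𝔸 κ : Type} [CommRing Z] [Ring 𝔸] [Algebra Z 𝔸] (e : κ → 𝔸)
    (zz : κ → κ → Z) : Prop where
  map_zz : ∀ a b, algebraMap Z 𝔸 (zz a b) = e a * e b
  anti : ∀ a b, e a * e b = -(e b * e a)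
  inj : Function.Injective (algebraMap Z 𝔸)

section
variable {Z 𝔸 κ ι : Type} [CommRing Z] [Algebra ℂ Z] [Ring 𝔸] [Algebra Z 𝔸] [Fintype κ]
  [Fintype ι] [DecidableEq ι]

/-- The curvature `∑ e_a e_b Q_a Q_b` attached to a family of matrices. -/
noncomputable def curv (zz : κ → κ → Z) (Q : κ → Matrix ι ι ℂ) : Matrix ι ι Z :=
  ∑ a, ∑ b, zz a b • ((Q a).map (algebraMap ℂ Z) * (Q b).map (algebraMap ℂ Z))

/-- `tr (P Ω ^ k)`. -/
noncomputable def chern (zz : κ → κ → Z) (P : Matrix ι ι ℂ) (Q : κ → Matrix ι ι ℂ) (k : ℕ) : Z :=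
  (P.map (algebraMap ℂ Z) * curv zz Q ^ k).trace

variable {e : κ → 𝔸} {zz : κ → κ → Z}

theorem OddGen.zz_anti (h : OddGen e zz) (a b : κ) : zz a b = -zz b a := by
  apply h.inj
  rw [map_neg, h.map_zz, h.map_zz, h.anti]

theorem curv_zero : curv zz (fun _ => (0 : Matrix ι ι ℂ)) = 0 := by
  simp [curv]

theorem chern_zero_deriv (P : Matrix ι ι ℂ) {k : ℕ} (hk : k ≠ 0) :
    chern zz P (fun _ => 0) k = 0 := by
  simp [chern, curv_zero, hk]

theorem map_one_sub (P : Matrix ι ι ℂ) :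
    (1 - P).map (algebraMap ℂ Z) = 1 - P.map (algebraMap ℂ Z) := by
  rw [Matrix.map_sub _ (fun _ _ => map_sub _ _ _),
    Matrix.map_one _ (map_zero _) (map_one _)]

theorem map_mul' (P Q : Matrix ι ι ℂ) :
    (P * Q).map (algebraMap ℂ Z) = P.map (algebraMap ℂ Z) * Q.map (algebraMap ℂ Z) :=
  Matrix.map_mul

/-- First order condition on the derivatives of a family of idempotents. -/
structure Tangent (P : Matrix ι ι ℂ) (Q : κ → Matrix ι ι ℂ) : Prop where
  idem : P * P = P
  tan : ∀ a, P * Q a + Q a * P = Q a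

theorem Tangent.comm_curv {P : Matrix ι ι ℂ} {Q : κ → Matrix ι ι ℂ} (h : Tangent P Q) :
    Commute (P.map (algebraMap ℂ Z)) (curv zz Q) := by
  refine Commute.sum_right _ _ _ fun a _ => Commute.sum_right _ _ _ fun b _ =>
    Commute.smul_right ?_ _
  rw [← map_mul', Commute, SemiconjBy, ← map_mul', ← map_mul']
  congr 1
  have h1 : P * Q a = Q a - Q a * P := eq_sub_of_add_eq (h.tan a)
  have h2 : P * Q b = Q b - Q b * P := eq_sub_of_add_eq (h.tan b)
  rw [← mul_assoc, h1, sub_mul, mul_assoc, mul_assoc, h2]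
  noncomm_ring

theorem Tangent.comm_curv_pow {P : Matrix ι ι ℂ} {Q : κ → Matrix ι ι ℂ} (h : Tangent P Q) (k : ℕ) :
    Commute (P.map (algebraMap ℂ Z)) (curv zz Q ^ k) := h.comm_curv.pow_right k

/-- Rank bound: the elementary symmetric functions vanish above the rank. -/
theorem newton_chern_eq_zero [Algebra ℚ Z] {P : Matrix ι ι ℂ} {Q : κ → Matrix ι ι ℂ}
    (h : Tangent P Q) {μ : Type} [Fintype μ] [DecidableEq μ] (A : Matrix ι μ ℂ)
    (B : Matrix μ ι ℂ) (hAB : A * B = P) (hBA : B * A = 1) (r : ℕ) (hr : Fintype.card μ < r) :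
    newton (chern zz P Q) r = 0 := by
  set A' := A.map (algebraMap ℂ Z)
  set B' := B.map (algebraMap ℂ Z)
  set P' := P.map (algebraMap ℂ Z)
  set Ω := curv zz Q
  have hAB' : A' * B' = P' := (Matrix.map_mul).symm.trans (by rw [hAB])
  have hBA' : B' * A' = 1 := by
    refine (Matrix.map_mul).symm.trans ?_
    rw [hBA, Matrix.map_one _ (map_zero _) (map_one _)]
  have hc : ∀ k, P' * Ω ^ k = Ω ^ k * P' := fun k => h.comm_curv_pow k
  have hpow : ∀ k, (B' * Ω * A') ^ k = B' * Ω ^ k * A' := by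
    intro k
    induction k with
    | zero => simp [hBA']
    | succ k ih =>
      have hPA : P' * A' = A' := by rw [← hAB', Matrix.mul_assoc, hBA', Matrix.mul_one]
      rw [pow_succ, ih]
      calc B' * Ω ^ k * A' * (B' * Ω * A') = B' * Ω ^ k * ((A' * B') * Ω) * A' := by
            simp only [Matrix.mul_assoc]
        _ = B' * Ω ^ k * (Ω * (P' * A')) := by
            rw [hAB', show P' * Ω = Ω * P' by simpa using hc 1]
            simp only [Matrix.mul_assoc]
        _ = _ := by rw [hPA, pow_succ]; simp only [Matrix.mul_assoc]
  rw [← newton_trace_eq_zero (B' * Ω * A') r hr]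
  congr 1
  ext k
  rw [hpow, Matrix.mul_assoc, trace_mul_comm, Matrix.mul_assoc, hAB', ← hc]
  rfl

/-- The matrix `∑ e_a Q_a` of odd elements. -/
noncomputable def oddMat (e : κ → 𝔸) (Q : κ → Matrix ι ι Z) : Matrix ι ι 𝔸 :=
  fun i j => ∑ a, e a * algebraMap Z 𝔸 (Q a i j)

theorem oddMat_mul_map (Q : κ → Matrix ι ι Z) (M : Matrix ι ι Z) :
    oddMat e Q * M.map (algebraMap Z 𝔸) = oddMat e fun a => Q a * M := by
  ext i j
  simp only [oddMat, mul_apply, map_apply, map_sum, map_mul, mul_sum, sum_mul,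
    mul_assoc]
  exact sum_comm

theorem map_mul_oddMat (Q : κ → Matrix ι ι Z) (M : Matrix ι ι Z) :
    M.map (algebraMap Z 𝔸) * oddMat e Q = oddMat e fun a => M * Q a := by
  ext i j
  simp only [oddMat, mul_apply, map_apply, map_sum, map_mul, mul_sum]
  rw [sum_comm]
  refine sum_congr rfl fun k _ => sum_congr rfl fun a _ => ?_
  rw [← mul_assoc, ← mul_assoc, Algebra.commutes]

theorem trace_oddMat (Q : κ → Matrix ι ι Z) :
    (oddMat e Q).trace = ∑ a, e a * algebraMap Z 𝔸 (Q a).trace := by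
  simp only [trace, diag, oddMat, map_sum, mul_sum]
  exact sum_comm

theorem OddGen.oddMat_mul_oddMat (h : OddGen e zz) (Q R : κ → Matrix ι ι Z) :
    oddMat e Q * oddMat e R = (∑ a, ∑ b, zz a b • (Q a * R b)).map (algebraMap Z 𝔸) := by
  ext i j
  simp only [oddMat, mul_apply, map_apply, Matrix.sum_apply, Matrix.smul_apply, smul_eq_mul,
    map_sum, map_mul, h.map_zz, mul_sum, sum_mul]
  rw [sum_comm]
  conv_lhs => enter [2, b]; rw [sum_comm]
  rw [sum_comm]
  refine sum_congr rfl fun a _ => sum_congr rfl fun b _ =>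
    sum_congr rfl fun k _ => ?_
  rw [mul_assoc, ← mul_assoc (algebraMap Z 𝔸 _) (e b), Algebra.commutes]
  simp only [mul_assoc]

variable {P : Matrix ι ι ℂ} {Q : κ → Matrix ι ι ℂ}

theorem OddGen.map_curv (h : OddGen e zz) : (curv zz Q).map (algebraMap Z 𝔸) =
    oddMat e (fun a => (Q a).map (algebraMap ℂ Z)) *
      oddMat e (fun a => (Q a).map (algebraMap ℂ Z)) := by
  rw [h.oddMat_mul_oddMat, curv]

theorem OddGen.sum_zz_pow (h : OddGen e zz) (k : ℕ) :
    ∑ a, ∑ b, zz a b • ((Q a).map (algebraMap ℂ Z) * curv zz Q ^ k * (Q b).map (algebraMap ℂ Z))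
      = curv zz Q ^ (k + 1) := by
  have hinj : Function.Injective fun M : Matrix ι ι Z => M.map (algebraMap Z 𝔸) :=
    Matrix.map_injective h.inj
  apply hinj
  have hp : ∀ k, (curv zz Q ^ k).map (algebraMap Z 𝔸) =
      (curv zz Q).map (algebraMap Z 𝔸) ^ k := fun k => map_pow (algebraMap Z 𝔸).mapMatrix _ k
  simp only
  rw [← h.oddMat_mul_oddMat (fun a => (Q a).map (algebraMap ℂ Z) * curv zz Q ^ k),
    ← oddMat_mul_map, hp, hp, h.map_curv, ← pow_two, ← pow_mul, ← pow_mul, ← pow_succ', ← pow_succ]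
  congr 1

theorem OddGen.trace_curv_pow (h : OddGen e zz) {k : ℕ} (hk : k ≠ 0) :
    (curv zz Q ^ k).trace = 0 := by
  obtain ⟨k, rfl⟩ := Nat.exists_eq_succ_of_ne_zero hk
  have h1 : (curv zz Q ^ (k + 1)).trace = -(curv zz Q ^ (k + 1)).trace := by
    conv_rhs => rw [← h.sum_zz_pow]
    conv_lhs => rw [pow_succ', curv, sum_mul]
    simp only [sum_mul, trace_sum, trace_smul, smul_mul_assoc, ← sum_neg_distrib]
    rw [sum_comm]
    refine sum_congr rfl fun a _ => sum_congr rfl fun b _ => ?_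
    rw [mul_assoc, trace_mul_comm, h.zz_anti b a, neg_smul]
    rfl
  have h2 : (2 : ℂ) • (curv zz Q ^ (k + 1)).trace = 0 := by
    rw [two_smul]; nth_rewrite 1 [h1]; exact neg_add_cancel _
  exact (smul_eq_zero_iff_right (two_ne_zero)).1 h2

/-- The even Chern characters of families of isotropic idempotents vanish. -/
theorem OddGen.chern_even (h : OddGen e zz) (hP : Pᵀ = 1 - P)
    (hQ : ∀ a, (Q a)ᵀ = -Q a) {k : ℕ} (hk : k ≠ 0) (hk2 : Even k) : chern zz P Q k = 0 := by
  have hΩ : (curv zz Q)ᵀ = -curv zz Q := by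
    rw [curv, transpose_sum]
    simp only [transpose_sum, transpose_smul, transpose_mul, ← transpose_map, hQ]
    rw [sum_comm, ← sum_neg_distrib]
    refine sum_congr rfl fun a _ => ?_
    rw [← sum_neg_distrib]
    refine sum_congr rfl fun b _ => ?_
    rw [h.zz_anti b a, Matrix.map_neg _ (fun x => map_neg _ x),
      Matrix.map_neg _ (fun x => map_neg _ x), neg_mul_neg, neg_smul]
  have h1 : chern zz P Q k = (curv zz Q ^ k).trace - chern zz P Q k := by
    conv_lhs => rw [chern, ← trace_transpose, transpose_mul, transpose_pow, hΩ, hk2.neg_pow,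
      ← transpose_map, hP, map_one_sub, mul_sub, mul_one, trace_sub, trace_mul_comm]
    rfl
  rw [h.trace_curv_pow hk, zero_sub] at h1
  have h2 : (2 : ℂ) • chern zz P Q k = 0 := by
    rw [two_smul]; nth_rewrite 1 [h1]; exact neg_add_cancel _
  exact (smul_eq_zero_iff_right (two_ne_zero)).1 h2

/-- `tr (dP Ω ^ k) = 0`. -/
theorem Tangent.trace_deriv_mul (hT : Tangent P Q) (a : κ) (k : ℕ) :
    ((Q a).map (algebraMap ℂ Z) * curv zz Q ^ k).trace = 0 := by
  set P' := P.map (algebraMap ℂ Z)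
  set q := (Q a).map (algebraMap ℂ Z)
  have hq : P' * q + q * P' = q := by
    rw [← map_mul', ← map_mul', ← Matrix.map_add _ (fun _ _ => map_add _ _ _), hT.tan]
  have hi : P' * P' = P' := by rw [← map_mul', hT.idem]
  have hc : P' * curv zz Q ^ k = curv zz Q ^ k * P' := hT.comm_curv_pow k
  have hpq : P' * q * P' = 0 := by
    have := congrArg (P' * ·) hq
    simp only [mul_add, ← mul_assoc, hi] at this
    simpa using this
  have h1 : (P' * (q * curv zz Q ^ k)).trace = 0 := by
    rw [← hi, mul_assoc, trace_mul_comm, mul_assoc, mul_assoc, ← hc, ← mul_assoc q, ← mul_assoc,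
      ← mul_assoc, hpq, zero_mul, trace_zero]
  have h2 : (q * P' * curv zz Q ^ k).trace = 0 := by
    rw [mul_assoc, hc, ← mul_assoc, trace_mul_comm, h1]
  rw [← hq, add_mul, trace_add, h2, mul_assoc, h1, add_zero]

end

section
variable {Z 𝔸 κ : Type} [NormedCommRing Z] [NormedAlgebra ℂ Z] [FiniteDimensional ℂ Z] [Ring 𝔸]
  [Algebra Z 𝔸] [Algebra ℂ 𝔸] [IsScalarTower ℂ Z 𝔸] [Fintype κ]
  {V : Type} [NormedAddCommGroup V] [NormedSpace ℝ V]

/-- Closedness of an even form `w` with respect to the odd generators `e` dual to `β`. -/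
def IsClosedForm (e : κ → 𝔸) (β : κ → V) (w : V → Z) : Prop :=
  ∀ x, ∑ k, e k * algebraMap Z 𝔸 (fderiv ℝ w x (β k)) = 0

variable {e : κ → 𝔸} {β : κ → V} {w η : V → Z}

theorem IsClosedForm.const (c : Z) : IsClosedForm e β (fun _ : V => c) := by
  intro x; simp

theorem IsClosedForm.add (hw : IsClosedForm e β w) (hη : IsClosedForm e β η)
    (h1 : ContDiff ℝ ∞ w) (h2 : ContDiff ℝ ∞ η) : IsClosedForm e β (fun x => w x + η x) := by
  intro x
  have : fderiv ℝ (fun x => w x + η x) x = fderiv ℝ w x + fderiv ℝ η x :=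
    fderiv_fun_add (h1.differentiable (by simp) x) (h2.differentiable (by simp) x)
  simp only [this, ContinuousLinearMap.add_apply, map_add, mul_add, sum_add_distrib, hw x,
    hη x, add_zero]

theorem IsClosedForm.mul (hw : IsClosedForm e β w) (hη : IsClosedForm e β η)
    (h1 : ContDiff ℝ ∞ w) (h2 : ContDiff ℝ ∞ η) : IsClosedForm e β (fun x => w x * η x) := by
  intro x
  have : fderiv ℝ (fun x => w x * η x) x = w x • fderiv ℝ η x + η x • fderiv ℝ w x :=
    fderiv_fun_mul (h1.differentiable (by simp) x) (h2.differentiable (by simp) x)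
  have h3 : ∀ k, e k * algebraMap Z 𝔸 (fderiv ℝ (fun x => w x * η x) x (β k)) =
      algebraMap Z 𝔸 (w x) * (e k * algebraMap Z 𝔸 (fderiv ℝ η x (β k))) +
        algebraMap Z 𝔸 (η x) * (e k * algebraMap Z 𝔸 (fderiv ℝ w x (β k))) := by
    intro k
    rw [this]
    simp only [ContinuousLinearMap.add_apply, ContinuousLinearMap.smul_apply, smul_eq_mul,
      map_add, map_mul, mul_add]
    rw [← mul_assoc, ← mul_assoc, ← mul_assoc, ← mul_assoc, Algebra.commutes, Algebra.commutes]
  simp only [h3, sum_add_distrib, ← mul_sum, hw x, hη x, mul_zero, add_zero]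

theorem IsClosedForm.sum {α : Type} (s : Finset α) {w : α → V → Z}
    (h : ∀ a, IsClosedForm e β (w a)) (h1 : ∀ a, ContDiff ℝ ∞ (w a)) :
    IsClosedForm e β (fun x => ∑ a ∈ s, w a x) := by
  classical
  induction s using Finset.induction_on with
  | empty => simpa using IsClosedForm.const (V := V) (e := e) (β := β) (0 : Z)
  | insert a s ha ih =>
    simp only [Finset.sum_insert ha]
    exact (h a).add ih (h1 a) (ContDiff.sum fun i _ => h1 i)

/-- The directions on `V × ℝ`; the extra generator is dual to the parameter. -/
def optDir (b : κ → V) : Option κ → V × ℝ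
  | none => (0, 1)
  | some a => (b a, 0)

variable [FiniteDimensional ℝ V] [MeasurableSpace V] [BorelSpace V] (μ : Measure V)
  [μ.IsAddHaarMeasure]

theorem integral_fderiv_eq_zero {F : V → ℂ} (hF : ContDiff ℝ ∞ F) (hc : HasCompactSupport F)
    (v : V) : ∫ x, fderiv ℝ F x v ∂μ = 0 := by
  have h := integral_smul_fderiv_eq_neg_fderiv_smul_of_integrable (μ := μ) (𝕜 := ℂ)
    (f := fun _ : V => (1 : ℂ)) (g := F) (v := v) (by simp)
    (by
      simp only [one_smul]
      refine Continuous.integrable_of_hasCompactSupport ?_ ?_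
      · exact (hF.continuous_fderiv (by simp)).clm_apply continuous_const
      · exact (hc.fderiv (𝕜 := ℝ)).comp_left (g := fun L : V →L[ℝ] ℂ => L v) (by simp))
    (by simpa using hF.continuous.integrable_of_hasCompactSupport hc)
    (by simp) (fun x _ => hF.differentiable (by simp) x)
  simpa using h

/-- The linear functional `c ↦ ℓ (a * c)`. -/
noncomputable def mulFun (ℓ : 𝔸 →ₗ[ℂ] ℂ) (a : 𝔸) : Z →L[ℂ] ℂ :=
  LinearMap.toContinuousLinearMap
    (ℓ ∘ₗ LinearMap.mulLeft ℂ a ∘ₗ (IsScalarTower.toAlgHom ℂ Z 𝔸).toLinearMap)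

@[simp] theorem mulFun_apply (ℓ : 𝔸 →ₗ[ℂ] ℂ) (a : 𝔸) (c : Z) :
    mulFun ℓ a c = ℓ (a * algebraMap Z 𝔸 c) := rfl

/-- Homotopy invariance of the integral of a closed form. -/
theorem integral_slice_eq {e : Option κ → 𝔸} {b : κ → V} {w : V × ℝ → Z}
    (hw : ContDiff ℝ ∞ w) (hcl : IsClosedForm e (optDir b) w) {K : Set V} (hK : IsCompact K)
    (hKw : ∀ x ∉ K, ∀ t, w (x, t) = 0) (ℓ : 𝔸 →ₗ[ℂ] ℂ) (s t : ℝ) :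
    ∫ x, mulFun ℓ (e none) (w (x, s)) ∂μ = ∫ x, mulFun ℓ (e none) (w (x, t)) ∂μ := by
  have hL : ∀ (a : 𝔸), ContDiff ℝ ∞ fun p => mulFun ℓ a (w p) := fun a => by
    have h : ContDiff ℝ ∞ ((mulFun ℓ a : Z →L[ℂ] ℂ).restrictScalars ℝ) :=
      ContinuousLinearMap.contDiff _
    exact h.comp hw
  have hsl : ∀ t : ℝ, ContDiff ℝ ∞ fun x : V => (x, t) := fun t =>
    contDiff_id.prodMk contDiff_const
  have hcs : ∀ (a : 𝔸) (t : ℝ), HasCompactSupport fun x => mulFun ℓ a (w (x, t)) := fun a t =>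
    HasCompactSupport.intro hK fun x hx => by simp [hKw x hx]
  have hint : ∀ (t : ℝ), Integrable (fun x => mulFun ℓ (e none) (w (x, t))) μ := fun t =>
    ((hL _).comp (hsl t)).continuous.integrable_of_hasCompactSupport (hcs _ t)
  rw [← sub_eq_zero, ← integral_sub (hint s) (hint t)]
  set G : V → ℝ → ℂ := fun x τ => mulFun ℓ (e none) (fderiv ℝ w (x, τ) (0, 1)) with hG
  have hGc : Continuous fun p : ℝ × V => G p.2 p.1 :=
    (mulFun ℓ (e none)).continuous.comp
      (((hw.continuous_fderiv (by simp)).comp continuous_swap).clm_apply continuous_const)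
  have hG0 : ∀ x ∉ K, ∀ τ, G x τ = 0 := by
    intro x hx τ
    have : fderiv ℝ w (x, τ) = 0 := by
      have : w =ᶠ[𝓝 (x, τ)] fun _ => 0 := by
        have : Kᶜ ×ˢ Set.univ ∈ 𝓝 (x, τ) :=
          (hK.isClosed.isOpen_compl.prod isOpen_univ).mem_nhds ⟨hx, trivial⟩
        filter_upwards [this] with p hp using hKw p.1 hp.1 p.2
      rw [this.fderiv_eq]; simp
    simp [hG, this]
  have hftc : ∀ x, mulFun ℓ (e none) (w (x, s)) - mulFun ℓ (e none) (w (x, t)) =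
      ∫ τ in t..s, G x τ := by
    intro x
    rw [intervalIntegral.integral_eq_sub_of_hasDerivAt]
    · intro τ _
      have h1 : HasFDerivAt w (fderiv ℝ w (x, τ)) (x, τ) :=
        (hw.differentiable (by simp) _).hasFDerivAt
      have h2 : HasDerivAt (fun τ : ℝ => (x, τ)) ((0 : V), (1 : ℝ)) τ :=
        (hasDerivAt_const τ x).prodMk (hasDerivAt_id τ)
      exact ((mulFun ℓ (e none)).restrictScalars ℝ).hasFDerivAt.comp_hasDerivAt τ
        (h1.comp_hasDerivAt τ h2)
    · exact (hGc.comp (continuous_id.prodMk continuous_const)).intervalIntegrable _ _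
  simp only [hftc]
  rw [← intervalIntegral_integral_swap (f := fun τ x => G x τ)]
  · refine intervalIntegral.integral_zero_ae (Filter.Eventually.of_forall fun τ _ => ?_)
    have hexp : ∀ x, G x τ = -∑ a : κ,
        fderiv ℝ (fun x => mulFun ℓ (e (some a)) (w (x, τ))) x (b a) := by
      intro x
      have h := congrArg ℓ (hcl (x, τ))
      rw [Fintype.sum_option, map_add, map_zero, map_sum] at h
      rw [eq_neg_iff_add_eq_zero, ← h]
      congr 1
      refine sum_congr rfl fun a _ => ?_
      have h1 : HasFDerivAt w (fderiv ℝ w (x, τ)) (x, τ) :=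
        (hw.differentiable (by simp) _).hasFDerivAt
      have h2 : HasFDerivAt (fun x : V => (x, τ)) (ContinuousLinearMap.inl ℝ V ℝ) x :=
        hasFDerivAt_prodMk_left x τ
      have h3 := (((mulFun ℓ (e (some a))).restrictScalars ℝ).hasFDerivAt.comp x
        (h1.comp x h2)).fderiv
      have h4 : fderiv ℝ (fun x => mulFun ℓ (e (some a)) (w (x, τ))) x = _ := h3
      rw [h4]
      rfl
    simp only [hexp]
    rw [integral_neg, integral_finsetSum]
    · rw [sum_eq_zero, neg_zero]
      intro a _
      exact integral_fderiv_eq_zero μ ((hL _).comp (hsl τ)) (hcs _ τ) _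
    · intro a _
      refine Continuous.integrable_of_hasCompactSupport
        ((((hL _).comp (hsl τ)).continuous_fderiv (by simp)).clm_apply continuous_const) ?_
      exact ((hcs (e (some a)) τ).fderiv (𝕜 := ℝ)).comp_left (g := fun L : V →L[ℝ] ℂ => L (b a))
        (by simp)
  · have h1 : IntegrableOn (fun p : ℝ × V => G p.2 p.1) (Set.uIcc t s ×ˢ K)
        ((volume : Measure ℝ).prod μ) :=
      hGc.continuousOn.integrableOn_compact (isCompact_uIcc.prod hK)
    have h2 : IntegrableOn (fun p : ℝ × V => G p.2 p.1) (Set.uIoc t s ×ˢ Set.univ)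
        ((volume : Measure ℝ).prod μ) := by
      refine h1.of_forall_diff_eq_zero
        (measurableSet_uIoc.prod MeasurableSet.univ) ?_
      rintro ⟨τ, x⟩ ⟨⟨h1, -⟩, h2⟩
      refine hG0 x (fun hx => h2 ⟨Set.uIoc_subset_uIcc h1, hx⟩) τ
    rw [IntegrableOn, ← Measure.prod_restrict, Measure.restrict_univ] at h2
    exact h2

end

section
open scoped Matrix.Norms.Operator

theorem sum_antisymm {κ A : Type} [Fintype κ] [AddCommGroup A] [Module ℂ A] (f : κ → κ → A)
    (h : ∀ a b, f a b = -f b a) : ∑ a, ∑ b, f a b = 0 := by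
  have h1 : ∑ a, ∑ b, f a b = -∑ a, ∑ b, f a b := by
    conv_lhs => rw [sum_comm]
    rw [← sum_neg_distrib]
    refine sum_congr rfl fun a _ => ?_
    rw [← sum_neg_distrib]
    exact sum_congr rfl fun b _ => h b a
  have h2 : (2 : ℂ) • ∑ a, ∑ b, f a b = 0 := by
    rw [two_smul]; nth_rw 2 [h1]; abel
  exact (smul_eq_zero_iff_right two_ne_zero).1 h2

section
variable {Z 𝔸 κ ι : Type} [NormedCommRing Z] [NormedAlgebra ℂ Z] [FiniteDimensional ℂ Z] [Ring 𝔸]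
  [Algebra Z 𝔸] [Algebra ℂ 𝔸] [IsScalarTower ℂ Z 𝔸] [Fintype κ] [Fintype ι] [DecidableEq ι]
  {V : Type} [NormedAddCommGroup V] [NormedSpace ℝ V]
variable {e : κ → 𝔸} {zz : κ → κ → Z}

/-- The derivative of the curvature in direction `c`, given second derivatives `H`. -/
noncomputable def dcurv (zz : κ → κ → Z) (Q : κ → Matrix ι ι ℂ) (H : κ → Matrix ι ι ℂ) :
    Matrix ι ι Z :=
  ∑ a, ∑ b, zz a b • ((H a).map (algebraMap ℂ Z) * (Q b).map (algebraMap ℂ Z) +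
    (Q a).map (algebraMap ℂ Z) * (H b).map (algebraMap ℂ Z))

theorem OddGen.sum_triple (h : OddGen e zz) (p p' : κ → κ → Z) (q q' : κ → Z)
    (hp : ∀ a b, p a b = p b a) (hp' : ∀ a b, p' a b = p' b a) :
    ∑ c, e c * algebraMap Z 𝔸 (∑ a, ∑ b, zz a b * (p c a * q b + q' a * p' c b)) = 0 := by
  simp only [map_sum, map_mul, map_add, mul_add, h.map_zz, mul_sum, sum_add_distrib]
  rw [show (0 : 𝔸) = 0 + 0 by simp]
  congr 1
  · have h1 : ∀ b, ∑ c, ∑ a, e c * (e a * e b * (algebraMap Z 𝔸 (p c a) * algebraMap Z 𝔸 (q b)))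
        = 0 := by
      refine fun b => sum_antisymm _ fun a c => ?_
      rw [hp a c]
      simp only [← mul_assoc]
      rw [h.anti a c]
      simp only [neg_mul]
    calc _ = ∑ b, ∑ c, ∑ a, e c * (e a * e b *
          (algebraMap Z 𝔸 (p c a) * algebraMap Z 𝔸 (q b))) := by
          symm
          rw [sum_comm]
          exact sum_congr rfl fun c _ => sum_comm
      _ = 0 := by simp [h1]
  · have h1 : ∀ a, ∑ c, ∑ b, e c * (e a * e b * (algebraMap Z 𝔸 (q' a) * algebraMap Z 𝔸 (p' c b)))
        = 0 := by
      refine fun b => sum_antisymm _ fun a c => ?_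
      rw [hp' a c]
      simp only [← mul_assoc]
      rw [h.anti a b, neg_mul, mul_assoc (e b), h.anti a c]
      conv_rhs => rw [h.anti c b, neg_mul, mul_assoc (e b)]
      simp only [neg_mul, mul_neg, mul_assoc]
    rw [sum_comm]
    simp [h1]

theorem dcurv_apply (Q H : κ → Matrix ι ι ℂ) (i j : ι) : dcurv zz Q H i j =
    ∑ l, ∑ a, ∑ b, zz a b * (algebraMap ℂ Z (H a i l) * algebraMap ℂ Z (Q b l j) +
      algebraMap ℂ Z (Q a i l) * algebraMap ℂ Z (H b l j)) := by
  simp only [dcurv, Matrix.sum_apply, Matrix.smul_apply, Matrix.add_apply, mul_apply, map_apply,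
    smul_eq_mul, mul_add, mul_sum, ← sum_add_distrib]
  symm
  rw [sum_comm]
  exact sum_congr rfl fun a _ => sum_comm

theorem OddGen.oddMat_dcurv (h : OddGen e zz) (Q : κ → Matrix ι ι ℂ)
    (H : κ → κ → Matrix ι ι ℂ) (hH : ∀ a b, H a b = H b a) :
    oddMat e (fun c => dcurv zz Q (H c)) = 0 := by
  ext i j
  simp only [oddMat, dcurv_apply, Matrix.zero_apply]
  simp only [map_sum (algebraMap Z 𝔸) _ (Finset.univ : Finset ι), mul_sum]
  rw [sum_comm]
  refine sum_eq_zero fun l _ => ?_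
  exact h.sum_triple (fun c a => algebraMap ℂ Z (H c a i l)) (fun c a => algebraMap ℂ Z (H c a l j))
    _ _ (fun a b => by rw [hH]) (fun a b => by rw [hH])

/-- Extension of scalars for matrices as a continuous linear map. -/
noncomputable def extMat (ι Z : Type) [NormedCommRing Z] [NormedAlgebra ℂ Z]
    [FiniteDimensional ℂ Z] [Fintype ι] [DecidableEq ι] :
    Matrix ι ι ℂ →L[ℝ] Matrix ι ι Z :=
  ((LinearMap.toContinuousLinearMap
    ((Algebra.linearMap ℂ Z).mapMatrix : Matrix ι ι ℂ →ₗ[ℂ] Matrix ι ι Z))).restrictScalars ℝ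

/-- The partial derivatives of a matrix valued map along the directions `β`. -/
noncomputable def partials (P : V → Matrix ι ι ℂ) (β : κ → V) (x : V) (a : κ) : Matrix ι ι ℂ :=
  fderiv ℝ P x (β a)

/-- The differential form `tr (P (dP)^{2k})`. -/
noncomputable def chernForm (zz : κ → κ → Z) (β : κ → V) (P : V → Matrix ι ι ℂ) (k : ℕ) (x : V) : Z :=
  chern zz (P x) (partials P β x) k

variable {β : κ → V} {P : V → Matrix ι ι ℂ}

theorem contDiff_partials (hP : ContDiff ℝ ∞ P) (a : κ) :
    ContDiff ℝ ∞ fun x => partials P β x a :=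
  (hP.fderiv_right (m := ∞) (by simp)).clm_apply contDiff_const

theorem contDiff_curv (hP : ContDiff ℝ ∞ P) : ContDiff ℝ ∞ fun x => curv zz (partials P β x) := by
  unfold curv
  refine ContDiff.sum fun a _ => ContDiff.sum fun b _ => ?_
  have h : ∀ a, ContDiff ℝ ∞ fun x => (partials P β x a).map (algebraMap ℂ Z) := fun a =>
    (extMat ι Z).contDiff.comp (contDiff_partials hP a)
  have h2 := (h a).mul (h b)
  have : (fun x => zz a b • ((partials P β x a).map (algebraMap ℂ Z) *
      (partials P β x b).map (algebraMap ℂ Z))) = fun x => (zz a b • (1 : Matrix ι ι Z)) * 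
      ((partials P β x a).map (algebraMap ℂ Z) * (partials P β x b).map (algebraMap ℂ Z)) := by
    ext1 x; rw [smul_mul_assoc, one_mul]
  rw [this]
  exact contDiff_const.mul h2

/-- The trace as a continuous linear map. -/
noncomputable def traceL (ι Z : Type) [NormedCommRing Z] [NormedAlgebra ℂ Z]
    [FiniteDimensional ℂ Z] [Fintype ι] [DecidableEq ι] : Matrix ι ι Z →L[ℝ] Z :=
  (LinearMap.toContinuousLinearMap (Matrix.traceLinearMap ι ℂ Z)).restrictScalars ℝ

theorem contDiff_chernForm (hP : ContDiff ℝ ∞ P) (k : ℕ) : ContDiff ℝ ∞ (chernForm zz β P k) := by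
  have h1 : ContDiff ℝ ∞ fun x => (P x).map (algebraMap ℂ Z) := (extMat ι Z).contDiff.comp hP
  exact (traceL ι Z).contDiff.comp (h1.mul ((contDiff_curv hP).pow k))

theorem oddMat_add (Q R : κ → Matrix ι ι Z) :
    oddMat e (fun a => Q a + R a) = oddMat e Q + oddMat e R := by
  ext i j
  simp [oddMat, Matrix.add_apply, mul_add, sum_add_distrib]

theorem fderiv_curv (hP : ContDiff ℝ ∞ P) (x v : V) :
    fderiv ℝ (fun x => curv zz (partials P β x)) x v =
      dcurv zz (partials P β x) (fun a => fderiv ℝ (fun x => partials P β x a) x v) := by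
  have h : ∀ a, HasFDerivAt (fun x => (partials P β x a).map (algebraMap ℂ Z))
      ((extMat ι Z).comp (fderiv ℝ (fun x => partials P β x a) x)) x := fun a =>
    (extMat ι Z).hasFDerivAt.comp x
      ((contDiff_partials hP a).differentiable (by simp) x).hasFDerivAt
  have h1 := HasFDerivAt.fun_sum (x := x) (u := Finset.univ) fun a (_ : a ∈ Finset.univ) =>
    HasFDerivAt.fun_sum (u := Finset.univ) fun b (_ : b ∈ Finset.univ) =>
      (ContinuousLinearMap.mul ℝ _ (zz a b • (1 : Matrix ι ι Z))).hasFDerivAt.comp x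
        ((h a).mul' (h b))
  have h2 : (fun x => curv zz (partials P β x)) = fun x => ∑ a, ∑ b, (zz a b • (1 : Matrix ι ι Z)) *
      ((partials P β x a).map (algebraMap ℂ Z) * (partials P β x b).map (algebraMap ℂ Z)) := by
    ext1 x; simp only [curv, smul_mul_assoc, one_mul]
  rw [h2]
  refine (congrArg (fun L => L v) h1.fderiv).trans ?_
  simp only [ContinuousLinearMap.sum_apply, dcurv]
  refine sum_congr rfl fun a _ => sum_congr rfl fun b _ => ?_
  refine (smul_mul_assoc (zz a b) (1 : Matrix ι ι Z) _).trans ?_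
  rw [one_mul]
  exact congrArg (zz a b • ·) (add_comm _ _)

theorem OddGen.oddMat_fderiv_curv (h : OddGen e zz) (hP : ContDiff ℝ ∞ P) (x : V) :
    oddMat e (fun c => fderiv ℝ (fun x => curv zz (partials P β x)) x (β c)) = 0 := by
  simp only [fderiv_curv hP]
  refine h.oddMat_dcurv _ (fun c a => fderiv ℝ (fun x => partials P β x a) x (β c)) fun a b => ?_
  have h2 : ∀ a b, fderiv ℝ (fun x => partials P β x b) x (β a) =
      fderiv ℝ (fderiv ℝ P) x (β a) (β b) := by
    intro a b
    have h3 : HasFDerivAt (fderiv ℝ P) (fderiv ℝ (fderiv ℝ P) x) x :=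
      ((hP.fderiv_right (m := ∞) (by simp)).differentiable (by simp) x).hasFDerivAt
    have h4 := (h3.clm_apply (hasFDerivAt_const (β b) x)).fderiv
    have h5 : fderiv ℝ (fun x => partials P β x b) x = _ := h4
    rw [h5]
    refine (congrArg₂ (· + ·) (map_zero (fderiv ℝ P x)) rfl).trans ?_
    exact zero_add _
  rw [h2, h2]
  exact (hP.contDiffAt.isSymmSndFDerivAt (by simp only [minSmoothness_of_isRCLikeNormedField]; exact WithTop.coe_le_coe.2 le_top)).eq _ _

theorem OddGen.oddMat_fderiv_curv_pow (h : OddGen e zz) (hP : ContDiff ℝ ∞ P) (x : V) (k : ℕ) :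
    oddMat e (fun c => fderiv ℝ (fun x => curv zz (partials P β x) ^ k) x (β c)) = 0 := by
  induction k with
  | zero =>
    ext i j
    simp [oddMat]
  | succ k ih =>
    have hd := fun k => ((contDiff_curv (zz := zz) (β := β) hP).pow k).differentiable (by simp) x
    have h1 : ∀ c, fderiv ℝ (fun x => curv zz (partials P β x) ^ (k + 1)) x (β c) =
        curv zz (partials P β x) ^ k * fderiv ℝ (fun x => curv zz (partials P β x)) x (β c) +
        fderiv ℝ (fun x => curv zz (partials P β x) ^ k) x (β c) * curv zz (partials P β x) := by
      intro c
      have := fderiv_fun_mul' (hd k) ((contDiff_curv (zz := zz) (β := β) hP).differentiable (by simp) x)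
      simp only [pow_succ]
      exact congrArg (fun L => L (β c)) this
    simp only [h1, oddMat_add, ← map_mul_oddMat, ← oddMat_mul_map, ih, h.oddMat_fderiv_curv hP x,
      mul_zero, zero_mul, add_zero]

theorem isTangent (hP : ContDiff ℝ ∞ P) (hi : ∀ x, P x * P x = P x) (x : V) :
    Tangent (P x) (partials P β x) := by
  refine ⟨hi x, fun a => ?_⟩
  have hd := hP.differentiable (by simp) x
  have h1 := fderiv_fun_mul' hd hd
  simp only [hi] at h1
  have h2 := congrArg (fun L => L (β a)) h1
  exact h2.symm

theorem OddGen.isClosedForm_chernForm (h : OddGen e zz) (hP : ContDiff ℝ ∞ P)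
    (hi : ∀ x, P x * P x = P x) (k : ℕ) : IsClosedForm e β (chernForm zz β P k) := by
  intro x
  have h0 : HasFDerivAt (fun x => (P x).map (algebraMap ℂ Z))
      ((extMat ι Z).comp (fderiv ℝ P x)) x :=
    (extMat ι Z).hasFDerivAt.comp x (hP.differentiable (by simp) x).hasFDerivAt
  have h1 : ∀ c, fderiv ℝ (chernForm zz β P k) x (β c) =
      ((P x).map (algebraMap ℂ Z) *
        fderiv ℝ (fun x => curv zz (partials P β x) ^ k) x (β c)).trace := by
    intro c
    have h2 := fderiv_fun_mul' h0.differentiableAt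
      (((contDiff_curv (zz := zz) (β := β) hP).pow k).differentiable (by simp) x)
    have h3 := ((traceL ι Z).hasFDerivAt.comp x (h0.differentiableAt.mul
      (((contDiff_curv (zz := zz) (β := β) hP).pow k).differentiable (by simp) x)).hasFDerivAt).fderiv
    have h4 : fderiv ℝ (chernForm zz β P k) x = (traceL ι Z).comp (fderiv ℝ (fun y =>
      (P y).map (algebraMap ℂ Z) * curv zz (partials P β y) ^ k) x) := h3
    rw [h4, ContinuousLinearMap.comp_apply]
    have h5 := (isTangent (β := β) hP hi x).trace_deriv_mul (zz := zz) c k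
    refine (congrArg (fun L => traceL ι Z (L (β c))) h2).trans ?_
    refine (Matrix.trace_add _ _).trans ?_
    refine (add_eq_left.2 ?_)
    have h6 := congrArg (fun L => (L (β c) * curv zz (partials P β x) ^ k).trace) h0.fderiv
    exact h6.trans h5
  simp only [h1]
  rw [← trace_oddMat, ← map_mul_oddMat, h.oddMat_fderiv_curv_pow hP, mul_zero, trace_zero]

end

theorem newton_map {Z W : Type} [CommRing Z] [Algebra ℚ Z] [CommRing W] [Algebra ℚ W]
    (φ : Z →+* W) (p : ℕ → Z) (r : ℕ) : φ (newton p r) = newton (fun k => φ (p k)) r := by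
  refine newton_unique _ (fun r => φ (newton p r)) (by simp) (fun r => ?_) r
  have := congrArg φ (newton_succ p r)
  simpa using this

theorem newton_zero_of_pos {Z : Type} [CommRing Z] [Algebra ℚ Z] {p : ℕ → Z} {r : ℕ} (hr : r ≠ 0)
    (h : ∀ k, 1 ≤ k → k ≤ r → p k = 0) : newton p r = 0 := by
  obtain ⟨r, rfl⟩ := Nat.exists_eq_succ_of_ne_zero hr
  rw [newton, sum_eq_zero, smul_zero]
  intro k _
  rw [h _ (by omega) (by omega)]; simp

section
variable {Z 𝔸 κ ι : Type} [NormedCommRing Z] [NormedAlgebra ℂ Z] [FiniteDimensional ℂ Z]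
  [Algebra ℚ Z] [Ring 𝔸] [Algebra Z 𝔸] [Algebra ℂ 𝔸] [IsScalarTower ℂ Z 𝔸] [Fintype κ] [Fintype ι] [DecidableEq ι]
  {V : Type} [NormedAddCommGroup V] [NormedSpace ℝ V]

/-- Smooth closed even forms. -/
structure SmoothClosed (e : κ → 𝔸) (β : κ → V) (w : V → Z) : Prop where
  smooth : ContDiff ℝ ∞ w
  closed : IsClosedForm e β w

namespace SmoothClosed
variable {e : κ → 𝔸} {zz : κ → κ → Z} {β : κ → V} {v w : V → Z}

theorem const (c : Z) : SmoothClosed e β (fun _ : V => c) := ⟨contDiff_const, .const c⟩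

theorem add (hv : SmoothClosed e β v) (hw : SmoothClosed e β w) :
    SmoothClosed e β (fun x => v x + w x) :=
  ⟨hv.1.add hw.1, hv.2.add hw.2 hv.1 hw.1⟩

theorem mul (hv : SmoothClosed e β v) (hw : SmoothClosed e β w) :
    SmoothClosed e β (fun x => v x * w x) :=
  ⟨hv.1.mul hw.1, hv.2.mul hw.2 hv.1 hw.1⟩

theorem const_mul (c : Z) (hw : SmoothClosed e β w) : SmoothClosed e β (fun x => c * w x) :=
  (const c).mul hw

theorem sum {α : Type} (s : Finset α) {w : α → V → Z} (h : ∀ a, SmoothClosed e β (w a)) :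
    SmoothClosed e β (fun x => ∑ a ∈ s, w a x) :=
  ⟨ContDiff.sum fun a _ => (h a).1, .sum s (fun a => (h a).2) fun a => (h a).1⟩

theorem chernForm (h : OddGen e zz) {P : V → Matrix ι ι ℂ} (hP : ContDiff ℝ ∞ P)
    (hi : ∀ x, P x * P x = P x) (k : ℕ) : SmoothClosed e β (chernForm zz β P k) :=
  ⟨contDiff_chernForm hP k, h.isClosedForm_chernForm hP hi k⟩

theorem newton {p : ℕ → V → Z} (hp : ∀ k, SmoothClosed e β (p k)) (r : ℕ) :
    SmoothClosed e β (fun x => newton (fun k => p k x) r) := by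
  induction r using Nat.strong_induction_on with
  | _ r ih =>
    cases r with
    | zero => simpa using const (1 : Z)
    | succ r =>
      have h : (fun x => ACS.newton (fun k => p k x) (r + 1)) = fun x =>
          algebraMap ℚ Z ((r + 1 : ℚ)⁻¹) * ∑ k : Fin (r + 1), (-1) ^ (k : ℕ) *
            (ACS.newton (fun k => p k x) (r - k) * p (k + 1) x) := by
        ext1 x; rw [ACS.newton, Algebra.smul_def]
      rw [h]
      exact const_mul _ (sum _ fun k => const_mul _ ((ih _ (by omega)).mul (hp _)))

/-- Pulling back along the projection. -/
theorem comp_fst {e : Option κ → 𝔸} {b : κ → V} {w : V → Z}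
    (hw : SmoothClosed e (fun o => o.elim 0 b) w) :
    SmoothClosed e (optDir b) (fun x : V × ℝ => w x.1) := by
  refine ⟨hw.1.comp contDiff_fst, fun x => ?_⟩
  have h1 := ((hw.1.differentiable (by simp) x.1).hasFDerivAt.comp x hasFDerivAt_fst).fderiv
  have h2 : fderiv ℝ (fun x : V × ℝ => w x.1) x = _ := h1
  rw [h2]
  have := hw.2 x.1
  rw [Fintype.sum_option] at this ⊢
  simpa [optDir] using this

end SmoothClosed

variable {e : Option κ → 𝔸} {zz : Option κ → Option κ → Z} {b : κ → V}

/-- The directions on `V`, where the extra generator is dual to zero. -/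
abbrev vDir (b : κ → V) : Option κ → V := fun o => o.elim 0 b

/-- The ideal of elements killed by the extra generator. -/
def noneIdeal (e : Option κ → 𝔸) : Ideal Z where
  carrier := {z | e none * algebraMap Z 𝔸 z = 0}
  add_mem' := by intro x y hx hy; simp_all [mul_add]
  zero_mem' := by simp
  smul_mem' := by
    intro c x hx
    simp only [Set.mem_setOf_eq, smul_eq_mul, map_mul] at hx ⊢
    rw [Algebra.left_comm, hx, mul_zero]

theorem mulFun_none_congr (ℓ : 𝔸 →ₗ[ℂ] ℂ) {z z' : Z}
    (h : Ideal.Quotient.mk (noneIdeal e) z = Ideal.Quotient.mk (noneIdeal e) z') :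
    mulFun ℓ (e none) z = mulFun ℓ (e none) z' := by
  have h1 : e none * algebraMap Z 𝔸 (z - z') = 0 := (Ideal.Quotient.eq.1 h)
  rw [map_sub, mul_sub, sub_eq_zero] at h1
  simp [h1]

theorem OddGen.mk_none (h : OddGen e zz) (o : Option κ) :
    Ideal.Quotient.mk (noneIdeal e) (zz none o) = 0 ∧
    Ideal.Quotient.mk (noneIdeal e) (zz o none) = 0 := by
  have h0 : e none * e none = 0 := by
    have := h.anti none none
    have h2 : (2 : ℂ) • (e none * e none) = 0 := by rw [two_smul]; nth_rw 2 [this]; abel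
    exact (smul_eq_zero_iff_right two_ne_zero).1 h2
  have h1 : ∀ o, Ideal.Quotient.mk (noneIdeal e) (zz none o) = 0 := fun o => by
    rw [Ideal.Quotient.eq_zero_iff_mem]
    change e none * algebraMap Z 𝔸 _ = 0
    rw [h.map_zz, ← mul_assoc, h0, zero_mul]
  exact ⟨h1 o, by rw [h.zz_anti, map_neg, h1, neg_zero]⟩

theorem OddGen.mk_chern (h : OddGen e zz) (P : Matrix ι ι ℂ) (Q Q' : Option κ → Matrix ι ι ℂ)
    (hQ : ∀ a, Q (some a) = Q' (some a)) (k : ℕ) :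
    Ideal.Quotient.mk (noneIdeal e) (chern zz P Q k) =
      Ideal.Quotient.mk (noneIdeal e) (chern zz P Q' k) := by
  set φ := Ideal.Quotient.mk (noneIdeal (Z := Z) e) with hφ
  have hc : φ.mapMatrix (curv zz Q) = φ.mapMatrix (curv zz Q') := by
    have hs : ∀ (c : Z) (M : Matrix ι ι Z), φ.mapMatrix (c • M) = φ c • φ.mapMatrix M := by
      intro c M; ext i j; simp [Matrix.smul_apply]
    have h1 : ∀ o, φ (zz none o) = 0 := fun o => (h.mk_none o).1
    have h2 : ∀ o, φ (zz o none) = 0 := fun o => (h.mk_none o).2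
    simp only [curv, map_sum, map_add, hs, Fintype.sum_option, h1, h2,
      zero_smul, zero_add, Finset.sum_const_zero, hQ]
  have ht : ∀ M : Matrix ι ι Z, φ M.trace = (φ.mapMatrix M).trace := fun M => by
    simp [Matrix.trace]
  rw [chern, chern, ht, ht, map_mul, map_mul, map_pow, map_pow, hc]

/-- On a slice of the homotopy parameter, Chern forms may be computed on the slice. -/
theorem OddGen.mk_chernForm_slice (h : OddGen e zz) {P : V × ℝ → Matrix ι ι ℂ}
    (hP : ContDiff ℝ ∞ P) (k : ℕ) (x : V) (s : ℝ) :
    Ideal.Quotient.mk (noneIdeal e) (chernForm zz (optDir b) P k (x, s)) =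
      Ideal.Quotient.mk (noneIdeal e) (chernForm zz (vDir b) (fun x => P (x, s)) k x) := by
  refine h.mk_chern _ _ _ (fun a => ?_) k
  have h1 := (HasFDerivAt.comp (f := fun x : V => (x, s)) x
    (hP.differentiable (by simp) (x, s)).hasFDerivAt (hasFDerivAt_prodMk_left x s)).fderiv
  have h2 : fderiv ℝ (fun x => P (x, s)) x = _ := h1
  rw [partials, partials, h2]
  rfl

variable [FiniteDimensional ℝ V] [MeasurableSpace V] [BorelSpace V] (μ : Measure V)
  [μ.IsAddHaarMeasure] (ℓ : 𝔸 →ₗ[ℂ] ℂ)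

/-- The integral of the top degree part of a form. -/
noncomputable def formInt (e : Option κ → 𝔸) (w : V → Z) : ℂ := ∫ x, mulFun ℓ (e none) (w x) ∂μ

variable {μ ℓ}

theorem integrable_mulFun {w : V → Z} (hw : ContDiff ℝ ∞ w) (hc : HasCompactSupport w) :
    Integrable (fun x => mulFun ℓ (e none) (w x)) μ :=
  ((mulFun ℓ (e none)).continuous.comp hw.continuous).integrable_of_hasCompactSupport
    (hc.comp_left (map_zero _))

theorem formInt_add {v w : V → Z} (hv : ContDiff ℝ ∞ v) (hw : ContDiff ℝ ∞ w)
    (hvc : HasCompactSupport v) (hwc : HasCompactSupport w) :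
    formInt μ ℓ e (fun x => v x + w x) = formInt μ ℓ e v + formInt μ ℓ e w := by
  simp only [formInt, map_add]
  exact integral_add (integrable_mulFun hv hvc) (integrable_mulFun hw hwc)

theorem formInt_sum {α : Type} (s : Finset α) {w : α → V → Z} (hw : ∀ a ∈ s, ContDiff ℝ ∞ (w a))
    (hc : ∀ a ∈ s, HasCompactSupport (w a)) :
    formInt μ ℓ e (fun x => ∑ a ∈ s, w a x) = ∑ a ∈ s, formInt μ ℓ e (w a) := by
  simp only [formInt, map_sum]
  exact integral_finsetSum _ fun a ha => integrable_mulFun (hw a ha) (hc a ha)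

variable (μ ℓ) in
/-- Forms whose product with every closed compactly supported form has vanishing integral. -/
def IsNull (e : Option κ → 𝔸) (b : κ → V) (w : V → Z) : Prop :=
  ∀ η : V → Z, SmoothClosed e (vDir b) η → HasCompactSupport η →
    formInt μ ℓ e (fun x => η x * w x) = 0

theorem IsNull.mul {v w : V → Z} (hv : SmoothClosed e (vDir b) v) (hw : IsNull μ ℓ e b w) :
    IsNull μ ℓ e b (fun x => v x * w x) := by
  intro η h hc
  simp only [← mul_assoc]
  exact hw _ (h.mul hv) hc.mul_right

theorem IsNull.sum {α : Type} (s : Finset α) {w : α → V → Z}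
    (h1 : ∀ a, SmoothClosed e (vDir b) (w a)) (h : ∀ a ∈ s, IsNull μ ℓ e b (w a)) :
    IsNull μ ℓ e b (fun x => ∑ a ∈ s, w a x) := by
  intro η hη hc
  simp only [mul_sum]
  rw [formInt_sum _ (fun a _ => hη.1.mul (h1 a).1) (fun a _ => hc.mul_right)]
  exact sum_eq_zero fun a ha => h a ha η hη hc

theorem IsNull.add {v w : V → Z} (hv : SmoothClosed e (vDir b) v) (hw : SmoothClosed e (vDir b) w)
    (nv : IsNull μ ℓ e b v) (nw : IsNull μ ℓ e b w) : IsNull μ ℓ e b (fun x => v x + w x) := by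
  intro η hη hc
  simp only [mul_add]
  rw [formInt_add (hη.1.mul hv.1) (hη.1.mul hw.1) hc.mul_right hc.mul_right, nv η hη hc,
    nw η hη hc, add_zero]

theorem IsNull.newton {p : ℕ → V → Z} (hp : ∀ k, SmoothClosed e (vDir b) (p k))
    {r : ℕ} (hr : r ≠ 0) (hn : ∀ k, 1 ≤ k → k ≤ r → IsNull μ ℓ e b (p k)) :
    IsNull μ ℓ e b (fun x => newton (fun k => p k x) r) := by
  obtain ⟨r, rfl⟩ := Nat.exists_eq_succ_of_ne_zero hr
  have h : (fun x => ACS.newton (fun k => p k x) (r + 1)) = fun x => ∑ k : Fin (r + 1),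
      (algebraMap ℚ Z ((r + 1 : ℚ)⁻¹) * (-1) ^ (k : ℕ) * ACS.newton (fun k => p k x) (r - k)) *
        p (k + 1) x := by
    ext1 x; rw [ACS.newton, Algebra.smul_def, mul_sum]; simp only [mul_assoc]
  rw [h]
  have h2 : ∀ k : Fin (r + 1), SmoothClosed e (vDir b) (fun x =>
      (algebraMap ℚ Z ((r + 1 : ℚ)⁻¹) * (-1) ^ (k : ℕ) * ACS.newton (fun k => p k x) (r - k))) :=
    fun k => (SmoothClosed.newton hp _).const_mul _
  exact IsNull.sum _ (fun k => (h2 k).mul (hp _)) fun k _ => (hn _ (by omega) (by omega)).mul (h2 k)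

/-- Chern forms are null, by contracting the map. -/
theorem OddGen.isNull_chernForm (h : OddGen e zz) {P : V → Matrix ι ι ℂ} (hP : ContDiff ℝ ∞ P)
    (hi : ∀ x, P x * P x = P x) {k : ℕ} (hk : k ≠ 0) :
    IsNull μ ℓ e b (chernForm zz (vDir b) P k) := by
  intro η hη hc
  have hG : ContDiff ℝ ∞ fun p : V × ℝ => P (p.2 • p.1) := hP.comp (contDiff_snd.smul contDiff_fst)
  have hw := hη.comp_fst.mul
    (SmoothClosed.chernForm (β := optDir b) h hG (fun p => hi _) k)
  have key := integral_slice_eq μ hw.1 hw.2 hc.isCompact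
    (fun x hx t => by
      have : η x = 0 := image_eq_zero_of_notMem_tsupport hx
      simp [this]) ℓ 1 0
  have hsl : ∀ s x, mulFun ℓ (e none) (η x * chernForm zz (optDir b) (fun p : V × ℝ =>
      P (p.2 • p.1)) k (x, s)) = mulFun ℓ (e none) (η x * chernForm zz (vDir b) (fun x =>
      P (s • x)) k x) := fun s x => by
    refine mulFun_none_congr ℓ ?_
    rw [map_mul, map_mul, h.mk_chernForm_slice hG k x s]
  simp only [hsl] at key
  simp only [one_smul] at key
  rw [formInt, key]
  refine integral_eq_zero_of_ae (Filter.Eventually.of_forall fun x => ?_)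
  have h1 : partials (fun x => P ((0 : ℝ) • x)) (vDir b) x = fun _ => 0 := by
    funext a
    have : (fun x : V => P ((0 : ℝ) • x)) = fun _ => P 0 := by ext1 x; rw [zero_smul]
    rw [partials, this, fderiv_const_apply]; rfl
  have h2 : chernForm zz (vDir b) (fun x => P ((0 : ℝ) • x)) k x = 0 := by
    rw [chernForm, h1, chern_zero_deriv _ hk]
  simp only [h2, mul_zero, map_zero, Pi.zero_apply]

theorem OddGen.chernForm_even {κ : Type} [Fintype κ] {e : κ → 𝔸} {zz : κ → κ → Z} (h : OddGen e zz)
    {β : κ → V} {P : V → Matrix ι ι ℂ} (hP : ContDiff ℝ ∞ P)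
    (ht : ∀ x, (P x)ᵀ = 1 - P x) {k : ℕ} (hk : k ≠ 0) (hk2 : Even k) (x : V) :
    chernForm zz β P k x = 0 := by
  refine h.chern_even (ht x) (fun a => ?_) hk hk2
  let T : Matrix ι ι ℂ →L[ℝ] Matrix ι ι ℂ :=
    LinearMap.toContinuousLinearMap (Matrix.transposeLinearEquiv ι ι ℝ ℂ).toLinearMap
  have hd := (hP.differentiable (by simp) x).hasFDerivAt
  have h1 : HasFDerivAt (fun x => (P x)ᵀ) (T.comp (fderiv ℝ P x)) x := T.hasFDerivAt.comp x hd
  have h2 : HasFDerivAt (fun x => (P x)ᵀ) (-(fderiv ℝ P x)) x := by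
    simp only [ht]; exact hd.const_sub 1
  exact congrArg (fun L => L (β a)) (h1.unique h2)

theorem hasCompactSupport_newton {C : ℕ → V → Z} {K : Set V} (hK : IsCompact K)
    (hC : ∀ x ∉ K, ∀ k ≠ 0, C k x = 0) {r : ℕ} (hr : r ≠ 0) :
    HasCompactSupport fun x => newton (fun k => C k x) r :=
  HasCompactSupport.intro hK fun x hx => newton_zero_of_pos hr fun k hk _ => hC x hx k (by omega)

theorem formInt_newton_self {C : ℕ → V → Z} {K : Set V} (hK : IsCompact K)
    (hC : ∀ x ∉ K, ∀ k ≠ 0, C k x = 0) (hs : ∀ k, SmoothClosed e (vDir b) (C k))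
    (hn : ∀ k ≠ 0, IsNull μ ℓ e b (C k)) {r : ℕ} (hr : r ≠ 0) (hCr : ∀ x, C r x = 0) :
    formInt μ ℓ e (fun x => newton (fun k => C k x) r) = 0 := by
  obtain ⟨r, rfl⟩ := Nat.exists_eq_succ_of_ne_zero hr
  have h : (fun x => newton (fun k => C k x) (r + 1)) = fun x => ∑ k : Fin (r + 1),
      (algebraMap ℚ Z ((r + 1 : ℚ)⁻¹) * (-1) ^ (k : ℕ) * newton (fun k => C k x) (r - k)) *
        C (k + 1) x := by
    ext1 x; rw [newton, Algebra.smul_def, mul_sum]; simp only [mul_assoc]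
  have h2 : ∀ k : Fin (r + 1), SmoothClosed e (vDir b) (fun x =>
      (algebraMap ℚ Z ((r + 1 : ℚ)⁻¹) * (-1) ^ (k : ℕ) * newton (fun k => C k x) (r - k))) :=
    fun k => (SmoothClosed.newton hs _).const_mul _
  have h3 : ∀ k : Fin (r + 1), HasCompactSupport (C (k + 1)) := fun k =>
    HasCompactSupport.intro hK fun x hx => hC x hx _ (by omega)
  rw [h, formInt_sum _ (fun k _ => (h2 k).1.mul (hs _).1) (fun k _ => (h3 k).mul_left)]
  refine sum_eq_zero fun k _ => ?_
  by_cases hk : (k : ℕ) = r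
  · simp only [hk, formInt]
    have : ∀ x, C (r + 1) x = 0 := hCr
    simp [this]
  · refine hn _ (by omega) _ (h2 k) ?_
    exact (hasCompactSupport_newton hK hC (r := r - k) (by omega)).mul_left

/-- The main vanishing theorem for the top elementary symmetric form. -/
theorem OddGen.formInt_newton_eq_zero (h : OddGen e zz) {P : Fin 3 → V → Matrix ι ι ℂ}
    (hP : ∀ i, ContDiff ℝ ∞ (P i)) (hi : ∀ i x, P i x * P i x = P i x)
    (ht : ∀ i x, (P i x)ᵀ = 1 - P i x) {K : Set V} (hK : IsCompact K)
    (hC : ∀ x ∉ K, ∀ k ≠ 0, chernForm zz (vDir b) (P 0) k x =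
      chernForm zz (vDir b) (P 1) k x + chernForm zz (vDir b) (P 2) k x)
    {r : ℕ} (hr : r ≠ 0) (hr2 : Even r)
    (h0 : ∀ x, newton (fun k => chernForm zz (vDir b) (P 0) k x) r = 0) :
    formInt μ ℓ e (fun x => newton (fun k => chernForm zz (vDir b) (P 1) k x +
      chernForm zz (vDir b) (P 2) k x) r) = 0 := by
  set p : Fin 3 → ℕ → V → Z := fun i => chernForm zz (vDir b) (P i) with hp
  have hsp : ∀ i k, SmoothClosed e (vDir b) (p i k) := fun i k => .chernForm h (hP i) (hi i) k
  have hnp : ∀ i, ∀ k ≠ 0, IsNull μ ℓ e b (p i k) := fun i k hk => h.isNull_chernForm (hP i) (hi i) hk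
  set C : ℕ → V → Z := fun k x => p 0 k x + ((-1) * p 1 k x + (-1) * p 2 k x) with hCdef
  set A : ℕ → V → Z := fun k x => p 1 k x + p 2 k x with hA
  have hsA : ∀ k, SmoothClosed e (vDir b) (A k) := fun k => (hsp 1 k).add (hsp 2 k)
  have hnA : ∀ k ≠ 0, IsNull μ ℓ e b (A k) := fun k hk =>
    IsNull.add (hsp 1 k) (hsp 2 k) (hnp 1 k hk) (hnp 2 k hk)
  have hs' : ∀ i k, SmoothClosed e (vDir b) (fun x => (-1) * p i k x) := fun i k =>
    (hsp i k).const_mul (-1)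
  have hn' : ∀ i, ∀ k ≠ 0, IsNull μ ℓ e b (fun x => (-1) * p i k x) := fun i k hk =>
    (hnp i k hk).mul (.const (-1))
  have hsC : ∀ k, SmoothClosed e (vDir b) (C k) := fun k =>
    (hsp 0 k).add ((hs' 1 k).add (hs' 2 k))
  have hnC : ∀ k ≠ 0, IsNull μ ℓ e b (C k) := fun k hk =>
    IsNull.add (hsp 0 k) ((hs' 1 k).add (hs' 2 k)) (hnp 0 k hk)
      (IsNull.add (hs' 1 k) (hs' 2 k) (hn' 1 k hk) (hn' 2 k hk))
  have hC0 : ∀ x ∉ K, ∀ k ≠ 0, C k x = 0 := fun x hx k hk => by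
    simp only [hCdef, hp, hC x hx k hk]; ring
  have hCr : ∀ x, C r x = 0 := fun x => by
    simp only [hCdef, hp, h.chernForm_even (hP _) (ht _) hr hr2]; ring
  set S := (Finset.HasAntidiagonal.antidiagonal r).erase (0, r) with hS
  have hexp : (fun x => newton (fun k => A k x) r) = fun x => (-1) * ∑ ab ∈ S,
      newton (fun k => C k x) ab.1 * newton (fun k => A k x) ab.2 := by
    ext1 x
    have h1 := newton_add (fun k => C k x) (fun k => A k x) r
    have h2 : ((fun k => C k x) + fun k => A k x) = fun k => p 0 k x := by
      funext k; simp only [Pi.add_apply, hCdef, hA]; ring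
    rw [h2, h0 x, ← Finset.add_sum_erase _ _ (by simp : (0, r) ∈ _), newton_zero, one_mul] at h1
    linear_combination -h1
  rw [hexp]
  have hS1 : ∀ ab ∈ S, ab.1 ≠ 0 := by
    intro ab hab h1
    simp only [hS, Finset.mem_erase, Finset.mem_antidiagonal, ne_eq] at hab
    exact hab.1 (Prod.ext h1 (by simpa [h1] using hab.2))
  have hcs : ∀ ab ∈ S, HasCompactSupport fun x => newton (fun k => C k x) ab.1 := fun ab hab =>
    hasCompactSupport_newton hK hC0 (hS1 ab hab)
  have hsm : ∀ ab : ℕ × ℕ, SmoothClosed e (vDir b)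
      fun x => newton (fun k => C k x) ab.1 * newton (fun k => A k x) ab.2 := fun ab =>
    (SmoothClosed.newton hsC _).mul (SmoothClosed.newton hsA _)
  have hsum : formInt μ ℓ e (fun x => ∑ ab ∈ S,
      newton (fun k => C k x) ab.1 * newton (fun k => A k x) ab.2) = 0 := by
    rw [formInt_sum _ (fun ab _ => (hsm ab).1) (fun ab hab => (hcs ab hab).mul_right)]
    refine sum_eq_zero fun ab hab => ?_
    by_cases hb : ab.2 = 0
    · have hr' : ab.1 = r := by
        have := Finset.HasAntidiagonal.mem_antidiagonal.1 (Finset.mem_of_mem_erase (hS ▸ hab))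
        omega
      simp only [hb, newton_zero, mul_one, hr']
      exact formInt_newton_self hK hC0 hsC hnC hr hCr
    · exact IsNull.newton hsA hb (fun k hk _ => hnA k (by omega)) _
        (SmoothClosed.newton hsC _) (hcs ab hab)
  simp only [formInt, neg_mul, one_mul, map_neg] at hsum ⊢
  rw [integral_neg, hsum, neg_zero]

end

end

section
open scoped Pointwise

section
variable {Z 𝔸 κ ι : Type} [CommRing Z] [Algebra ℂ Z] [Ring 𝔸]
  [Algebra Z 𝔸] [Algebra ℂ 𝔸] [IsScalarTower ℂ Z 𝔸] {e : κ → 𝔸} {zz : κ → κ → Z}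

theorem OddGen.sq_eq_zero (h : OddGen e zz) (a : κ) : e a * e a = 0 := by
  have h2 : (2 : ℂ) • (e a * e a) = 0 := by rw [two_smul]; nth_rw 2 [h.anti a a]; abel
  exact (smul_eq_zero_iff_right two_ne_zero).1 h2

theorem OddGen.prod_perm (h : OddGen e zz) {w w' : List κ} (hw : w.Perm w') :
    (w.map e).prod = (w'.map e).prod ∨ (w.map e).prod = -(w'.map e).prod := by
  induction hw with
  | nil => simp
  | cons a _ ih =>
    rcases ih with ih | ih <;> simp [ih]
  | swap a b l =>
    right
    simp only [List.map_cons, List.prod_cons, ← mul_assoc]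
    rw [h.anti b a, neg_mul]
  | trans _ _ h1 h2 =>
    rcases h1 with h1 | h1 <;> rcases h2 with h2 | h2 <;> simp [h1, h2]

theorem OddGen.prod_eq_zero (h : OddGen e zz) {w : List κ} (hw : ¬ w.Nodup) :
    (w.map e).prod = 0 := by
  obtain ⟨a, ha⟩ := List.exists_duplicate_iff_not_nodup.2 hw
  obtain ⟨l, hl⟩ := (List.duplicate_iff_sublist.1 ha).exists_perm_append
  have : (([a, a] ++ l).map e).prod = 0 := by
    simp [← mul_assoc, h.sq_eq_zero]
  rcases h.prod_perm hl with h | h <;> rw [h, this] ; simp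

/-- The span of some of the generators. -/
def genSpan (e : κ → 𝔸) (S : Finset κ) : Submodule ℂ 𝔸 := Submodule.span ℂ (e '' S)

theorem mem_pow_image {S : Finset κ} {N : ℕ} {x : 𝔸} (hx : x ∈ (e '' (S : Set κ)) ^ N) :
    ∃ w : List κ, w.length = N ∧ (∀ a ∈ w, a ∈ S) ∧ (w.map e).prod = x := by
  induction N generalizing x with
  | zero => exact ⟨[], rfl, by simp, by simpa [eq_comm] using hx⟩
  | succ N ih =>
    rw [pow_succ'] at hx
    obtain ⟨y, ⟨a, ha, rfl⟩, z, hz, rfl⟩ := hx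
    obtain ⟨w, h1, h2, rfl⟩ := ih hz
    refine ⟨a :: w, by simp [h1], ?_, by simp⟩
    intro b hb
    rcases List.mem_cons.1 hb with rfl | hb
    · exact ha
    · exact h2 b hb

theorem OddGen.genSpan_pow_eq_bot (h : OddGen e zz) {S : Finset κ} {N : ℕ} (hN : S.card < N) :
    genSpan e S ^ N = ⊥ := by
  classical
  rw [genSpan, Submodule.span_pow, Submodule.span_eq_bot]
  intro x hx
  obtain ⟨w, h1, h2, rfl⟩ := mem_pow_image hx
  refine h.prod_eq_zero fun hnd => ?_
  have h3 : w.toFinset ⊆ S := fun a ha => h2 a (List.mem_toFinset.1 ha)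
  have := Finset.card_le_card h3
  rw [List.toFinset_card_of_nodup hnd] at this
  omega

theorem OddGen.genSpan_pow_le (h : OddGen e zz) [DecidableEq κ] {S : Finset κ} {w : List κ}
    (hw : w.Nodup) (hS : w.toFinset = S) :
    genSpan e S ^ S.card ≤ Submodule.span ℂ {(w.map e).prod} := by
  rw [genSpan, Submodule.span_pow, Submodule.span_le]
  intro x hx
  obtain ⟨w', h1, h2, rfl⟩ := mem_pow_image hx
  by_cases hnd : w'.Nodup
  · have h3 : w'.toFinset ⊆ S := fun a ha => h2 a (List.mem_toFinset.1 ha)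
    have h4 : w'.toFinset = w.toFinset := by
      rw [hS]
      exact Finset.eq_of_subset_of_card_le h3 (by rw [List.toFinset_card_of_nodup hnd, h1])
    have h5 : w'.Perm w := List.perm_of_nodup_nodup_toFinset_eq hnd hw h4
    rcases h.prod_perm h5 with h | h
    · rw [h]; exact Submodule.mem_span_singleton_self _
    · rw [h]; exact Submodule.neg_mem _ (Submodule.mem_span_singleton_self _)
  · rw [h.prod_eq_zero hnd]; exact Submodule.zero_mem _

/-- Even elements of degree `2d` in some of the generators. -/
def gr (Z : Type) [CommRing Z] [Algebra ℂ Z] [Algebra Z 𝔸] [IsScalarTower ℂ Z 𝔸] (e : κ → 𝔸)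
    (S : Finset κ) (d : ℕ) : Submodule ℂ Z :=
  (genSpan e S ^ (2 * d)).comap (IsScalarTower.toAlgHom ℂ Z 𝔸).toLinearMap

theorem mem_gr {S : Finset κ} {d : ℕ} {z : Z} :
    z ∈ gr Z e S d ↔ algebraMap Z 𝔸 z ∈ genSpan e S ^ (2 * d) := Iff.rfl

theorem gr_mul {S : Finset κ} {c d : ℕ} {z z' : Z} (h : z ∈ gr Z e S c) (h' : z' ∈ gr Z e S d) :
    z * z' ∈ gr Z e S (c + d) := by
  rw [mem_gr] at *
  rw [map_mul, mul_add, pow_add]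
  exact Submodule.mul_mem_mul h h'

theorem gr_algebraMap {S : Finset κ} (c : ℂ) : algebraMap ℂ Z c ∈ gr Z e S 0 := by
  rw [mem_gr, ← IsScalarTower.algebraMap_apply]
  simp [Submodule.mem_one]

theorem gr_trace [Fintype ι] {S : Finset κ} {d : ℕ} {M : Matrix ι ι Z}
    (h : ∀ i j, M i j ∈ gr Z e S d) : M.trace ∈ gr Z e S d :=
  Submodule.sum_mem _ fun i _ => h i i

theorem gr_matrix_mul [Fintype ι] {S : Finset κ} {c d : ℕ} {M N : Matrix ι ι Z}
    (h : ∀ i j, M i j ∈ gr Z e S c) (h' : ∀ i j, N i j ∈ gr Z e S d) (i j : ι) :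
    (M * N) i j ∈ gr Z e S (c + d) := by
  rw [Matrix.mul_apply]
  exact Submodule.sum_mem _ fun k _ => gr_mul (h _ _) (h' _ _)

theorem OddGen.chern_mem_gr [Fintype κ] [Fintype ι] [DecidableEq ι] (h : OddGen e zz)
    {S : Finset κ} {P : Matrix ι ι ℂ}
    {Q : κ → Matrix ι ι ℂ} (hQ : ∀ a ∉ S, Q a = 0) (k : ℕ) : chern zz P Q k ∈ gr Z e S k := by
  have hc : ∀ i j, curv zz Q i j ∈ gr Z e S 1 := fun i j => by
    rw [curv, Matrix.sum_apply]
    refine Submodule.sum_mem _ fun a _ => ?_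
    rw [Matrix.sum_apply]
    refine Submodule.sum_mem _ fun b _ => ?_
    by_cases ha : a ∈ S
    · by_cases hb : b ∈ S
      · rw [Matrix.smul_apply, smul_eq_mul, ← map_mul', Matrix.map_apply]
        refine gr_mul (c := 1) (d := 0) ?_ (gr_algebraMap _)
        rw [mem_gr, h.map_zz, mul_one, sq]
        exact Submodule.mul_mem_mul (Submodule.subset_span ⟨a, ha, rfl⟩)
          (Submodule.subset_span ⟨b, hb, rfl⟩)
      · simp [hQ b hb]
    · simp [hQ a ha]
  have hp : ∀ k i j, (curv zz Q ^ k) i j ∈ gr Z e S k := fun k => by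
    induction k with
    | zero =>
      intro i j
      rw [pow_zero, Matrix.one_apply]
      split_ifs
      · simpa using gr_algebraMap (e := e) (S := S) (Z := Z) 1
      · exact Submodule.zero_mem _
    | succ k ih => rw [pow_succ]; exact gr_matrix_mul ih hc
  refine gr_trace fun i j => ?_
  have := gr_matrix_mul (e := e) (S := S) (c := 0) (M := P.map (algebraMap ℂ Z))
    (fun i j => gr_algebraMap _) (hp k) i j
  rwa [zero_add] at this

theorem newton_mem_gr [Algebra ℚ Z] {S : Finset κ} {p : ℕ → Z} (hp : ∀ k, p k ∈ gr Z e S k) (r : ℕ) :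
    newton p r ∈ gr Z e S r := by
  induction r using Nat.strong_induction_on with
  | _ r ih =>
    cases r with
    | zero => simpa using gr_algebraMap (e := e) (S := S) (Z := Z) 1
    | succ r =>
      have hq : ∀ q : ℚ, algebraMap ℚ Z q = algebraMap ℂ Z q := fun q => by
        exact RingHom.congr_fun (Subsingleton.elim (algebraMap ℚ Z)
          ((algebraMap ℂ Z).comp (algebraMap ℚ ℂ))) q
      rw [newton, Algebra.smul_def, hq, ← Algebra.smul_def]
      refine Submodule.smul_mem _ _ (Submodule.sum_mem _ fun k _ => ?_)
      have h1 : newton p (r - k) * p (k + 1) ∈ gr Z e S (r + 1) := by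
        have := gr_mul (ih (r - k) (by omega)) (hp (k + 1))
        rwa [show r - k + (k + 1) = r + 1 by omega] at this
      rcases neg_one_pow_eq_or Z (k : ℕ) with h | h
      · rw [h, one_mul]; exact h1
      · rw [h, neg_one_mul]; exact Submodule.neg_mem _ h1

end

section
variable {Z 𝔸 L : Type} [CommRing Z] [Algebra ℂ Z] [Ring 𝔸]
  [Algebra Z 𝔸] [Algebra ℂ 𝔸] [IsScalarTower ℂ Z 𝔸] [DecidableEq L]
  {e : Option (L × Bool) → 𝔸} {zz : Option (L × Bool) → Option (L × Bool) → Z}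

/-- The generators over a set of labels. -/
def gens (S : Finset L) : Finset (Option (L × Bool)) := (S ×ˢ Finset.univ).map Function.Embedding.some

theorem card_gens (S : Finset L) : (gens S).card = 2 * S.card := by
  simp [gens, mul_comm]

/-- The product of all generators over a set of labels. -/
def top (zz : Option (L × Bool) → Option (L × Bool) → Z) (S : Finset L) : Z :=
  ∏ l ∈ S, zz (some (l, false)) (some (l, true))

theorem OddGen.gr_eq_zero (h : OddGen e zz) {S : Finset L} {d : ℕ} (hd : S.card < d) {z : Z}
    (hz : z ∈ gr Z e (gens S) d) : z = 0 := by
  rw [mem_gr, h.genSpan_pow_eq_bot (by rw [card_gens]; omega), Submodule.mem_bot] at hz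
  exact h.inj (by rw [hz, map_zero])

theorem OddGen.gr_top (h : OddGen e zz) {S : Finset L} {z : Z}
    (hz : z ∈ gr Z e (gens S) S.card) : ∃ c : ℂ, z = c • top zz S := by
  set w : List (Option (L × Bool)) :=
    S.toList.flatMap fun l => [some (l, false), some (l, true)] with hw
  have h1 : w.toFinset = gens S := by
    ext a
    simp only [hw, List.mem_toFinset, List.mem_flatMap, Finset.mem_toList, gens]
    rcases a with _ | ⟨l, _ | _⟩ <;> simp
  have h2 : w.Nodup := by
    rw [hw, List.nodup_flatMap]
    refine ⟨fun l _ => by simp, ?_⟩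
    refine (Finset.nodup_toList S).imp ?_
    intro l l' hl
    simp [Function.onFun, List.Disjoint, hl]
  have h3 : algebraMap Z 𝔸 (top zz S) = (w.map e).prod := by
    rw [top, ← Finset.prod_map_toList, map_list_prod, hw, List.map_flatMap, List.flatMap,
      List.prod_flatten, List.map_map, List.map_map]
    congr 1
    refine List.map_congr_left fun l _ => ?_
    simp [h.map_zz]
  have h4 := h.genSpan_pow_le h2 h1
  rw [card_gens] at h4
  obtain ⟨c, hc⟩ := Submodule.mem_span_singleton.1 (h4 (mem_gr.1 hz))
  refine ⟨c, h.inj ?_⟩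
  rw [← hc, ← h3]
  exact (map_smul (IsScalarTower.toAlgHom ℂ Z 𝔸) c _).symm

end

section
variable (L : Type) [Fintype L]

/-- A Grassmann algebra with a pair of generators for each label and one more generator. -/
abbrev GrA : Type := ExteriorAlgebra ℂ (Option (L × Bool) → ℂ)

/-- The centre of the Grassmann algebra. -/
abbrev GrZ : Type := Subalgebra.center ℂ (GrA L)

instance : FiniteDimensional ℂ (GrA L) := by
  classical
  let _ : LinearOrder (Option (L × Bool)) := LinearOrder.lift' (Fintype.equivFin _) (Equiv.injective _)
  exact (Pi.basisFun ℂ (Option (L × Bool))).ExteriorAlgebra.finiteDimensional_of_finite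

open scoped Matrix.Norms.Operator in
noncomputable instance : NormedCommRing (GrZ L) :=
  NormedCommRing.induced (GrZ L) (Matrix (Fin (Module.finrank ℂ (GrZ L))) _ ℂ)
    (Algebra.leftMulMatrix (Module.finBasis ℂ (GrZ L))) (Algebra.leftMulMatrix_injective _)

open scoped Matrix.Norms.Operator in
noncomputable instance : NormedAlgebra ℂ (GrZ L) :=
  NormedAlgebra.induced ℂ (GrZ L) (Matrix (Fin (Module.finrank ℂ (GrZ L))) _ ℂ)
    (Algebra.leftMulMatrix (Module.finBasis ℂ (GrZ L)))

noncomputable instance : Algebra (GrZ L) (GrA L) where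
  algebraMap := (Subalgebra.center ℂ (GrA L)).val.toRingHom
  smul z a := z.1 * a
  commutes' z a := (Subalgebra.mem_center_iff.1 z.2 a).symm
  smul_def' _ _ := rfl

instance : IsScalarTower ℂ (GrZ L) (GrA L) := ⟨fun c z a => smul_mul_assoc c z.1 a⟩

noncomputable instance : Algebra ℚ (GrZ L) := Algebra.compHom _ (algebraMap ℚ ℂ)

variable {L} [DecidableEq L]

/-- The generators. -/
noncomputable def grE (k : Option (L × Bool)) : GrA L := ExteriorAlgebra.ι ℂ (Pi.single k 1)

theorem ι_anti (v w : Option (L × Bool) → ℂ) : ExteriorAlgebra.ι ℂ v * ExteriorAlgebra.ι ℂ w =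
    -(ExteriorAlgebra.ι ℂ w * ExteriorAlgebra.ι ℂ v) :=
  eq_neg_of_add_eq_zero_left (ExteriorAlgebra.ι_add_mul_swap v w)

/-- Products of two generators. -/
noncomputable def grZZ (a b : Option (L × Bool)) : GrZ L :=
  ⟨grE a * grE b, by
    rw [Subalgebra.mem_center_iff]
    intro x
    induction x using ExteriorAlgebra.induction with
    | algebraMap r => exact Algebra.commutes r _
    | ι v =>
      rw [grE, grE, ← mul_assoc, ι_anti v, neg_mul, mul_assoc, ι_anti v]
      simp [mul_assoc]
    | mul x y hx hy => rw [mul_assoc, hy, ← mul_assoc, hx, mul_assoc]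
    | add x y hx hy => rw [add_mul, mul_add, hx, hy]⟩

theorem oddGen_gr : OddGen (grE (L := L)) grZZ :=
  ⟨fun _ _ => rfl, fun _ _ => ι_anti _ _, Subtype.val_injective⟩

theorem exists_gr_functional : ∃ ℓ : GrA L →ₗ[ℂ] ℂ,
    ℓ (grE none * algebraMap (GrZ L) (GrA L) (top grZZ Finset.univ)) = 1 := by
  let D : Option (L × Bool) → GrA L →ₗ[ℂ] GrA L := fun k =>
    CliffordAlgebra.contractLeft (Q := (0 : QuadraticForm ℂ (Option (L × Bool) → ℂ))) (LinearMap.proj k)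
  have hD : ∀ k l x, D k (grE l * x) = (if l = k then 1 else 0 : ℂ) • x - grE l * D k x := fun k l x => by
    have := CliffordAlgebra.contractLeft_ι_mul (Q := (0 : QuadraticForm ℂ (Option (L × Bool) → ℂ)))
      (LinearMap.proj k) (Pi.single l 1) x
    simp only [LinearMap.proj_apply, Pi.single_apply] at this
    simp only [eq_comm (a := l)]
    exact this
  let T : Finset L → GrA L := fun S => algebraMap (GrZ L) (GrA L) (top grZZ S)
  have hT : ∀ l S, l ∉ S → T (insert l S) = grE (some (l, false)) * (grE (some (l, true)) * T S) := by
    intro l S hl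
    simp only [T, top]
    rw [Finset.prod_insert hl, map_mul, oddGen_gr.map_zz, mul_assoc]
  have hDT : ∀ S k, k ∉ gens S → D k (T S) = 0 := by
    intro S
    induction S using Finset.induction_on with
    | empty => intro k _; simp [T, top, D]
    | insert l S hl ih =>
      intro k hk
      have h1 : k ≠ some (l, false) := by rintro rfl; exact hk (by simp [gens])
      have h2 : k ≠ some (l, true) := by rintro rfl; exact hk (by simp [gens])
      have h3 : k ∉ gens S := fun h => hk (by
        simp only [gens, Finset.mem_map, Finset.mem_product] at h ⊢
        obtain ⟨a, ha, rfl⟩ := h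
        exact ⟨a, ⟨Finset.mem_insert_of_mem ha.1, ha.2⟩, rfl⟩)
      rw [hT l S hl, hD, hD, ih k h3]
      simp [h1.symm, h2.symm]
  have hne : ∀ S, T S ≠ 0 := by
    intro S
    induction S using Finset.induction_on with
    | empty => simp [T, top]
    | insert l S hl ih =>
      intro h
      apply ih
      have h1 : some (l, false) ∉ gens S := by simp [gens, hl]
      have h2 : some (l, true) ∉ gens S := by simp [gens, hl]
      have := congrArg (fun x => D (some (l, true)) (D (some (l, false)) x)) h
      simpa [hT l S hl, hD, hDT S _ h1, hDT S _ h2] using this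
  have hne' : grE none * T Finset.univ ≠ 0 := by
    intro h
    apply hne Finset.univ
    have := congrArg (D none) h
    simpa [hD, hDT Finset.univ none (by simp [gens])] using this
  obtain ⟨f, hf⟩ : ∃ f : Module.Dual ℂ (GrA L), f (grE none * T Finset.univ) ≠ 0 := by
    by_contra! h
    exact hne' ((Module.forall_dual_apply_eq_zero_iff ℂ _).1 h)
  exact ⟨(f (grE none * T Finset.univ))⁻¹ • f, by simpa using inv_mul_cancel₀ hf⟩

end

end

section
variable {𝔸 : Type} [NormedRing 𝔸] [NormedAlgebra ℝ 𝔸] [CompleteSpace 𝔸]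

/-- The Taylor coefficients of `(1 + x)^(-1/2)`. -/
noncomputable def isqrtCoeff (n : ℕ) : ℝ := Ring.choose (-(1 / 2) : ℝ) n

/-- `(1 + x)^(-1/2)`, given by the binomial series. -/
noncomputable def isqrt (x : 𝔸) : 𝔸 := FormalMultilinearSeries.ofScalarsSum isqrtCoeff x

theorem isqrt_eq_tsum (x : 𝔸) : isqrt x = ∑' n, isqrtCoeff n • x ^ n :=
  FormalMultilinearSeries.ofScalars_sum_eq _ _

theorem isqrt_zero : isqrt (0 : 𝔸) = 1 := by
  rw [isqrt, FormalMultilinearSeries.ofScalarsSum_zero]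
  simp [isqrtCoeff]

theorem summable_isqrtCoeff {r : NNReal} (hr : r < 1) :
    Summable fun n => ‖isqrtCoeff n‖ * (r : ℝ) ^ n := by
  have h : (1 : ENNReal) ≤ (binomialSeries ℝ (-(1 / 2) : ℝ)).radius := binomialSeries_radius_ge_one
  have := (binomialSeries ℝ (-(1 / 2) : ℝ)).summable_norm_mul_pow (r := r)
    (lt_of_lt_of_le (by exact_mod_cast hr) h)
  refine this.congr fun n => ?_
  rw [binomialSeries, FormalMultilinearSeries.ofScalars_norm]; rfl

theorem summable_isqrt {x : 𝔸} (hx : ‖x‖ < 1) : Summable fun n => ‖isqrtCoeff n • x ^ n‖ := by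
  have h := summable_isqrtCoeff (r := ‖x‖₊) hx
  rw [← summable_nat_add_iff 1] at h ⊢
  refine Summable.of_nonneg_of_le (fun _ => norm_nonneg _) (fun n => ?_) h
  rw [norm_smul]
  exact mul_le_mul_of_nonneg_left (norm_pow_le' x (Nat.succ_pos n)) (norm_nonneg _)

theorem contDiffOn_isqrt : ContDiffOn ℝ ∞ (isqrt (𝔸 := 𝔸)) (Metric.ball 0 1) := by
  set p := FormalMultilinearSeries.ofScalars 𝔸 isqrtCoeff with hp
  have hr : 1 ≤ p.radius := by
    refine le_of_forall_lt fun c hc => ?_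
    obtain ⟨c, rfl⟩ : ∃ c' : NNReal, (c' : ENNReal) = c := by
      lift c to NNReal using (hc.trans ENNReal.one_lt_top).ne; exact ⟨c, rfl⟩
    obtain ⟨r, hcr, hr⟩ := exists_between (show c < 1 by exact_mod_cast hc)
    refine lt_of_lt_of_le (b := (r : ENNReal)) (by exact_mod_cast hcr) ?_
    apply p.le_radius_of_summable_norm
    have h := summable_isqrtCoeff hr
    rw [← summable_nat_add_iff 1] at h ⊢
    refine Summable.of_nonneg_of_le (fun _ => by positivity) (fun n => ?_) h
    exact mul_le_mul_of_nonneg_right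
      (FormalMultilinearSeries.ofScalars_norm_le _ _ _ (Nat.succ_pos n)) (by positivity)
  have h := (p.hasFPowerSeriesOnBall (by positivity)).mono one_pos hr
  have h2 : AnalyticOnNhd ℝ (isqrt (𝔸 := 𝔸)) (Metric.ball 0 1) := by
    have := h.analyticOnNhd
    rwa [← ENNReal.ofReal_one, Metric.eball_ofReal] at this
  exact h2.contDiffOn (Metric.isOpen_ball.uniqueDiffOn)

theorem map_isqrt {𝔹 : Type} [NormedRing 𝔹] [NormedAlgebra ℝ 𝔹] [CompleteSpace 𝔹] (φ : 𝔸 →L[ℝ] 𝔹)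
    (hφ : ∀ (x : 𝔸) (n : ℕ), φ (x ^ n) = φ x ^ n) {x : 𝔸} (hx : ‖x‖ < 1) :
    φ (isqrt x) = isqrt (φ x) := by
  rw [isqrt_eq_tsum, isqrt_eq_tsum, φ.map_tsum (summable_isqrt hx).of_norm]
  simp [hφ]

theorem commute_isqrt {x y : 𝔸} (h : Commute y x) (hx : ‖x‖ < 1) : Commute y (isqrt x) := by
  rw [isqrt_eq_tsum]
  exact Commute.tsum_right _ fun n => (h.pow_right n).smul_right _

theorem isqrt_mul_self {x : 𝔸} (hx : ‖x‖ < 1) : isqrt x * isqrt x * (1 + x) = 1 := by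
  have hc : ∀ n, ∑ kl ∈ Finset.HasAntidiagonal.antidiagonal n, isqrtCoeff kl.1 * isqrtCoeff kl.2 =
      (-1) ^ n := fun n => by
    have h1 := PowerSeries.binomialSeries_add (A := ℝ) (-(1 / 2) : ℝ) (-(1 / 2) : ℝ)
    have h2 := congrArg (PowerSeries.coeff n) h1
    rw [PowerSeries.coeff_mul] at h2
    simp only [PowerSeries.binomialSeries_coeff, smul_eq_mul, mul_one] at h2
    simp only [isqrtCoeff]
    rw [← h2]
    have : (-(1 / 2) : ℝ) + -(1 / 2) = -1 := by norm_num
    rw [this, Ring.choose_neg]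
    simp [Units.smul_def, Ring.choose_natCast]
  have h1 : isqrt x * isqrt x = ∑' n, (-x) ^ n := by
    rw [isqrt_eq_tsum, tsum_mul_tsum_eq_tsum_sum_antidiagonal_of_summable_norm
      (summable_isqrt hx) (summable_isqrt hx)]
    refine tsum_congr fun n => ?_
    rw [neg_pow, ← map_one (algebraMap ℝ 𝔸), ← map_neg, ← map_pow, ← Algebra.smul_def, ← hc n,
      sum_smul]
    refine sum_congr rfl fun kl hkl => ?_
    rw [smul_mul_smul_comm, ← pow_add, Finset.HasAntidiagonal.mem_antidiagonal.1 hkl]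
  rw [h1]
  have := geom_series_mul_neg (-x) (by rwa [norm_neg])
  rwa [sub_neg_eq_add] at this

end

section
open scoped Matrix.Norms.Operator

section
variable {ι : Type} [Fintype ι] [DecidableEq ι]

/-- Orthogonal complex structures on `ℝ^ι`. -/
def OCS (ι : Type) [Fintype ι] [DecidableEq ι] : Set (Matrix ι ι ℝ) := {J | Jᵀ * J = 1 ∧ J * J = -1}

theorem mem_OCS {J : Matrix ι ι ℝ} : J ∈ OCS ι ↔ Jᵀ = -J ∧ J * J = -1 := by
  constructor
  · rintro ⟨h1, h2⟩
    refine ⟨?_, h2⟩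
    calc Jᵀ = -(Jᵀ * (J * J)) := by rw [h2]; simp
      _ = -J := by rw [← mul_assoc, h1, one_mul]
  · rintro ⟨h1, h2⟩
    exact ⟨by rw [h1, neg_mul, h2, neg_neg], h2⟩

/-- Transposition as a continuous linear map. -/
noncomputable def transposeL (ι : Type) [Fintype ι] [DecidableEq ι] : Matrix ι ι ℝ →L[ℝ] Matrix ι ι ℝ :=
  LinearMap.toContinuousLinearMap (Matrix.transposeLinearEquiv ι ι ℝ ℝ).toLinearMap

theorem transpose_isqrt {x : Matrix ι ι ℝ} (hx : ‖x‖ < 1) : (isqrt x)ᵀ = isqrt xᵀ :=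
  map_isqrt (transposeL ι) (fun x n => Matrix.transpose_pow x n) hx

theorem mul_isqrt_mem_OCS {A : Matrix ι ι ℝ} (hA : Aᵀ = -A) (hx : ‖-(A * A) - 1‖ < 1) :
    A * isqrt (-(A * A) - 1) ∈ OCS ι := by
  have hc : Commute A (isqrt (-(A * A) - 1)) := commute_isqrt
    ((((Commute.refl A).mul_right (Commute.refl A)).neg_right).sub_right (Commute.one_right A)) hx
  have ht : (isqrt (-(A * A) - 1))ᵀ = isqrt (-(A * A) - 1) := by
    rw [transpose_isqrt hx]; simp [hA]
  refine mem_OCS.2 ⟨by rw [transpose_mul, ht, hA, mul_neg, hc.eq], ?_⟩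
  have h := isqrt_mul_self hx
  set B := isqrt (-(A * A) - 1)
  calc A * B * (A * B) = -(B * B * (1 + (-(A * A) - 1))) := by
        rw [hc.eq, show 1 + (-(A * A) - 1) = -(A * A) by abel, mul_neg, neg_neg]
        simp only [mul_assoc]; rw [← mul_assoc A B, hc.eq, mul_assoc]
    _ = -1 := by rw [h]

theorem norm_neg_sq_sub_one_lt {A J : Matrix ι ι ℝ} (hJ : J * J = -1)
    (h : ‖A - J‖ < 1 / (4 * (1 + ‖J‖))) : ‖-(A * A) - 1‖ < 1 := by
  set E := A - J with hE
  have h1 : -(A * A) - 1 = -(J * E + E * J + E * E) := by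
    have : A = J + E := by rw [hE]; abel
    rw [this]; simp only [mul_add, add_mul, hJ]; abel
  have h0 : 0 ≤ ‖J‖ := norm_nonneg _
  have h0' : 0 ≤ ‖E‖ := norm_nonneg _
  rw [lt_div_iff₀ (by positivity)] at h
  rw [h1, norm_neg]
  have h2 := norm_add₃_le (a := J * E) (b := E * J) (c := E * E)
  have h3 := norm_mul_le J E
  have h4 := norm_mul_le E J
  have h5 := norm_mul_le E E
  nlinarith [mul_nonneg h0 h0']

/-- Relative smooth approximation of maps to orthogonal complex structures. -/
theorem exists_smooth_OCS {V : Type} [NormedAddCommGroup V] [NormedSpace ℝ V] [FiniteDimensional ℝ V]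
    {G : V → Matrix ι ι ℝ} (hG : Continuous G) (hm : ∀ x, G x ∈ OCS ι) {C U : Set V}
    (hC : IsClosed C) (hU : U ∈ 𝓝ˢ C) (hs : ContDiffOn ℝ ∞ G U) :
    ∃ G' : V → Matrix ι ι ℝ, ContDiff ℝ ∞ G' ∧ (∀ x, G' x ∈ OCS ι) ∧ Set.EqOn G' G C := by
  let S : Matrix ι ι ℝ →L[ℝ] Matrix ι ι ℝ := (1 / 2 : ℝ) • (ContinuousLinearMap.id ℝ _ - transposeL ι)
  have hS : ∀ A, S A = (1 / 2 : ℝ) • (A - Aᵀ) := fun A => rfl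
  have hSJ : ∀ J ∈ OCS ι, S J = J := fun J hJ => by
    rw [hS, (mem_OCS.1 hJ).1, sub_neg_eq_add, ← two_smul ℝ, smul_smul]; norm_num
  have hSt : ∀ A, (S A)ᵀ = -S A := fun A => by
    rw [hS, transpose_smul, transpose_sub, transpose_transpose, ← smul_neg, neg_sub]
  obtain ⟨c, hc, hb⟩ : ∃ c > 0, ∀ A, ‖S A‖ ≤ c * ‖A‖ := ContinuousLinearMap.bound S
  obtain ⟨g, hg, hgε, hgC, -⟩ := Continuous.exists_contDiff_approx_and_eqOn (f := G)
    (ε := fun x => (1 / (4 * (1 + ‖G x‖))) / c) ⊤ hG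
    (((continuous_const.div (continuous_const.mul (continuous_const.add (continuous_norm.comp hG)))
      fun x => (by positivity : 4 * (1 + ‖G x‖) ≠ 0))).div_const _) (fun x => by positivity) hC hU hs
  have hx : ∀ x, ‖-(S (g x) * S (g x)) - 1‖ < 1 := fun x => by
    refine norm_neg_sq_sub_one_lt (mem_OCS.1 (hm x)).2 ?_
    have h1 : S (g x) - G x = S (g x - G x) := by rw [map_sub, hSJ _ (hm x)]
    have h2 := hgε x
    rw [dist_eq_norm, lt_div_iff₀ (by positivity)] at h2
    rw [h1]
    exact lt_of_le_of_lt (hb _) (by rwa [mul_comm])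
  refine ⟨fun x => S (g x) * isqrt (-(S (g x) * S (g x)) - 1), ?_,
    fun x => mul_isqrt_mem_OCS (hSt _) (hx x), fun x hxC => ?_⟩
  · have h1 : ContDiff ℝ ∞ fun x => S (g x) := S.contDiff.comp hg
    have h2 : ContDiff ℝ ∞ fun x => -(S (g x) * S (g x)) - 1 := (h1.mul h1).neg.sub contDiff_const
    refine h1.mul ?_
    have := contDiffOn_isqrt.comp (s := Set.univ) h2.contDiffOn
      (fun x _ => by simpa using hx x)
    exact contDiffOn_univ.1 this
  · simp only [hgC hxC, hSJ _ (hm x), (mem_OCS.1 (hm x)).2]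
    simp [isqrt_zero]

end

end

section
variable {X Y ι κ τ : Type} [TopologicalSpace X] [Fintype ι] [DecidableEq ι] [Fintype κ] [DecidableEq κ]
  [Fintype τ] [DecidableEq τ]

/-- Isomorphism of the vector bundles given by two families of idempotents. -/
structure MvN (P : X → Matrix ι ι ℂ) (Q : X → Matrix κ κ ℂ) : Prop where
  left : ∀ x, P x * P x = P x
  right : ∀ x, Q x * Q x = Q x
  equiv : ∃ (A : X → Matrix ι κ ℂ) (B : X → Matrix κ ι ℂ), Continuous A ∧ Continuous B ∧
    (∀ x, A x * B x = P x) ∧ ∀ x, B x * A x = Q x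

theorem MvN.symm {P : X → Matrix ι ι ℂ} {Q : X → Matrix κ κ ℂ} (h : MvN P Q) : MvN Q P := by
  obtain ⟨h1, h2, A, B, hA, hB, hAB, hBA⟩ := h
  exact ⟨h2, h1, B, A, hB, hA, hBA, hAB⟩

theorem MvN.trans {P : X → Matrix ι ι ℂ} {Q : X → Matrix κ κ ℂ} {R : X → Matrix τ τ ℂ}
    (h : MvN P Q) (h' : MvN Q R) : MvN P R := by
  obtain ⟨h1, h2, A, B, hA, hB, hAB, hBA⟩ := h
  obtain ⟨_, h3, A', B', hA', hB', hAB', hBA'⟩ := h'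
  refine ⟨h1, h3, fun x => A x * A' x, fun x => B' x * B x, hA.matrix_mul hA', hB'.matrix_mul hB,
    fun x => ?_, fun x => ?_⟩
  · rw [← Matrix.mul_assoc, Matrix.mul_assoc (A x), hAB', ← hBA, ← Matrix.mul_assoc, hAB,
      Matrix.mul_assoc, hAB, h1]
  · rw [← Matrix.mul_assoc, Matrix.mul_assoc (B' x), hBA, ← hAB', ← Matrix.mul_assoc, hBA',
      Matrix.mul_assoc, hBA', h3]

theorem MvN.comp {P : X → Matrix ι ι ℂ} {Q : X → Matrix κ κ ℂ} (h : MvN P Q) [TopologicalSpace Y]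
    {φ : Y → X} (hφ : Continuous φ) : MvN (fun y => P (φ y)) (fun y => Q (φ y)) := by
  obtain ⟨h1, h2, A, B, hA, hB, hAB, hBA⟩ := h
  exact ⟨fun y => h1 _, fun y => h2 _, fun y => A (φ y), fun y => B (φ y), hA.comp hφ, hB.comp hφ,
    fun y => hAB _, fun y => hBA _⟩

/-- Adding a trivial bundle. -/
abbrev plusOne (κ : Type) [DecidableEq κ] (M : Matrix ι ι ℂ) : Matrix (ι ⊕ κ) (ι ⊕ κ) ℂ :=
  fromBlocks M 0 0 1

theorem plusOne_mul (M N : Matrix ι ι ℂ) : plusOne κ M * plusOne κ N = plusOne κ (M * N) := by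
  simp [fromBlocks_multiply]

theorem MvN.plusOne {P : X → Matrix ι ι ℂ} {Q : X → Matrix κ κ ℂ} (h : MvN P Q) :
    MvN (fun x => plusOne τ (P x)) (fun x => ACS.plusOne τ (Q x)) := by
  obtain ⟨h1, h2, A, B, hA, hB, hAB, hBA⟩ := h
  refine ⟨fun x => by rw [plusOne_mul, h1], fun x => by rw [plusOne_mul, h2],
    fun x => fromBlocks (A x) 0 0 1, fun x => fromBlocks (B x) 0 0 1,
    hA.matrix_fromBlocks continuous_const continuous_const continuous_const,
    hB.matrix_fromBlocks continuous_const continuous_const continuous_const, fun x => ?_, fun x => ?_⟩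
  · simp [fromBlocks_multiply, hAB]
  · simp [fromBlocks_multiply, hBA]

theorem MvN.reindex {P : X → Matrix ι ι ℂ} (hc : Continuous P) (hP : ∀ x, P x * P x = P x) (e : κ ≃ ι) :
    MvN P (fun x => (P x).submatrix e e) := by
  refine ⟨hP, fun x => ?_, fun x => (P x).submatrix id e, fun x => (P x).submatrix e id,
    hc.matrix_submatrix _ _, hc.matrix_submatrix _ _, fun x => ?_, fun x => ?_⟩
  · rw [submatrix_mul_equiv, hP]
  · rw [submatrix_mul_equiv, hP, submatrix_id_id]
  · have := submatrix_mul_equiv (P x) (P x) e (Equiv.refl ι) e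
    rw [hP] at this; exact this

theorem continuous_inv_matrix {u : X → Matrix ι ι ℂ} (hu : Continuous u) (h : ∀ x, IsUnit (u x)) :
    Continuous fun x => (u x)⁻¹ := by
  have h2 : ∀ x, (u x).det ≠ 0 := fun x => ((isUnit_iff_isUnit_det _).1 (h x)).ne_zero
  have : (fun x => (u x)⁻¹) = fun x => (u x).det⁻¹ • (u x).adjugate := by
    ext1 x; rw [inv_def, Ring.inverse_eq_inv']
  rw [this]
  exact (hu.matrix_det.inv₀ h2).smul hu.matrix_adjugate

theorem inv_mul_of_isUnit {M : Matrix ι ι ℂ} (h : IsUnit M) : M⁻¹ * M = 1 :=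
  nonsing_inv_mul _ ((isUnit_iff_isUnit_det _).1 h)

theorem mul_inv_of_isUnit {M : Matrix ι ι ℂ} (h : IsUnit M) : M * M⁻¹ = 1 :=
  mul_nonsing_inv _ ((isUnit_iff_isUnit_det _).1 h)

theorem isUnit_of_mul_eq_one_left {M N : Matrix ι ι ℂ} (h : M * N = 1) : IsUnit M :=
  (isUnit_iff_isUnit_det _).2 (isUnit_det_of_right_inverse h)

theorem isUnit_of_mul_eq_one_right {M N : Matrix ι ι ℂ} (h : M * N = 1) : IsUnit N :=
  (isUnit_iff_isUnit_det _).2 (isUnit_det_of_left_inverse h)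

theorem MvN.conj {P Q u : X → Matrix ι ι ℂ} (hP : Continuous P) (hu : Continuous u)
    (hi : ∀ x, IsUnit (u x)) (hPi : ∀ x, P x * P x = P x) (h : ∀ x, u x * P x = Q x * u x) :
    MvN P Q := by
  have hQ : ∀ x, Q x = u x * P x * (u x)⁻¹ := fun x => by
    rw [h, mul_assoc, mul_inv_of_isUnit (hi x), mul_one]
  have h1 : ∀ x, (u x)⁻¹ * u x = 1 := fun x => inv_mul_of_isUnit (hi x)
  refine ⟨hPi, fun x => ?_, fun x => P x * (u x)⁻¹, fun x => u x * P x,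
    hP.matrix_mul (continuous_inv_matrix hu hi), hu.matrix_mul hP, fun x => ?_, fun x => ?_⟩
  · rw [hQ, mul_assoc (u x * P x), ← mul_assoc _ (u x * P x), ← mul_assoc _ (u x),
      h1, one_mul, ← mul_assoc, mul_assoc (u x), hPi]
  · rw [mul_assoc, ← mul_assoc _ (u x), h1, one_mul, hPi]
  · rw [← mul_assoc, mul_assoc (u x), hPi, hQ]

/-- Transport along a homotopy of idempotents. -/
theorem exists_transport [MetricSpace Y] [CompactSpace Y] {P : ℝ × Y → Matrix ι ι ℂ}
    (hP : Continuous P) (hi : ∀ p, P p * P p = P p) : ∃ u : ℝ × Y → Matrix ι ι ℂ, Continuous u ∧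
      (∀ t ∈ Set.Icc (0 : ℝ) 1, ∀ y, IsUnit (u (t, y)) ∧ u (t, y) * P (0, y) = P (t, y) * u (t, y)) ∧
      ∀ y, u (0, y) = 1 := by
  let v : (ℝ × ℝ) × Y → Matrix ι ι ℂ := fun q =>
    P (q.1.1, q.2) * P (q.1.2, q.2) + (1 - P (q.1.1, q.2)) * (1 - P (q.1.2, q.2))
  have c1 : Continuous fun q : (ℝ × ℝ) × Y => P (q.1.1, q.2) := hP.comp (by fun_prop)
  have c2 : Continuous fun q : (ℝ × ℝ) × Y => P (q.1.2, q.2) := hP.comp (by fun_prop)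
  have hv : Continuous v :=
    (c1.matrix_mul c2).add ((continuous_const.sub c1).matrix_mul (continuous_const.sub c2))
  have hv1 : ∀ t y, v ((t, t), y) = 1 := fun t y => by
    simp only [v, mul_sub, sub_mul, hi, one_mul, mul_one]; abel
  have hvP : ∀ s t y, v ((s, t), y) * P (t, y) = P (s, y) * v ((s, t), y) := fun s t y => by
    simp only [v, mul_sub, sub_mul, mul_add, add_mul, mul_assoc, hi, one_mul, mul_one]
    simp only [← mul_assoc, hi]; abel
  obtain ⟨δ, hδ, hvu⟩ : ∃ δ > 0, ∀ s ∈ Set.Icc (0 : ℝ) 1, ∀ t ∈ Set.Icc (0 : ℝ) 1, |s - t| < δ → ∀ y,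
      IsUnit (v ((s, t), y)) := by
    have hK : IsCompact ((Set.Icc (0 : ℝ) 1 ×ˢ Set.Icc (0 : ℝ) 1) ×ˢ (Set.univ : Set Y)) :=
      (isCompact_Icc.prod isCompact_Icc).prod isCompact_univ
    have h := hK.uniformContinuousOn_of_continuous (f := fun q => (v q).det) hv.matrix_det.continuousOn
    obtain ⟨δ, hδ, h⟩ := Metric.uniformContinuousOn_iff.1 h 1 one_pos
    refine ⟨δ, hδ, fun s hs t ht hst y => ?_⟩
    have := h ((s, t), y) ⟨⟨hs, ht⟩, trivial⟩ ((t, t), y) ⟨⟨ht, ht⟩, trivial⟩ (by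
      simp [Prod.dist_eq, Real.dist_eq, hst, hδ])
    rw [hv1, det_one, dist_eq_norm] at this
    rw [isUnit_iff_isUnit_det, isUnit_iff_ne_zero]
    intro h0
    rw [h0] at this; simp at this
  obtain ⟨N, hN⟩ := exists_nat_one_div_lt hδ
  let τ : ℕ → ℝ → ℝ := fun k t => min t (k / (N + 1 : ℝ))
  let w : ℕ → ℝ × Y → Matrix ι ι ℂ := fun k => k.rec (fun _ => 1)
    fun k ih p => v ((τ (k + 1) p.1, τ k p.1), p.2) * ih p
  have hw : ∀ k p, w (k + 1) p = v ((τ (k + 1) p.1, τ k p.1), p.2) * w k p := fun k p => rfl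
  have hNp : (0 : ℝ) < N + 1 := by positivity
  have hτ0 : ∀ t ∈ Set.Icc (0 : ℝ) 1, τ 0 t = 0 := fun t ht => by simp [τ, ht.1]
  have hτm : ∀ k, ∀ t ∈ Set.Icc (0 : ℝ) 1, τ k t ∈ Set.Icc (0 : ℝ) 1 := fun k t ht =>
    ⟨le_min ht.1 (by positivity), (min_le_left _ _).trans ht.2⟩
  have hτd : ∀ k, ∀ t, |τ (k + 1) t - τ k t| < δ := fun k t => by
    refine lt_of_le_of_lt ?_ hN
    have h1 := abs_min_sub_min_le_max t ((k + 1 : ℕ) / (N + 1 : ℝ)) t (k / (N + 1 : ℝ))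
    refine h1.trans ?_
    rw [sub_self, abs_zero, ← sub_div, abs_div]
    simp [abs_of_pos hNp]; positivity
  refine ⟨w (N + 1), ?_, fun t ht y => ?_, fun y => ?_⟩
  · suffices ∀ k, Continuous (w k) from this (N + 1)
    intro k
    induction k with
    | zero => exact continuous_const
    | succ k ih => exact (hv.comp (by fun_prop)).matrix_mul ih
  · suffices ∀ k, IsUnit (w k (t, y)) ∧ w k (t, y) * P (0, y) = P (τ k t, y) * w k (t, y) by
      have h := this (N + 1)
      have h1 : τ (N + 1) t = t := by
        simp only [τ]; push_cast; rw [div_self hNp.ne']; exact min_eq_left ht.2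
      rwa [h1] at h
    intro k
    induction k with
    | zero => rw [hτ0 t ht]; simp [w]
    | succ k ih =>
      rw [hw]
      refine ⟨(hvu _ (hτm _ t ht) _ (hτm _ t ht) (hτd k t) y).mul ih.1, ?_⟩
      rw [mul_assoc, ih.2, ← mul_assoc, hvP, mul_assoc]
  · suffices ∀ k, w k (0, y) = 1 from this (N + 1)
    intro k
    induction k with
    | zero => rfl
    | succ k ih =>
      rw [hw, ih, mul_one]
      have : ∀ k, τ k 0 = 0 := fun k => by simp only [τ]; exact min_eq_left (by positivity)
      simp only [this, hv1]

theorem MvN.of_homotopy [MetricSpace Y] [CompactSpace Y] {P : ℝ × Y → Matrix ι ι ℂ}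
    (hP : Continuous P) (hi : ∀ p, P p * P p = P p) :
    MvN (fun y => P (0, y)) (fun y => P (1, y)) := by
  obtain ⟨u, hu, h, -⟩ := exists_transport hP hi
  exact MvN.conj (u := fun y => u (1, y)) (hP.comp (by fun_prop)) (hu.comp (by fun_prop))
    (fun y => (h 1 (by simp) y).1) (fun y => hi _) (fun y => (h 1 (by simp) y).2)

end

section
section
variable {X Y Z ι κ : Type} [TopologicalSpace X] [TopologicalSpace Y] [TopologicalSpace Z]
  [Fintype ι] [DecidableEq ι] [Fintype κ] [DecidableEq κ]

theorem plusOne_eq_iff_submatrix {κ' : Type} [DecidableEq κ'] (M : Matrix ι ι ℂ) :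
    plusOne (κ ⊕ κ') M = (plusOne κ' (plusOne κ M)).submatrix (Equiv.sumAssoc ι κ κ').symm
      (Equiv.sumAssoc ι κ κ').symm := by
  ext (i | i | i) (j | j | j) <;> simp [Matrix.one_apply]

theorem isUnit_plusOne {M : Matrix ι ι ℂ} (h : IsUnit M) : IsUnit (plusOne κ M) := by
  rw [isUnit_iff_isUnit_det] at h ⊢
  simpa using h

theorem isUnit_submatrix {M : Matrix ι ι ℂ} (h : IsUnit M) (e : κ ≃ ι) : IsUnit (M.submatrix e e) := by
  rw [isUnit_iff_isUnit_det] at h ⊢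
  simpa using h

theorem continuous_plusOne {h : X → Matrix ι ι ℂ} (hc : Continuous h) :
    Continuous fun x => plusOne κ (h x) :=
  hc.matrix_fromBlocks continuous_const continuous_const continuous_const

/-- Homotopy of maps to the general linear group. -/
def GLHtpy (h h' : X → Matrix ι ι ℂ) : Prop :=
  ∃ H : ℝ × X → Matrix ι ι ℂ, Continuous H ∧ (∀ p, IsUnit (H p)) ∧ (∀ x, H (0, x) = h x) ∧
    ∀ x, H (1, x) = h' x

namespace GLHtpy
variable {h h' k k' l : X → Matrix ι ι ℂ}

theorem refl (hc : Continuous h) (hu : ∀ x, IsUnit (h x)) : GLHtpy h h :=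
  ⟨fun p => h p.2, hc.comp continuous_snd, fun _ => hu _, fun _ => rfl, fun _ => rfl⟩

theorem continuous_right (a : GLHtpy h h') : Continuous h' := by
  obtain ⟨H, hc, hu, h0, h1⟩ := a
  have : h' = fun x => H (1, x) := funext fun x => (h1 x).symm
  rw [this]; exact hc.comp (by fun_prop)

theorem isUnit_right (a : GLHtpy h h') (x : X) : IsUnit (h' x) := by
  obtain ⟨H, hc, hu, h0, h1⟩ := a
  rw [← h1]; exact hu _

theorem mul (a : GLHtpy h h') (b : GLHtpy k k') :
    GLHtpy (fun x => h x * k x) (fun x => h' x * k' x) := by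
  obtain ⟨H, hc, hu, h0, h1⟩ := a
  obtain ⟨K, kc, ku, k0, k1⟩ := b
  exact ⟨fun p => H p * K p, hc.matrix_mul kc, fun p => (hu p).mul (ku p), fun x => by simp only [h0, k0],
    fun x => by simp only [h1, k1]⟩

theorem inv (a : GLHtpy h h') : GLHtpy (fun x => (h x)⁻¹) (fun x => (h' x)⁻¹) := by
  obtain ⟨H, hc, hu, h0, h1⟩ := a
  exact ⟨fun p => (H p)⁻¹, continuous_inv_matrix hc hu, fun p => by
    rw [isUnit_nonsing_inv_iff]; exact hu p, fun x => by simp only [h0], fun x => by simp only [h1]⟩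

theorem trans (a : GLHtpy h k) (b : GLHtpy k l) : GLHtpy h l := by
  have c := (a.mul (refl (a.continuous_right) a.isUnit_right).inv).mul b
  have e := a.isUnit_right
  convert c using 2 with x x
  · rw [mul_assoc, inv_mul_of_isUnit (e x), mul_one]
  · rw [mul_inv_of_isUnit (e x), one_mul]

theorem congr (a : GLHtpy h h') (e : ∀ x, k x = h x) (e' : ∀ x, k' x = h' x) : GLHtpy k k' := by
  rwa [funext e, funext e']

theorem comp (a : GLHtpy h h') {φ : Y → X} (hφ : Continuous φ) :
    GLHtpy (fun y => h (φ y)) (fun y => h' (φ y)) := by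
  obtain ⟨H, hc, hu, h0, h1⟩ := a
  exact ⟨fun p => H (p.1, φ p.2), hc.comp (by fun_prop), fun _ => hu _, fun x => h0 _, fun x => h1 _⟩

theorem plusOne (a : GLHtpy h h') :
    GLHtpy (fun x => plusOne κ (h x)) (fun x => ACS.plusOne κ (h' x)) := by
  obtain ⟨H, hc, hu, h0, h1⟩ := a
  exact ⟨fun p => ACS.plusOne κ (H p), continuous_plusOne hc, fun p => isUnit_plusOne (hu p),
    fun x => by simp only [h0], fun x => by simp only [h1]⟩

theorem submatrix (a : GLHtpy h h') (e : κ ≃ ι) :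
    GLHtpy (fun x => (h x).submatrix e e) (fun x => (h' x).submatrix e e) := by
  obtain ⟨H, hc, hu, h0, h1⟩ := a
  exact ⟨fun p => (H p).submatrix e e, hc.matrix_submatrix _ _, fun p => isUnit_submatrix (hu p) e,
    fun x => by simp only [h0], fun x => by simp only [h1]⟩

/-- A homotopy only needs to be invertible for times in the unit interval. -/
theorem of_Icc {H : ℝ × X → Matrix ι ι ℂ} (hc : Continuous H)
    (hu : ∀ t ∈ Set.Icc (0 : ℝ) 1, ∀ x, IsUnit (H (t, x))) :
    GLHtpy (fun x => H (0, x)) (fun x => H (1, x)) :=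
  ⟨fun p => H (Set.projIcc 0 1 zero_le_one p.1, p.2),
    hc.comp ((continuous_subtype_val.comp ((continuous_projIcc (h := zero_le_one)).comp continuous_fst)).prodMk continuous_snd),
    fun p => hu _ (Subtype.property _) _, fun x => by simp, fun x => by simp⟩

theorem line (hc : Continuous h) (hc' : Continuous h')
    (hu : ∀ t ∈ Set.Icc (0 : ℝ) 1, ∀ x, IsUnit (h x + t • (h' x - h x))) : GLHtpy h h' := by
  refine (of_Icc (H := fun p => h p.2 + p.1 • (h' p.2 - h p.2)) ?_ hu).congr (fun x => by simp)
    (fun x => by simp)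
  exact (hc.comp continuous_snd).add (continuous_fst.smul ((hc'.comp continuous_snd).sub (hc.comp continuous_snd)))

theorem upper {a : X → Matrix ι κ ℂ} (ha : Continuous a) :
    GLHtpy (fun x => fromBlocks 1 (a x) 0 1) (fun _ => 1) := by
  refine (of_Icc (H := fun p => fromBlocks 1 ((1 - p.1) • a p.2) 0 1) ?_ fun t _ x => ?_).congr
    (fun x => by simp) (fun x => by simp)
  · exact continuous_const.matrix_fromBlocks
      ((continuous_const.sub continuous_fst).smul (ha.comp continuous_snd)) continuous_const continuous_const
  · simp [isUnit_iff_isUnit_det]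

theorem lower {a : X → Matrix κ ι ℂ} (ha : Continuous a) :
    GLHtpy (fun x => fromBlocks 1 0 (a x) 1) (fun _ => 1) := by
  refine (of_Icc (H := fun p => fromBlocks 1 0 ((1 - p.1) • a p.2) 1) ?_ fun t _ x => ?_).congr
    (fun x => by simp) (fun x => by simp)
  · exact continuous_const.matrix_fromBlocks continuous_const
      ((continuous_const.sub continuous_fst).smul (ha.comp continuous_snd)) continuous_const
  · simp [isUnit_iff_isUnit_det]

end GLHtpy

/-- A map to the general linear group on a product is stably homotopic to a product of maps of the
factors. -/
def Decomposable (h : Y × Z → Matrix ι ι ℂ) : Prop :=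
  ∃ (κ : Type) (_ : Fintype κ) (_ : DecidableEq κ) (c : Y → Matrix (ι ⊕ κ) (ι ⊕ κ) ℂ)
    (b : Z → Matrix (ι ⊕ κ) (ι ⊕ κ) ℂ), Continuous c ∧ Continuous b ∧ (∀ y, IsUnit (c y)) ∧
    (∀ z, IsUnit (b z)) ∧ GLHtpy (fun p => plusOne κ (h p)) (fun p => c p.1 * b p.2)

namespace Decomposable
variable {h h' : Y × Z → Matrix ι ι ℂ}

theorem of_htpy (a : GLHtpy h h') (d : Decomposable h') : Decomposable h := by
  obtain ⟨κ, _, _, c, b, hc, hb, cu, bu, d⟩ := d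
  exact ⟨κ, _, _, c, b, hc, hb, cu, bu, a.plusOne.trans d⟩

theorem of_plusOne (d : Decomposable (fun p => plusOne κ (h p))) : Decomposable h := by
  obtain ⟨κ', _, _, c, b, hc, hb, cu, bu, d⟩ := d
  let e := (Equiv.sumAssoc ι κ κ').symm
  refine ⟨κ ⊕ κ', inferInstance, inferInstance, fun y => (c y).submatrix e e, fun y => (b y).submatrix e e,
    hc.matrix_submatrix _ _, hb.matrix_submatrix _ _, fun y => isUnit_submatrix (cu y) e,
    fun y => isUnit_submatrix (bu y) e, (d.submatrix e).congr (fun p => plusOne_eq_iff_submatrix _) fun p => ?_⟩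
  rw [submatrix_mul_equiv]

theorem mul_right (d : Decomposable h) {b' : Z → Matrix ι ι ℂ} (hb' : Continuous b')
    (bu' : ∀ z, IsUnit (b' z)) : Decomposable (fun p => h p * b' p.2) := by
  obtain ⟨κ, _, _, c, b, hc, hb, cu, bu, d⟩ := d
  refine ⟨κ, _, _, c, fun z => b z * plusOne κ (b' z), hc, hb.matrix_mul (continuous_plusOne hb'), cu,
    fun z => (bu z).mul (isUnit_plusOne (bu' z)), ?_⟩
  refine (d.mul (GLHtpy.refl (h := fun p : Y × Z => plusOne κ (b' p.2))
    (continuous_plusOne (hb'.comp continuous_snd)) fun p => isUnit_plusOne (bu' _))).congr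
    (fun p => (plusOne_mul _ _).symm) fun p => (mul_assoc _ _ _).symm

theorem mul_left (d : Decomposable h) {c' : Y → Matrix ι ι ℂ} (hc' : Continuous c')
    (cu' : ∀ z, IsUnit (c' z)) : Decomposable (fun p => c' p.1 * h p) := by
  obtain ⟨κ, _, _, c, b, hc, hb, cu, bu, d⟩ := d
  refine ⟨κ, _, _, fun z => plusOne κ (c' z) * c z, b, (continuous_plusOne hc').matrix_mul hc, hb,
    fun z => (isUnit_plusOne (cu' z)).mul (cu z), bu, ?_⟩
  refine ((GLHtpy.refl (h := fun p : Y × Z => plusOne κ (c' p.1))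
    (continuous_plusOne (hc'.comp continuous_fst)) fun p => isUnit_plusOne (cu' _)).mul d).congr
    (fun p => (plusOne_mul _ _).symm) fun p => mul_assoc _ _ _

theorem of_right {b : Z → Matrix ι ι ℂ} (hb : Continuous b) (bu : ∀ z, IsUnit (b z)) :
    Decomposable (fun p : Y × Z => b p.2) := by
  refine ⟨Empty, inferInstance, inferInstance, fun _ => 1, fun z => plusOne Empty (b z), continuous_const,
    continuous_plusOne hb, fun _ => isUnit_one, fun z => isUnit_plusOne (bu z), ?_⟩
  refine (GLHtpy.refl (continuous_plusOne (hb.comp continuous_snd)) fun p => isUnit_plusOne (bu _)).congr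
    (fun p => rfl) fun p => one_mul _

end Decomposable
end

end

section
variable {Y ι : Type} [MetricSpace Y] [CompactSpace Y] [Fintype ι] [DecidableEq ι]

/-- Evaluation at a point as a ring homomorphism. -/
noncomputable def evalHom (y : Y) : C(Y, ℂ) →+* ℂ where
  toFun f := f y
  map_one' := rfl
  map_mul' _ _ := rfl
  map_zero' := rfl
  map_add' _ _ := rfl

@[simp] theorem evalHom_apply (y : Y) (f : C(Y, ℂ)) : evalHom y f = f y := rfl

/-- The functions on `Y × S¹` which are Laurent polynomials in the second variable. -/
def IsLaurent (F : C(Y × Circle, ℂ)) : Prop :=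
  ∃ (K : ℕ) (p : Polynomial C(Y, ℂ)), ∀ y (z : Circle), (z : ℂ) ^ K * F (y, z) = p.eval₂ (evalHom y) z

theorem exists_laurent_approx (F : C(Y × Circle, ℂ)) {ε : ℝ} (hε : 0 < ε) :
    ∃ (K : ℕ) (p : Polynomial C(Y, ℂ)), ∀ y (z : Circle),
      ‖(z : ℂ) ^ K * F (y, z) - p.eval₂ (evalHom y) z‖ < ε := by
  let zc : C(Y × Circle, ℂ) := ⟨fun q => (q.2 : ℂ), by fun_prop⟩
  let S : Set C(Y × Circle, ℂ) := insert zc (Set.range fun f : C(Y, ℂ) => f.comp ⟨Prod.fst, continuous_fst⟩)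
  have hsep : (StarAlgebra.adjoin ℂ S).SeparatesPoints := by
    rintro ⟨y, z⟩ ⟨y', z'⟩ hne
    by_cases hz : z = z'
    · have hy : y ≠ y' := fun h => hne (by rw [h, hz])
      let f : C(Y, ℂ) := ⟨fun x => (dist y x : ℂ), by fun_prop⟩
      refine ⟨_, ⟨f.comp ⟨Prod.fst, continuous_fst⟩, StarAlgebra.subset_adjoin ℂ S (Or.inr ⟨f, rfl⟩), rfl⟩, ?_⟩
      have : (0 : ℂ) ≠ (dist y y' : ℂ) := by exact_mod_cast (dist_pos.2 hy).ne
      simpa [f] using this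
    · refine ⟨_, ⟨zc, StarAlgebra.subset_adjoin ℂ S (Or.inl rfl), rfl⟩, ?_⟩
      exact fun h => hz (Circle.ext h)
  have htop := ContinuousMap.starSubalgebra_topologicalClosure_eq_top_of_separatesPoints _ hsep
  have hF : F ∈ closure ((StarAlgebra.adjoin ℂ S : StarSubalgebra ℂ C(Y × Circle, ℂ)) : Set C(Y × Circle, ℂ)) := by
    rw [← StarSubalgebra.topologicalClosure_coe, htop]; trivial
  have hL : ∀ G ∈ StarAlgebra.adjoin ℂ S, IsLaurent G := by
    intro G hG
    rw [← StarSubalgebra.mem_toSubalgebra, StarAlgebra.adjoin_toSubalgebra] at hG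
    induction hG using Algebra.adjoin_induction with
    | mem G hG =>
      rcases hG with hG | hG
      · rcases hG with rfl | ⟨f, rfl⟩
        · exact ⟨0, Polynomial.X, fun y z => by simp [zc]⟩
        · exact ⟨0, Polynomial.C f, fun y z => by simp⟩
      · rw [Set.mem_star] at hG
        rcases hG with h | ⟨f, h⟩
        · refine ⟨1, 1, fun y z => ?_⟩
          have : G (y, z) = star (z : ℂ) := by
            have h1 : star (star G (y, z)) = G (y, z) := by simp
            rw [← h1, h]; rfl
          have h2 : (z : ℂ) * star (z : ℂ) = 1 := by
            have := Circle.coe_inv_eq_conj z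
            rw [← starRingEnd_apply, ← this, Circle.coe_inv, mul_inv_cancel₀ (Circle.coe_ne_zero z)]
          rw [this, pow_one, h2]; simp
        · refine ⟨0, Polynomial.C (star f), fun y z => ?_⟩
          have : G (y, z) = star (f y) := by
            have h1 : star (star G (y, z)) = G (y, z) := by simp
            rw [← h1, ← h]; rfl
          simp [this]
    | algebraMap r =>
      exact ⟨0, Polynomial.C (algebraMap ℂ _ r), fun y z => by simp⟩
    | add G G' _ _ h h' =>
      obtain ⟨K, p, h⟩ := h
      obtain ⟨K', p', h'⟩ := h'
      refine ⟨K + K', p * Polynomial.X ^ K' + p' * Polynomial.X ^ K, fun y z => ?_⟩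
      simp only [Polynomial.eval₂_add, Polynomial.eval₂_mul, Polynomial.eval₂_X_pow, ← h, ← h',
        ContinuousMap.add_apply]
      ring
    | mul G G' _ _ h h' =>
      obtain ⟨K, p, h⟩ := h
      obtain ⟨K', p', h'⟩ := h'
      refine ⟨K + K', p * p', fun y z => ?_⟩
      simp only [Polynomial.eval₂_mul, ← h, ← h', ContinuousMap.mul_apply]
      ring
  obtain ⟨G, hG, hd⟩ := Metric.mem_closure_iff.1 hF ε hε
  obtain ⟨K, p, hp⟩ := hL G hG
  refine ⟨K, p, fun y z => ?_⟩
  rw [← hp, ← mul_sub, norm_mul, norm_pow, Circle.norm_coe, one_pow, one_mul]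
  refine lt_of_le_of_lt ?_ hd
  rw [← dist_eq_norm]
  exact ContinuousMap.dist_apply_le_dist (y, z)

theorem exists_matrix_laurent_approx {h : Y × Circle → Matrix ι ι ℂ} (hc : Continuous h) {ε : ℝ}
    (hε : 0 < ε) : ∃ (K d : ℕ) (a : ℕ → Y → Matrix ι ι ℂ), (∀ k, Continuous (a k)) ∧
      ∀ y (z : Circle) i j, ‖((z : ℂ) ^ K • h (y, z) -
        ∑ k ∈ Finset.range (d + 2), (z : ℂ) ^ k • a k y) i j‖ < ε := by
  have key := fun i j => exists_laurent_approx (⟨fun q => h q i j, hc.matrix_elem i j⟩ : C(Y × Circle, ℂ)) hε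
  choose K p hp using key
  let K' : ℕ := ∑ i, ∑ j, K i j
  have hK : ∀ i j, K i j ≤ K' := fun i j =>
    (single_le_sum (f := fun j => K i j) (fun _ _ => Nat.zero_le _) (Finset.mem_univ j)).trans
      (single_le_sum (f := fun i => ∑ j, K i j) (fun _ _ => Nat.zero_le _) (Finset.mem_univ i))
  let q : ι → ι → Polynomial C(Y, ℂ) := fun i j => Polynomial.X ^ (K' - K i j) * p i j
  let d : ℕ := ∑ i, ∑ j, (q i j).natDegree
  have hd : ∀ i j, (q i j).natDegree ≤ d := fun i j =>
    (single_le_sum (f := fun j => (q i j).natDegree) (fun _ _ => Nat.zero_le _) (Finset.mem_univ j)).trans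
      (single_le_sum (f := fun i => ∑ j, (q i j).natDegree) (fun _ _ => Nat.zero_le _) (Finset.mem_univ i))
  refine ⟨K', d, fun k y => Matrix.of fun i j => (q i j).coeff k y, fun k => ?_, fun y z i j => ?_⟩
  · exact continuous_matrix fun i j => ((q i j).coeff k).continuous
  · have h1 : ((z : ℂ) ^ K' • h (y, z) - ∑ k ∈ Finset.range (d + 2), (z : ℂ) ^ k •
        (Matrix.of fun i j => (q i j).coeff k y : Matrix ι ι ℂ)) i j
        = (z : ℂ) ^ (K' - K i j) * ((z : ℂ) ^ K i j * h (y, z) i j - (p i j).eval₂ (evalHom y) z) := by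
      have h2 : (q i j).eval₂ (evalHom y) z = (z : ℂ) ^ (K' - K i j) * (p i j).eval₂ (evalHom y) z := by
        simp [q, Polynomial.eval₂_mul]
      rw [mul_sub, ← h2, ← mul_assoc, ← pow_add, Nat.sub_add_cancel (hK i j),
        Polynomial.eval₂_eq_sum_range' _ (n := d + 2) (by have := hd i j; omega)]
      simp only [Matrix.sub_apply, Matrix.smul_apply, Matrix.sum_apply, smul_eq_mul, Matrix.of_apply]
      congr 1
      exact sum_congr rfl fun k _ => mul_comm _ _
    rw [h1, norm_mul, norm_pow, Circle.norm_coe, one_pow, one_mul]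
    exact hp i j y z

section
open scoped Matrix.Norms.Elementwise

theorem exists_GLHtpy_of_close {X : Type} [TopologicalSpace X] [CompactSpace X] {h : X → Matrix ι ι ℂ}
    (hc : Continuous h) (hu : ∀ x, IsUnit (h x)) : ∃ ε > 0, ∀ g : X → Matrix ι ι ℂ, Continuous g →
      (∀ x i j, ‖(h x - g x) i j‖ < ε) → GLHtpy h g := by
  have hK : IsCompact (Set.range h) := isCompact_range hc
  have hO : IsOpen {M : Matrix ι ι ℂ | M.det ≠ 0} :=
    isOpen_ne.preimage (continuous_id.matrix_det)
  obtain ⟨ε, hε, hs⟩ := hK.exists_thickening_subset_open hO (by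
    rintro _ ⟨x, rfl⟩
    exact ((isUnit_iff_isUnit_det _).1 (hu x)).ne_zero)
  refine ⟨ε, hε, fun g hg hd => GLHtpy.line hc hg fun t ht x => ?_⟩
  have : h x + t • (g x - h x) ∈ Metric.thickening ε (Set.range h) := by
    refine Metric.mem_thickening_iff.2 ⟨h x, ⟨x, rfl⟩, ?_⟩
    rw [dist_eq_norm, add_sub_cancel_left, norm_smul, Real.norm_of_nonneg ht.1]
    have h1 : ‖g x - h x‖ < ε := by
      rw [norm_sub_rev]
      exact (Matrix.norm_lt_iff hε).2 (hd x)
    exact lt_of_le_of_lt (mul_le_of_le_one_left (norm_nonneg _) ht.2) h1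
  exact (isUnit_iff_isUnit_det _).2 (isUnit_iff_ne_zero.2 (hs this))

end

/-- Linearization of matrix polynomials. -/
theorem Decomposable.of_polynomial
    (hl : ∀ (ι : Type) [Fintype ι] [DecidableEq ι] (a b : Y → Matrix ι ι ℂ), Continuous a → Continuous b →
      (∀ y (z : Circle), IsUnit (a y + (z : ℂ) • b y)) →
      Decomposable fun p : Y × Circle => a p.1 + (p.2 : ℂ) • b p.1) (d : ℕ) :
    ∀ (ι : Type) [Fintype ι] [DecidableEq ι] (a : ℕ → Y → Matrix ι ι ℂ), (∀ k, Continuous (a k)) →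
      (∀ y (z : Circle), IsUnit (∑ k ∈ Finset.range (d + 2), (z : ℂ) ^ k • a k y)) →
      Decomposable fun p : Y × Circle => ∑ k ∈ Finset.range (d + 2), (p.2 : ℂ) ^ k • a k p.1 := by
  induction d with
  | zero =>
    intro ι _ _ a ha hu
    simp only [Finset.sum_range_succ, Finset.sum_range_zero, zero_add, pow_zero, one_smul, pow_one] at hu ⊢
    exact hl ι _ _ (ha 0) (ha 1) hu
  | succ d ih =>
    intro ι _ _ a ha hu
    let m : ℕ → Y → Matrix (ι ⊕ ι) (ι ⊕ ι) ℂ := fun k y =>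
      fromBlocks (if k = 0 then a 0 y else 0) (a (k + 1) y) (if k = 1 then -1 else 0) (if k = 0 then 1 else 0)
    have hm : ∀ k, Continuous (m k) := fun k => by
      refine Continuous.matrix_fromBlocks ?_ (ha _) continuous_const continuous_const
      split_ifs
      exacts [ha 0, continuous_const]
    let q : Y × Circle → Matrix ι ι ℂ := fun p => ∑ k ∈ Finset.range (d + 2), (p.2 : ℂ) ^ k • a (k + 1) p.1
    have hq : Continuous q := continuous_finsetSum _ fun k _ =>
      (show Continuous fun p : Y × Circle => (p.2 : ℂ) ^ k by fun_prop).smul ((ha _).comp continuous_fst)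
    have hM : ∀ p : Y × Circle, ∑ k ∈ Finset.range (d + 2), (p.2 : ℂ) ^ k • m k p.1
        = fromBlocks (a 0 p.1) (q p) (-(p.2 : ℂ) • (1 : Matrix ι ι ℂ)) 1 := fun p => by
      ext (i | i) (j | j)
      · rw [Matrix.sum_apply, sum_eq_single 0] <;> simp +contextual [m]
      · rw [Matrix.sum_apply]; simp [m, q, Matrix.sum_apply]
      · rw [Matrix.sum_apply, sum_eq_single 1] <;> simp +contextual [m]
      · rw [Matrix.sum_apply, sum_eq_single 0] <;> simp +contextual [m]
    have hz0 : Continuous fun p : Y × Circle => (p.2 : ℂ) := by fun_prop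
    have hz : Continuous fun p : Y × Circle => (p.2 : ℂ) • (1 : Matrix ι ι ℂ) := hz0.smul continuous_const
    have hf : ∀ p : Y × Circle, plusOne ι (∑ k ∈ Finset.range (d + 1 + 2), (p.2 : ℂ) ^ k • a k p.1)
        = fromBlocks 1 (-q p) 0 1 * fromBlocks (a 0 p.1) (q p) (-(p.2 : ℂ) • (1 : Matrix ι ι ℂ)) 1
          * fromBlocks 1 0 ((p.2 : ℂ) • (1 : Matrix ι ι ℂ)) 1 := fun p => by
      rw [Finset.sum_range_succ']
      simp [fromBlocks_multiply, q, smul_sum, smul_smul, pow_succ', add_comm]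
    have hMc : Continuous fun p : Y × Circle => fromBlocks (a 0 p.1) (q p) (-(p.2 : ℂ) • (1 : Matrix ι ι ℂ)) 1 :=
      ((ha 0).comp continuous_fst).matrix_fromBlocks hq (hz0.neg.smul continuous_const)
        continuous_const
    have hMu : ∀ p : Y × Circle, IsUnit (fromBlocks (a 0 p.1) (q p) (-(p.2 : ℂ) • (1 : Matrix ι ι ℂ)) 1) := fun p => by
      have h1 := isUnit_plusOne (κ := ι) (hu p.1 p.2)
      rw [hf p, isUnit_iff_isUnit_det, det_mul, det_mul, det_fromBlocks_zero₂₁, det_fromBlocks_zero₁₂] at h1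
      rw [isUnit_iff_isUnit_det]
      simpa using h1
    have hd := ih (ι ⊕ ι) m hm (fun y z => by rw [hM (y, z)]; exact hMu (y, z))
    simp only [hM] at hd
    refine Decomposable.of_plusOne (κ := ι) (Decomposable.of_htpy (h' := _) ?_ hd)
    exact (((GLHtpy.upper hq.neg).mul (GLHtpy.refl hMc hMu)).mul (GLHtpy.lower hz)).congr hf
      fun p => by rw [one_mul, mul_one]

theorem Decomposable.of_linear
    (hl : ∀ (ι : Type) [Fintype ι] [DecidableEq ι] (a b : Y → Matrix ι ι ℂ), Continuous a → Continuous b →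
      (∀ y (z : Circle), IsUnit (a y + (z : ℂ) • b y)) →
      Decomposable fun p : Y × Circle => a p.1 + (p.2 : ℂ) • b p.1)
    {h : Y × Circle → Matrix ι ι ℂ} (hc : Continuous h) (hu : ∀ x, IsUnit (h x)) : Decomposable h := by
  obtain ⟨ε, hε, hg⟩ := exists_GLHtpy_of_close hc hu
  obtain ⟨K, d, a, ha, hK⟩ := exists_matrix_laurent_approx hc hε
  have hzc : ∀ k : ℕ, Continuous fun z : Circle => (z : ℂ) ^ k := fun k => by fun_prop
  have hz0 : ∀ (z : Circle) k, (z : ℂ) ^ k ≠ 0 := fun z k => pow_ne_zero _ (Circle.coe_ne_zero z)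
  have hzi : ∀ k : ℕ, Continuous fun z : Circle => ((z : ℂ) ^ k)⁻¹ := fun k => (hzc k).inv₀ fun z => hz0 z k
  let q : Y × Circle → Matrix ι ι ℂ := fun p => ∑ k ∈ Finset.range (d + 2), (p.2 : ℂ) ^ k • a k p.1
  have hq : Continuous q := continuous_finsetSum _ fun k _ =>
      (show Continuous fun p : Y × Circle => (p.2 : ℂ) ^ k by fun_prop).smul ((ha _).comp continuous_fst)
  have hh : GLHtpy h (fun p => q p * ((p.2 : ℂ) ^ K)⁻¹ • 1) := by
    refine hg _ (hq.matrix_mul (((hzi K).comp continuous_snd).smul continuous_const)) fun p i j => ?_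
    have h1 : h p - q p * ((p.2 : ℂ) ^ K)⁻¹ • 1 = ((p.2 : ℂ) ^ K)⁻¹ • ((p.2 : ℂ) ^ K • h p - q p) := by
      rw [smul_sub, inv_smul_smul₀ (hz0 _ _)]; simp
    rw [h1, Matrix.smul_apply, norm_smul, norm_inv, norm_pow, Circle.norm_coe, one_pow, inv_one, one_mul]
    exact hK p.1 p.2 i j
  have hsu : ∀ z : Circle, IsUnit (((z : ℂ) ^ K)⁻¹ • (1 : Matrix ι ι ℂ)) := fun z =>
    isUnit_of_mul_eq_one_left (N := (z : ℂ) ^ K • 1) (by simp [smul_smul, hz0])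
  have hqu : ∀ y (z : Circle), IsUnit (q (y, z)) := fun y z => by
    have h1 := hh.isUnit_right (y, z)
    replace h1 : IsUnit (q (y, z) * (((z : ℂ) ^ K)⁻¹ • (1 : Matrix ι ι ℂ))) := h1
    rw [isUnit_iff_isUnit_det, det_mul] at h1
    exact (isUnit_iff_isUnit_det _).2 (isUnit_of_mul_isUnit_left h1)

  have hdq : Decomposable q := Decomposable.of_polynomial hl d ι a ha hqu
  have := (hdq.mul_right (b' := fun z : Circle => ((z : ℂ) ^ K)⁻¹ • (1 : Matrix ι ι ℂ)) ((hzi K).smul continuous_const) hsu)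
  exact Decomposable.of_htpy hh this

end

section
variable {ι : Type} [Fintype ι] [DecidableEq ι]

theorem commute_inv_matrix {b M : Matrix ι ι ℂ} (h : Commute b M) (hu : IsUnit M) : Commute b M⁻¹ := by
  have h1 := inv_mul_of_isUnit hu
  have h2 := mul_inv_of_isUnit hu
  calc b * M⁻¹ = M⁻¹ * M * b * M⁻¹ := by rw [h1, one_mul]
    _ = M⁻¹ * (b * M) * M⁻¹ := by rw [h.eq]; simp only [mul_assoc]
    _ = M⁻¹ * b := by rw [mul_assoc, mul_assoc b, h2, mul_one]

/-- The integrand of the Riesz projection. -/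
noncomputable def rieszTerm (b : Matrix ι ι ℂ) (w : ℂ) : Matrix ι ι ℂ := w • (b * (1 - b + w • b)⁻¹)

theorem commute_rieszTerm {b : Matrix ι ι ℂ} {w : ℂ} (h : IsUnit (1 - b + w • b)) :
    Commute b (rieszTerm b w) := by
  have h1 : Commute b (1 - b + w • b) :=
    ((Commute.one_right b).sub_right (Commute.refl b)).add_right ((Commute.refl b).smul_right w)
  exact (((Commute.refl b).mul_right (commute_inv_matrix h1 h))).smul_right w

theorem rieszTerm_mul {b : Matrix ι ι ℂ} {w v : ℂ} (hw : IsUnit (1 - b + w • b))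
    (hv : IsUnit (1 - b + v • b)) (hne : v ≠ w) :
    rieszTerm b w * rieszTerm b v = (v / (v - w)) • rieszTerm b w + (w / (w - v)) • rieszTerm b v := by
  set W := 1 - b + w • b with hW
  set V := 1 - b + v • b with hV
  have hbW : Commute b W :=
    ((Commute.one_right b).sub_right (Commute.refl b)).add_right ((Commute.refl b).smul_right w)
  have cW := commute_inv_matrix hbW hw
  have hd : V - W = (v - w) • b := by rw [hW, hV, sub_smul]; abel
  have key : W⁻¹ - V⁻¹ = (v - w) • (W⁻¹ * (b * V⁻¹)) := by
    have : W⁻¹ * (V - W) * V⁻¹ = W⁻¹ - V⁻¹ := by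
      rw [mul_sub, sub_mul, inv_mul_of_isUnit hw, one_mul, mul_assoc,
        mul_inv_of_isUnit hv, mul_one]
    rw [← this, hd]; simp [mul_assoc]
  have h0 : v - w ≠ 0 := sub_ne_zero.2 hne
  have k2 : W⁻¹ * (b * V⁻¹) = (v - w)⁻¹ • (W⁻¹ - V⁻¹) := by rw [key, smul_smul, inv_mul_cancel₀ h0, one_smul]
  have k3 : w - v = -(v - w) := by ring
  rw [rieszTerm, rieszTerm, ← hW, ← hV, smul_mul_smul_comm, mul_assoc, k2, Matrix.mul_smul, mul_sub,
    k3, smul_smul, smul_smul, smul_smul, smul_sub, sub_eq_add_neg, ← neg_smul]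
  congr 2 <;> field_simp

theorem sum_div_sub_nthRoots {N : ℕ} (hN : 0 < N) {w : ℂ} (hw : w ∈ nthRootsFinset N (1 : ℂ)) :
    ∑ v ∈ (nthRootsFinset N (1 : ℂ)).erase w, v / (v - w) = (N - 1) / 2 := by
  have hwN := (mem_nthRootsFinset hN _).1 hw
  have hne : ∀ v ∈ nthRootsFinset N (1 : ℂ), v ≠ 0 := fun v hv h => by
    have := (mem_nthRootsFinset hN _).1 hv
    rw [h, zero_pow hN.ne'] at this
    exact zero_ne_one this
  have hw0 := hne w hw
  set S := (nthRootsFinset N (1 : ℂ)).erase w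
  have hm : ∀ v ∈ S, w ^ 2 / v ∈ S := fun v hv => by
    obtain ⟨h1, h2⟩ := Finset.mem_erase.1 hv
    refine Finset.mem_erase.2 ⟨fun h => h1 ?_, ?_⟩
    · have := hne v h2
      field_simp at h
      exact h.symm
    · rw [mem_nthRootsFinset hN, div_pow, (mem_nthRootsFinset hN _).1 h2, ← pow_mul,
        mul_comm, pow_mul, hwN]; simp
  have hs : ∑ v ∈ S, v / (v - w) = ∑ v ∈ S, (w ^ 2 / v) / (w ^ 2 / v - w) := by
    refine Finset.sum_nbij' (fun v => w ^ 2 / v) (fun v => w ^ 2 / v) hm hm ?_ ?_ ?_ <;> intro v hv <;>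
      have := hne v (Finset.mem_of_mem_erase hv) <;> field_simp
  have h2 : ∑ v ∈ S, (v / (v - w) + (w ^ 2 / v) / (w ^ 2 / v - w)) = ∑ v ∈ S, (1 : ℂ) :=
    sum_congr rfl fun v hv => by
      obtain ⟨h1, h2⟩ := Finset.mem_erase.1 hv
      have h3 := hne v h2
      have h4 : v - w ≠ 0 := sub_ne_zero.2 h1
      have h5 : w ^ 2 / v - w = -(w * (v - w) / v) := by field_simp; ring
      rw [h5]
      field_simp
      ring
  rw [sum_add_distrib, ← hs, sum_const, Finset.card_erase_of_mem hw,
    (Complex.isPrimitiveRoot_exp N hN.ne').card_nthRootsFinset, nsmul_eq_mul, mul_one, Nat.cast_sub hN,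
    Nat.cast_one] at h2
  rw [eq_div_iff two_ne_zero, mul_two, h2]

/-- The Riemann sum of the Riesz projection. -/
noncomputable def rieszSum (b : Matrix ι ι ℂ) (N : ℕ) : Matrix ι ι ℂ :=
  (N : ℂ)⁻¹ • ∑ w ∈ nthRootsFinset N (1 : ℂ), rieszTerm b w

theorem rieszSum_sub_sq {b : Matrix ι ι ℂ} {N : ℕ} (hN : 0 < N)
    (hu : ∀ w ∈ nthRootsFinset N (1 : ℂ), IsUnit (1 - b + w • b)) :
    rieszSum b N - rieszSum b N * rieszSum b N = (N : ℂ)⁻¹ • (rieszSum b N -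
      (N : ℂ)⁻¹ • ∑ w ∈ nthRootsFinset N (1 : ℂ), rieszTerm b w * rieszTerm b w) := by
  set S := nthRootsFinset N (1 : ℂ)
  set u := rieszTerm b
  have h1 : (∑ w ∈ S, u w) * ∑ w ∈ S, u w = ∑ w ∈ S, u w * u w + (N - 1 : ℂ) • ∑ w ∈ S, u w := by
    have e1 : ∀ w ∈ S, u w * ∑ v ∈ S, u v = u w * u w + (((N - 1) / 2 : ℂ) • u w
        + ∑ v ∈ S.erase w, (w / (w - v)) • u v) := fun w hw => by
      rw [← Finset.add_sum_erase _ _ hw, mul_add, mul_sum, ← sum_div_sub_nthRoots hN hw, sum_smul,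
        ← sum_add_distrib]
      congr 1
      exact sum_congr rfl fun v hv => rieszTerm_mul (hu w hw) (hu v (Finset.mem_of_mem_erase hv))
        (Finset.ne_of_mem_erase hv)
    have e2 : ∑ w ∈ S, ∑ v ∈ S.erase w, (w / (w - v)) • u v = ((N - 1) / 2 : ℂ) • ∑ w ∈ S, u w := by
      rw [Finset.sum_comm' (s' := fun v => S.erase v) (t' := S) (fun x y => by
        simp only [Finset.mem_erase]; tauto), smul_sum]
      refine sum_congr rfl fun v hv => ?_
      rw [← sum_smul, sum_div_sub_nthRoots hN hv]
    rw [sum_mul, sum_congr rfl e1, sum_add_distrib, sum_add_distrib, e2,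
      ← smul_sum, ← add_smul]
    congr 2
    ring
  have hN0 : (N : ℂ) ≠ 0 := Nat.cast_ne_zero.2 hN.ne'
  have h2 : rieszSum b N = (N : ℂ)⁻¹ • ∑ w ∈ S, u w := rfl
  rw [h2, smul_mul_smul_comm, h1]
  match_scalars <;> (field_simp; try ring)

theorem mulVec_rieszTerm {b : Matrix ι ι ℂ} {w l : ℂ} (hu : IsUnit (1 - b + w • b)) {v : ι → ℂ}
    (hv : v ≠ 0) (hb : b *ᵥ v = l • v) :
    1 - l + w * l ≠ 0 ∧ rieszTerm b w *ᵥ v = (w * l / (1 - l + w * l)) • v := by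
  have h1 : (1 - b + w • b) *ᵥ v = (1 - l + w * l) • v := by
    rw [add_mulVec, sub_mulVec, one_mulVec, smul_mulVec, hb]; module
  have h2 : v = (1 - l + w * l) • ((1 - b + w • b)⁻¹ *ᵥ v) := by
    rw [← mulVec_smul, ← h1, mulVec_mulVec, inv_mul_of_isUnit hu, one_mulVec]
  have h3 : 1 - l + w * l ≠ 0 := fun h => hv (by rw [h2, h, zero_smul])
  refine ⟨h3, ?_⟩
  have h4 : (1 - b + w • b)⁻¹ *ᵥ v = (1 - l + w * l)⁻¹ • v := by
    nth_rw 2 [h2]; rw [smul_smul, inv_mul_cancel₀ h3, one_smul]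
  rw [rieszTerm, smul_mulVec, ← mulVec_mulVec, h4, mulVec_smul, hb, smul_smul, smul_smul]
  congr 1
  field_simp

theorem half_lt_re_iff {w l : ℂ} (hw : ‖w‖ = 1) (h : 1 - l + w * l ≠ 0) :
    (1 / 2 < (w * l / (1 - l + w * l)).re ↔ 1 / 2 < l.re) ∧
      ((w * l / (1 - l + w * l)).re < 1 / 2 ↔ l.re < 1 / 2) := by
  have hn : 0 < Complex.normSq (1 - l + w * l) := Complex.normSq_pos.2 h
  have hw2 : w.re * w.re + w.im * w.im = 1 := by
    have := Complex.normSq_eq_norm_sq w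
    rw [hw, Complex.normSq_apply] at this; simpa using this
  have key : (w * l / (1 - l + w * l)).re - 1 / 2
      = (2 * l.re - 1) / (2 * Complex.normSq (1 - l + w * l)) := by
    have e : (w * l / (1 - l + w * l)).re = ((w * l).re * (1 - l + w * l).re
        + (w * l).im * (1 - l + w * l).im) / Complex.normSq (1 - l + w * l) := by
      rw [Complex.div_re]; ring
    rw [e, div_sub_div _ _ hn.ne' two_ne_zero, div_eq_div_iff (by positivity) (by positivity)]
    have : Complex.normSq (1 - l + w * l) = (1 - l.re) ^ 2 + l.im ^ 2 + (l.re ^ 2 + l.im ^ 2)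
        * (w.re * w.re + w.im * w.im) + 2 * ((1 - l.re) * (w * l).re - l.im * (w * l).im) := by
      simp [Complex.normSq_apply]; ring
    have h2 : 2 * ((w * l).re * (1 - l + w * l).re + (w * l).im * (1 - l + w * l).im)
        - Complex.normSq (1 - l + w * l) = 2 * l.re - 1 := by
      rw [this, hw2]
      have h3 : (w * l).re ^ 2 + (w * l).im ^ 2 = (w.re * w.re + w.im * w.im) * (l.re ^ 2 + l.im ^ 2) := by
        simp; ring
      rw [hw2] at h3
      simp only [Complex.add_re, Complex.add_im, Complex.sub_re, Complex.sub_im, Complex.one_re, Complex.one_im]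
      linear_combination 2 * h3
    linear_combination (2 * Complex.normSq (1 - l + w * l)) * h2
  have hp : 0 < 2 * Complex.normSq (1 - l + w * l) := by positivity
  constructor
  · rw [← sub_pos, key, div_pos_iff_of_pos_right hp]; constructor <;> intro h <;> linarith
  · rw [← sub_neg, key, div_lt_iff₀ hp]; constructor <;> intro h <;> linarith

open scoped Matrix.Norms.Operator

theorem isUnit_of_close_rieszSum {b e : Matrix ι ι ℂ} (hu : ∀ w : ℂ, ‖w‖ = 1 → IsUnit (1 - b + w • b))
    {N : ℕ} (hN : 0 < N) (he : e * e = e) (hbe : Commute b e) (hd : ‖e - rieszSum b N‖ < 1 / 2)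
    {s : ℝ} (hs : s ∈ Set.Icc (0 : ℝ) 1) {z : ℂ} (hz : ‖z‖ = 1) :
    IsUnit (1 + (z - 1) • ((1 - s : ℂ) • b + (s : ℂ) • e)) := by
  set T := 1 + (z - 1) • ((1 - s : ℂ) • b + (s : ℂ) • e) with hT
  by_contra hne
  have hbT : Commute b T := (Commute.one_right b).add_right
    ((((Commute.refl b).smul_right _).add_right (hbe.smul_right _)).smul_right _)
  have heT : Commute e T := (Commute.one_right e).add_right
    (((hbe.symm.smul_right _).add_right ((Commute.refl e).smul_right _)).smul_right _)
  obtain ⟨v, hv, hTv⟩ : ∃ v, v ≠ 0 ∧ T *ᵥ v = 0 := by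
    rw [Matrix.exists_mulVec_eq_zero_iff]
    by_contra h
    exact hne ((isUnit_iff_isUnit_det _).2 (isUnit_iff_ne_zero.2 h))
  obtain ⟨ε, hε, v, hv, hTv, hev⟩ : ∃ ε : ℂ, (ε = 0 ∨ ε = 1) ∧ ∃ v, v ≠ 0 ∧ T *ᵥ v = 0 ∧ e *ᵥ v = ε • v := by
    by_cases h : e *ᵥ v = 0
    · exact ⟨0, Or.inl rfl, v, hv, hTv, by rw [h, zero_smul]⟩
    · refine ⟨1, Or.inr rfl, e *ᵥ v, h, ?_, ?_⟩
      · rw [mulVec_mulVec, ← heT.eq, ← mulVec_mulVec, hTv, mulVec_zero]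
      · rw [mulVec_mulVec, he, one_smul]
  let K : Submodule ℂ (ι → ℂ) := LinearMap.ker (toLin' T) ⊓ LinearMap.ker (toLin' (e - ε • 1))
  have hK : ∀ x, x ∈ K ↔ T *ᵥ x = 0 ∧ e *ᵥ x = ε • x := fun x => by
    simp [K, sub_mulVec, smul_mulVec, sub_eq_zero]
  have hbK : ∀ x ∈ K, toLin' b x ∈ K := fun x hx => by
    rw [hK] at hx ⊢
    rw [toLin'_apply, mulVec_mulVec, mulVec_mulVec, ← hbT.eq, ← hbe.eq, ← mulVec_mulVec, ← mulVec_mulVec,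
      hx.1, hx.2, mulVec_zero, mulVec_smul]
    exact ⟨rfl, rfl⟩
  have : Nontrivial K := Submodule.nontrivial_iff_ne_bot.2 fun h => hv (by
    have : v ∈ K := (hK v).2 ⟨hTv, hev⟩
    rwa [h] at this)
  obtain ⟨l, hl⟩ := Module.End.exists_eigenvalue ((toLin' b).restrict hbK)
  obtain ⟨⟨x, hxK⟩, hx⟩ := hl.exists_hasEigenvector
  have hx0 : x ≠ 0 := fun h => hx.2 (Subtype.ext h)
  have hbx : b *ᵥ x = l • x := by
    have := congrArg Subtype.val hx.apply_eq_smul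
    simpa using this
  obtain ⟨hTx, hex⟩ := (hK x).1 hxK
  have h1 : 1 + (z - 1) * ((1 - s) * l + s * ε) = 0 := by
    have : T *ᵥ x = (1 + (z - 1) * ((1 - s) * l + s * ε)) • x := by
      rw [hT, add_mulVec, one_mulVec, smul_mulVec, add_mulVec, smul_mulVec, smul_mulVec, hbx, hex]; module
    rw [hTx] at this
    exact (smul_eq_zero.1 this.symm).resolve_right hx0
  set m := (1 - s) * l + s * ε with hm
  have h2 : m.re = 1 / 2 := by
    have h3 : 1 - m = -(z * m) := by linear_combination h1
    have h4 : ‖1 - m‖ = ‖m‖ := by rw [h3, norm_neg, norm_mul, hz, one_mul]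
    have h5 := congrArg (· ^ 2) h4
    simp only [← Complex.normSq_eq_norm_sq, Complex.normSq_apply] at h5
    simp at h5
    linarith
  have hm2 : m.re = (1 - s) * l.re + s * ε.re := by
    rw [hm]
    have : ((1 : ℂ) - s) = ((1 - s : ℝ) : ℂ) := by push_cast; rfl
    rw [this, Complex.add_re, Complex.re_ofReal_mul, Complex.re_ofReal_mul]
  set S := nthRootsFinset N (1 : ℂ) with hS
  have hS1 : ∀ w ∈ S, ‖w‖ = 1 := fun w hw =>
    Complex.norm_eq_one_of_pow_eq_one ((mem_nthRootsFinset hN _).1 hw) hN.ne'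
  have hcard : S.card = N := (Complex.isPrimitiveRoot_exp N hN.ne').card_nthRootsFinset
  let f : ℂ → ℂ := fun w => w * l / (1 - l + w * l)
  have ha : rieszSum b N *ᵥ x = ((N : ℂ)⁻¹ * ∑ w ∈ S, f w) • x := by
    rw [rieszSum, smul_mulVec, sum_mulVec, sum_congr rfl fun w hw =>
      (mulVec_rieszTerm (hu w (hS1 w hw)) hx0 hbx).2, ← sum_smul, smul_smul]
  have h3 : ‖ε - (N : ℂ)⁻¹ * ∑ w ∈ S, f w‖ < 1 / 2 := by
    refine lt_of_le_of_lt ?_ hd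
    have := linfty_opNorm_mulVec (e - rieszSum b N) x
    rw [sub_mulVec, hex, ha, ← sub_smul, norm_smul] at this
    exact le_of_mul_le_mul_right this (norm_pos_iff.2 hx0)
  have h4 : |ε.re - (N : ℝ)⁻¹ * ∑ w ∈ S, (f w).re| < 1 / 2 := by
    refine lt_of_le_of_lt (le_of_eq_of_le ?_ (Complex.abs_re_le_norm _)) h3
    rw [Complex.sub_re, ← Complex.ofReal_natCast, ← Complex.ofReal_inv, Complex.re_ofReal_mul, Complex.re_sum]
  have hNr : (0 : ℝ) < N := Nat.cast_pos.2 hN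
  rw [abs_lt] at h4
  have h5 : ∀ c : ℝ, (N : ℝ)⁻¹ * ∑ w ∈ S, c = c := fun c => by
    rw [sum_const, hcard, nsmul_eq_mul]; field_simp
  rcases hε with rfl | rfl
  · have : ∃ w ∈ S, (f w).re < 1 / 2 := by
      by_contra! hc
      have h6 := mul_le_mul_of_nonneg_left (Finset.sum_le_sum hc) (inv_nonneg.2 hNr.le)
      rw [h5] at h6
      simp only [Complex.zero_re] at h4
      linarith
    obtain ⟨w, hw, h⟩ := this
    have := ((half_lt_re_iff (hS1 w hw) (mulVec_rieszTerm (hu w (hS1 w hw)) hx0 hbx).1).2).1 h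
    rw [Complex.zero_re, h2] at hm2
    have h6 := mul_nonneg (sub_nonneg.2 hs.2) (sub_pos.2 this).le
    have h7 : s = 0 := le_antisymm (by linarith) hs.1
    rw [h7] at hm2
    linarith
  · have : ∃ w ∈ S, 1 / 2 < (f w).re := by
      by_contra! hc
      have h6 := mul_le_mul_of_nonneg_left (Finset.sum_le_sum hc) (inv_nonneg.2 hNr.le)
      rw [h5] at h6
      simp only [Complex.one_re] at h4
      linarith
    obtain ⟨w, hw, h⟩ := this
    have := ((half_lt_re_iff (hS1 w hw) (mulVec_rieszTerm (hu w (hS1 w hw)) hx0 hbx).1).1).1 h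
    rw [Complex.one_re, h2] at hm2
    have h6 := mul_nonneg (sub_nonneg.2 hs.2) (sub_pos.2 this).le
    have h7 : s = 0 := le_antisymm (by linarith) hs.1
    rw [h7] at hm2
    linarith

end

section
variable {Y ι κ : Type} [MetricSpace Y] [CompactSpace Y] [Fintype ι] [DecidableEq ι] [Fintype κ] [DecidableEq κ]

section
open scoped Matrix.Norms.Operator

theorem continuous_rieszTerm {b : Y → Matrix ι ι ℂ} (hb : Continuous b)
    (hu : ∀ y (w : Circle), IsUnit (1 - b y + (w : ℂ) • b y)) :
    Continuous fun p : Y × Circle => rieszTerm (b p.1) p.2 := by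
  have h1 : Continuous fun p : Y × Circle => (p.2 : ℂ) := by fun_prop
  have h2 : Continuous fun p : Y × Circle => b p.1 := hb.comp continuous_fst
  exact h1.smul (h2.matrix_mul (continuous_inv_matrix ((continuous_const.sub h2).add (h1.smul h2))
    fun p => hu p.1 p.2))

theorem exists_idempotent_GLHtpy {b : Y → Matrix ι ι ℂ} (hb : Continuous b)
    (hu : ∀ y (w : Circle), IsUnit (1 - b y + (w : ℂ) • b y)) :
    ∃ e : Y → Matrix ι ι ℂ, Continuous e ∧ (∀ y, e y * e y = e y) ∧
      GLHtpy (fun p : Y × Circle => 1 + ((p.2 : ℂ) - 1) • b p.1)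
        (fun p : Y × Circle => 1 + ((p.2 : ℂ) - 1) • e p.1) := by
  have hu' : ∀ y (w : ℂ), ‖w‖ = 1 → IsUnit (1 - b y + w • b y) := fun y w hw =>
    hu y ⟨w, mem_sphere_zero_iff_norm.2 hw⟩
  obtain ⟨C, hC⟩ := (isCompact_range (continuous_rieszTerm hb hu).norm).bddAbove
  have hC1 : ∀ y (w : ℂ), ‖w‖ = 1 → ‖rieszTerm (b y) w‖ ≤ max C 0 := fun y w hw =>
    (hC ⟨(y, ⟨w, mem_sphere_zero_iff_norm.2 hw⟩), rfl⟩).trans (le_max_left _ _)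
  set D := max C 0
  have hD0 : 0 ≤ D := le_max_right _ _
  set R : ℝ := 2 * D + ‖(1 : Matrix ι ι ℂ)‖ + 1
  have hR : 0 < R := by positivity
  obtain ⟨η, hη, hη1, hq⟩ : ∃ η > 0, η ≤ 1 ∧ ∀ x : Matrix ι ι ℂ, ‖x‖ < η → ‖isqrt x - 1‖ < 1 / R := by
    have h1 : ContinuousAt (isqrt (𝔸 := Matrix ι ι ℂ)) 0 :=
      contDiffOn_isqrt.continuousOn.continuousAt (Metric.ball_mem_nhds _ one_pos)
    obtain ⟨η, hη, h⟩ := Metric.continuousAt_iff.1 h1 (1 / R) (by positivity)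
    refine ⟨min η 1, by positivity, min_le_right _ _, fun x hx => ?_⟩
    have := h (x := x) (by rw [dist_zero_right]; exact lt_of_lt_of_le hx (min_le_left _ _))
    rwa [isqrt_zero, dist_eq_norm] at this
  obtain ⟨N, hN⟩ := exists_nat_gt (4 * (D + D * D) / η)
  have hNr : (0 : ℝ) < N := lt_of_le_of_lt (by positivity) hN
  have hNp : 0 < N := Nat.cast_pos.1 hNr
  set S := nthRootsFinset N (1 : ℂ) with hS
  have hS1 : ∀ w ∈ S, ‖w‖ = 1 := fun w hw =>
    Complex.norm_eq_one_of_pow_eq_one ((mem_nthRootsFinset hNp _).1 hw) hNp.ne'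
  have hcard : S.card = N := (Complex.isPrimitiveRoot_exp N hNp.ne').card_nthRootsFinset
  have havg : ∀ (f : ℂ → Matrix ι ι ℂ) (c : ℝ), (∀ w ∈ S, ‖f w‖ ≤ c) → ‖(N : ℂ)⁻¹ • ∑ w ∈ S, f w‖ ≤ c := by
    intro f c hf
    rw [norm_smul, norm_inv, Complex.norm_natCast, inv_mul_le_iff₀ hNr]
    refine (norm_sum_le _ _).trans ((Finset.sum_le_sum hf).trans ?_)
    rw [sum_const, hcard, nsmul_eq_mul]
  let a : Y → Matrix ι ι ℂ := fun y => rieszSum (b y) N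
  have hac : Continuous a := by
    have h1 : Continuous fun y => ∑ w ∈ S, rieszTerm (b y) w := continuous_finsetSum _ fun w hw =>
      (continuous_rieszTerm hb hu).comp
        (f := fun y => (y, (⟨w, mem_sphere_zero_iff_norm.2 (hS1 w hw)⟩ : Circle))) (by fun_prop)
    exact h1.const_smul ((N : ℂ)⁻¹)
  have ha : ∀ y, ‖a y‖ ≤ D := fun y => havg _ _ fun w hw => hC1 y w (hS1 w hw)
  have hba : ∀ y, Commute (b y) (a y) := fun y => Commute.smul_right
    (Commute.sum_right _ _ _ fun w hw => commute_rieszTerm (hu' y w (hS1 w hw))) _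
  let x : Y → Matrix ι ι ℂ := fun y => -(4 : ℝ) • (a y - a y * a y)
  have hxc : Continuous x := (hac.sub (hac.mul hac)).const_smul (-(4 : ℝ))
  have hx : ∀ y, ‖x y‖ < η := fun y => by
    have h1 : ‖a y - a y * a y‖ ≤ (N : ℝ)⁻¹ * (D + D * D) := by
      rw [rieszSum_sub_sq hNp fun w hw => hu' y w (hS1 w hw), norm_smul, norm_inv, Complex.norm_natCast]
      refine mul_le_mul_of_nonneg_left ((norm_sub_le _ _).trans (add_le_add (ha y) (havg _ _ fun w hw => ?_)))
        (inv_nonneg.2 hNr.le)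
      exact (norm_mul_le _ _).trans (mul_le_mul (hC1 y w (hS1 w hw)) (hC1 y w (hS1 w hw)) (norm_nonneg _) hD0)
    rw [norm_smul, norm_neg, Real.norm_of_nonneg (by norm_num)]
    refine lt_of_le_of_lt (mul_le_mul_of_nonneg_left h1 (by norm_num)) ?_
    rw [div_lt_iff₀ hη] at hN
    have h2 : (N : ℝ)⁻¹ * N = 1 := inv_mul_cancel₀ hNr.ne'
    calc 4 * ((N : ℝ)⁻¹ * (D + D * D)) = (N : ℝ)⁻¹ * (4 * (D + D * D)) := by ring
      _ < (N : ℝ)⁻¹ * (N * η) := mul_lt_mul_of_pos_left hN (inv_pos.2 hNr)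
      _ = η := by rw [← mul_assoc, h2, one_mul]
  have hx1 : ∀ y, ‖x y‖ < 1 := fun y => lt_of_lt_of_le (hx y) hη1
  have hcx : ∀ y (m : Matrix ι ι ℂ), Commute m (a y) → Commute m (isqrt (x y)) := fun y m hm =>
    commute_isqrt ((hm.sub_right (hm.mul_right hm)).smul_right _) (hx1 y)
  let s : Y → Matrix ι ι ℂ := fun y => (2 * a y - 1) * isqrt (x y)
  have hss : ∀ y, s y * s y = 1 := fun y => by
    have h1 : Commute (2 * a y - 1) (a y) := (((Commute.ofNat_left 2 (a y)).mul_left (Commute.refl _))).sub_left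
      (Commute.one_left _)
    have h2 := (hcx y _ h1).eq
    have h3 := isqrt_mul_self (hx1 y)
    have h4 : 1 + x y = (2 * a y - 1) * (2 * a y - 1) := by
      have : x y = -4 * (a y - a y * a y) := by
        simp only [x]; rw [Algebra.smul_def]; congr 1; rw [map_neg, map_ofNat]
      rw [this]; noncomm_ring
    have h5 : Commute (2 * a y - 1) (isqrt (x y) * isqrt (x y)) := (hcx y _ h1).mul_right (hcx y _ h1)
    calc s y * s y = (2 * a y - 1) * (isqrt (x y) * (2 * a y - 1)) * isqrt (x y) := by
          simp only [s, mul_assoc]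
      _ = (2 * a y - 1) * (2 * a y - 1) * (isqrt (x y) * isqrt (x y)) := by rw [← h2]; simp only [mul_assoc]
      _ = isqrt (x y) * isqrt (x y) * (1 + x y) := by rw [h4]; exact (h5.mul_left h5).eq
      _ = 1 := h3
  let e : Y → Matrix ι ι ℂ := fun y => (1 / 2 : ℝ) • (1 + s y)
  have hqc : Continuous fun y => isqrt (x y) :=
    contDiffOn_isqrt.continuousOn.comp_continuous hxc fun y => mem_ball_zero_iff.2 (hx1 y)
  have hec : Continuous e :=
    (continuous_const.add (((continuous_const.mul hac).sub continuous_const).mul hqc)).const_smul (1 / 2 : ℝ)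
  have hee : ∀ y, e y * e y = e y := fun y => by
    have h1 := hss y
    simp only [e, smul_mul_smul_comm, add_mul, mul_add, one_mul, mul_one, h1]
    module
  have hbe : ∀ y, Commute (b y) (e y) := fun y => by
    refine ((Commute.one_right _).add_right (Commute.mul_right ?_ (hcx y _ (hba y)))).smul_right _
    exact ((Commute.ofNat_right _ _).mul_right (hba y)).sub_right (Commute.one_right _)
  have hd : ∀ y, ‖e y - rieszSum (b y) N‖ < 1 / 2 := fun y => by
    have h1 : e y - a y = (1 / 2 : ℝ) • ((2 * a y - 1) * (isqrt (x y) - 1)) := by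
      simp only [e, s]
      rw [mul_sub, mul_one, two_mul]
      module
    change ‖e y - a y‖ < 1 / 2
    have h2 : ‖2 * a y - 1‖ ≤ R - 1 := by
      rw [two_mul]
      refine (norm_sub_le _ _).trans ?_
      have := norm_add_le (a y) (a y)
      have := ha y
      simp only [R]; linarith
    have h3 : ‖(2 * a y - 1) * (isqrt (x y) - 1)‖ ≤ (R - 1) * (1 / R) :=
      (norm_mul_le _ _).trans (mul_le_mul h2 (hq _ (hx y)).le (norm_nonneg _) ((norm_nonneg _).trans h2))
    have h4 : (R - 1) * (1 / R) < 1 := by rw [mul_one_div, div_lt_one hR]; linarith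
    rw [h1, norm_smul, Real.norm_of_nonneg (by norm_num)]
    linarith
  refine ⟨e, hec, hee, GLHtpy.line ?_ ?_ fun t ht p => ?_⟩
  · exact continuous_const.add ((show Continuous fun p : Y × Circle => (p.2 : ℂ) - 1 by fun_prop).smul
      (hb.comp continuous_fst))
  · exact continuous_const.add ((show Continuous fun p : Y × Circle => (p.2 : ℂ) - 1 by fun_prop).smul
      (hec.comp continuous_fst))
  · have := isUnit_of_close_rieszSum (hu' p.1) hNp (hee p.1) (hbe p.1) (hd p.1) ht (Circle.norm_coe p.2)
    convert this using 1
    have ht' : ∀ m : Matrix ι ι ℂ, t • m = (t : ℂ) • m := fun m => (Complex.coe_smul t m).symm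
    rw [ht']
    module

end

/-- All complex vector bundles over the space are stably trivial. -/
def StablyTrivial (Y : Type) [TopologicalSpace Y] : Prop :=
  ∀ (ι : Type) [Fintype ι] [DecidableEq ι] (P : Y → Matrix ι ι ℂ), Continuous P → (∀ y, P y * P y = P y) →
    ∃ (σ τ : Type) (_ : Fintype σ) (_ : DecidableEq σ) (_ : Fintype τ) (_ : DecidableEq τ),
      MvN (fun y => plusOne σ (P y)) (fun _ => (1 : Matrix τ τ ℂ))

theorem GLHtpy.involution {W : Y → Matrix ι ι ℂ} (hW : Continuous W) (h : ∀ y, W y * W y = 1) {c : ℂ}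
    (hc : c * c = -1) : GLHtpy (fun y => c • W y) (fun _ => 1) := by
  let f : ℝ × Y → Matrix ι ι ℂ := fun p =>
    (Real.sin (pi / 2 * p.1) : ℂ) • 1 + (c * (Real.cos (pi / 2 * p.1) : ℂ)) • W p.2
  have hf : Continuous f := by
    refine Continuous.add ?_ ?_
    · exact (show Continuous fun p : ℝ × Y => (Real.sin (pi / 2 * p.1) : ℂ) by fun_prop).smul continuous_const
    · exact (show Continuous fun p : ℝ × Y => (c * (Real.cos (pi / 2 * p.1) : ℂ)) by fun_prop).smul
        (hW.comp continuous_snd)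
  refine ⟨f, hf, fun p => isUnit_of_mul_eq_one_left (N := (Real.sin (pi / 2 * p.1) : ℂ) • 1 -
    (c * (Real.cos (pi / 2 * p.1) : ℂ)) • W p.2) ?_, fun y => by simp [f], fun y => by simp [f]⟩
  have h1 : (Real.sin (pi / 2 * p.1) : ℂ) * (Real.sin (pi / 2 * p.1) : ℂ)
      + (Real.cos (pi / 2 * p.1) : ℂ) * (Real.cos (pi / 2 * p.1) : ℂ) = 1 := by
    rw [← Complex.ofReal_mul, ← Complex.ofReal_mul, ← Complex.ofReal_add, ← sq, ← sq, Real.sin_sq_add_cos_sq,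
      Complex.ofReal_one]
  simp only [f]
  generalize (Real.sin (pi / 2 * p.1) : ℂ) = S at h1 ⊢
  generalize (Real.cos (pi / 2 * p.1) : ℂ) = K at h1 ⊢
  simp only [add_mul, mul_sub, smul_mul_smul_comm, h, mul_one, one_mul]
  have h2 : c * K * (c * K) = -(K * K) := by linear_combination K * K * hc
  have h3 : S * S = 1 - K * K := by linear_combination h1
  rw [h2, h3]
  module

theorem Decomposable.of_trivial {τ : Type} [Fintype τ] [DecidableEq τ] {A : Y → Matrix ι τ ℂ}
    {B : Y → Matrix τ ι ℂ} (hA : Continuous A) (hB : Continuous B) (h : ∀ y, B y * A y = 1) :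
    Decomposable fun p : Y × Circle => 1 + ((p.2 : ℂ) - 1) • (A p.1 * B p.1) := by
  let W : Y → Matrix (ι ⊕ τ) (ι ⊕ τ) ℂ := fun y => fromBlocks (1 - A y * B y) (A y) (B y) 0
  have hW : Continuous W := (continuous_const.sub (hA.matrix_mul hB)).matrix_fromBlocks hA hB continuous_const
  have hAB : ∀ y, A y * B y * A y = A y := fun y => by rw [Matrix.mul_assoc, h, Matrix.mul_one]
  have hBA : ∀ y, B y * (A y * B y) = B y := fun y => by rw [← Matrix.mul_assoc, h, Matrix.one_mul]
  have hWW : ∀ y, W y * W y = 1 := fun y => by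
    simp only [W, fromBlocks_multiply, Matrix.sub_mul, Matrix.mul_sub, ← Matrix.mul_assoc, hAB, h,
      Matrix.one_mul, Matrix.mul_one, Matrix.mul_zero, add_zero]
    rw [← fromBlocks_one]
    simp [Matrix.mul_assoc, hBA]
  let b : Circle → Matrix (ι ⊕ τ) (ι ⊕ τ) ℂ := fun z => fromBlocks 1 0 0 ((z : ℂ) • (1 : Matrix τ τ ℂ))
  have hb : Continuous b := continuous_const.matrix_fromBlocks continuous_const continuous_const
    ((show Continuous fun z : Circle => (z : ℂ) by fun_prop).smul continuous_const)
  have hbu : ∀ z, IsUnit (b z) := fun z => isUnit_of_mul_eq_one_left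
    (N := fromBlocks 1 0 0 ((z : ℂ)⁻¹ • (1 : Matrix τ τ ℂ))) (by
      simp [b, fromBlocks_multiply, smul_smul])
  have key : ∀ p : Y × Circle, plusOne τ (1 + ((p.2 : ℂ) - 1) • (A p.1 * B p.1))
      = (I • W p.1) * b p.2 * (-I • W p.1) := fun p => by
    have : (I • W p.1) * b p.2 * (-I • W p.1) = W p.1 * b p.2 * W p.1 := by
      simp [smul_smul]
    rw [this]
    simp only [W, b]
    generalize (p.2 : ℂ) = z
    simp only [fromBlocks_multiply, Matrix.sub_mul, Matrix.mul_sub, hAB, h,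
      Matrix.one_mul, Matrix.mul_one, Matrix.mul_zero, add_zero, Matrix.mul_smul, Matrix.smul_mul]
    rw [hBA, plusOne]
    congr 1
    · rw [zero_add, Matrix.smul_mul, Matrix.mul_assoc (A p.1), hBA]; module
    · simp
    · simp
  refine Decomposable.of_plusOne (κ := τ) (Decomposable.of_htpy ?_ (Decomposable.of_right hb hbu))
  refine (((GLHtpy.involution hW hWW Complex.I_mul_I).comp (Y := Y × Circle) continuous_fst).mul
    (GLHtpy.refl (h := fun p : Y × Circle => b p.2) (hb.comp continuous_snd) fun p => hbu _) |>.mul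
    ((GLHtpy.involution hW hWW (c := -I) (by simp)).comp (Y := Y × Circle) continuous_fst)).congr key
    fun p => by simp

theorem StablyTrivial.decomposable (hT : StablyTrivial Y) {h : Y × Circle → Matrix ι ι ℂ} (hc : Continuous h)
    (hu : ∀ x, IsUnit (h x)) : Decomposable h := by
  refine Decomposable.of_linear (fun ι _ _ a b ha hb hu => ?_) hc hu
  let c : Y → Matrix ι ι ℂ := fun y => a y + b y
  have hcc : Continuous c := ha.add hb
  have hcu : ∀ y, IsUnit (c y) := fun y => by simpa using hu y 1
  let b' : Y → Matrix ι ι ℂ := fun y => (c y)⁻¹ * b y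
  have hb' : Continuous b' := (continuous_inv_matrix hcc hcu).matrix_mul hb
  have hf : ∀ y (z : ℂ), c y * (1 - b' y + z • b' y) = a y + z • b y := fun y z => by
    have hcb : c y * b' y = b y := by rw [← mul_assoc, mul_inv_of_isUnit (hcu y), one_mul]
    rw [mul_add, mul_sub, mul_one, Matrix.mul_smul, hcb]
    simp [c]
  have hbu : ∀ y (z : Circle), IsUnit (1 - b' y + (z : ℂ) • b' y) := fun y z => by
    have h1 := hu y z
    rw [← hf, isUnit_iff_isUnit_det, det_mul] at h1
    exact (isUnit_iff_isUnit_det _).2 (isUnit_of_mul_isUnit_right h1)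
  obtain ⟨e, he, hee, hh⟩ := exists_idempotent_GLHtpy hb' hbu
  obtain ⟨σ, τ, _, _, _, _, -, -, A, B, hA, hB, hAB, hBA⟩ := hT ι e he hee
  have hd := Decomposable.of_trivial hA hB hBA
  let w : Circle → Matrix (ι ⊕ σ) (ι ⊕ σ) ℂ := fun z => fromBlocks 1 0 0 ((z : ℂ)⁻¹ • (1 : Matrix σ σ ℂ))
  have hw : Continuous w := continuous_const.matrix_fromBlocks continuous_const continuous_const
    ((show Continuous fun z : Circle => (z : ℂ) by fun_prop).inv₀ (fun z => Circle.coe_ne_zero z) |>.smul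
      continuous_const)
  have hwu : ∀ z, IsUnit (w z) := fun z => isUnit_of_mul_eq_one_left
    (N := fromBlocks 1 0 0 ((z : ℂ) • (1 : Matrix σ σ ℂ))) (by
      simp [w, fromBlocks_multiply, smul_smul])
  have hd2 := hd.mul_right hw hwu
  have h3 : Decomposable (fun p : Y × Circle => 1 + ((p.2 : ℂ) - 1) • e p.1) := by
    refine Decomposable.of_plusOne (κ := σ) ?_
    convert hd2 using 2 with p
    rw [hAB, ← fromBlocks_one, plusOne, plusOne, fromBlocks_smul, fromBlocks_add, fromBlocks_multiply]
    have hz : (p.2 : ℂ) ≠ 0 := Circle.coe_ne_zero _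
    generalize (p.2 : ℂ) = z at hz ⊢
    have h5 : z⁻¹ + z⁻¹ * (z - 1) = 1 := by field_simp; ring
    simp [smul_smul, ← add_smul, h5]
  have h4 := (h3.of_htpy hh).mul_left hcc hcu
  convert h4 using 2 with p
  rw [← hf]
  congr 1
  module

end

section
variable {X ι κ σ τ : Type} [TopologicalSpace X] [Fintype ι] [DecidableEq ι] [Fintype κ] [DecidableEq κ]
  [Fintype σ] [DecidableEq σ] [Fintype τ] [DecidableEq τ]

theorem MvN.exists_plusOne_fin {P : X → Matrix ι ι ℂ} (hP : Continuous P)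
    (h : MvN (fun x => ACS.plusOne σ (P x)) (fun _ => (1 : Matrix τ τ ℂ))) {k : ℕ} (hk : Fintype.card σ ≤ k) :
    ∃ t, MvN (fun x => ACS.plusOne (Fin k) (P x)) (fun _ => (1 : Matrix (Fin t) (Fin t) ℂ)) := by
  obtain ⟨j, rfl⟩ := Nat.exists_eq_add_of_le hk
  let e : Fin (Fintype.card σ + j) ≃ σ ⊕ Fin j := Fintype.equivOfCardEq (by simp)
  let e2 : ι ⊕ Fin (Fintype.card σ + j) ≃ (ι ⊕ σ) ⊕ Fin j :=
    (Equiv.sumCongr (Equiv.refl ι) e).trans (Equiv.sumAssoc ι σ (Fin j)).symm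
  have h1 := h.plusOne (τ := Fin j)
  have h2 := MvN.reindex (continuous_plusOne (continuous_plusOne hP)) h1.left e2
  have h3 : (fun x => (ACS.plusOne (Fin j) (ACS.plusOne σ (P x))).submatrix e2 e2) =
      fun x => ACS.plusOne (Fin (Fintype.card σ + j)) (P x) := by
    funext x
    have h4 : ACS.plusOne (σ ⊕ Fin j) (P x) = (ACS.plusOne (Fin j) (ACS.plusOne σ (P x))).submatrix
      (Equiv.sumAssoc ι σ (Fin j)).symm (Equiv.sumAssoc ι σ (Fin j)).symm := plusOne_eq_iff_submatrix _
    have h5 : (ACS.plusOne (σ ⊕ Fin j) (P x)).submatrix (Equiv.sumCongr (Equiv.refl ι) e)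
        (Equiv.sumCongr (Equiv.refl ι) e) = ACS.plusOne (Fin (Fintype.card σ + j)) (P x) := by
      ext (a | a) (b | b) <;> simp [one_apply]
    rw [← h5, h4]
    rfl
  rw [h3] at h2
  refine ⟨Fintype.card (τ ⊕ Fin j), h2.symm.trans (h1.trans ?_)⟩
  convert MvN.reindex (X := X) (P := fun _ => ACS.plusOne (Fin j) (1 : Matrix τ τ ℂ)) continuous_const (fun _ => by
    rw [plusOne_mul, one_mul]) (Fintype.equivFin (τ ⊕ Fin j)).symm using 2
  simp

theorem MvN.card_eq {P : X → Matrix ι ι ℂ} (h : MvN P (fun _ => (1 : Matrix τ τ ℂ))) (x : X) :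
    (P x).trace = Fintype.card τ := by
  obtain ⟨-, -, A, B, -, -, hAB, hBA⟩ := h
  rw [← hAB, trace_mul_comm, hBA, trace_one]

omit [DecidableEq ι] in
theorem exists_continuous_lift {Z M : Type} [TopologicalSpace Z] [TopologicalSpace M] [CompactSpace Z]
    [T2Space X] {q : Z → X} (hq : Continuous q) (hs : Function.Surjective q) {f : Z → M} (hf : Continuous f)
    (h : ∀ a b, q a = q b → f a = f b) : ∃ F : X → M, Continuous F ∧ ∀ z, F (q z) = f z := by
  have h1 : IsQuotientMap q := hq.isClosedMap.isQuotientMap hq hs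
  have h2 : ∀ z, f (Function.surjInv hs (q z)) = f z := fun z => h _ _ (Function.surjInv_eq hs _)
  exact ⟨fun x => f (Function.surjInv hs x), h1.continuous_iff.2 (by simpa only [Function.comp_def, h2] using hf), h2⟩

end

section
variable {E : Type} [NormedAddCommGroup E] [NormedSpace ℝ E]

/-- The part `‖x‖ = 1` of the unit sphere of `E × ℂ`. -/
def sphL (p : sphere (0 : E) 1 × closedBall (0 : ℂ) 1) : sphere (0 : E × ℂ) 1 :=
  ⟨(p.1, p.2), by
    have h1 := mem_sphere_zero_iff_norm.1 p.1.2
    have h2 := mem_closedBall_zero_iff.1 p.2.2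
    rw [mem_sphere_zero_iff_norm, Prod.norm_mk, h1, max_eq_left h2]⟩

/-- The part `‖z‖ = 1` of the unit sphere of `E × ℂ`. -/
def sphR (p : closedBall (0 : E) 1 × Circle) : sphere (0 : E × ℂ) 1 :=
  ⟨(p.1, p.2), by
    have h2 := mem_closedBall_zero_iff.1 p.1.2
    rw [mem_sphere_zero_iff_norm, Prod.norm_mk, Circle.norm_coe, max_eq_right h2]⟩

theorem continuous_sphL : Continuous (sphL (E := E)) := by
  unfold sphL; fun_prop

theorem continuous_sphR : Continuous (sphR (E := E)) := by
  unfold sphR; fun_prop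

/-- Radial contraction in the unit ball. -/
def ballSMul (p : unitInterval × closedBall (0 : E) 1) : closedBall (0 : E) 1 :=
  ⟨(p.1 : ℝ) • (p.2 : E), by
    rw [mem_closedBall_zero_iff, norm_smul, Real.norm_of_nonneg p.1.2.1]
    exact mul_le_one₀ p.1.2.2 (norm_nonneg _) (mem_closedBall_zero_iff.1 p.2.2)⟩

theorem continuous_ballSMul : Continuous (ballSMul (E := E)) := by
  unfold ballSMul; fun_prop

def sphToBall (y : sphere (0 : E) 1) : closedBall (0 : E) 1 :=
  ⟨y, Metric.sphere_subset_closedBall y.2⟩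

theorem continuous_sphToBall : Continuous (sphToBall (E := E)) := by
  unfold sphToBall; fun_prop

noncomputable def circleToBall (z : Circle) : closedBall (0 : ℂ) 1 :=
  ⟨z, by rw [mem_closedBall_zero_iff, Circle.norm_coe]⟩

theorem continuous_circleToBall : Continuous circleToBall := by
  unfold circleToBall; fun_prop

/-- The cylinder collapsing onto the part `‖x‖ = 1`. -/
noncomputable def sphC (p : (sphere (0 : E) 1 × Circle) × unitInterval) : sphere (0 : E × ℂ) 1 :=
  sphL (p.1.1, ballSMul (p.2, circleToBall p.1.2))

theorem continuous_sphC : Continuous (sphC (E := E)) :=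
  continuous_sphL.comp ((by fun_prop : Continuous fun p : (sphere (0 : E) 1 × Circle) × unitInterval =>
    p.1.1).prodMk (continuous_ballSMul.comp ((by fun_prop : Continuous fun p : (sphere (0 : E) 1 × Circle)
      × unitInterval => p.2).prodMk (continuous_circleToBall.comp (by fun_prop)))))

theorem surjective_sphCR : Function.Surjective (Sum.elim (sphC (E := E)) sphR) := by
  rintro ⟨⟨x, z⟩, h⟩
  rw [mem_sphere_zero_iff_norm, Prod.norm_mk] at h
  have hx : ‖x‖ ≤ 1 := h ▸ le_max_left _ _
  have hz : ‖z‖ ≤ 1 := h ▸ le_max_right _ _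
  by_cases h1 : ‖z‖ = 1
  · exact ⟨Sum.inr (⟨x, mem_closedBall_zero_iff.2 hx⟩, ⟨z, mem_sphere_zero_iff_norm.2 h1⟩), rfl⟩
  · have h2 : ‖x‖ = 1 := by
      rcases max_choice ‖x‖ ‖z‖ with h3 | h3
      · rw [← h3, h]
      · exact absurd (h3 ▸ h) h1
    have : ∃ w : Circle, (‖z‖ : ℝ) • (w : ℂ) = z := by
      by_cases h0 : z = 0
      · exact ⟨1, by simp [h0]⟩
      · refine ⟨⟨(‖z‖ : ℂ)⁻¹ * z, mem_sphere_zero_iff_norm.2 ?_⟩, ?_⟩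
        · rw [norm_mul, norm_inv, Complex.norm_real, norm_norm, inv_mul_cancel₀ (norm_ne_zero_iff.2 h0)]
        · change (‖z‖ : ℝ) • ((‖z‖ : ℂ)⁻¹ * z) = z
          rw [Complex.real_smul, mul_inv_cancel_left₀ (by simpa using h0)]
    obtain ⟨w, hw⟩ := this
    refine ⟨Sum.inl ((⟨x, mem_sphere_zero_iff_norm.2 h2⟩, w), ⟨‖z‖, norm_nonneg _, hz⟩), Subtype.ext ?_⟩
    simp only [Sum.elim_inl, sphC, sphL, ballSMul, circleToBall, hw]

theorem sphC_eq_iff {y y' : sphere (0 : E) 1} {z z' : Circle} {t t' : unitInterval}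
    (h : sphC ((y, z), t) = sphC ((y', z'), t')) : y = y' ∧ t = t' ∧ (t = 0 ∨ z = z') := by
  have h1 := Subtype.ext_iff.1 h
  simp only [sphC, sphL, ballSMul, circleToBall, Prod.mk.injEq] at h1
  have h2 : t = t' := by
    have := congrArg norm h1.2
    rw [norm_smul, norm_smul, Circle.norm_coe, Circle.norm_coe, Real.norm_of_nonneg t.2.1,
      Real.norm_of_nonneg t'.2.1, mul_one, mul_one] at this
    exact Subtype.ext this
  refine ⟨Subtype.ext h1.1, h2, ?_⟩
  by_cases h3 : (t : ℝ) = 0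
  · exact Or.inl (Subtype.ext h3)
  · rw [← h2] at h1
    exact Or.inr (Subtype.ext (smul_right_injective ℂ h3 h1.2))

theorem sphC_eq_sphR_iff {y : sphere (0 : E) 1} {z z' : Circle} {t : unitInterval}
    {x : closedBall (0 : E) 1} (h : sphC ((y, z), t) = sphR (x, z')) :
    t = 1 ∧ z = z' ∧ x = sphToBall y := by
  have h1 := Subtype.ext_iff.1 h
  simp only [sphC, sphL, sphR, ballSMul, circleToBall, Prod.mk.injEq] at h1
  have h2 : (t : ℝ) = 1 := by
    have := congrArg norm h1.2
    rwa [norm_smul, Circle.norm_coe, Circle.norm_coe, Real.norm_of_nonneg t.2.1, mul_one] at this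
  rw [h2, one_smul] at h1
  exact ⟨Subtype.ext h2, Subtype.ext h1.2, Subtype.ext h1.1.symm⟩

theorem sphR_injective : Function.Injective (sphR (E := E)) := by
  rintro ⟨x, z⟩ ⟨x', z'⟩ h
  have h1 := Subtype.ext_iff.1 h
  simp only [sphR, Prod.mk.injEq] at h1
  exact Prod.ext (Subtype.ext h1.1) (Subtype.ext h1.2)

variable [ProperSpace E] {ι τ : Type} [Fintype ι] [DecidableEq ι] [Fintype τ] [DecidableEq τ]

theorem MvN.glue {P : sphere (0 : E × ℂ) 1 → Matrix ι ι ℂ}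
    {A₁ : sphere (0 : E) 1 × closedBall (0 : ℂ) 1 → Matrix ι τ ℂ}
    {B₁ : sphere (0 : E) 1 × closedBall (0 : ℂ) 1 → Matrix τ ι ℂ}
    {A₂ : closedBall (0 : E) 1 × Circle → Matrix ι τ ℂ}
    {B₂ : closedBall (0 : E) 1 × Circle → Matrix τ ι ℂ}
    (hA₁ : Continuous A₁) (hB₁ : Continuous B₁) (hA₂ : Continuous A₂) (hB₂ : Continuous B₂)
    (h₁ : ∀ p, A₁ p * B₁ p = P (sphL p)) (h₁' : ∀ p, B₁ p * A₁ p = 1)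
    (h₂ : ∀ p, A₂ p * B₂ p = P (sphR p)) (h₂' : ∀ p, B₂ p * A₂ p = 1)
    {c : sphere (0 : E) 1 → Matrix τ τ ℂ} {b : Circle → Matrix τ τ ℂ} (hb : Continuous b)
    (bu : ∀ z, IsUnit (b z))
    (h : GLHtpy (fun p : sphere (0 : E) 1 × Circle => B₁ (p.1, circleToBall p.2) * A₂ (sphToBall p.1, p.2))
      (fun p => c p.1 * b p.2)) : MvN P (fun _ => (1 : Matrix τ τ ℂ)) := by
  have hbi := continuous_inv_matrix hb bu
  obtain ⟨N, Nc, Nu, N0, N1⟩ := h.mul (GLHtpy.refl (h := fun p : sphere (0 : E) 1 × Circle => (b p.2)⁻¹)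
    (hbi.comp continuous_snd) fun p => isUnit_of_mul_eq_one_left (inv_mul_of_isUnit (bu _)))
  have N1' : ∀ x, N (1, x) = c x.1 := fun x => by
    rw [N1]; dsimp only; rw [mul_assoc, mul_inv_of_isUnit (bu _), mul_one]
  let fC : (sphere (0 : E) 1 × Circle) × unitInterval → Matrix ι τ ℂ × Matrix τ ι ℂ := fun p =>
    (A₁ (p.1.1, ballSMul (p.2, circleToBall p.1.2)) * N (1 - p.2, p.1),
      (N (1 - p.2, p.1))⁻¹ * B₁ (p.1.1, ballSMul (p.2, circleToBall p.1.2)))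
  let fR : closedBall (0 : E) 1 × Circle → Matrix ι τ ℂ × Matrix τ ι ℂ := fun p =>
    (A₂ p * (b p.2)⁻¹, b p.2 * B₂ p)
  have hj : Continuous fun p : (sphere (0 : E) 1 × Circle) × unitInterval =>
      (p.1.1, ballSMul (p.2, circleToBall p.1.2)) :=
    (by fun_prop : Continuous fun p : (sphere (0 : E) 1 × Circle) × unitInterval =>
    p.1.1).prodMk (continuous_ballSMul.comp ((by fun_prop : Continuous fun p : (sphere (0 : E) 1 × Circle)
      × unitInterval => p.2).prodMk (continuous_circleToBall.comp (by fun_prop))))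
  have hN : Continuous fun p : (sphere (0 : E) 1 × Circle) × unitInterval => N (1 - p.2, p.1) :=
    Nc.comp (by fun_prop)
  have hfC : Continuous fC := ((hA₁.comp hj).matrix_mul hN).prodMk
    ((continuous_inv_matrix hN fun _ => Nu _).matrix_mul (hB₁.comp hj))
  have hfR : Continuous fR := (hA₂.matrix_mul (hbi.comp continuous_snd)).prodMk
    ((hb.comp continuous_snd).matrix_mul hB₂)
  have hCR : ∀ p q, sphC p = sphR q → fC p = fR q := by
    rintro ⟨⟨y, z⟩, t⟩ ⟨x, z'⟩ hpq
    obtain ⟨rfl, rfl, rfl⟩ := sphC_eq_sphR_iff hpq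
    have e1 : ballSMul (1, circleToBall z) = circleToBall z := Subtype.ext (by simp [ballSMul])
    have hP : A₁ (y, circleToBall z) * B₁ (y, circleToBall z) = A₂ (sphToBall y, z) * B₂ (sphToBall y, z) := by
      rw [h₁, h₂, ← hpq, sphC, e1]
    have hinv : (N (0, (y, z)))⁻¹ = b z * (B₂ (sphToBall y, z) * A₁ (y, circleToBall z)) := by
      refine inv_eq_left_inv ?_
      rw [N0]
      calc b z * (B₂ (sphToBall y, z) * A₁ (y, circleToBall z)) *
          (B₁ (y, circleToBall z) * A₂ (sphToBall y, z) * (b z)⁻¹)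
          = b z * (B₂ (sphToBall y, z) * (A₁ (y, circleToBall z) * B₁ (y, circleToBall z)) *
            A₂ (sphToBall y, z)) * (b z)⁻¹ := by simp only [Matrix.mul_assoc]
        _ = b z * ((B₂ (sphToBall y, z) * A₂ (sphToBall y, z)) * (B₂ (sphToBall y, z) * A₂ (sphToBall y, z)))
            * (b z)⁻¹ := by rw [hP]; simp only [Matrix.mul_assoc]
        _ = 1 := by rw [h₂', Matrix.mul_one, Matrix.mul_one, mul_inv_of_isUnit (bu z)]
    simp only [fC, fR, e1, Set.Icc.coe_one, sub_self]
    refine Prod.ext ?_ ?_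
    · calc A₁ (y, circleToBall z) * N (0, (y, z)) = A₁ (y, circleToBall z) * B₁ (y, circleToBall z) *
          A₂ (sphToBall y, z) * (b z)⁻¹ := by rw [N0]; simp only [Matrix.mul_assoc]
        _ = A₂ (sphToBall y, z) * (b z)⁻¹ := by
          rw [hP, Matrix.mul_assoc (A₂ _), h₂', Matrix.mul_one]
    · calc (N (0, (y, z)))⁻¹ * B₁ (y, circleToBall z) = b z * (B₂ (sphToBall y, z) *
          (A₁ (y, circleToBall z) * B₁ (y, circleToBall z))) := by rw [hinv]; simp only [Matrix.mul_assoc]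
        _ = b z * B₂ (sphToBall y, z) := by
          rw [hP, ← Matrix.mul_assoc (B₂ _), h₂', Matrix.one_mul]
  obtain ⟨F, hF, hFq⟩ := exists_continuous_lift (f := Sum.elim fC fR)
    (continuous_sphC.sumElim continuous_sphR) surjective_sphCR (hfC.sumElim hfR) (by
      rintro (p | p) (q | q) hpq
      · obtain ⟨⟨y, z⟩, t⟩ := p
        obtain ⟨⟨y', z'⟩, t'⟩ := q
        obtain ⟨rfl, rfl, rfl | rfl⟩ := sphC_eq_iff hpq
        · have e0 : ∀ z, ballSMul (0, circleToBall z) = ⟨0, by simp⟩ := fun z => Subtype.ext (by simp [ballSMul])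
          simp only [Sum.elim_inl, fC, e0, Set.Icc.coe_zero, sub_zero, N1']
        · rfl
      · exact hCR _ _ hpq
      · exact (hCR _ _ hpq.symm).symm
      · rw [sphR_injective hpq])
  have hAB : ∀ x, (F x).1 * (F x).2 = P x := by
    intro x
    obtain ⟨p | p, rfl⟩ := surjective_sphCR x
    · rw [hFq]
      simp only [Sum.elim_inl, fC]
      rw [Matrix.mul_assoc, ← Matrix.mul_assoc (N _), mul_inv_of_isUnit (Nu _), Matrix.one_mul, h₁]
      rfl
    · rw [hFq]
      simp only [Sum.elim_inr, fR]
      rw [Matrix.mul_assoc, ← Matrix.mul_assoc _ (b _), inv_mul_of_isUnit (bu _), Matrix.one_mul, h₂]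
  have hBA : ∀ x, (F x).2 * (F x).1 = 1 := by
    intro x
    obtain ⟨p | p, rfl⟩ := surjective_sphCR x
    · rw [hFq]
      simp only [Sum.elim_inl, fC]
      rw [Matrix.mul_assoc, ← Matrix.mul_assoc (B₁ _), h₁', Matrix.one_mul, inv_mul_of_isUnit (Nu _)]
    · rw [hFq]
      simp only [Sum.elim_inr, fR]
      rw [Matrix.mul_assoc, ← Matrix.mul_assoc (B₂ _), h₂', Matrix.one_mul, mul_inv_of_isUnit (bu _)]
  refine ⟨fun x => ?_, fun _ => Matrix.mul_one _, fun x => (F x).1, fun x => (F x).2, continuous_fst.comp hF,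
    continuous_snd.comp hF, hAB, hBA⟩
  rw [← hAB, Matrix.mul_assoc, ← Matrix.mul_assoc _ (F x).1, hBA, Matrix.one_mul]

theorem StablyTrivial.sphere_prod (y₀ : sphere (0 : E) 1) (hY : StablyTrivial (sphere (0 : E) 1)) (hS : StablyTrivial Circle) :
    StablyTrivial (sphere (0 : E × ℂ) 1) := by
  intro ι _ _ P hP hi
  have c1 : Continuous fun p : ℝ × (sphere (0 : E) 1 × closedBall (0 : ℂ) 1) =>
      sphL (p.2.1, ballSMul (Set.projIcc 0 1 zero_le_one p.1, p.2.2)) :=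
    continuous_sphL.comp ((continuous_fst.comp continuous_snd).prodMk (continuous_ballSMul.comp
      (((continuous_projIcc (h := zero_le_one)).comp continuous_fst).prodMk
        (continuous_snd.comp continuous_snd))))
  have c2 : Continuous fun p : ℝ × (closedBall (0 : E) 1 × Circle) =>
      sphR (ballSMul (Set.projIcc 0 1 zero_le_one p.1, p.2.1), p.2.2) :=
    continuous_sphR.comp ((continuous_ballSMul.comp
      (((continuous_projIcc (h := zero_le_one)).comp continuous_fst).prodMk
        (continuous_fst.comp continuous_snd))).prodMk (continuous_snd.comp continuous_snd))
  have m1 := MvN.of_homotopy (hP.comp c1) fun p => hi _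
  have m2 := MvN.of_homotopy (hP.comp c2) fun p => hi _
  have z1 : ∀ w : closedBall (0 : ℂ) 1, ballSMul (Set.projIcc (0 : ℝ) 1 zero_le_one 0, w) = ⟨0, by simp⟩ :=
    fun w => Subtype.ext (by simp [ballSMul])
  have z2 : ∀ w : closedBall (0 : E) 1, ballSMul (Set.projIcc (0 : ℝ) 1 zero_le_one 0, w) = ⟨0, by simp⟩ :=
    fun w => Subtype.ext (by simp [ballSMul])
  have o1 : ∀ w : closedBall (0 : ℂ) 1, ballSMul (Set.projIcc (0 : ℝ) 1 zero_le_one 1, w) = w :=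
    fun w => Subtype.ext (by simp [ballSMul])
  have o2 : ∀ w : closedBall (0 : E) 1, ballSMul (Set.projIcc (0 : ℝ) 1 zero_le_one 1, w) = w :=
    fun w => Subtype.ext (by simp [ballSMul])
  simp only [Function.comp_def, z1, z2, o1, o2] at m1 m2
  have p1 : Continuous fun y : sphere (0 : E) 1 => P (sphL (y, ⟨0, by simp⟩)) :=
    hP.comp (continuous_sphL.comp (by fun_prop))
  have p2 : Continuous fun z : Circle => P (sphR (⟨0, by simp⟩, z)) :=
    hP.comp (continuous_sphR.comp (by fun_prop))
  obtain ⟨σ₁, τ₁, _, _, _, _, n1⟩ := hY ι _ p1 fun y => hi _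
  obtain ⟨σ₂, τ₂, _, _, _, _, n2⟩ := hS ι _ p2 fun y => hi _
  obtain ⟨t₁, q1⟩ := n1.exists_plusOne_fin p1 (Nat.le_add_right (Fintype.card σ₁) (Fintype.card σ₂))
  obtain ⟨t₂, q2⟩ := n2.exists_plusOne_fin p2 (Nat.le_add_left (Fintype.card σ₂) (Fintype.card σ₁))
  generalize Fintype.card σ₁ + Fintype.card σ₂ = k at q1 q2
  have r1 := m1.symm.plusOne.trans (q1.comp (continuous_fst (X := sphere (0 : E) 1)
    (Y := closedBall (0 : ℂ) 1)))
  have r2 := m2.symm.plusOne.trans (q2.comp (continuous_snd (X := closedBall (0 : E) 1) (Y := Circle)))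
  have ht : t₁ = t₂ := by
    have e1 := r1.card_eq (y₀, circleToBall 1)
    have e2 := r2.card_eq (sphToBall y₀, 1)
    rw [show sphR (sphToBall y₀, 1) = sphL (y₀, circleToBall 1) from rfl, e1] at e2
    simpa using e2
  subst ht
  obtain ⟨-, -, A₁, B₁, hA₁, hB₁, h₁, h₁'⟩ := r1
  obtain ⟨-, -, A₂, B₂, hA₂, hB₂, h₂, h₂'⟩ := r2
  obtain ⟨κ, _, _, c, b, hc, hb, cu, bu, hd⟩ := hY.decomposable
    (h := fun p => B₁ (p.1, circleToBall p.2) * A₂ (sphToBall p.1, p.2))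
    ((hB₁.comp (continuous_fst.prodMk (continuous_circleToBall.comp continuous_snd))).matrix_mul
      (hA₂.comp ((continuous_sphToBall.comp continuous_fst).prodMk continuous_snd))) fun p => by
    refine isUnit_of_mul_eq_one_right (M := B₂ (sphToBall p.1, p.2) * A₁ (p.1, circleToBall p.2)) ?_
    have e1 : A₁ (p.1, circleToBall p.2) * B₁ (p.1, circleToBall p.2) =
      A₂ (sphToBall p.1, p.2) * B₂ (sphToBall p.1, p.2) := (h₁ _).trans (h₂ (sphToBall p.1, p.2)).symm
    rw [Matrix.mul_assoc, ← Matrix.mul_assoc (A₁ _), e1, Matrix.mul_assoc (A₂ _), h₂',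
      Matrix.mul_one, h₂']
  have hfin : MvN (fun x => plusOne κ (plusOne (Fin k) (P x))) (fun _ => (1 : Matrix (Fin t₁ ⊕ κ) (Fin t₁ ⊕ κ) ℂ)) := by
    refine MvN.glue (A₁ := fun p => fromBlocks (A₁ p) 0 0 1) (B₁ := fun p => fromBlocks (B₁ p) 0 0 1)
      (A₂ := fun p => fromBlocks (A₂ p) 0 0 1) (B₂ := fun p => fromBlocks (B₂ p) 0 0 1)
      (hA₁.matrix_fromBlocks continuous_const continuous_const continuous_const)
      (hB₁.matrix_fromBlocks continuous_const continuous_const continuous_const)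
      (hA₂.matrix_fromBlocks continuous_const continuous_const continuous_const)
      (hB₂.matrix_fromBlocks continuous_const continuous_const continuous_const)
      (fun p => ?_) (fun p => ?_) (fun p => ?_) (fun p => ?_) hb bu (hd.congr (fun p => ?_) fun p => rfl)
    · simp [fromBlocks_multiply, h₁]
    · simp [fromBlocks_multiply, h₁']
    · simp [fromBlocks_multiply, h₂]
    · simp [fromBlocks_multiply, h₂']
    · simp [fromBlocks_multiply]
  refine ⟨Fin k ⊕ κ, Fin t₁ ⊕ κ, inferInstance, inferInstance, inferInstance, inferInstance, ?_⟩
  have := (MvN.reindex (continuous_plusOne (κ := κ) (continuous_plusOne (κ := Fin k) hP)) (fun x => by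
    rw [plusOne_mul, plusOne_mul, hi]) (Equiv.sumAssoc ι (Fin k) κ).symm).symm.trans hfin
  simpa only [← plusOne_eq_iff_submatrix] using this

end

section
variable {X Y ι κ : Type} [TopologicalSpace X] [TopologicalSpace Y] [Fintype ι] [DecidableEq ι]

theorem StablyTrivial.of_retract (hY : StablyTrivial Y) {f : X → Y} {g : Y → X} (hf : Continuous f)
    (hg : Continuous g) (h : ∀ x, g (f x) = x) : StablyTrivial X := by
  intro ι _ _ P hP hi
  obtain ⟨σ, τ, _, _, _, _, m⟩ := hY ι (fun y => P (g y)) (hP.comp hg) fun y => hi _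
  refine ⟨σ, τ, inferInstance, inferInstance, inferInstance, inferInstance, ?_⟩
  simpa only [h] using m.comp hf

theorem exists_factor_of_idempotent {P : Matrix ι ι ℂ} (hP : P * P = P) :
    ∃ (t : ℕ) (A : Matrix ι (Fin t) ℂ) (B : Matrix (Fin t) ι ℂ), A * B = P ∧ B * A = 1 := by
  let f := toLin' P
  have hf : ∀ x, f (f x) = f x := fun x => by
    simp only [f, toLin'_apply, mulVec_mulVec, hP]
  let e := (Module.finBasis ℂ (LinearMap.range f)).equivFun
  refine ⟨_, LinearMap.toMatrix' ((LinearMap.range f).subtype ∘ₗ e.symm.toLinearMap),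
    LinearMap.toMatrix' (e.toLinearMap ∘ₗ f.rangeRestrict), ?_, ?_⟩
  · rw [← LinearMap.toMatrix'_comp]
    have : ((LinearMap.range f).subtype ∘ₗ e.symm.toLinearMap) ∘ₗ e.toLinearMap ∘ₗ f.rangeRestrict = f := by
      refine LinearMap.ext fun x => ?_
      change ((e.symm (e (f.rangeRestrict x)) : LinearMap.range f) : ι → ℂ) = f x
      rw [e.symm_apply_apply]
      rfl
    rw [this]
    exact LinearMap.toMatrix'_toLin' P
  · rw [← LinearMap.toMatrix'_comp, ← LinearMap.toMatrix'_id]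
    congr 1
    refine LinearMap.ext fun x => ?_
    have h1 : f.rangeRestrict (e.symm x : ι → ℂ) = e.symm x := by
      obtain ⟨y, hy⟩ := (e.symm x).2
      exact Subtype.ext (by rw [LinearMap.codRestrict_apply, ← hy, hf])
    simp only [LinearMap.comp_apply, LinearEquiv.coe_coe, Submodule.subtype_apply, h1, LinearEquiv.apply_symm_apply,
      LinearMap.id_apply]

theorem exists_path_one {h : Matrix ι ι ℂ} (hu : IsUnit h) : ∃ ζ : unitInterval → ℂ, Continuous ζ ∧
    ζ 0 = 0 ∧ ζ 1 = 1 ∧ ∀ t, IsUnit (1 + ζ t • (h - 1)) := by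
  have he : ∀ z : ℂ, (charpolyRev (1 - h)).eval z = (1 + z • (h - 1)).det := fun z => by
    rw [charpolyRev, ← Polynomial.coe_evalRingHom, RingHom.map_det]
    congr 1
    ext i j
    simp only [RingHom.mapMatrix_apply, map_apply, Matrix.sub_apply, Matrix.add_apply, Matrix.smul_apply,
      smul_eq_mul, map_sub, map_mul, Polynomial.coe_evalRingHom, Polynomial.eval_X, Polynomial.eval_C]
    by_cases hij : i = j
    · subst hij; rw [one_apply_eq, one_apply_eq]; generalize h i i = w; simp; ring
    · rw [one_apply_ne hij, one_apply_ne hij]; generalize h i j = w; simp; exact mul_comm _ _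
  have h0 : charpolyRev (1 - h) ≠ 0 := fun h1 => by
    have := he 0
    simp [h1] at this
  have hc : {z : ℂ | (charpolyRev (1 - h)).IsRoot z}.Countable :=
    (Polynomial.finite_setOf_isRoot h0).countable
  have hp := hc.isPathConnected_compl_of_one_lt_rank (by rw [Complex.rank_real_complex]; norm_num)
  obtain ⟨γ, hγ⟩ := hp.joinedIn 0 (by simp [he]) 1 (by
    simpa [he] using ((isUnit_iff_isUnit_det _).1 hu).ne_zero)
  refine ⟨γ, γ.continuous, γ.source, γ.target, fun t => (isUnit_iff_isUnit_det _).2 ?_⟩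
  have := hγ t
  simp only [Set.mem_compl_iff, Set.mem_setOf_eq, Polynomial.IsRoot, he] at this
  exact isUnit_iff_ne_zero.2 this

theorem stablyTrivial_circle : StablyTrivial Circle := by
  intro ι _ _ P hP hi
  obtain ⟨u, hu, h, h0⟩ := exists_transport (Y := Unit) (P := fun p => P (Circle.exp (2 * pi * p.1)))
    (hP.comp (by fun_prop)) fun p => hi _
  have e0 : Circle.exp (2 * pi * 0) = 1 := by simp
  have e1 : Circle.exp (2 * pi * 1) = 1 := by simp
  simp only [e0] at h
  obtain ⟨g1, g2⟩ := h 1 ⟨zero_le_one, le_rfl⟩ ()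
  simp only [e1] at g2
  set g := u (1, ())
  obtain ⟨ζ, hζ, ζ0, ζ1, hζu⟩ := exists_path_one (h := g⁻¹) (isUnit_of_mul_eq_one_left (inv_mul_of_isUnit g1))
  have hcomm : g⁻¹ * P 1 = P 1 * g⁻¹ := by
    calc g⁻¹ * P 1 = g⁻¹ * (P 1 * g) * g⁻¹ := by
          rw [mul_assoc, mul_assoc, mul_inv_of_isUnit g1, mul_one]
      _ = P 1 * g⁻¹ := by rw [← g2, ← mul_assoc, inv_mul_of_isUnit g1, one_mul]
  let U : unitInterval → Matrix ι ι ℂ := fun t => u (t, ()) * (1 + ζ t • (g⁻¹ - 1))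
  have hU : Continuous U := (hu.comp (by fun_prop)).matrix_mul
    (continuous_const.add (hζ.smul continuous_const))
  have hUu : ∀ t, IsUnit (U t) := fun t => (h t t.2 ()).1.mul (hζu t)
  have hUP : ∀ t : unitInterval, U t * P 1 = P (Circle.exp (2 * pi * t)) * U t := fun t => by
    have h2 : (1 + ζ t • (g⁻¹ - 1)) * P 1 = P 1 * (1 + ζ t • (g⁻¹ - 1)) := by
      simp only [add_mul, mul_add, Matrix.smul_mul, Matrix.mul_smul, sub_mul, mul_sub, hcomm, one_mul,
        mul_one]
    simp only [U]
    rw [mul_assoc, h2, ← mul_assoc, (h t t.2 ()).2, mul_assoc]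
  have U0 : U 0 = 1 := by simp [U, h0, ζ0]
  have U1 : U 1 = 1 := by simp only [U, ζ1]; simpa using mul_inv_of_isUnit g1
  let q : unitInterval → Circle := fun t => Circle.exp (2 * pi * t)
  have hq : Continuous q := by fun_prop
  have hqs : Function.Surjective q := by
    intro z
    obtain ⟨x, rfl⟩ := Circle.exp_surjective z
    have hp : (2 * pi) ≠ 0 := by positivity
    refine ⟨⟨Int.fract (x / (2 * pi)), Int.fract_nonneg _, (Int.fract_lt_one _).le⟩,
      Circle.exp_eq_exp.2 ⟨-⌊x / (2 * pi)⌋, ?_⟩⟩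
    change 2 * pi * Int.fract (x / (2 * pi)) = _
    rw [← Int.self_sub_floor]
    push_cast
    field_simp
    ring
  obtain ⟨F, hF, hFq⟩ := exists_continuous_lift hq hqs hU (by
    have key : ∀ a b : unitInterval, (a : ℝ) ≤ b → q a = q b → U a = U b := by
      intro a b hab h
      obtain ⟨m, hm⟩ := Circle.exp_eq_exp.1 h.symm
      have hm' : (b : ℝ) = a + m := by
        have hp : (2 * pi) ≠ 0 := by positivity
        apply mul_left_cancel₀ hp
        rw [hm]; ring
      have ha := a.2.1
      have hb := b.2.2
      have m0 : 0 ≤ m := by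
        have : (0 : ℝ) ≤ m := by linarith
        exact_mod_cast this
      have m1 : m ≤ 1 := by
        have : (m : ℝ) ≤ 1 := by linarith
        exact_mod_cast this
      obtain rfl | rfl : m = 0 ∨ m = 1 := by omega
      · have : a = b := Subtype.ext (by simpa using hm'.symm)
        rw [this]
      · rw [Int.cast_one] at hm'
        have ha0 : a = 0 := Subtype.ext (by change (a : ℝ) = 0; linarith)
        have hb1 : b = 1 := Subtype.ext (by change (b : ℝ) = 1; linarith)
        rw [ha0, hb1, U0, U1]
    intro a b hab
    rcases le_total (a : ℝ) b with h | h
    · exact key a b h hab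
    · exact (key b a h hab.symm).symm)
  have m1 : MvN (fun _ : Circle => P 1) P := by
    refine MvN.conj continuous_const hF (fun z => ?_) (fun z => hi _) fun z => ?_
    · obtain ⟨t, rfl⟩ := hqs z
      rw [hFq]; exact hUu t
    · obtain ⟨t, rfl⟩ := hqs z
      rw [hFq]; exact hUP t
  obtain ⟨t, A, B, hAB, hBA⟩ := exists_factor_of_idempotent (hi 1)
  have m2 : MvN (fun _ : Circle => P 1) (fun _ => (1 : Matrix (Fin t) (Fin t) ℂ)) :=
    ⟨fun _ => hi _, fun _ => mul_one _, fun _ => A, fun _ => B, continuous_const, continuous_const,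
      fun _ => hAB, fun _ => hBA⟩
  exact ⟨Fin 0, Fin t ⊕ Fin 0, inferInstance, inferInstance, inferInstance, inferInstance, by simpa using (m1.symm.trans m2).plusOne (τ := Fin 0)⟩

theorem exists_stablyTrivial_sphere (k : ℕ) : ∃ (E : Type) (_ : NormedAddCommGroup E) (_ : NormedSpace ℝ E)
    (_ : FiniteDimensional ℝ E), Module.finrank ℝ E = 2 * (k + 1) ∧ StablyTrivial (sphere (0 : E) 1) := by
  induction k with
  | zero =>
    refine ⟨ℂ, inferInstance, inferInstance, inferInstance, by simp, ?_⟩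
    exact stablyTrivial_circle.of_retract (f := fun x => ⟨x.1, x.2⟩) (g := fun x => ⟨x.1, x.2⟩) (by fun_prop)
      (by fun_prop) fun x => rfl
  | succ k ih =>
    obtain ⟨E, _, _, _, hE, hS⟩ := ih
    have : ProperSpace E := FiniteDimensional.proper_real E
    have : Nontrivial E := Module.nontrivial_of_finrank_pos (R := ℝ) (by omega)
    obtain ⟨y, hy⟩ := (NormedSpace.sphere_nonempty (x := (0 : E)) (r := 1)).2 zero_le_one
    exact ⟨E × ℂ, inferInstance, inferInstance, inferInstance, by
      rw [Module.finrank_prod, hE, Complex.finrank_real_complex]; ring,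
      hS.sphere_prod ⟨y, hy⟩ stablyTrivial_circle⟩

theorem stablyTrivial_sph (n : ℕ) : StablyTrivial (Sph (4 * n + 1)) := by
  obtain ⟨E, _, _, _, hE, hS⟩ := exists_stablyTrivial_sphere (2 * n)
  let F := EuclideanSpace ℝ (Fin (4 * n + 1 + 1))
  let φ : E ≃L[ℝ] F := ContinuousLinearEquiv.ofFinrankEq (by rw [hE, finrank_euclideanSpace_fin]; ring)
  have n1 : ∀ y : sphere (0 : F) 1, φ.symm y ≠ 0 := fun y h => by
    have := mem_sphere_zero_iff_norm.1 y.2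
    rw [φ.symm.map_eq_zero_iff] at h
    rw [h, norm_zero] at this
    exact zero_ne_one this
  have n2 : ∀ y : sphere (0 : E) 1, φ y ≠ 0 := fun y h => by
    have := mem_sphere_zero_iff_norm.1 y.2
    rw [φ.map_eq_zero_iff] at h
    rw [h, norm_zero] at this
    exact zero_ne_one this
  refine hS.of_retract (X := sphere (0 : F) 1)
    (f := fun y => ⟨‖φ.symm y‖⁻¹ • φ.symm y, by
      rw [mem_sphere_zero_iff_norm, norm_smul, norm_inv, norm_norm, inv_mul_cancel₀ (norm_ne_zero_iff.2 (n1 y))]⟩)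
    (g := fun y => ⟨‖φ y‖⁻¹ • φ y, by
      rw [mem_sphere_zero_iff_norm, norm_smul, norm_inv, norm_norm, inv_mul_cancel₀ (norm_ne_zero_iff.2 (n2 y))]⟩)
    ?_ ?_ fun y => Subtype.ext ?_
  · have h1 : Continuous fun y : sphere (0 : F) 1 => φ.symm y := φ.symm.continuous.comp continuous_subtype_val
    exact ((h1.norm.inv₀ fun y => norm_ne_zero_iff.2 (n1 y)).smul h1).subtype_mk _
  · have h1 : Continuous fun y : sphere (0 : E) 1 => φ y := φ.continuous.comp continuous_subtype_val
    exact ((h1.norm.inv₀ fun y => norm_ne_zero_iff.2 (n2 y)).smul h1).subtype_mk _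
  · have hy := mem_sphere_zero_iff_norm.1 y.2
    have h2 : ‖φ.symm (y : F)‖⁻¹ ≠ 0 := inv_ne_zero (norm_ne_zero_iff.2 (n1 y))
    simp only [map_smul, φ.apply_symm_apply, norm_smul, hy, norm_inv, norm_norm, mul_one, smul_smul]
    rw [inv_mul_cancel₀ h2, one_smul]

end

section
variable {Y ι κ ρ : Type} [Fintype ι] [DecidableEq ι] [Fintype ρ] [DecidableEq ρ]

theorem dotProduct_star_ne_zero {v : ρ → ℂ} (hv : v ≠ 0) : v ⬝ᵥ star v ≠ 0 := fun h => by
  open scoped ComplexOrder in exact hv (dotProduct_star_self_eq_zero.1 ((dotProduct_comm _ _).trans h))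

/-- The orthogonal projection onto the complement of a line. -/
noncomputable def coLine (v : ρ → ℂ) : Matrix ρ ρ ℂ := 1 - (v ⬝ᵥ star v)⁻¹ • vecMulVec v (star v)

theorem coLine_mulVec {v : ρ → ℂ} (hv : v ≠ 0) (w : ρ → ℂ) : coLine v * vecMulVec v w = 0 := by
  rw [coLine, Matrix.sub_mul, one_mul, Matrix.smul_mul, vecMulVec_mul_vecMulVec, dotProduct_comm (star v),
    vecMulVec_smul, smul_smul, inv_mul_cancel₀ (dotProduct_star_ne_zero hv), one_smul, sub_self]

theorem coLine_mul_self {v : ρ → ℂ} (hv : v ≠ 0) : coLine v * coLine v = coLine v := by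
  conv_lhs => rw [← sub_sub_cancel 1 (coLine v), Matrix.mul_sub]
  rw [sub_sub_cancel]
  have : (1 - coLine v) = vecMulVec v ((v ⬝ᵥ star v)⁻¹ • star v) := by
    rw [coLine, sub_sub_cancel, vecMulVec_smul]
  rw [this, coLine_mulVec hv, mul_one, sub_zero]

theorem continuous_coLine [TopologicalSpace Y] {v : Y → ρ → ℂ} (hv : Continuous v) (h0 : ∀ y, v y ≠ 0) :
    Continuous fun y => coLine (v y) := by
  have h1 : Continuous fun y => v y ⬝ᵥ star (v y) := hv.dotProduct hv.star
  exact continuous_const.sub ((h1.inv₀ fun y => dotProduct_star_ne_zero (h0 y)).smul (hv.matrix_vecMulVec hv.star))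

theorem MvN.coLine_of_segment [MetricSpace Y] [CompactSpace Y] {v w : Y → ρ → ℂ} (hv : Continuous v)
    (hw : Continuous w) (h : ∀ y, ∀ t ∈ Set.Icc (0 : ℝ) 1, (1 - t) • v y + t • w y ≠ 0) :
    MvN (fun y => coLine (v y)) (fun y => coLine (w y)) := by
  let c : ℝ → ℝ := fun t => Set.projIcc 0 1 zero_le_one t
  have hc : Continuous c := continuous_subtype_val.comp (continuous_projIcc (h := zero_le_one))
  have hn : ∀ p : ℝ × Y, (1 - c p.1) • v p.2 + c p.1 • w p.2 ≠ 0 := fun p => h _ _ (Subtype.mem _)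
  have h1 : Continuous fun p : ℝ × Y => (1 - c p.1) • v p.2 + c p.1 • w p.2 := by fun_prop
  have h2 := MvN.of_homotopy (continuous_coLine h1 hn) fun p => coLine_mul_self (hn p)
  simpa [c] using h2

theorem MvN.coLine_const {E : Type} [NormedAddCommGroup E] [NormedSpace ℝ E] [FiniteDimensional ℝ E]
    (hd : Module.finrank ℝ E + 1 < 2 * Fintype.card ρ) {v : sphere (0 : E) 1 → ρ → ℂ}
    (hv : Continuous v) (h0 : ∀ y, v y ≠ 0) :
    ∃ q : ρ → ℂ, q ≠ 0 ∧ MvN (fun y => coLine (v y)) (fun _ => coLine q) := by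
  have : ProperSpace E := FiniteDimensional.proper ℝ E
  have : CompactSpace (sphere (0 : E) 1) := isCompact_iff_compactSpace.1 (isCompact_sphere 0 1)
  obtain ⟨g, hg⟩ := ContinuousMap.exists_restrict_eq (Metric.isClosed_sphere (x := (0 : E)) (ε := 1)) ⟨v, hv⟩
  have hgv : ∀ y : sphere (0 : E) 1, g y = v y := fun y => DFunLike.congr_fun hg y
  obtain ⟨ε, hε, hεv⟩ : ∃ ε > 0, ∀ y, ε ≤ ‖v y‖ := by
    rcases isEmpty_or_nonempty (sphere (0 : E) 1) with he | he
    · exact ⟨1, one_pos, fun y => he.elim y⟩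
    · obtain ⟨y₀, hy⟩ := isCompact_univ.exists_isMinOn Set.univ_nonempty hv.norm.continuousOn
      exact ⟨‖v y₀‖, norm_pos_iff.2 (h0 _), fun y => hy.2 (Set.mem_univ y)⟩
  obtain ⟨u, hu, hug, -⟩ := g.continuous.exists_contDiff_approx ⊤ continuous_const fun _ => hε
  have hF : ContDiff ℝ 1 fun p : ℝ × E => p.1 • u p.2 :=
    contDiff_fst.smul ((hu.of_le (by simp)).comp contDiff_snd)
  have hdF : Module.finrank ℝ (ℝ × E) < Module.finrank ℝ (ρ → ℂ) := by
    rw [Module.finrank_prod, Module.finrank_self, Module.finrank_pi_fintype]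
    simp only [Complex.finrank_real_complex, sum_const, Finset.card_univ, smul_eq_mul]
    omega
  obtain ⟨q, hq⟩ := (hF.dense_compl_range_of_finrank_lt_finrank hdF).nonempty
  have hq : ∀ (t : ℝ) x, t • u x ≠ q := fun t x h => hq ⟨(t, x), h⟩
  have hq0 : q ≠ 0 := fun h => hq 0 0 (by rw [h, zero_smul])
  have huv : ∀ y : sphere (0 : E) 1, ‖u y - v y‖ < ‖v y‖ := fun y => by
    rw [← dist_eq_norm, ← hgv y]
    exact (hug _).trans_le ((hεv y).trans_eq (by rw [hgv]))
  have hu' : Continuous fun y : sphere (0 : E) 1 => u y := hu.continuous.comp continuous_subtype_val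
  have h1 : ∀ y : sphere (0 : E) 1, ∀ t ∈ Set.Icc (0 : ℝ) 1, (1 - t) • v y + t • u y ≠ 0 := by
    intro y t ht h
    have h2 : v y = t • (v y - u y) := by
      rw [smul_sub, ← sub_eq_zero, ← h]; module
    have h3 := congrArg norm h2
    rw [norm_smul, norm_sub_rev, Real.norm_of_nonneg ht.1] at h3
    nlinarith [huv y, norm_nonneg (u y - v y), ht.2]
  have h2 : ∀ y : sphere (0 : E) 1, ∀ t ∈ Set.Icc (0 : ℝ) 1, (1 - t) • u y + t • q ≠ 0 := by
    intro y t ht h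
    rcases eq_or_ne t 0 with rfl | ht0
    · have := huv y
      rw [sub_zero, one_smul, zero_smul, add_zero] at h
      rw [h, zero_sub, norm_neg] at this
      exact lt_irrefl _ this
    · refine hq (-(t⁻¹ * (1 - t))) y ?_
      have : t⁻¹ • ((1 - t) • u y + t • q) = 0 := by rw [h, smul_zero]
      rw [smul_add, smul_smul, smul_smul, inv_mul_cancel₀ ht0, one_smul] at this
      rw [neg_smul, neg_eq_iff_add_eq_zero]
      exact this
  exact ⟨q, hq0, (MvN.coLine_of_segment hv hu' h1).trans (MvN.coLine_of_segment hu' continuous_const h2)⟩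

/-- A trivial line summand splits off, leaving the complement of a line in a trivial bundle. -/
theorem MvN.exists_coLine [TopologicalSpace Y] {P : Y → Matrix ι ι ℂ} 
    (h : MvN (fun y => ACS.plusOne Unit (P y)) (fun _ => (1 : Matrix ρ ρ ℂ))) :
    ∃ v : Y → ρ → ℂ, Continuous v ∧ (∀ y, v y ≠ 0) ∧ MvN P fun y => coLine (v y) := by
  obtain ⟨h1, -, A, B, hA, hB, hAB, hBA⟩ := h
  let v : Y → ρ → ℂ := fun y i => B y i (.inr ())
  let w : Y → ρ → ℂ := fun y i => A y (.inr ()) i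
  have hv : Continuous v := continuous_pi fun i => hB.matrix_elem _ _
  have hw : Continuous w := continuous_pi fun i => hA.matrix_elem _ _
  have hP : ∀ y, P y * P y = P y := fun y => by
    have := h1 y
    rw [plusOne_mul] at this
    exact (fromBlocks_inj.1 this).1
  have hwv : ∀ y, w y ⬝ᵥ v y = 1 := fun y => by
    have := congrFun (congrFun (hAB y) (.inr ())) (.inr ())
    rw [mul_apply] at this
    exact this.trans (by simp)
  have hv0 : ∀ y, v y ≠ 0 := fun y h => by
    have := hwv y
    rw [h, dotProduct_zero] at this
    exact zero_ne_one this
  have hX : ∀ y, (1 - vecMulVec (v y) (w y)) * (1 - vecMulVec (v y) (w y)) = 1 - vecMulVec (v y) (w y) := fun y => by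
    rw [Matrix.sub_mul, one_mul, Matrix.mul_sub, mul_one, vecMulVec_mul_vecMulVec, hwv, one_smul,
      sub_self, sub_zero]
  have e1 : MvN P fun y => 1 - vecMulVec (v y) (w y) := by
    refine ⟨hP, hX, fun y => (A y).submatrix Sum.inl id, fun y => (B y).submatrix id Sum.inl,
      hA.matrix_submatrix _ _, hB.matrix_submatrix _ _, fun y => ?_, fun y => ?_⟩
    · have : ((A y).submatrix Sum.inl id * (B y).submatrix id Sum.inl) = (A y * B y).submatrix Sum.inl Sum.inl := by
        ext i j; simp [mul_apply]
      rw [this, hAB]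
      ext i j; simp
    · rw [← hBA y]
      ext i j
      simp [mul_apply, vecMulVec_apply, v, w]
  refine ⟨v, hv, hv0, e1.trans ⟨hX, fun y => coLine_mul_self (hv0 y), fun y => 1 - vecMulVec (v y) (w y),
    fun y => coLine (v y), continuous_const.sub (hv.matrix_vecMulVec hw), continuous_coLine hv hv0,
    fun y => ?_, fun y => ?_⟩⟩
  · dsimp only
    rw [coLine, Matrix.mul_sub, mul_one, Matrix.mul_smul, Matrix.sub_mul, one_mul,
      vecMulVec_mul_vecMulVec, hwv, one_smul, sub_self, smul_zero, sub_zero]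
  · rw [Matrix.mul_sub, coLine_mulVec (hv0 y), sub_zero, mul_one]

theorem MvN.unstable {E : Type} [NormedAddCommGroup E] [NormedSpace ℝ E] [FiniteDimensional ℝ E] {m : ℕ}
    (hd : Module.finrank ℝ E ≤ 2 * m) {P : sphere (0 : E) 1 → Matrix ι ι ℂ} (hP : Continuous P)
    (ht : ∀ y, (P y).trace = m) (hne : Nonempty (sphere (0 : E) 1)) (s : ℕ) {t : ℕ}
    (h : MvN (fun y => ACS.plusOne (Fin s) (P y)) (fun _ => (1 : Matrix (Fin t) (Fin t) ℂ))) :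
    MvN P (fun _ => (1 : Matrix (Fin m) (Fin m) ℂ)) := by
  induction s generalizing t with
  | zero =>
    have hs : MvN P fun y => ACS.plusOne (Fin 0) (P y) := by
      have h1 := MvN.reindex (continuous_plusOne hP) h.left (Equiv.sumEmpty ι (Fin 0)).symm
      have h2 : (fun y => (ACS.plusOne (Fin 0) (P y)).submatrix (Equiv.sumEmpty ι (Fin 0)).symm
          (Equiv.sumEmpty ι (Fin 0)).symm) = P := by
        funext y; ext i j; simp
      rw [h2] at h1
      exact h1.symm
    have h3 := hs.trans h
    have h4 := h3.card_eq hne.some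
    rw [ht, Fintype.card_fin] at h4
    obtain rfl : m = t := by exact_mod_cast h4
    exact h3
  | succ s ih =>
    have ht' : t = m + (s + 1) := by
      have h4 := h.card_eq hne.some
      have h5 : (ACS.plusOne (Fin (s + 1)) (P hne.some)).trace = (P hne.some).trace + (s + 1) := by
        simp [trace]
      rw [h5, ht, Fintype.card_fin] at h4
      exact_mod_cast h4.symm
    let e : (ι ⊕ Fin s) ⊕ Unit ≃ ι ⊕ Fin (s + 1) :=
      (Equiv.sumAssoc ι (Fin s) Unit).trans (Equiv.sumCongr (Equiv.refl ι) (Fintype.equivOfCardEq (by simp)))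
    have h1 := MvN.reindex (continuous_plusOne hP) h.left e
    have h2 : (fun y => (ACS.plusOne (Fin (s + 1)) (P y)).submatrix e e) =
        fun y => ACS.plusOne Unit (ACS.plusOne (Fin s) (P y)) := by
      funext y
      ext ((i | i) | i) ((j | j) | j) <;> simp [e, one_apply]
    rw [h2] at h1
    obtain ⟨v, hv, hv0, hm⟩ := (h1.symm.trans h).exists_coLine
    obtain ⟨q, hq, hm'⟩ := MvN.coLine_const (by rw [Fintype.card_fin]; omega) hv hv0
    obtain ⟨t', A, B, hAB, hBA⟩ := exists_factor_of_idempotent (coLine_mul_self hq)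
    exact ih ((hm.trans hm').trans ⟨fun _ => coLine_mul_self hq, fun _ => one_mul _, fun _ => A, fun _ => B,
      continuous_const, continuous_const, fun _ => hAB, fun _ => hBA⟩)

end

section
open scoped Matrix.Norms.L2Operator
variable {Y ι κ ρ : Type} [Fintype ι] [DecidableEq ι] 

theorem norm_smul_gram_sub_one_lt {G H : Matrix ι ι ℝ} (hH : H * G = 1) :
    ‖(1 + ‖G‖ ^ 2)⁻¹ • (Gᵀ * G) - 1‖ < 1 := by
  set ε : ℝ := (1 + ‖G‖ ^ 2)⁻¹ with hε
  have hd : (0 : ℝ) < 1 + ‖G‖ ^ 2 := by positivity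
  have hε0 : 0 < ε := inv_pos.2 hd
  have hε1 : ε * (1 + ‖G‖ ^ 2) = 1 := inv_mul_cancel₀ hd.ne'
  have hGt : ‖Gᵀ‖ = ‖G‖ := by rw [← conjTranspose_eq_transpose_of_trivial, l2_opNorm_conjTranspose]
  set δ : ℝ := ε * (1 + ‖H‖ ^ 2)⁻¹ with hδ
  have hδ0 : 0 < δ := by positivity
  have key : ∀ x : EuclideanSpace ℝ ι, ‖toEuclideanCLM (𝕜 := ℝ) (ε • (Gᵀ * G) - 1) x‖ ^ 2 ≤ (1 - δ) * ‖x‖ ^ 2 := by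
    intro x
    set L := toEuclideanCLM (n := ι) (𝕜 := ℝ) with hL
    set y := L G x with hy
    have hSx : L (Gᵀ * G) x = L Gᵀ y := by rw [map_mul]; rfl
    have hxy : ‖x‖ ≤ ‖H‖ * ‖y‖ := by
      have : x = L H y := by
        have : L H y = (L H * L G) x := rfl
        rw [this, ← map_mul, hH, map_one]; rfl
      conv_lhs => rw [this]
      exact ((L H).le_opNorm y).trans_eq (by rw [hL, ← cstar_norm_def])
    have hSy : ‖L Gᵀ y‖ ≤ ‖G‖ * ‖y‖ := by
      rw [← hGt]
      exact ((L Gᵀ).le_opNorm y).trans_eq (by rw [hL, ← cstar_norm_def])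
    have hin : inner ℝ (L Gᵀ y) x = ‖y‖ ^ 2 := by
      have : L Gᵀ = ContinuousLinearMap.adjoint (L G) := by
        rw [← ContinuousLinearMap.star_eq_adjoint, ← map_star]; rfl
      rw [this, ContinuousLinearMap.adjoint_inner_left, real_inner_self_eq_norm_sq]
    have e1 : L (ε • (Gᵀ * G) - 1) x = ε • L Gᵀ y - x := by
      rw [map_sub, map_smul, map_one, ← hSx]; rfl
    rw [e1, @norm_sub_sq_real, inner_smul_left, hin, norm_smul, Real.norm_of_nonneg hε0.le]
    simp only [conj_trivial]
    have h1 : ‖x‖ ^ 2 ≤ (1 + ‖H‖ ^ 2) * ‖y‖ ^ 2 := by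
      have := pow_le_pow_left₀ (norm_nonneg _) hxy 2
      nlinarith [sq_nonneg ‖y‖]
    have h2 : δ * ‖x‖ ^ 2 ≤ ε * ‖y‖ ^ 2 := by
      rw [hδ, mul_assoc]
      refine mul_le_mul_of_nonneg_left ?_ hε0.le
      rw [inv_mul_le_iff₀ (by positivity)]
      exact h1
    have h3 : (ε * ‖L Gᵀ y‖) ^ 2 ≤ ε * ‖y‖ ^ 2 := by
      have h4 : ‖L Gᵀ y‖ ^ 2 ≤ ‖G‖ ^ 2 * ‖y‖ ^ 2 := by
        rw [← mul_pow]; exact pow_le_pow_left₀ (norm_nonneg _) hSy 2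
      calc (ε * ‖L Gᵀ y‖) ^ 2 = ε * (ε * ‖L Gᵀ y‖ ^ 2) := by ring
        _ ≤ ε * (ε * (‖G‖ ^ 2 * ‖y‖ ^ 2)) := by gcongr
        _ ≤ ε * ((ε * (1 + ‖G‖ ^ 2)) * ‖y‖ ^ 2) := by
          rw [mul_assoc ε (1 + _)]; gcongr; linarith
        _ = _ := by rw [hε1, one_mul]
    linarith
  have hδ1 : 0 ≤ 1 - δ := by
    have : δ ≤ ε := mul_le_of_le_one_right hε0.le (inv_le_one_of_one_le₀ (by nlinarith [sq_nonneg ‖H‖]))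
    nlinarith [sq_nonneg ‖G‖]
  have hb : ‖ε • (Gᵀ * G) - 1‖ ≤ √(1 - δ) := by
    rw [cstar_norm_def]
    refine ContinuousLinearMap.opNorm_le_bound _ (Real.sqrt_nonneg _) fun x => ?_
    refine le_of_sq_le_sq ?_ (by positivity)
    rw [mul_pow, Real.sq_sqrt hδ1]
    exact key x
  refine hb.trans_lt ?_
  rw [Real.sqrt_lt' one_pos]
  linarith

theorem exists_polar [TopologicalSpace Y] {G : Y → Matrix ι ι ℝ} (hG : Continuous G) (hu : ∀ y, IsUnit (G y)) :
    ∃ R : Y → Matrix ι ι ℝ, Continuous R ∧ ∀ y, (G y * R y)ᵀ * (G y * R y) = 1 ∧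
      ∀ K, Commute K ((G y)ᵀ * G y) → Commute K (R y) := by
  let c : Y → ℝ := fun y => (1 + ‖G y‖ ^ 2)⁻¹
  have hc0 : ∀ y, 0 < c y := fun y => inv_pos.2 (by positivity : (0:ℝ) < 1 + ‖G y‖ ^ 2)
  let x : Y → Matrix ι ι ℝ := fun y => c y • ((G y)ᵀ * G y) - 1
  have hx : ∀ y, ‖x y‖ < 1 := fun y => by
    obtain ⟨H, -, h⟩ := isUnit_iff_exists.1 (hu y)
    exact norm_smul_gram_sub_one_lt h
  have hn : Continuous fun y => ‖G y‖ := continuous_norm.comp hG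
  have hcc : Continuous c := (continuous_const.add (hn.pow 2)).inv₀ fun y => (by positivity : (0:ℝ) < 1 + ‖G y‖ ^ 2).ne'
  have hxc : Continuous x := (hcc.smul (hG.matrix_transpose.matrix_mul hG)).sub continuous_const
  have hi : Continuous fun y => isqrt (x y) :=
    contDiffOn_isqrt.continuousOn.comp_continuous hxc fun y => mem_ball_zero_iff.2 (hx y)
  have hcomm : ∀ y K, Commute K ((G y)ᵀ * G y) → Commute K (isqrt (x y)) := fun y K hK =>
    commute_isqrt ((hK.smul_right _).sub_right (Commute.one_right K)) (hx y)
  refine ⟨fun y => √(c y) • isqrt (x y), (Real.continuous_sqrt.comp hcc).smul hi, fun y =>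
    ⟨?_, fun K hK => (hcomm y K hK).smul_right _⟩⟩
  have ht : (isqrt (x y))ᵀ = isqrt (x y) := by
    have h1 : (x y)ᵀ = x y := by
      simp only [x, transpose_sub, transpose_smul, transpose_mul, transpose_transpose, transpose_one]
    have h2 := map_isqrt ((starL' ℝ : Matrix ι ι ℝ ≃L[ℝ] Matrix ι ι ℝ) : Matrix ι ι ℝ →L[ℝ] Matrix ι ι ℝ)
      (fun z n => star_pow z n) (hx y)
    have h3 : ((starL' ℝ : Matrix ι ι ℝ ≃L[ℝ] Matrix ι ι ℝ) : Matrix ι ι ℝ →L[ℝ] Matrix ι ι ℝ) (x y) = (x y)ᵀ := by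
      ext i j; rfl
    rw [h3, h1] at h2
    conv_rhs => rw [← h2]
    ext i j; rfl
  have h1 := isqrt_mul_self (hx y)
  have h2 := hcomm y _ (Commute.refl _)
  have h3 : 1 + x y = c y • ((G y)ᵀ * G y) := by simp only [x]; abel
  rw [h3] at h1
  simp only [transpose_mul, transpose_smul, ht]
  generalize isqrt (x y) = r at h1 h2 ⊢
  calc √(c y) • r * (G y)ᵀ * (G y * √(c y) • r) = (√(c y) * √(c y)) • (r * (((G y)ᵀ * G y) * r)) := by
        simp only [Matrix.smul_mul, Matrix.mul_smul, smul_smul, mul_assoc]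
    _ = 1 := by
      rw [h2.eq, Real.mul_self_sqrt (hc0 y).le, ← mul_assoc, ← Matrix.mul_smul, h1]

end

section
variable {Y μ : Type} [TopologicalSpace Y] [Fintype μ] [DecidableEq μ]

/-- The projection onto the `i`-eigenspace of a complex structure. -/
noncomputable def eigenProj {ι : Type} [DecidableEq ι] (J : Matrix ι ι ℝ) : Matrix ι ι ℂ :=
  (2⁻¹ : ℂ) • (1 - I • J.map ofRealHom)

/-- If the `i`-eigenbundle of a family of orthogonal complex structures is trivial then the family is an
orthogonal conjugate of the standard one. -/
theorem exists_orthogonal_of_trivial {J : Y → Matrix (μ ⊕ μ) (μ ⊕ μ) ℝ} (hJ : ∀ y, J y ∈ OCS (μ ⊕ μ))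
    (h : MvN (fun y => eigenProj (J y)) (fun _ => (1 : Matrix μ μ ℂ))) :
    ∃ g : Y → Matrix (μ ⊕ μ) (μ ⊕ μ) ℝ, Continuous g ∧ (∀ y, (g y)ᵀ * g y = 1) ∧
      ∀ y, J y = g y * fromBlocks 0 (-1) 1 0 * (g y)ᵀ := by
  obtain ⟨-, -, A, B, hA, hB, hAB, hBA⟩ := h
  let X : Y → Matrix (μ ⊕ μ) μ ℝ := fun y => (A y).map Complex.re
  let Z : Y → Matrix (μ ⊕ μ) μ ℝ := fun y => (A y).map Complex.im
  let G : Y → Matrix (μ ⊕ μ) (μ ⊕ μ) ℝ := fun y => fromCols (X y) (-Z y)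
  have hXc : Continuous X := hA.matrix_map Complex.continuous_re
  have hZc : Continuous Z := hA.matrix_map Complex.continuous_im
  have hGc : Continuous G := continuous_matrix fun i j => by
    rcases j with j | j
    · exact hXc.matrix_elem i j
    · exact (hZc.matrix_elem i j).neg
  have hJP : ∀ y, (J y).map ofRealHom * eigenProj (J y) = I • eigenProj (J y) := fun y => by
    have h2 : (J y).map ofRealHom * (J y).map ofRealHom = -1 := by
      rw [← Matrix.map_mul, (mem_OCS.1 (hJ y)).2]
      ext i j; by_cases hij : i = j <;> simp [hij]
    rw [eigenProj, Matrix.mul_smul, Matrix.mul_sub, Matrix.mul_smul, h2, Matrix.mul_one, smul_comm]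
    congr 1
    rw [smul_sub, smul_smul, Complex.I_mul_I]
    module
  have hJA : ∀ y, (J y).map ofRealHom * A y = I • A y := fun y => by
    have h1 : eigenProj (J y) * A y = A y := by
      rw [← hAB, Matrix.mul_assoc, hBA, Matrix.mul_one]
    rw [← h1, ← Matrix.mul_assoc, hJP, Matrix.smul_mul]
  have hJX : ∀ y, J y * X y = -Z y := fun y => by
    ext i a
    have := congrArg Complex.re (congrFun (congrFun (hJA y) i) a)
    simpa [mul_apply, X, Z] using this
  have hJZ : ∀ y, J y * Z y = X y := fun y => by
    ext i a
    have := congrArg Complex.im (congrFun (congrFun (hJA y) i) a)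
    simpa [mul_apply, X, Z] using this
  have hG : ∀ y, J y * G y = G y * fromBlocks 0 (-1) 1 0 := fun y => by
    simp only [G]
    rw [mul_fromCols, hJX, Matrix.mul_neg, hJZ, ← fromCols_fromRows_eq_fromBlocks, mul_fromCols]
    congr 1 <;> rw [fromCols_mul_fromRows] <;> simp
  have hu : ∀ y, IsUnit (G y) := fun y => by
    refine .of_mul_eq_one ((2 : ℝ) • fromRows ((B y).map Complex.re) ((B y).map Complex.im)) ?_
    simp only [G]
    rw [Matrix.mul_smul, fromCols_mul_fromRows]
    ext i j
    have := congrArg Complex.re (congrFun (congrFun (hAB y) i) j)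
    have h2 : (eigenProj (J y) i j).re = 2⁻¹ * (1 : Matrix (μ ⊕ μ) (μ ⊕ μ) ℝ) i j := by
      by_cases hij : i = j <;> simp [eigenProj, hij, one_apply]
    rw [h2] at this
    rw [Matrix.smul_apply, smul_eq_mul, ← mul_left_cancel_iff_of_pos (a := (2⁻¹ : ℝ)) (by norm_num), ← this]
    simp [mul_apply, X, Z, Finset.sum_sub_distrib]
    ring
  obtain ⟨R, hR, hRo⟩ := exists_polar hGc hu
  have hgJ : ∀ y, J y * (G y * R y) = G y * R y * fromBlocks 0 (-1) 1 0 := fun y => by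
    have h1 : Commute (fromBlocks 0 (-1) 1 0) ((G y)ᵀ * G y) := by
      have h2 := congrArg transpose (hG y)
      have h3 : (fromBlocks 0 (-1) 1 0 : Matrix (μ ⊕ μ) (μ ⊕ μ) ℝ)ᵀ = -fromBlocks 0 (-1) 1 0 := by
        rw [fromBlocks_transpose, fromBlocks_neg]; simp
      rw [transpose_mul, transpose_mul, h3, (mem_OCS.1 (hJ y)).1, Matrix.mul_neg, Matrix.neg_mul, neg_inj] at h2
      rw [Commute, SemiconjBy, ← mul_assoc, ← h2, mul_assoc, hG, mul_assoc]
    rw [← mul_assoc, hG, mul_assoc, ((hRo y).2 _ h1).eq, mul_assoc]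
  refine ⟨fun y => G y * R y, hGc.matrix_mul hR, fun y => (hRo y).1, fun y => ?_⟩
  simp only
  rw [← hgJ, mul_assoc, mul_eq_one_comm.1 (hRo y).1, mul_one]

end

section
variable {ι : Type} [Fintype ι] [DecidableEq ι]

theorem eigenProj_mul_self {J : Matrix ι ι ℝ} (hJ : J ∈ OCS ι) : eigenProj J * eigenProj J = eigenProj J := by
  have h2 : J.map ofRealHom * J.map ofRealHom = -1 := by
    rw [← Matrix.map_mul, (mem_OCS.1 hJ).2]
    ext i j; by_cases hij : i = j <;> simp [hij]
  have h3 : (I • J.map ofRealHom) * (I • J.map ofRealHom) = 1 := by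
    rw [Matrix.smul_mul, Matrix.mul_smul, h2, smul_smul, Complex.I_mul_I]; simp
  rw [eigenProj, Matrix.smul_mul, Matrix.mul_smul, Matrix.mul_sub, Matrix.sub_mul, Matrix.sub_mul, h3,
    one_mul, one_mul, mul_one, smul_smul]
  module

theorem trace_eigenProj {J : Matrix ι ι ℝ} (hJ : J ∈ OCS ι) : (eigenProj J).trace = Fintype.card ι / 2 := by
  have h0 : J.trace = 0 := by
    have h := congrArg trace (mem_OCS.1 hJ).1
    rw [trace_transpose, trace_neg] at h
    linarith
  have h1 : (J.map ofRealHom).trace = 0 := by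
    rw [← AddMonoidHom.map_trace]; simp [h0]
  rw [eigenProj, trace_smul, trace_sub, trace_one, trace_smul, h1]
  simp; ring

theorem transpose_eigenProj {J : Matrix ι ι ℝ} (hJ : J ∈ OCS ι) : (eigenProj J)ᵀ = 1 - eigenProj J := by
  have h1 : (J.map ofRealHom)ᵀ = -J.map ofRealHom := by
    rw [← transpose_map, (mem_OCS.1 hJ).1]; ext i j; simp
  rw [eigenProj, transpose_smul, transpose_sub, transpose_one, transpose_smul, h1]
  module

theorem continuous_eigenProj : Continuous (eigenProj : Matrix ι ι ℝ → Matrix ι ι ℂ) := by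
  unfold eigenProj
  refine Continuous.const_smul (continuous_const.sub (Continuous.const_smul ?_ I)) (2⁻¹ : ℂ)
  exact continuous_id.matrix_map Complex.continuous_ofReal

end

theorem exists_lift (n : ℕ) (f : C(Sph (4 * n + 1), GammaPlus (2 * n + 1))) :
    ∃ g : Sph (4 * n + 1) → Matrix (Fin (2 * n + 1) ⊕ Fin (2 * n + 1)) (Fin (2 * n + 1) ⊕ Fin (2 * n + 1)) ℝ,
      Continuous g ∧ (∀ y, (g y)ᵀ * g y = 1) ∧
      ∀ y, ((f y : Gamma (2 * n + 1)) : Matrix _ _ ℝ) = g y * J0 (2 * n + 1) * (g y)ᵀ := by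
  let J : Sph (4 * n + 1) → Matrix (Fin (2 * n + 1) ⊕ Fin (2 * n + 1)) (Fin (2 * n + 1) ⊕ Fin (2 * n + 1)) ℝ :=
    fun y => (f y : Gamma (2 * n + 1))
  have hJ : ∀ y, J y ∈ OCS (Fin (2 * n + 1) ⊕ Fin (2 * n + 1)) := fun y => (f y : Gamma (2 * n + 1)).2
  have hJc : Continuous J := continuous_subtype_val.comp (continuous_subtype_val.comp f.continuous)
  have hPc : Continuous fun y => eigenProj (J y) := continuous_eigenProj.comp hJc
  obtain ⟨σ, τ, _, _, _, _, h⟩ := stablyTrivial_sph n _ _ hPc fun y => eigenProj_mul_self (hJ y)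
  obtain ⟨t, ht⟩ := h.exists_plusOne_fin hPc le_rfl
  refine exists_orthogonal_of_trivial hJ (MvN.unstable (E := EuclideanSpace ℝ (Fin (4 * n + 1 + 1))) ?_ hPc
    (fun y => ?_) ⟨northPole (4 * n + 1)⟩ _ ht)
  · rw [finrank_euclideanSpace_fin]; omega
  · rw [trace_eigenProj (hJ y)]; simp

section
open scoped Matrix.Norms.Operator

section
variable {Z 𝔸 κ ι : Type} [NormedCommRing Z] [NormedAlgebra ℂ Z] [FiniteDimensional ℂ Z]
  [Algebra ℚ Z] [Ring 𝔸] [Algebra Z 𝔸] [Algebra ℂ 𝔸] [IsScalarTower ℂ Z 𝔸] [Fintype κ] [Fintype ι] [DecidableEq ι]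
  {V : Type} [NormedAddCommGroup V] [NormedSpace ℝ V]
  {e : Option κ → 𝔸} {zz : Option κ → Option κ → Z} {b : κ → V}
  [FiniteDimensional ℝ V] [MeasurableSpace V] [BorelSpace V] {μ : Measure V}
  [μ.IsAddHaarMeasure] {ℓ : 𝔸 →ₗ[ℂ] ℂ}

theorem OddGen.zz_self (h : OddGen e zz) (a : Option κ) : zz a a = 0 := by
  have h2 : (2 : ℂ) • zz a a = 0 := by rw [two_smul]; nth_rw 2 [h.zz_anti]; abel
  exact (smul_eq_zero_iff_right two_ne_zero).1 h2

theorem OddGen.chern_none (h : OddGen e zz) {P : Matrix ι ι ℂ} {Q : Option κ → Matrix ι ι ℂ}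
    (hQ : ∀ c, Q (some c) = 0) {k : ℕ} (hk : k ≠ 0) : chern zz P Q k = 0 := by
  have hc : curv zz Q = 0 := by
    simp [curv, Fintype.sum_option, hQ, h.zz_self]
  simp [chern, hc, hk]

/-- The integral of a characteristic class of a smooth family of idempotents does not depend on
the parameter, provided that the class vanishes outside a compact set. -/
theorem OddGen.formInt_newton_homotopy_of_vanish (h : OddGen e zz) {α : Type} [Fintype α]
    {P : α → V × ℝ → Matrix ι ι ℂ} (hP : ∀ a, ContDiff ℝ ∞ (P a)) (hi : ∀ a x, P a x * P a x = P a x)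
    {K : Set V} (hK : IsCompact K) {r : ℕ}
    (hv : ∀ x ∉ K, ∀ s, newton (fun k => ∑ a, chernForm zz (optDir b) (P a) k (x, s)) r = 0)
    (s t : ℝ) :
    formInt μ ℓ e (fun x => newton (fun k => ∑ a, chernForm zz (vDir b)
      (fun x => P a (x, s)) k x) r) =
    formInt μ ℓ e (fun x => newton (fun k => ∑ a, chernForm zz (vDir b)
      (fun x => P a (x, t)) k x) r) := by
  have hw : SmoothClosed e (optDir b) (fun x : V × ℝ => newton (fun k => ∑ a, chernForm zz
      (optDir b) (P a) k x) r) :=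
    .newton (fun k => .sum _ fun a => .chernForm h (hP a) (hi a) k) r
  have key := integral_slice_eq μ hw.1 hw.2 hK (fun x hx u => hv x hx u) ℓ s t
  have hsl : ∀ s x, mulFun ℓ (e none) (newton (fun k => ∑ a, chernForm zz
      (optDir b) (P a) k (x, s)) r) = mulFun ℓ (e none) (newton (fun k => ∑ a, chernForm zz
      (vDir b) (fun x => P a (x, s)) k x) r) := fun s x => by
    refine mulFun_none_congr ℓ ?_
    rw [newton_map, newton_map]
    refine congrArg (fun p => newton p r) (funext fun k => ?_)
    rw [map_sum, map_sum]
    exact sum_congr rfl fun a _ => h.mk_chernForm_slice (hP a) k x s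
  simp only [hsl] at key
  exact key

theorem OddGen.formInt_newton_homotopy (h : OddGen e zz) {α : Type} [Fintype α]
    {P : α → V × ℝ → Matrix ι ι ℂ} (hP : ∀ a, ContDiff ℝ ∞ (P a)) (hi : ∀ a x, P a x * P a x = P a x)
    {K : Set V} (hK : IsCompact K)
    (hloc : ∀ a, ∀ x ∉ K, ∀ s, fderiv ℝ (fun x => P a (x, s)) x = 0) {r : ℕ} (hr : r ≠ 0)
    (s t : ℝ) :
    formInt μ ℓ e (fun x => newton (fun k => ∑ a, chernForm zz (vDir b)
      (fun x => P a (x, s)) k x) r) =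
    formInt μ ℓ e (fun x => newton (fun k => ∑ a, chernForm zz (vDir b)
      (fun x => P a (x, t)) k x) r) := by
  refine h.formInt_newton_homotopy_of_vanish hP hi hK (fun x hx s =>
    newton_zero_of_pos hr fun k hk _ => sum_eq_zero fun a _ => ?_) s t
  refine h.chern_none (fun c => ?_) (by omega)
  have h1 := (HasFDerivAt.comp (f := fun x : V => (x, s)) x
    ((hP a).differentiable (by simp) (x, s)).hasFDerivAt (hasFDerivAt_prodMk_left x s)).fderiv
  have h2 : fderiv ℝ (fun x => P a (x, s)) x = _ := h1
  rw [hloc a x hx] at h2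
  exact (congrArg (fun L => L (b c)) h2).symm

end

end

section
variable {Z 𝔸 γ M : Type} [CommRing Z] [Algebra ℂ Z] [Ring 𝔸] [Algebra Z 𝔸] [Fintype γ]
  [DecidableEq γ] {e : γ → 𝔸} {zz : γ → γ → Z} [Ring M] [Algebra Z M]

theorem OddGen.sq_zero (h : OddGen e zz) [Algebra ℂ 𝔸] (d : γ) : e d * e d = 0 := by
  have := h.anti d d
  have h2 : (2 : ℂ) • (e d * e d) = 0 := by rw [two_smul]; nth_rw 2 [this]; abel
  exact (smul_eq_zero_iff_right two_ne_zero).1 h2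

theorem OddGen.zz_mul_zz (h : OddGen e zz) [Algebra ℂ 𝔸] (a d c : γ) : zz a d * zz d c = 0 := by
  apply h.inj
  rw [map_mul, h.map_zz, h.map_zz, map_zero, mul_assoc, ← mul_assoc (e d), h.sq_zero, zero_mul,
    mul_zero]

theorem OddGen.zz_swap (h : OddGen e zz) (a d b c : γ) :
    zz a d * zz b c = -(zz b d * zz a c) := by
  apply h.inj
  simp only [map_mul, map_neg, h.map_zz]
  have h1 : e a * e d * e b = -(e b * e d * e a) := by
    rw [mul_assoc, h.anti d b, mul_neg, ← mul_assoc, h.anti a b, neg_mul, mul_assoc, h.anti a d,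
      mul_neg, neg_neg, mul_assoc]
  rw [← mul_assoc, h1, neg_mul, mul_assoc]

/-- The Clifford relations. -/
structure Cliff (F : γ → M) (El : M) : Prop where
  rel : ∀ c d, F c * F d = -(F d * F c) - if c = d then 2 else 0
  anti : ∀ c, El * F c = -(F c * El)
  sq : El * El = -1

namespace Cliff
variable {F : γ → M} {El : M}

/-- The quadratic element `∑ zz c d • F c F d`. -/
def quad (zz : γ → γ → Z) (F : γ → M) : M := ∑ c, ∑ d, zz c d • (F c * F d)
/-- Linear combinations of the generators. -/
def lin (F : γ → M) (u : γ → Z) : M := ∑ c, u c • F c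
/-- Contraction of a vector with the odd generators. -/
def con (zz : γ → γ → Z) (u : γ → Z) (d : γ) : Z := ∑ c, u c * zz c d

theorem quad_mul (hF : Cliff F El) (h : OddGen e zz) (a : γ) :
    quad zz F * F a = F a * quad zz F + (4 : Z) • ∑ d, zz a d • F d := by
  have h1 : ∀ c d, F c * F d * F a = F a * (F c * F d) + (if c = a then (2 : Z) • F d else 0) -
      (if d = a then (2 : Z) • F c else 0) := by
    intro c d
    rw [mul_assoc, hF.rel d a, mul_sub, mul_neg, ← mul_assoc, hF.rel c a, sub_mul, neg_mul,
      mul_assoc, neg_sub]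
    split_ifs <;> simp only [mul_zero, zero_mul, sub_zero, zero_sub, add_zero, mul_two, two_mul, two_smul] <;> abel
  simp only [quad, sum_mul, mul_sum, smul_mul_assoc, mul_smul_comm, h1, smul_sub,
    smul_add, sum_add_distrib, Finset.sum_sub_distrib, smul_ite, smul_zero]
  have h2 : ∑ c, ∑ d, (if c = a then zz c d • (2 : Z) • F d else 0) =
      (2 : Z) • ∑ d, zz a d • F d := by
    rw [sum_eq_single a, smul_sum]
    · simp only [if_true]; exact sum_congr rfl fun d _ => smul_comm _ _ _
    · intro c _ hc; simp [hc]
    · simp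
  have h3 : ∑ c, ∑ d, (if d = a then zz c d • (2 : Z) • F c else 0) =
      -((2 : Z) • ∑ d, zz a d • F d) := by
    rw [smul_sum, ← sum_neg_distrib]
    refine sum_congr rfl fun c _ => ?_
    rw [sum_eq_single a]
    · rw [if_pos rfl, h.zz_anti, neg_smul, smul_comm]
    · intro c _ hc; simp [hc]
    · simp
  rw [h2, h3]
  module

theorem quad_mul_lin (hF : Cliff F El) (h : OddGen e zz) (u : γ → Z) :
    quad zz F * lin F u = lin F u * quad zz F + (4 : Z) • lin F (con zz u) := by
  simp only [lin, mul_sum, sum_mul, mul_smul_comm, smul_mul_assoc, hF.quad_mul h,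
    smul_add, sum_add_distrib, con, sum_smul, mul_smul]
  congr 1
  rw [sum_comm, smul_sum]
  refine sum_congr rfl fun c _ => ?_
  rw [smul_comm, smul_sum]

theorem quad_comm_con [Algebra ℂ 𝔸] (hF : Cliff F El) (h : OddGen e zz) (u : γ → Z) :
    quad zz F * lin F (con zz u) = lin F (con zz u) * quad zz F := by
  rw [hF.quad_mul_lin h]
  have : con zz (con zz u) = fun _ => 0 := by
    funext d
    simp only [con, sum_mul, mul_assoc, h.zz_mul_zz, mul_zero, Finset.sum_const_zero]
  rw [this]; simp [lin]

theorem con_mul_con (h : OddGen e zz) (u : γ → Z) (c d : γ) : con zz u c * con zz u d = 0 := by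
  simp only [con, Finset.sum_mul_sum]
  refine sum_antisymm _ fun a b => ?_
  rw [mul_mul_mul_comm, h.zz_swap, mul_mul_mul_comm]; ring

theorem con_sandwich (h : OddGen e zz) (u : γ → Z) (Y : M) :
    lin F (con zz u) * Y * lin F (con zz u) = 0 := by
  simp only [lin, sum_mul, mul_sum, smul_mul_assoc, mul_smul_comm, smul_sum,
    smul_smul, con_mul_con h, zero_smul, Finset.sum_const_zero]

theorem quad_pow_mul_lin [Algebra ℂ 𝔸] (hF : Cliff F El) (h : OddGen e zz) (u : γ → Z) (k : ℕ) :
    quad zz F ^ (k + 1) * lin F u = lin F u * quad zz F ^ (k + 1) +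
      (4 * (k + 1) : Z) • (lin F (con zz u) * quad zz F ^ k) := by
  induction k with
  | zero => simpa using hF.quad_mul_lin h u
  | succ k ih =>
    rw [pow_succ' _ (k + 1), mul_assoc, ih, mul_add, ← mul_assoc, hF.quad_mul_lin h, mul_smul_comm,
      ← mul_assoc, hF.quad_comm_con h, mul_assoc _ _ (_ ^ k), ← pow_succ', add_mul, mul_assoc,
      ← pow_succ', smul_mul_assoc]
    push_cast
    module

theorem el_quad (hF : Cliff F El) : El * quad zz F = quad zz F * El := by
  simp only [quad, sum_mul, mul_sum, smul_mul_assoc, mul_smul_comm]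
  refine sum_congr rfl fun c _ => sum_congr rfl fun d _ => ?_
  rw [← mul_assoc, hF.anti, neg_mul, mul_assoc, hF.anti, mul_neg, neg_neg, mul_assoc]

omit [Algebra ℂ Z] in
theorem el_lin (hF : Cliff F El) (u : γ → Z) : El * lin F u = -(lin F u * El) := by
  simp only [lin, sum_mul, mul_sum, smul_mul_assoc, mul_smul_comm, hF.anti,
    smul_neg, sum_neg_distrib]

omit [Algebra ℂ Z] in
theorem lin_mul_lin (hF : Cliff F El) (u v : γ → Z) :
    lin F u * lin F v = -(lin F v * lin F u) - (2 * ∑ c, u c * v c) • (1 : M) := by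
  have h1 : ∀ u v : γ → Z, lin F u * lin F v = ∑ c, ∑ d, (u c * v d) • (F c * F d) := fun u v => by
    simp only [lin, sum_mul, mul_sum, smul_mul_assoc, mul_smul_comm, smul_smul,
      smul_sum]
    rw [sum_comm]
    simp only [mul_comm]
  rw [h1, h1, sum_comm (γ := γ) (f := fun c d => (v c * u d) • (F c * F d)), mul_sum,
    sum_smul, ← sum_neg_distrib, ← Finset.sum_sub_distrib]
  refine sum_congr rfl fun c _ => ?_
  rw [← sum_neg_distrib, sub_eq_add_neg]
  have h2 : -((2 * (u c * v c)) • (1 : M)) = ∑ d, if c = d then -((2 * (u c * v c)) • (1 : M)) else 0 := by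
    simp
  rw [h2, ← sum_add_distrib]
  refine sum_congr rfl fun d _ => ?_
  rw [hF.rel c d, mul_comm (v d)]
  split_ifs with hcd
  · subst hcd
    have h2 : (2 : M) = (2 : Z) • (1 : M) := by rw [two_smul, one_add_one_eq_two]
    rw [h2]; module
  · simp

theorem lin_mul_con (hF : Cliff F El) (h : OddGen e zz) (u : γ → Z) :
    lin F u * lin F (con zz u) = -(lin F (con zz u) * lin F u) := by
  rw [hF.lin_mul_lin]
  have : ∑ c, u c * con zz u c = 0 := by
    simp only [con, mul_sum]
    refine sum_antisymm _ fun a b => ?_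
    rw [h.zz_anti]; ring
  rw [this]; simp

omit [Algebra ℂ Z] in
theorem lin_sq_of_half (hF : Cliff F El) {w : Z} (hw : w * 2 = 1) (u : γ → Z) :
    lin F u * lin F u = -((∑ c, u c * u c) • (1 : M)) := by
  have h1 : (2 : Z) • (lin F u * lin F u) = (2 : Z) • -((∑ c, u c * u c) • (1 : M)) := by
    rw [two_smul]; nth_rw 2 [hF.lin_mul_lin u u]; module
  have := congrArg (w • ·) h1
  simpa only [smul_smul, hw, one_smul] using this

theorem lin_sq (hF : Cliff F El) (u : γ → Z) : lin F u * lin F u = -((∑ c, u c * u c) • (1 : M)) :=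
  hF.lin_sq_of_half (w := algebraMap ℂ Z 2⁻¹)
    (by rw [← map_ofNat (algebraMap ℂ Z) 2, ← map_mul]; norm_num) u

/-- The curvature of the derivative of `A • El + B • lin u`. -/
theorem quad_deriv (hF : Cliff F El) (h : OddGen e zz) (u : γ → Z) (x y B : Z) :
    quad zz (fun c => u c • (x • El + y • lin F u) + B • F c) =
      (B * B) • quad zz F + (2 * B) • ((x • El + y • lin F u) * lin F (con zz u)) := by
  set X := x • El + y • lin F u with hX
  have hXW : lin F (con zz u) * X = -(X * lin F (con zz u)) := by
    rw [hX, mul_add, add_mul, mul_smul_comm, mul_smul_comm, smul_mul_assoc, smul_mul_assoc,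
      hF.el_lin, hF.lin_mul_con h]
    simp only [smul_neg]; abel
  have h1 : ∑ c, ∑ d, (zz c d * (u c * u d)) • (X * X) = 0 := by
    simp only [← sum_smul]
    rw [sum_antisymm _ fun a b => ?_, zero_smul]
    rw [h.zz_anti]; ring
  have h2 : ∑ c, ∑ d, (zz c d * (u c * B)) • (X * F d) = B • (X * lin F (con zz u)) := by
    simp only [lin, con, mul_sum, smul_sum, sum_smul, mul_smul_comm]
    rw [sum_comm]
    refine sum_congr rfl fun c _ => sum_congr rfl fun d _ => ?_
    rw [smul_smul]; congr 1; ring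
  have h3 : ∑ c, ∑ d, (zz c d * (B * u d)) • (F c * X) = B • (X * lin F (con zz u)) := by
    rw [← neg_eq_iff_eq_neg.2 hXW]
    simp only [lin, con, sum_mul, smul_sum, sum_smul, smul_mul_assoc,
      ← sum_neg_distrib]
    refine sum_congr rfl fun c _ => sum_congr rfl fun d _ => ?_
    rw [smul_neg, smul_smul, ← neg_smul, h.zz_anti]; congr 1; ring
  have h4 : quad zz (fun c => u c • X + B • F c) = ∑ c, ∑ d, (zz c d * (u c * u d)) • (X * X) +
      ∑ c, ∑ d, (zz c d * (u c * B)) • (X * F d) + ∑ c, ∑ d, (zz c d * (B * u d)) • (F c * X) +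
      (B * B) • quad zz F := by
    simp only [quad, smul_sum, ← sum_add_distrib]
    refine sum_congr rfl fun c _ => sum_congr rfl fun d _ => ?_
    simp only [mul_add, add_mul, smul_mul_smul_comm, smul_add, smul_smul]
    rw [mul_comm (B * B)]
    abel
  rw [h4, h1, h2, h3]
  module

theorem quad_deriv_pow [Algebra ℂ 𝔸] (hF : Cliff F El) (h : OddGen e zz) (u : γ → Z) (x y B : Z) (k : ℕ) :
    quad zz (fun c => u c • (x • El + y • lin F u) + B • F c) ^ (k + 1) =
      B ^ (2 * k + 2) • quad zz F ^ (k + 1) + (2 * (k + 1) * B ^ (2 * k + 1)) •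
        ((x • El + y • lin F u) * lin F (con zz u) * quad zz F ^ k) := by
  induction k with
  | zero => rw [zero_add, pow_one, hF.quad_deriv h]; simp [pow_two]
  | succ k ih =>
    set X := x • El + y • lin F u with hX
    set W := lin F (con zz u) with hW
    set K := quad zz F with hK
    have h1 : K * (X * W) = X * W * K := by
      have : K * X = X * K + (4 * y) • W := by
        rw [hX, mul_add, add_mul, mul_smul_comm, mul_smul_comm, smul_mul_assoc, smul_mul_assoc,
          hF.quad_mul_lin h, ← hF.el_quad]
        module
      rw [← mul_assoc, this, add_mul, smul_mul_assoc, mul_assoc, mul_assoc, hF.quad_comm_con h]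
      have := con_sandwich (F := F) h u (1 : M)
      rw [mul_one] at this
      rw [this, smul_zero, add_zero]
    have h2 : X * W * (X * W * K ^ k) = 0 := by
      rw [← mul_assoc, mul_assoc X, ← mul_assoc W, con_sandwich h, mul_zero, zero_mul]
    have h3 := hF.quad_deriv h u x y B
    rw [← hX, ← hW, ← hK] at h3
    rw [pow_succ', ih, h3, add_mul, mul_add, mul_add ((2 * B) • (X * W)),
      smul_mul_smul_comm, smul_mul_smul_comm, smul_mul_smul_comm, smul_mul_smul_comm, h2, smul_zero, add_zero,
      ← mul_assoc K, h1, mul_assoc (X * W), ← pow_succ', ← pow_succ', add_assoc, ← add_smul]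
    congr 2 <;> push_cast <;> ring

section trace
variable {tr : M →ₗ[Z] Z} (ht : ∀ x y, tr (x * y) = tr (y * x))
include ht

theorem tr_odd (hF : Cliff F El) {Y : M} (hY : El * Y = -(Y * El)) (k : ℕ) :
    tr (Y * quad zz F ^ k) = 0 := by
  have h1 : tr (El * (Y * quad zz F ^ k * El)) = -tr (Y * quad zz F ^ k) := by
    rw [ht, mul_assoc, hF.sq]; simp
  have h2 : El * (Y * quad zz F ^ k * El) = Y * quad zz F ^ k := by
    have hc : Commute El (quad zz F ^ k) := Commute.pow_right hF.el_quad k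
    rw [mul_assoc, ← hc.eq, ← mul_assoc, ← mul_assoc, hY, neg_mul, mul_assoc Y, hF.sq]; simp
  rw [h2] at h1
  have h3 : algebraMap ℂ Z 2⁻¹ * 2 = 1 := by
    rw [← map_ofNat (algebraMap ℂ Z) 2, ← map_mul]; norm_num
  linear_combination (algebraMap ℂ Z 2⁻¹) * h1 - tr (Y * quad zz F ^ k) * h3

theorem tr_el_lin_con [Algebra ℂ 𝔸] (hF : Cliff F El) (h : OddGen e zz) (u : γ → Z) (k : ℕ) :
    2 * (k + 1) * tr (El * lin F u * (lin F (con zz u) * quad zz F ^ k)) =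
      (∑ c, u c * u c) * tr (El * quad zz F ^ (k + 1)) := by
  have h1 : tr (El * lin F u * (quad zz F ^ (k + 1) * lin F u)) =
      (∑ c, u c * u c) * tr (El * quad zz F ^ (k + 1)) := by
    rw [← mul_assoc, ht, ← mul_assoc, ← mul_assoc, ← neg_eq_iff_eq_neg.2 (hF.el_lin u), neg_mul,
      mul_assoc El, hF.lin_sq]
    simp
  have h2 : tr (El * lin F u * (quad zz F ^ (k + 1) * lin F u)) =
      -((∑ c, u c * u c) * tr (El * quad zz F ^ (k + 1))) +
      4 * (k + 1) * tr (El * lin F u * (lin F (con zz u) * quad zz F ^ k)) := by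
    rw [hF.quad_pow_mul_lin h, mul_add, map_add, mul_smul_comm, map_smul, ← mul_assoc,
      mul_assoc El, hF.lin_sq]
    simp
  have h3 : algebraMap ℂ Z 2⁻¹ * 2 = 1 := by
    rw [← map_ofNat (algebraMap ℂ Z) 2, ← map_mul]; norm_num
  have h4 := h2.symm.trans h1
  generalize tr (El * lin F u * (lin F (con zz u) * quad zz F ^ k)) = t at *
  generalize (∑ c, u c * u c) * tr (El * quad zz F ^ (k + 1)) = s at *
  linear_combination (algebraMap ℂ Z 2⁻¹) * h4 - (2 * (k + 1) * t - s) * h3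

theorem tr_el_quad [Algebra ℂ 𝔸] (hF : Cliff F El) (h : OddGen e zz) (k : ℕ)
    (hk : 2 * (k + 1) ≠ Fintype.card γ) : tr (El * quad zz F ^ (k + 1)) = 0 := by
  set τ := tr (El * quad zz F ^ (k + 1)) with hτ
  have hsq : ∀ c, F c * F c = -1 := fun c => by
    have := hF.lin_sq (Pi.single c (1 : Z))
    simpa [lin, Pi.single_apply] using this
  have h1 : ∀ c, tr (El * F c * (quad zz F ^ (k + 1) * F c)) = τ := by
    intro c
    rw [← mul_assoc, ht, ← mul_assoc, ← mul_assoc, ← neg_eq_iff_eq_neg.2 (hF.anti c), neg_mul,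
      mul_assoc El, hsq]
    simp [hτ]
  have h2 : ∀ c, quad zz F ^ (k + 1) * F c = F c * quad zz F ^ (k + 1) +
      (4 * (k + 1) : Z) • ((∑ d, zz c d • F d) * quad zz F ^ k) := by
    intro c
    have := hF.quad_pow_mul_lin h (Pi.single c (1 : Z)) k
    simpa [lin, con, Pi.single_apply] using this
  have h3 : ∑ c, F c * ∑ d, zz c d • F d = quad zz F := by
    simp only [quad, mul_sum, mul_smul_comm]
  have h4 : ∑ c, tr (El * F c * (quad zz F ^ (k + 1) * F c)) =
      -(Fintype.card γ * τ) + 4 * (k + 1) * τ := by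
    have : ∀ c, El * F c * (quad zz F ^ (k + 1) * F c) = -(El * quad zz F ^ (k + 1)) +
        (4 * (k + 1) : Z) • (El * (F c * (∑ d, zz c d • F d)) * quad zz F ^ k) := by
      intro c
      rw [h2, mul_add, mul_smul_comm, ← mul_assoc, mul_assoc El, hsq]
      simp [mul_assoc]
    simp only [this, map_add, map_neg, map_smul, sum_add_distrib, ← smul_sum,
      ← map_sum, ← sum_mul, ← mul_sum, h3]
    rw [mul_assoc El, ← pow_succ']
    simp [hτ]
  simp only [h1, sum_const, Finset.card_univ, nsmul_eq_mul] at h4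
  have h5 : (algebraMap ℂ Z ((4 * (k + 1) - 2 * Fintype.card γ : ℂ))) * τ = 0 := by
    simp only [map_sub, map_mul, map_add, map_natCast, map_one, map_ofNat]
    linear_combination -h4
  rw [← Algebra.smul_def] at h5
  refine (smul_eq_zero_iff_right ?_).1 h5
  intro h6
  apply hk
  have : (4 * (k + 1) : ℂ) = 2 * Fintype.card γ := sub_eq_zero.1 h6
  have h7 : 4 * (k + 1) = 2 * Fintype.card γ := by exact_mod_cast this
  omega

/-- The trace form of the Clifford family. -/
theorem tr_deriv [Algebra ℂ 𝔸] (hF : Cliff F El) (h : OddGen e zz) (u : γ → Z) (A B A' B' : Z) (k : ℕ) :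
    tr ((A • El + B • lin F u) *
      quad zz (fun c => u c • ((2 * A') • El + (2 * B') • lin F u) + B • F c) ^ (k + 1)) =
      B ^ (2 * k + 1) * (A * B + 2 * (∑ c, u c * u c) * (A * B' - A' * B)) *
        tr (El * quad zz F ^ (k + 1)) := by
  rw [hF.quad_deriv_pow h]
  set W := lin F (con zz u)
  set U := lin F u with hU
  set K := quad zz F
  have hUU : U * U = -((∑ c, u c * u c) • (1 : M)) := hF.lin_sq u
  have e1 : tr (U * K ^ (k + 1)) = 0 := hF.tr_odd ht (hF.el_lin u) _
  have e2 : tr (W * K ^ k) = 0 := hF.tr_odd ht (hF.el_lin _) _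
  have e3 := hF.tr_el_lin_con ht h u k
  have e4 : (A • El + B • U) * (((2 * A') • El + (2 * B') • U) * W * K ^ k) =
      (-(2 * A * A') - 2 * B * B' * (∑ c, u c * u c)) • (W * K ^ k) +
      (2 * (A * B' - A' * B)) • (El * U * (W * K ^ k)) := by
    have : (A • El + B • U) * ((2 * A') • El + (2 * B') • U) =
      (-(2 * A * A') - 2 * B * B' * (∑ c, u c * u c)) • 1 +
      (2 * (A * B' - A' * B)) • (El * U) := by
      rw [add_mul, mul_add, mul_add, smul_mul_smul_comm, smul_mul_smul_comm, smul_mul_smul_comm,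
        smul_mul_smul_comm, hF.sq, hUU, ← neg_eq_iff_eq_neg.2 (hF.el_lin u)]
      module
    rw [mul_assoc _ W, ← mul_assoc, this, add_mul, smul_mul_assoc, one_mul, smul_mul_assoc]
  rw [mul_add, mul_smul_comm, mul_smul_comm, e4, add_mul]
  simp only [map_add, map_smul, smul_mul_assoc, e1, e2, smul_eq_mul, mul_zero, add_zero, zero_add]
  linear_combination 2 * B ^ (2 * k + 1) * (A * B' - A' * B) * e3

end trace
end Cliff
end

section
variable {R : Type} [Ring R]

theorem pow_add_of_sq_zero {f S : R} (hf : f * f = 0) (hc : f * S = S * f) (n : ℕ) :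
    (f + S) ^ (n + 1) = S ^ (n + 1) + (n + 1 : ℕ) • (f * S ^ n) := by
  have hc' : ∀ n, S ^ n * f = f * S ^ n := fun n => ((show Commute f S from hc).pow_right n).eq.symm
  induction n with
  | zero => simp [add_comm]
  | succ n ih =>
    rw [pow_succ, ih, add_mul, mul_add, mul_add, smul_mul_assoc, smul_mul_assoc, mul_assoc f (S ^ n) f,
      hc' (n + 1), hc' n, ← mul_assoc f f, hf, zero_mul, smul_zero, zero_add, mul_assoc f, ← pow_succ,
      ← pow_succ, add_smul (n + 1) 1]
    rw [one_smul]; abel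

theorem pow_list_sum {σ : Type} {f : σ × Bool → R} (hf : ∀ c, f c * f c = 0)
    (hc : ∀ c d, f c * f d = f d * f c) (l : List σ) :
    (l.map fun a => f (a, false) + f (a, true)).sum ^ (2 * l.length + 1) = 0 ∧
    (l.map fun a => f (a, false) + f (a, true)).sum ^ (2 * l.length) =
      (2 * l.length).factorial • (l.map fun a => f (a, false) * f (a, true)).prod := by
  induction l with
  | nil => simp
  | cons a l ih =>
    set S := (l.map fun a => f (a, false) + f (a, true)).sum with hS
    have hcS : ∀ c, f c * S = S * f c := fun c => by
      refine (Commute.list_sum_right _ _ fun x hx => ?_ : Commute (f c) S)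
      obtain ⟨b, -, rfl⟩ := List.mem_map.1 hx
      exact (show Commute _ _ from hc _ _).add_right (hc _ _)
    obtain ⟨h1, h2⟩ := ih
    simp only [List.map_cons, List.sum_cons, List.length_cons, List.prod_cons, ← hS]
    have e1 : ∀ n, (f (a, true) + S) ^ (n + 1) = _ := pow_add_of_sq_zero (hf _) (hcS _)
    have hcT : f (a, false) * (f (a, true) + S) = (f (a, true) + S) * f (a, false) := by
      rw [mul_add, add_mul, hcS, hc]
    have e2 : ∀ n, (f (a, false) + (f (a, true) + S)) ^ (n + 1) = _ :=
      pow_add_of_sq_zero (hf _) hcT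
    rw [add_assoc]
    have h3 : S ^ (2 * l.length + 2) = 0 := by rw [pow_succ, h1, zero_mul]
    have t1 : (f (a, true) + S) ^ (2 * l.length + 2) = 0 := by
      rw [e1, h3, h1, mul_zero, smul_zero, add_zero]
    have t2 : (f (a, true) + S) ^ (2 * l.length + 3) = 0 := by rw [pow_succ, t1, zero_mul]
    constructor
    · rw [show 2 * (l.length + 1) + 1 = (2 * l.length + 2) + 1 by ring, e2, t2, t1]; simp
    · rw [show 2 * (l.length + 1) = (2 * l.length + 1) + 1 by ring, e2, t1, e1, h1, h2,
        Nat.factorial_succ, Nat.factorial_succ]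
      simp only [zero_add, mul_smul_comm, smul_smul, mul_assoc]

end

section
variable {M : Type} [Ring M] {i : ℕ} {F : Fin i × Bool → M}

/-- The product of the Clifford generators. -/
def volume (F : Fin i × Bool → M) : M :=
  ((List.finRange i).map fun l => F (l, false) * F (l, true)).prod

theorem map_volume {N : Type} [Ring N] (φ : M →+* N) : φ (volume F) = volume fun c => φ (F c) := by
  rw [volume, volume, map_list_prod, List.map_map]
  congr 2; funext l; simp

variable (hF : ∀ c d, F c * F d = -(F d * F c) - if c = d then 2 else 0) (hsq : ∀ c, F c * F c = -1)
include hF hsq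

theorem pair_comm (l : Fin i) (c : Fin i × Bool) : F (l, false) * F (l, true) * F c =
    (if l = c.1 then -1 else 1) * (F c * (F (l, false) * F (l, true))) := by
  obtain ⟨k, b⟩ := c
  have h0 := hF (l, true) (k, b)
  have h1 := hF (l, false) (k, b)
  have h2 := hF (l, false) (l, true)
  by_cases hlk : l = k
  · subst hlk
    cases b
    · rw [mul_assoc, hF]; simp
    · have h3 := hF (l, true) (l, false)
      simp only [Prod.mk.injEq, Bool.true_eq_false, and_false, if_false, sub_zero] at h3
      rw [mul_assoc, hsq, ← mul_assoc, mul_assoc _ (F (l, true)), ← mul_assoc (F (l, true)), h3, neg_mul, mul_assoc, hsq]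
      simp
  · simp only [Prod.mk.injEq, hlk, false_and, if_false, sub_zero] at h0 h1 ⊢
    rw [mul_assoc, h0, mul_neg, ← mul_assoc, h1]; simp [mul_assoc]

theorem pair_pair_comm (l k : Fin i) : Commute (F (l, false) * F (l, true)) (F (k, false) * F (k, true)) := by
  rw [Commute, SemiconjBy, ← mul_assoc, pair_comm hF hsq, mul_assoc, mul_assoc, pair_comm hF hsq]
  dsimp only
  split_ifs <;> simp [mul_assoc]

theorem pair_sq (l : Fin i) : (F (l, false) * F (l, true)) * (F (l, false) * F (l, true)) = -1 := by
  rw [← mul_assoc, pair_comm hF hsq]; simp [← mul_assoc, hsq]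

theorem volume_anti (hi : Odd i) (c : Fin i × Bool) : volume F * F c = -(F c * volume F) := by
  have : ∀ ls : List (Fin i), (ls.map fun l => F (l, false) * F (l, true)).prod * F c =
      (ls.map fun l => if l = c.1 then (-1 : M) else 1).prod *
        (F c * (ls.map fun l => F (l, false) * F (l, true)).prod) := by
    intro ls
    induction ls with
    | nil => simp
    | cons l ls ih =>
      have hs : Commute (F (l, false) * F (l, true)) (ls.map fun l => if l = c.1 then (-1 : M) else 1).prod := by
        refine Commute.list_prod_right _ _ fun x hx => ?_
        obtain ⟨k, -, rfl⟩ := List.mem_map.1 hx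
        split_ifs <;> simp
      rw [List.map_cons, List.prod_cons, List.map_cons, List.prod_cons, mul_assoc, ih, ← mul_assoc,
        hs.eq, mul_assoc, ← mul_assoc _ (F c), pair_comm hF hsq]
      split_ifs <;> simp [mul_assoc]
  rw [volume, this]
  have h2 : ((List.finRange i).map fun l => if l = c.1 then (-1 : M) else 1).prod = -1 := by
    have h3 : ((List.finRange i).map fun l => if l = c.1 then (-1 : ℤ) else 1).prod = -1 := by
      rw [← List.ofFn_eq_map, List.prod_ofFn, Finset.prod_ite_eq']; simp
    have := congrArg (Int.castRingHom M) h3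
    rw [map_list_prod, List.map_map] at this
    simpa [Function.comp_def, apply_ite (Int.castRingHom M)] using this
  rw [h2, neg_one_mul]

theorem volume_sq (hi : Odd i) : volume F * volume F = -1 := by
  have : ∀ ls : List (Fin i), (ls.map fun l => F (l, false) * F (l, true)).prod *
      (ls.map fun l => F (l, false) * F (l, true)).prod = (-1) ^ ls.length := by
    intro ls
    induction ls with
    | nil => simp
    | cons l ls ih =>
      have hs : Commute (F (l, false) * F (l, true)) (ls.map fun l => F (l, false) * F (l, true)).prod := by
        refine Commute.list_prod_right _ _ fun x hx => ?_
        obtain ⟨k, -, rfl⟩ := List.mem_map.1 hx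
        exact pair_pair_comm hF hsq _ _
      rw [List.map_cons, List.prod_cons, hs.symm.mul_mul_mul_comm, ih, pair_sq hF hsq,
        List.length_cons, pow_succ']
  rw [volume, this, List.length_finRange, hi.neg_one_pow]

end

theorem transpose_volume {ι A : Type} [CommRing A] [Fintype ι] [DecidableEq ι] {i : ℕ} (hi : Odd i)
    {F : Fin i × Bool → Matrix ι ι A}
    (hF : ∀ c d, F c * F d = -(F d * F c) - if c = d then 2 else 0) (hsq : ∀ c, F c * F c = -1)
    (ht : ∀ c, (F c)ᵀ = -F c) : (volume F)ᵀ = -volume F := by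
  have : ∀ ls : List (Fin i), (ls.map fun l => F (l, false) * F (l, true)).prodᵀ =
      (-1) ^ ls.length * (ls.map fun l => F (l, false) * F (l, true)).prod := by
    intro ls
    induction ls with
    | nil => simp
    | cons l ls ih =>
      have hs : Commute (F (l, false) * F (l, true)) (ls.map fun l => F (l, false) * F (l, true)).prod := by
        refine Commute.list_prod_right _ _ fun x hx => ?_
        obtain ⟨k, -, rfl⟩ := List.mem_map.1 hx
        exact pair_pair_comm hF hsq _ _
      have h2 := hF (l, true) (l, false)
      simp only [Prod.mk.injEq, Bool.true_eq_false, and_false, if_false, sub_zero] at h2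
      rw [List.map_cons, List.prod_cons, transpose_mul, ih, transpose_mul, ht, ht, neg_mul_neg, h2,
        mul_neg, List.length_cons, pow_succ', mul_assoc, ← hs.eq]
      simp
  rw [volume, this, List.length_finRange, hi.neg_one_pow, neg_one_mul]

/-- Real Clifford matrices. -/
theorem exists_clifford (d n : ℕ) : ∃ (ι : Type) (_ : Fintype ι) (_ : DecidableEq ι)
    (E : Fin n → Matrix ι ι ℝ), Fintype.card ι = 2 ^ n * d ∧ (∀ c, (E c)ᵀ = -E c) ∧
    (∀ c, E c * E c = -1) ∧ ∀ a b, E a * E b = -(E b * E a) - if a = b then 2 else 0 := by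
  induction n with
  | zero => exact ⟨Fin d, inferInstance, inferInstance, fun c => c.elim0, by simp,
      fun c => c.elim0, fun c => c.elim0, fun c => c.elim0⟩
  | succ n ih =>
    obtain ⟨ι, _, _, E, h1, h2, h3, h4⟩ := ih
    have hsq : ∀ c : Fin (n + 1), (Fin.cons (fromBlocks 0 (-1) 1 0)
      (fun c => fromBlocks (E c) 0 0 (-E c)) : Fin (n + 1) → Matrix (ι ⊕ ι) (ι ⊕ ι) ℝ) c * (Fin.cons (fromBlocks 0 (-1) 1 0)
      (fun c => fromBlocks (E c) 0 0 (-E c)) : Fin (n + 1) → Matrix (ι ⊕ ι) (ι ⊕ ι) ℝ) c = -1 := fun c => by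
      refine Fin.cases ?_ (fun c => ?_) c
      · simp [fromBlocks_multiply, ← fromBlocks_one, fromBlocks_neg]
      · simp [fromBlocks_multiply, ← fromBlocks_one, fromBlocks_neg, h3]
    refine ⟨ι ⊕ ι, inferInstance, inferInstance, Fin.cons (fromBlocks 0 (-1) 1 0)
      (fun c => fromBlocks (E c) 0 0 (-E c)), ?_, ?_, hsq, ?_⟩
    · rw [Fintype.card_sum, h1]; ring
    · refine Fin.cases ?_ (fun c => ?_)
      · simp [fromBlocks_transpose, fromBlocks_neg]
      · simp [fromBlocks_transpose, fromBlocks_neg, h2]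
    · intro a b
      by_cases hab : a = b
      · subst hab
        rw [hsq, if_pos rfl, neg_neg, ← one_add_one_eq_two]; abel
      · rw [if_neg hab, sub_zero]
        revert hab
        refine Fin.cases (Fin.cases (fun h => absurd rfl h) fun b _ => ?_) (fun a => Fin.cases
          (fun _ => ?_) fun b hab => ?_) a b
        · simp [fromBlocks_multiply, fromBlocks_neg]
        · simp [fromBlocks_multiply, fromBlocks_neg]
        · have : a ≠ b := fun h => hab (h ▸ rfl)
          have h5 := h4 a b
          rw [if_neg this, sub_zero] at h5
          simp [fromBlocks_multiply, fromBlocks_neg, h5]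

section
variable {Z 𝔸 ι : Type} [CommRing Z] [Algebra ℂ Z] [Ring 𝔸] [Algebra Z 𝔸] [Algebra ℂ 𝔸] [Fintype ι]
  [DecidableEq ι] {i : ℕ} {e : Fin i × Bool → 𝔸} {zz : Fin i × Bool → Fin i × Bool → Z}
  {F : Fin i × Bool → Matrix ι ι Z}

theorem OddGen.quad_pow (h : OddGen e zz)
    (hF : ∀ c d, F c * F d = -(F d * F c) - if c = d then 2 else 0) :
    Cliff.quad zz F ^ i = ((2 * i).factorial • ∏ l, zz (l, false) (l, true)) • volume F := by
  set φ := (algebraMap Z 𝔸).mapMatrix (m := ι) with hφ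
  have hinj : Function.Injective φ := Matrix.map_injective h.inj
  set f : Fin i × Bool → Matrix ι ι 𝔸 := fun c => oddMat e (Pi.single c (F c)) with hf
  have hff : ∀ c d, f c * f d = φ (zz c d • (F c * F d)) := fun c d => by
    simp only [hf]
    rw [h.oddMat_mul_oddMat, hφ, RingHom.mapMatrix_apply]
    congr 1
    rw [sum_eq_single c, sum_eq_single d]
    · simp
    · intro b _ hb; simp [Pi.single_eq_of_ne hb]
    · simp
    · intro b _ hb; simp [Pi.single_eq_of_ne hb]
    · simp
  have h0 : ∀ c, f c * f c = 0 := fun c => by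
    have h2 : (2 : ℂ) • zz c c = 0 := by rw [two_smul]; nth_rw 2 [h.zz_anti]; abel
    rw [hff, (smul_eq_zero_iff_right two_ne_zero).1 h2, zero_smul, map_zero]
  have hc : ∀ c d, f c * f d = f d * f c := fun c d => by
    by_cases hcd : c = d
    · rw [hcd]
    · have := hF c d
      rw [if_neg hcd, sub_zero] at this
      rw [hff, hff, this, h.zz_anti, neg_smul, smul_neg, neg_neg]
  have hs : oddMat e F = ((List.finRange i).map fun a => f (a, false) + f (a, true)).sum := by
    rw [← List.ofFn_eq_map, List.sum_ofFn]
    have : ∑ l, (f (l, false) + f (l, true)) = ∑ c, f c := by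
      rw [Fintype.sum_prod_type]
      exact sum_congr rfl fun l _ => by rw [Fintype.sum_bool, add_comm]
    rw [this]
    ext p q
    simp only [hf, oddMat, Matrix.sum_apply]
    refine sum_congr rfl fun c _ => ?_
    rw [sum_eq_single c]
    · simp
    · intro b _ hb; simp [Pi.single_eq_of_ne hb]
    · simp
  have hK : φ (Cliff.quad zz F) = oddMat e F ^ 2 := by
    rw [pow_two, h.oddMat_mul_oddMat]; rfl
  apply hinj
  have := (pow_list_sum h0 hc (List.finRange i)).2
  rw [← hs, List.length_finRange] at this
  rw [map_pow, hK, ← pow_mul, this]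
  simp only [hff]
  have h3 : ∀ ls : List (Fin i), (ls.map fun a => φ (zz (a, false) (a, true) •
      (F (a, false) * F (a, true)))).prod = φ ((ls.map fun a => zz (a, false) (a, true)).prod •
        (ls.map fun a => F (a, false) * F (a, true)).prod) := by
    intro ls
    induction ls with
    | nil => simp
    | cons a ls ih =>
      rw [List.map_cons, List.prod_cons, ih, ← map_mul, smul_mul_smul_comm]
      simp
  rw [h3, ← map_nsmul, volume, ← smul_assoc]
  congr 3

end

section
open scoped Matrix.Norms.Operator

section
variable {Z 𝔸 κ γ ι : Type} [CommRing Z] [Algebra ℂ Z] [Ring 𝔸] [Algebra Z 𝔸] [Fintype κ]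
  [Fintype γ] [Fintype ι] [DecidableEq ι] {e : κ → 𝔸} {zz : κ → κ → Z}

theorem OddGen.comp (h : OddGen e zz) (g : γ → κ) :
    OddGen (fun c => e (g c)) fun c d => zz (g c) (g d) :=
  ⟨fun _ _ => h.map_zz _ _, fun _ _ => h.anti _ _, h.inj⟩

theorem chern_comp {g : γ → κ} (hg : Function.Injective g) (P : Matrix ι ι ℂ) {Q : κ → Matrix ι ι ℂ}
    (hQ : ∀ a ∉ Set.range g, Q a = 0) (k : ℕ) :
    chern zz P Q k = chern (fun c d => zz (g c) (g d)) P (fun c => Q (g c)) k := by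
  rw [chern, chern, curv, curv]
  congr 3
  symm
  refine Fintype.sum_of_injective g hg _ _ (fun a ha => ?_) fun c => ?_
  · simp [hQ a ha]
  · refine Fintype.sum_of_injective g hg _ _ (fun a ha => ?_) fun d => rfl
    simp [hQ a ha]

end

section
variable {Z 𝔸 ι : Type} [CommRing Z] [Algebra ℂ Z] [Algebra ℚ Z] [Ring 𝔸] [Algebra Z 𝔸] [Algebra ℂ 𝔸]
  [Fintype ι] [DecidableEq ι] {i : ℕ}
  {e : Fin i × Bool → 𝔸} {zz : Fin i × Bool → Fin i × Bool → Z}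

/-- Entrywise scalar extension of a real matrix. -/
noncomputable def scalarExt (ι Z : Type) [CommRing Z] [Algebra ℂ Z] [Fintype ι] [DecidableEq ι] :
    Matrix ι ι ℝ →+* Matrix ι ι Z :=
  ((algebraMap ℂ Z).comp ofRealHom).mapMatrix

theorem scalarExt_smul (a : ℝ) (N : Matrix ι ι ℝ) :
    scalarExt ι Z (a • N) = (algebraMap ℂ Z a) • scalarExt ι Z N := by
  ext; simp [scalarExt]

theorem map_smul_ext (c : ℂ) (N : Matrix ι ι ℝ) :
    (c • N.map ofRealHom).map (algebraMap ℂ Z) = c • scalarExt ι Z N := by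
  ext
  simp only [scalarExt, RingHom.mapMatrix_apply, map_apply, Matrix.smul_apply, smul_eq_mul, map_mul,
    RingHom.comp_apply]
  rw [Algebra.smul_def]

theorem newton_eq_of_zero {p : ℕ → Z} (hi : Odd i) (hp : ∀ k, 1 ≤ k → k < i → p k = 0) :
    newton p i = (i : ℂ)⁻¹ • p i := by
  obtain ⟨j, rfl⟩ := hi
  have h1 := newton_succ p (2 * j)
  rw [sum_eq_single (2 * j)] at h1
  · have h2 : ((2 * j + 1 : ℕ) : ℂ) • newton p (2 * j + 1) = p (2 * j + 1) := by
      rw [Nat.cast_smul_eq_nsmul, nsmul_eq_mul]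
      push_cast at h1 ⊢
      rw [h1]; simp [newton]
    conv_rhs => rw [← h2, smul_smul, inv_mul_cancel₀ (Nat.cast_ne_zero.2 (by omega)), one_smul]
  · intro k hk hk2
    rw [hp _ (by omega) (by have := Finset.mem_range.1 hk; omega), mul_zero, mul_zero]
  · simp

variable (h : OddGen e zz) (hi : Odd i) {E : Fin i × Bool → Matrix ι ι ℝ}
  (hE : ∀ c d, E c * E d = -(E d * E c) - if c = d then 2 else 0) (hsq : ∀ c, E c * E c = -1)
include h hi hE hsq

theorem OddGen.newton_clifford (u : Fin i × Bool → ℝ) (A B A' B' : ℝ) :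
    newton (chern zz (eigenProj (A • volume E + B • ∑ c, u c • E c)) fun c =>
      (-(I / 2)) • (u c • ((2 * A') • volume E + (2 * B') • ∑ c, u c • E c) + B • E c).map
        ofRealHom) i =
    (((i : ℂ)⁻¹ * (1 / 2) * (-1 / 4) ^ i * I * (2 * i).factorial * Fintype.card ι) *
      (B ^ (2 * i - 1) * (A * B + 2 * (∑ c, u c * u c) * (A * B' - A' * B)) : ℝ)) •
      ∏ l, zz (l, false) (l, true) := by
  set φ := scalarExt ι Z with hφ
  set F : Fin i × Bool → Matrix ι ι Z := fun c => φ (E c) with hF'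
  have hF : ∀ c d, F c * F d = -(F d * F c) - if c = d then 2 else 0 := fun c d => by
    rw [hF', ← map_mul, hE, map_sub, map_neg, map_mul]
    split_ifs
    · rw [map_ofNat]
    · rw [map_zero]
  have hFsq : ∀ c, F c * F c = -1 := fun c => by
    rw [hF', ← map_mul, hsq, map_neg, map_one]
  have hvol : φ (volume E) = volume F := map_volume φ
  have hC : Cliff F (volume F) :=
    ⟨hF, volume_anti hF hFsq hi, volume_sq hF hFsq hi⟩
  set a : ℝ → Z := fun x => algebraMap ℂ Z x with ha
  have hlin : φ (∑ c, u c • E c) = Cliff.lin F (fun c => a (u c)) := by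
    rw [map_sum]; exact sum_congr rfl fun c _ => scalarExt_smul _ _
  set J := A • volume E + B • ∑ c, u c • E c with hJ
  set D := fun c => u c • ((2 * A') • volume E + (2 * B') • ∑ c, u c • E c) + B • E c with hD
  have hφJ : φ J = a A • volume F + a B • Cliff.lin F (fun c => a (u c)) := by
    rw [hJ, map_add, hφ, scalarExt_smul, scalarExt_smul, ← hφ, hvol, hlin]
  have hφD : ∀ c, φ (D c) = a (u c) • ((2 * a A') • volume F + (2 * a B') •
      Cliff.lin F (fun c => a (u c))) + a B • F c := fun c => by
    simp only [hD]
    rw [map_add, hφ, scalarExt_smul, scalarExt_smul, map_add, scalarExt_smul, scalarExt_smul, ← hφ,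
      hvol, hlin]
    simp only [ha, Complex.ofReal_mul, map_mul, Complex.ofReal_ofNat, map_ofNat, hF', hφ]
  have hcurv : curv zz (fun c => (-(I / 2)) • (D c).map ofRealHom) =
      (-1 / 4 : ℂ) • Cliff.quad zz (fun c => φ (D c)) := by
    rw [curv, Cliff.quad]
    simp only [map_smul_ext, smul_sum]
    refine sum_congr rfl fun c _ => sum_congr rfl fun d _ => ?_
    rw [smul_mul_smul_comm, smul_comm, show -(I / 2) * -(I / 2) = -1 / 4 by
      linear_combination (1 / 4 : ℂ) * Complex.I_mul_I]
  have hP : (eigenProj J).map (algebraMap ℂ Z) = (1 / 2 : ℂ) • (1 - I • φ J) := by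
    ext x y
    simp only [eigenProj, hφ, scalarExt, map_apply, Matrix.smul_apply, Matrix.sub_apply, smul_eq_mul,
      map_mul, map_sub, RingHom.mapMatrix_apply, RingHom.comp_apply, one_div]
    simp only [Algebra.smul_def]
    congr 2
    rw [Matrix.one_apply, Matrix.one_apply]; split_ifs <;> simp
  have htr : ∀ x y : Matrix ι ι Z, traceLinearMap ι Z Z (x * y) = traceLinearMap ι Z Z (y * x) :=
    fun x y => trace_mul_comm x y
  have hval : ∀ k, chern zz (eigenProj J) (fun c => (-(I / 2)) • (D c).map ofRealHom)
      (k + 1) = (-((1 / 2) * (-1 / 4) ^ (k + 1) * I) : ℂ) • (a B ^ (2 * k + 1) *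
        (a A * a B + 2 * (∑ c, a (u c) * a (u c)) * (a A * a B' - a A' * a B)) *
        (volume F * Cliff.quad zz F ^ (k + 1)).trace) := fun k => by
    have h1 := hC.tr_deriv htr h (fun c => a (u c)) (a A) (a B) (a A') (a B') k
    simp only [traceLinearMap_apply] at h1
    rw [← h1, ← hφJ]
    simp only [← hφD]
    have h2 := h.trace_curv_pow (Q := fun c => (-(I / 2)) • (D c).map ofRealHom)
      k.succ_ne_zero
    rw [chern, hP, Matrix.smul_mul, Matrix.sub_mul, one_mul, trace_smul, trace_sub, h2, hcurv,
      smul_pow, Matrix.smul_mul, Matrix.mul_smul, trace_smul, trace_smul, zero_sub, smul_neg, neg_smul,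
      smul_smul, smul_smul]
    congr 2; ring
  obtain ⟨j, hj⟩ := hi
  obtain ⟨j', rfl⟩ : ∃ j', i = j' + 1 := ⟨2 * j, hj⟩
  rw [newton_eq_of_zero ⟨j, hj⟩]
  · rw [hval, h.quad_pow hF, Matrix.mul_smul, volume_sq hF hFsq ⟨j, hj⟩, smul_neg, trace_neg, trace_smul,
      trace_one, show 2 * (j' + 1) - 1 = 2 * j' + 1 by omega]
    simp only [nsmul_eq_mul, smul_eq_mul]
    simp only [ha, Algebra.smul_def, map_mul, map_neg, map_pow, map_add, map_sub,
      map_sum, Complex.ofReal_mul, Complex.ofReal_pow, Complex.ofReal_add, Complex.ofReal_sub,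
      Complex.ofReal_sum, map_natCast, Complex.ofReal_ofNat, map_ofNat]
    ring
  · intro k hk1 hk2
    obtain ⟨k, rfl⟩ := Nat.exists_eq_succ_of_ne_zero (by omega : k ≠ 0)
    have := hC.tr_el_quad htr h k (by simp; omega)
    simp only [traceLinearMap_apply] at this
    rw [hval, this, mul_zero, smul_zero]

end

section
variable {ι V : Type} [Fintype ι] [DecidableEq ι] [NormedAddCommGroup V] [NormedSpace ℝ V]

/-- The linear part of `eigenProj`. -/
noncomputable def eigenProjL (ι : Type) [Fintype ι] [DecidableEq ι] :
    Matrix ι ι ℝ →L[ℝ] Matrix ι ι ℂ :=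
  LinearMap.toContinuousLinearMap
    { toFun := fun N => (-(I / 2)) • N.map ofRealHom
      map_add' := fun M N => by ext; simp [mul_add]
      map_smul' := fun r N => by ext; simp; try ring }

theorem eigenProj_eq (N : Matrix ι ι ℝ) : eigenProj N = (2⁻¹ : ℂ) • 1 + eigenProjL ι N := by
  ext x y
  simp [eigenProj, eigenProjL, mul_sub]; ring

theorem contDiff_eigenProj {J : V → Matrix ι ι ℝ} (hJ : ContDiff ℝ ∞ J) :
    ContDiff ℝ ∞ fun v => eigenProj (J v) := by
  simp only [eigenProj_eq]
  exact contDiff_const.add ((eigenProjL ι).contDiff.comp hJ)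

theorem fderiv_eigenProj {J : V → Matrix ι ι ℝ} {x : V} (hJ : DifferentiableAt ℝ J x) (v : V) :
    fderiv ℝ (fun v => eigenProj (J v)) x v =
      (-(I / 2)) • (fderiv ℝ J x v).map ofRealHom := by
  simp only [eigenProj_eq]
  have h1 : HasFDerivAt (fun v => (2⁻¹ : ℂ) • 1 + eigenProjL ι (J v))
      ((eigenProjL ι).comp (fderiv ℝ J x)) x :=
    ((eigenProjL ι).hasFDerivAt.comp x hJ.hasFDerivAt).const_add _
  rw [h1.fderiv]; rfl

end

/-- Profile functions interpolating between the two ends of the Clifford family. -/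
theorem exists_profile : ∃ A B : ℝ → ℝ, ContDiff ℝ ∞ A ∧ ContDiff ℝ ∞ B ∧
    (∀ x, A x ^ 2 + x * B x ^ 2 = 1) ∧ (∀ x, 1 ≤ x → A x = 1 ∧ B x = 0) ∧ (∀ x, 0 ≤ B x) ∧ 0 < B 0 ∧
    (∀ x, 0 ≤ x → A x * B x + 2 * x * (A x * deriv B x - deriv A x * B x) ≤ 0) ∧
    A 0 * B 0 < 0 := by
  set b : ℝ → ℝ := fun x => smoothTransition (2 - 2 * x) with hb
  have hbs : ContDiff ℝ ∞ b := smoothTransition.contDiff.comp (by fun_prop)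
  have hb1 : ∀ x ≤ 1 / 2, b x = 1 := fun x hx =>
    smoothTransition.one_of_one_le (by linarith)
  have hb0 : ∀ x, 1 ≤ x → b x = 0 := fun x hx =>
    smoothTransition.zero_of_nonpos (by linarith)
  have hbn : ∀ x, 0 ≤ b x := fun x => smoothTransition.nonneg _
  have hanti : Antitone b := fun x y hxy => smoothTransition.monotone (by linarith)
  have hd : ∀ x, deriv b x ≤ 0 := fun x => hanti.deriv_nonpos
  have hd0 : ∀ x < 1 / 2, deriv b x = 0 := fun x hx => by
    have : b =ᶠ[𝓝 x] fun _ => 1 := by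
      filter_upwards [Iio_mem_nhds hx] with y hy using hb1 y (le_of_lt hy)
    rw [this.deriv_eq, deriv_const]
  set N : ℝ → ℝ := fun x => (x - 1 / 2) ^ 2 + x * b x ^ 2 with hN
  have hNs : ContDiff ℝ ∞ N := by fun_prop
  have hNp : ∀ x, 0 < N x := fun x => by
    simp only [hN]
    rcases le_or_gt x (1 / 2) with hx | hx
    · rw [hb1 x hx]; nlinarith [sq_nonneg x]
    · have h1 : 0 < (x - 1 / 2) ^ 2 := by have : 0 < x - 1 / 2 := by linarith
                                          positivity
      have h2 : 0 ≤ x * b x ^ 2 := by have : 0 ≤ x := by linarith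
                                      positivity
      linarith
  set s : ℝ → ℝ := fun x => (√(N x))⁻¹ with hs
  have hss : ContDiff ℝ ∞ s := (hNs.sqrt fun x => (hNp x).ne').inv fun x => (Real.sqrt_pos.2 (hNp x)).ne'
  have hsp : ∀ x, 0 < s x := fun x => inv_pos.2 (Real.sqrt_pos.2 (hNp x))
  have hs2 : ∀ x, s x ^ 2 * N x = 1 := fun x => by
    rw [hs, inv_pow, Real.sq_sqrt (hNp x).le, inv_mul_cancel₀ (hNp x).ne']
  refine ⟨fun x => (x - 1 / 2) * s x, fun x => b x * s x, by fun_prop, hbs.mul hss, fun x => ?_,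
    fun x hx => ?_, fun x => mul_nonneg (hbn x) (hsp x).le, ?_, fun x hx => ?_, ?_⟩
  · have h1 := hs2 x
    simp only [hN] at h1
    linear_combination h1
  · have h1 := hs2 x
    rw [hN] at h1
    simp only [hb0 x hx] at h1 ⊢
    have h2 : 0 < (x - 1 / 2) * s x := mul_pos (by linarith) (hsp x)
    exact ⟨by nlinarith, by simp⟩
  · simp only [hb1 0 (by norm_num), one_mul]; exact hsp 0
  · have e1 : HasDerivAt (fun x => (x - 1 / 2) * s x) (1 * s x + (x - 1 / 2) * deriv s x) x :=
      ((hasDerivAt_id x).sub_const _).mul (hss.differentiable (by simp) x).hasDerivAt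
    have e2 : HasDerivAt (fun x => b x * s x) (deriv b x * s x + b x * deriv s x) x :=
      (hbs.differentiable (by simp) x).hasDerivAt.mul (hss.differentiable (by simp) x).hasDerivAt
    rw [e1.deriv, e2.deriv]
    have h1 : x * ((x - 1 / 2) * deriv b x) ≤ 0 := by
      rcases lt_or_ge x (1 / 2) with hx2 | hx2
      · rw [hd0 x hx2]; simp
      · exact mul_nonpos_of_nonneg_of_nonpos hx (mul_nonpos_of_nonneg_of_nonpos (by linarith) (hd x))
    have h2 : 0 ≤ (x + 1 / 2) * b x := mul_nonneg (by linarith) (hbn x)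
    calc _ = s x ^ 2 * (2 * (x * ((x - 1 / 2) * deriv b x)) - (x + 1 / 2) * b x) := by ring
      _ ≤ 0 := mul_nonpos_of_nonneg_of_nonpos (sq_nonneg _) (by linarith)
  · simp only [hb1 0 (by norm_num)]; nlinarith [hsp 0]

section
variable {Z 𝔸 κ ι ι' : Type} [NormedCommRing Z] [NormedAlgebra ℂ Z] [FiniteDimensional ℂ Z]
  [Algebra ℚ Z] [Ring 𝔸] [Algebra Z 𝔸] [Algebra ℂ 𝔸] [IsScalarTower ℂ Z 𝔸] [Fintype κ]
  [Fintype ι] [DecidableEq ι] [Fintype ι'] [DecidableEq ι']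

/-- There is a smooth family of orthogonal complex structures of size `ι`, constant outside a compact
set, on which the `i`-th characteristic class does not integrate to zero. -/
def Charged {V : Type} [NormedAddCommGroup V] [NormedSpace ℝ V] [MeasurableSpace V] (μ : Measure V) (ℓ : 𝔸 →ₗ[ℂ] ℂ) (e : Option κ → 𝔸) (zz : Option κ → Option κ → Z)
    (b : κ → V) (i : ℕ) (ι : Type) [Fintype ι] [DecidableEq ι] : Prop :=
  ∃ α : V → Matrix ι ι ℝ, ContDiff ℝ ∞ α ∧ (∀ v, α v ∈ OCS ι) ∧
    (∃ K, IsCompact K ∧ ∃ J, ∀ v ∉ K, α v = J) ∧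
    formInt μ ℓ e (fun v => newton (fun k => chernForm zz (vDir b) (fun v => eigenProj (α v)) k v) i) ≠ 0

section
variable {γ : Type} [Fintype γ] [DecidableEq γ]
  {E : γ → Matrix ι ι ℝ} {El : Matrix ι ι ℝ}

theorem cliff_mem_OCS (hC : Cliff E El) (hE : ∀ c, (E c)ᵀ = -E c) (hEl : Elᵀ = -El) (u : γ → ℝ) (A B : ℝ)
    (h : A ^ 2 + (∑ c, u c * u c) * B ^ 2 = 1) : A • El + B • ∑ c, u c • E c ∈ OCS ι := by
  rw [mem_OCS]
  constructor
  · simp only [transpose_add, transpose_smul, transpose_sum, hE, hEl, smul_neg, sum_neg_distrib,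
      neg_add]
  · have h1 : El * (∑ c, u c • E c) = -((∑ c, u c • E c) * El) := hC.el_lin u
    have h2 : (∑ c, u c • E c) * (∑ c, u c • E c) = -((∑ c, u c * u c) • (1 : Matrix ι ι ℝ)) :=
      hC.lin_sq_of_half (w := 2⁻¹) (by norm_num) u
    rw [Matrix.add_mul, Matrix.mul_add, Matrix.mul_add, smul_mul_smul_comm, smul_mul_smul_comm,
      smul_mul_smul_comm, smul_mul_smul_comm, h1, h2, hC.sq, mul_comm B A, smul_neg, smul_neg, smul_neg,
      smul_smul]
    have h3 : (1 : Matrix ι ι ℝ) = (A ^ 2 + (∑ c, u c * u c) * B ^ 2) • 1 := by rw [h, one_smul]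
    conv_rhs => rw [h3]
    rw [add_smul, show (∑ c, u c * u c) * B ^ 2 = B * B * ∑ c, u c * u c by ring, sq]
    abel

theorem hasFDerivAt_cliff {A B : ℝ → ℝ} {u : γ → ℝ} {A' B' : ℝ} (hA : HasDerivAt A A' (∑ c, u c * u c))
    (hB : HasDerivAt B B' (∑ c, u c * u c)) :
    ∃ L : (γ → ℝ) →L[ℝ] Matrix ι ι ℝ,
      HasFDerivAt (fun u : γ → ℝ => A (∑ c, u c * u c) • El + B (∑ c, u c * u c) • ∑ c, u c • E c) L u ∧
      ∀ c, L (Pi.single c 1) = u c • ((2 * A') • El + (2 * B') • ∑ c, u c • E c) +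
        B (∑ c, u c * u c) • E c := by
  have hρ : HasFDerivAt (fun u : γ → ℝ => ∑ c, u c * u c)
      (∑ c, (2 * u c) • (ContinuousLinearMap.proj c : (γ → ℝ) →L[ℝ] ℝ)) u := by
    refine HasFDerivAt.fun_sum fun c _ => ?_
    have h1 := (ContinuousLinearMap.proj c : (γ → ℝ) →L[ℝ] ℝ).hasFDerivAt (x := u)
    rw [two_mul, add_smul]
    exact h1.mul h1
  have hU : HasFDerivAt (fun u : γ → ℝ => ∑ c, u c • E c)
      (∑ c, (ContinuousLinearMap.proj c : (γ → ℝ) →L[ℝ] ℝ).smulRight (E c)) u :=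
    HasFDerivAt.fun_sum fun c _ =>
      ((ContinuousLinearMap.proj c : (γ → ℝ) →L[ℝ] ℝ).hasFDerivAt (x := u)).smul_const (E c)
  have e1 := (HasDerivAt.comp_hasFDerivAt u hA hρ).smul_const El
  have e2 := HasFDerivAt.fun_smul (HasDerivAt.comp_hasFDerivAt u hB hρ) hU
  refine ⟨_, e1.add e2, fun c => ?_⟩
  have s1 : (∑ d, (2 * u d) • (ContinuousLinearMap.proj d : (γ → ℝ) →L[ℝ] ℝ)) (Pi.single c 1) = 2 * u c := by
    rw [ContinuousLinearMap.sum_apply, sum_eq_single c] <;> simp +contextual [Pi.single_apply]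
  have s2 : (∑ d, (ContinuousLinearMap.proj d : (γ → ℝ) →L[ℝ] ℝ).smulRight (E d)) (Pi.single c 1) = E c := by
    rw [ContinuousLinearMap.sum_apply, sum_eq_single c] <;> simp +contextual [Pi.single_apply]
  refine Eq.trans (b := (A' * (∑ d, (2 * u d) • (ContinuousLinearMap.proj d : (γ → ℝ) →L[ℝ] ℝ))
    (Pi.single c 1)) • El + (B (∑ c, u c * u c) • (∑ d, (ContinuousLinearMap.proj d :
      (γ → ℝ) →L[ℝ] ℝ).smulRight (E d)) (Pi.single c 1) + (B' * (∑ d, (2 * u d) •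
      (ContinuousLinearMap.proj d : (γ → ℝ) →L[ℝ] ℝ)) (Pi.single c 1)) • ∑ c, u c • E c)) rfl ?_
  rw [s1, s2]
  module

end

section
variable {i : ℕ} {e : Option κ → 𝔸} {zz : Option κ → Option κ → Z} {b : κ → Fin i × Bool → ℝ}
  {μ : Measure (Fin i × Bool → ℝ)} [μ.IsAddHaarMeasure] {ℓ : 𝔸 →ₗ[ℂ] ℂ} {g : Fin i × Bool → κ}

theorem OddGen.charged_clifford (h : OddGen e zz) (hi : Odd i) (hg : Function.Injective g)
    (hb : ∀ c, b (g c) = Pi.single c 1) (hb0 : ∀ a ∉ Set.range g, b a = 0)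
    (hℓ : ℓ (e none * algebraMap Z 𝔸 (∏ l, zz (some (g (l, false))) (some (g (l, true))))) ≠ 0)
    [Nonempty ι] {E : Fin i × Bool → Matrix ι ι ℝ}
    (hE : ∀ c d, E c * E d = -(E d * E c) - if c = d then 2 else 0) (hsq : ∀ c, E c * E c = -1)
    (ht : ∀ c, (E c)ᵀ = -E c) : Charged μ ℓ e zz b i ι := by
  obtain ⟨A, B, hA, hB, hAB, hAB1, hB0, hBp, hG, hG0⟩ := exists_profile
  set ρ : (Fin i × Bool → ℝ) → ℝ := fun u => ∑ c, u c * u c with hρ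
  have hρs : ContDiff ℝ ∞ ρ := by fun_prop
  have hρ0 : ∀ u, 0 ≤ ρ u := fun u => Finset.sum_nonneg fun c _ => mul_self_nonneg _
  set α : (Fin i × Bool → ℝ) → Matrix ι ι ℝ := fun u => A (ρ u) • volume E + B (ρ u) • ∑ c, u c • E c
    with hα
  have hαs : ContDiff ℝ ∞ α := by
    refine ((hA.comp hρs).smul contDiff_const).add ((hB.comp hρs).smul (ContDiff.sum fun c _ => ?_))
    exact (contDiff_apply ℝ ℝ c).smul contDiff_const
  have hC : Cliff E (volume E) := ⟨hE, volume_anti hE hsq hi, volume_sq hE hsq hi⟩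
  have hK : IsCompact {u | ρ u ≤ 1} := by
    refine Metric.isCompact_of_isClosed_isBounded (isClosed_le hρs.continuous continuous_const)
      (Metric.isBounded_closedBall (x := (0 : Fin i × Bool → ℝ)) (r := 1) |>.subset fun u hu => ?_)
    rw [mem_closedBall_zero_iff, pi_norm_le_iff_of_nonneg zero_le_one]
    intro c
    have h1 : u c * u c ≤ ρ u := single_le_sum (f := fun c => u c * u c)
      (fun c _ => mul_self_nonneg _) (Finset.mem_univ c)
    rw [Real.norm_eq_abs, ← sq_le_one_iff_abs_le_one, sq]
    exact h1.trans hu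
  refine ⟨α, hαs, fun u => cliff_mem_OCS hC ht (transpose_volume hi hE hsq ht) u _ _ (hAB _),
    ⟨_, hK, volume E, fun u hu => ?_⟩, ?_⟩
  · obtain ⟨h1, h2⟩ := hAB1 (ρ u) (not_le.1 hu).le
    simp [hα, h1, h2]
  set f : (Fin i × Bool → ℝ) → ℝ := fun u => B (ρ u) ^ (2 * i - 1) * (A (ρ u) * B (ρ u) + 2 * ρ u *
    (A (ρ u) * deriv B (ρ u) - deriv A (ρ u) * B (ρ u))) with hf
  have hfc : Continuous f := by
    have h1 := hA.continuous_deriv (by simp)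
    have h2 := hB.continuous_deriv (by simp)
    have h3 := hρs.continuous
    have h4 := hA.continuous
    have h5 := hB.continuous
    fun_prop
  have hi0 : 2 * i - 1 ≠ 0 := by obtain ⟨j, rfl⟩ := hi; omega
  have hfint : ∫ u, f u ∂μ ≠ 0 := by
    have h1 : 0 < ∫ u, -f u ∂μ := by
      refine Continuous.integral_pos_of_hasCompactSupport_nonneg_nonzero (x := 0) hfc.neg ?_ ?_ ?_
      · refine HasCompactSupport.intro hK fun u hu => ?_
        obtain ⟨-, h2⟩ := hAB1 (ρ u) (not_le.1 hu).le
        simp [hf, h2, hi0]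
      · intro u
        exact neg_nonneg.2 (mul_nonpos_of_nonneg_of_nonpos (pow_nonneg (hB0 _) _) (hG _ (hρ0 u)))
      · have : ρ 0 = 0 := by simp [hρ]
        simp only [hf, this]
        have := mul_neg_of_pos_of_neg (pow_pos hBp (2 * i - 1)) hG0
        simp only [mul_zero, zero_mul, add_zero]
        exact (neg_pos.2 this).ne'
    rw [integral_neg] at h1
    intro h2; simp [h2] at h1
  have hw : ∀ u, newton (fun k => chernForm zz (vDir b) (fun v => eigenProj (α v)) k u) i =
      (((i : ℂ)⁻¹ * (1 / 2) * (-1 / 4) ^ i * I * (2 * i).factorial * Fintype.card ι) * (f u : ℝ)) •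
      ∏ l, zz (some (g (l, false))) (some (g (l, true))) := fun u => by
    obtain ⟨L, hL, hL2⟩ := hasFDerivAt_cliff (E := E) (El := volume E) (u := u)
      (hA.differentiable (by simp) (ρ u)).hasDerivAt (hB.differentiable (by simp) (ρ u)).hasDerivAt
    have hLf : fderiv ℝ α u = L := hL.fderiv
    have h1 : ∀ k, chernForm zz (vDir b) (fun v => eigenProj (α v)) k u =
        chern (fun c d => zz (some (g c)) (some (g d))) (eigenProj (α u)) (fun c =>
      (-(I / 2)) • (u c • ((2 * deriv A (ρ u)) • volume E + (2 * deriv B (ρ u)) • ∑ c, u c • E c) +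
        B (ρ u) • E c).map ofRealHom) k := fun k => by
      rw [chernForm, chern_comp (g := fun c => some (g c)) ((Option.some_injective _).comp hg)]
      · congr 1; funext c
        rw [partials, fderiv_eigenProj (hαs.differentiable (by simp) u), hLf, ← hL2]
        simp only [vDir, Option.elim, hb]
      · intro a ha
        have : vDir b a = 0 := by
          cases a with
          | none => rfl
          | some a => exact hb0 a fun ⟨c, hc⟩ => ha ⟨c, by simp [hc]⟩
        rw [partials, this, map_zero]
    simp only [h1]
    exact (h.comp fun c => some (g c)).newton_clifford hi hE hsq u _ _ _ _
  rw [formInt]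
  simp only [hw, map_smul, smul_eq_mul]
  rw [integral_mul_const, integral_const_mul, integral_complex_ofReal]
  refine mul_ne_zero (mul_ne_zero ?_ (Complex.ofReal_ne_zero.2 hfint)) hℓ
  have hi1 : i ≠ 0 := by omega
  simp [hi1, Nat.factorial_ne_zero]

end

theorem conj_mem_OCS {S : Matrix ι' ι ℝ} (h1 : Sᵀ * S = 1) (h2 : S * Sᵀ = 1) {J : Matrix ι ι ℝ}
    (hJ : J ∈ OCS ι) : S * J * Sᵀ ∈ OCS ι' := by
  rw [mem_OCS] at hJ ⊢
  constructor
  · rw [transpose_mul, transpose_mul, transpose_transpose, hJ.1, Matrix.neg_mul, Matrix.mul_neg,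
      Matrix.mul_assoc]
  · rw [show S * J * Sᵀ * (S * J * Sᵀ) = S * (J * (Sᵀ * S) * J) * Sᵀ by simp only [Matrix.mul_assoc],
      h1, Matrix.mul_one, hJ.2, Matrix.mul_neg, Matrix.mul_one, Matrix.neg_mul, h2]

/-- The reflection in the hyperplane orthogonal to `w`. -/
noncomputable def reflection (w : ι → ℝ) : Matrix ι ι ℝ := 1 - (2 / (w ⬝ᵥ w)) • vecMulVec w w

theorem reflection_mulVec (w x : ι → ℝ) :
    reflection w *ᵥ x = x - (2 * (w ⬝ᵥ x) / (w ⬝ᵥ w)) • w := by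
  rw [reflection, sub_mulVec, one_mulVec, smul_mulVec, vecMulVec_mulVec]
  congr 1
  ext; simp; ring

theorem reflection_transpose (w : ι → ℝ) : (reflection w)ᵀ = reflection w := by
  rw [reflection, transpose_sub, transpose_one, transpose_smul, transpose_vecMulVec]

theorem reflection_mul_self (w : ι → ℝ) : reflection w * reflection w = 1 := by
  have h1 : vecMulVec w w * vecMulVec w w = (w ⬝ᵥ w) • vecMulVec w w := by
    rw [vecMulVec_mul_vecMulVec]; ext; simp [vecMulVec_apply]; ring
  rw [reflection, sub_mul, mul_sub, mul_sub, smul_mul_smul_comm, h1, smul_smul]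
  by_cases hw : w ⬝ᵥ w = 0
  · simp [hw]
  · rw [show 2 / (w ⬝ᵥ w) * (2 / (w ⬝ᵥ w)) * (w ⬝ᵥ w) = 2 / (w ⬝ᵥ w) + 2 / (w ⬝ᵥ w) by
      field_simp; ring, add_smul]
    simp

theorem reflection_of_orthogonal {w x : ι → ℝ} (h : w ⬝ᵥ x = 0) : reflection w *ᵥ x = x := by
  rw [reflection_mulVec, h]; simp

theorem reflection_sub {a b : ι → ℝ} (h : a ⬝ᵥ a = b ⬝ᵥ b) : reflection (a - b) *ᵥ a = b := by
  rw [reflection_mulVec]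
  have h1 : (a - b) ⬝ᵥ (a - b) = 2 * ((a - b) ⬝ᵥ a) := by
    simp only [sub_dotProduct, dotProduct_sub, ← h, dotProduct_comm a b]; ring
  rw [h1]
  by_cases h2 : (a - b) ⬝ᵥ a = 0
  · rw [h2, mul_zero, dotProduct_self_eq_zero] at h1
    rw [h1]; simpa using sub_eq_zero.1 h1
  · rw [div_self (by simpa using h2), one_smul, sub_sub_cancel]

theorem reflection_self {a : ι → ℝ} (h : a ⬝ᵥ a ≠ 0) : reflection a *ᵥ a = -a := by
  rw [reflection_mulVec, mul_div_assoc, div_self h, mul_one, two_smul, sub_add_cancel_left]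

theorem contDiff_reflection {X : Type} [NormedAddCommGroup X] [NormedSpace ℝ X] {w : X → ι → ℝ}
    (hw : ContDiff ℝ ∞ w) (h : ∀ x, w x ⬝ᵥ w x ≠ 0) : ContDiff ℝ ∞ fun x => reflection (w x) := by
  have hc : ∀ j, ContDiff ℝ ∞ fun x => w x j := fun j => contDiff_pi.1 hw j
  have hd : ContDiff ℝ ∞ fun x => w x ⬝ᵥ w x := ContDiff.sum fun j _ => (hc j).mul (hc j)
  refine contDiff_const.sub ((contDiff_const.div hd h).smul ?_)
  let L : (ι → ι → ℝ) →L[ℝ] Matrix ι ι ℝ :=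
    LinearMap.toContinuousLinearMap (Matrix.ofLinearEquiv ℝ : (ι → ι → ℝ) ≃ₗ[ℝ] Matrix ι ι ℝ).toLinearMap
  exact L.contDiff.comp (contDiff_pi.2 fun j => contDiff_pi.2 fun k => (hc j).mul (hc k))

section
variable {V : Type} [NormedAddCommGroup V] [NormedSpace ℝ V] {zz : κ → κ → Z} {β : κ → V}

theorem chern_conj {S : Matrix ι' ι ℂ} {T : Matrix ι ι' ℂ} (h : T * S = 1) (P : Matrix ι ι ℂ)
    (Q : κ → Matrix ι ι ℂ) (k : ℕ) :
    chern zz (S * P * T) (fun a => S * Q a * T) k = chern zz P Q k := by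
  set S' := S.map (algebraMap ℂ Z)
  set T' := T.map (algebraMap ℂ Z)
  have hTS : T' * S' = 1 := by
    refine (Matrix.map_mul).symm.trans ?_
    rw [h, Matrix.map_one _ (map_zero _) (map_one _)]
  have hm : ∀ N : Matrix ι ι ℂ, (S * N * T).map (algebraMap ℂ Z) = S' * N.map (algebraMap ℂ Z) * T' :=
    fun N => by rw [Matrix.map_mul, Matrix.map_mul]
  have hmm : ∀ M N : Matrix ι ι Z, S' * M * T' * (S' * N * T') = S' * (M * N) * T' := fun M N => by
    rw [show S' * M * T' * (S' * N * T') = S' * (M * (T' * S') * N) * T' by simp only [Matrix.mul_assoc],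
      hTS, Matrix.mul_one]
  have hc : curv zz (fun a => S * Q a * T) = S' * curv zz Q * T' := by
    simp only [curv, hm, hmm, Matrix.mul_sum, Matrix.sum_mul, Matrix.mul_smul, Matrix.smul_mul]
  have hp : ∀ (N : Matrix ι ι Z) k, S' * N * T' * (S' * curv zz Q * T') ^ k =
      S' * (N * curv zz Q ^ k) * T' := fun N k => by
    induction k with
    | zero => simp
    | succ k ih => rw [pow_succ, ← Matrix.mul_assoc, ih, hmm, pow_succ, Matrix.mul_assoc N]
  rw [chern, hc, hm, hp, trace_mul_comm, ← Matrix.mul_assoc, hTS, Matrix.one_mul]; rfl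

theorem chern_fromBlocks (P : Matrix ι ι ℂ) (R : Matrix ι' ι' ℂ) (Q : κ → Matrix ι ι ℂ) {k : ℕ} (hk : k ≠ 0) :
    chern zz (fromBlocks P 0 0 R) (fun a => fromBlocks (Q a) 0 0 0) k = chern zz P Q k := by
  have hm : ∀ N : Matrix ι ι ℂ, ∀ R : Matrix ι' ι' ℂ, (fromBlocks N 0 0 R).map (algebraMap ℂ Z) =
      fromBlocks (N.map (algebraMap ℂ Z)) 0 0 (R.map (algebraMap ℂ Z)) := fun N R => by
    rw [fromBlocks_map, Matrix.map_zero _ (map_zero _), Matrix.map_zero _ (map_zero _)]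
  have hs : ∀ (s : Finset κ) (f : κ → Matrix ι ι Z),
      ∑ a ∈ s, fromBlocks (f a) 0 0 (0 : Matrix ι' ι' Z) = fromBlocks (∑ a ∈ s, f a) 0 0 0 := fun s f => by
    induction s using Finset.cons_induction with
    | empty => simp
    | cons a s ha ih => rw [Finset.sum_cons, Finset.sum_cons, ih, fromBlocks_add]; simp
  have hc : curv zz (fun a => fromBlocks (Q a) 0 0 (0 : Matrix ι' ι' ℂ)) =
      fromBlocks (curv zz Q) 0 0 0 := by
    simp only [curv, hm, fromBlocks_multiply, fromBlocks_smul, ← hs]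
    simp
  have hp : ∀ k, (fromBlocks (curv zz Q) 0 0 (0 : Matrix ι' ι' Z)) ^ (k + 1) =
      fromBlocks (curv zz Q ^ (k + 1)) 0 0 0 := fun k => by
    induction k with
    | zero => simp
    | succ k ih => rw [pow_succ, ih, fromBlocks_multiply, pow_succ _ (k + 1)]; simp
  obtain ⟨k, rfl⟩ := Nat.exists_eq_succ_of_ne_zero hk
  rw [chern, hc, hm, hp, fromBlocks_multiply, chern]
  simp [trace, Fintype.sum_sum_type]

theorem eigenProj_conj {S : Matrix ι' ι ℝ} (h2 : S * Sᵀ = 1) (J : Matrix ι ι ℝ) :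
    eigenProj (S * J * Sᵀ) = S.map ofRealHom * eigenProj J * Sᵀ.map ofRealHom := by
  have h3 : S.map ofRealHom * Sᵀ.map ofRealHom = 1 := by
    refine (Matrix.map_mul).symm.trans ?_
    rw [h2, Matrix.map_one _ (map_zero _) (map_one _)]
  rw [eigenProj, eigenProj, Matrix.mul_smul, Matrix.smul_mul, Matrix.mul_sub, Matrix.sub_mul, Matrix.mul_one,
    h3, Matrix.mul_smul, Matrix.smul_mul, Matrix.map_mul, Matrix.map_mul]

theorem chernForm_conj {S : Matrix ι' ι ℝ} (h1 : Sᵀ * S = 1) (h2 : S * Sᵀ = 1) {α : V → Matrix ι ι ℝ}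
    (hα : ContDiff ℝ ∞ α) (k : ℕ) (v : V) :
    chernForm zz β (fun v => eigenProj (S * α v * Sᵀ)) k v = chernForm zz β (fun v => eigenProj (α v)) k v := by
  have h3 : Sᵀ.map ofRealHom * S.map ofRealHom = 1 := by
    refine (Matrix.map_mul).symm.trans ?_
    rw [h1, Matrix.map_one _ (map_zero _) (map_one _)]
  let L : Matrix ι ι ℝ →L[ℝ] Matrix ι' ι' ℝ := LinearMap.toContinuousLinearMap
    { toFun := fun N => S * N * Sᵀ
      map_add' := fun M N => by rw [Matrix.mul_add, Matrix.add_mul]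
      map_smul' := fun r N => by simp }
  have hd := hα.differentiable (by simp) v
  have hd2 : HasFDerivAt (fun v => S * α v * Sᵀ) (L.comp (fderiv ℝ α v)) v :=
    L.hasFDerivAt.comp v hd.hasFDerivAt
  rw [chernForm, chernForm, eigenProj_conj h2, ← chern_conj h3]
  congr 1
  funext a
  rw [partials, partials, fderiv_eigenProj hd2.differentiableAt, fderiv_eigenProj hd, hd2.fderiv,
    Matrix.mul_smul, Matrix.smul_mul, ← Matrix.map_mul, ← Matrix.map_mul]
  rfl

theorem eigenProj_fromBlocks (J : Matrix ι ι ℝ) (R : Matrix ι' ι' ℝ) :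
    eigenProj (fromBlocks J 0 0 R) = fromBlocks (eigenProj J) 0 0 (eigenProj R) := by
  ext (x | x) (y | y) <;> simp [eigenProj, Matrix.one_apply]

theorem chernForm_fromBlocks {α : V → Matrix ι ι ℝ} (hα : ContDiff ℝ ∞ α) (R : Matrix ι' ι' ℝ) {k : ℕ}
    (hk : k ≠ 0) (v : V) : chernForm zz β (fun v => eigenProj (fromBlocks (α v) 0 0 R)) k v =
      chernForm zz β (fun v => eigenProj (α v)) k v := by
  let L : Matrix ι ι ℝ →L[ℝ] Matrix (ι ⊕ ι') (ι ⊕ ι') ℝ := LinearMap.toContinuousLinearMap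
    { toFun := fun N => fromBlocks N 0 0 0
      map_add' := fun M N => by rw [fromBlocks_add]; simp
      map_smul' := fun r N => by rw [fromBlocks_smul]; simp }
  have hd := hα.differentiable (by simp) v
  have hd2 : HasFDerivAt (fun v => fromBlocks (α v) 0 0 R) (L.comp (fderiv ℝ α v)) v := by
    have h1 : (fun v => fromBlocks (α v) 0 0 R) = fun v => L (α v) + fromBlocks 0 0 0 R := by
      funext v
      change _ = fromBlocks (α v) 0 0 0 + _
      rw [fromBlocks_add]; simp
    rw [h1]
    exact (L.hasFDerivAt.comp v hd.hasFDerivAt).add_const _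
  rw [chernForm, chernForm, eigenProj_fromBlocks, ← chern_fromBlocks (eigenProj (α v)) (eigenProj R) (partials (fun v => eigenProj (α v)) β v) hk]
  congr 1
  funext a
  rw [partials, partials, fderiv_eigenProj hd2.differentiableAt, fderiv_eigenProj hd, hd2.fderiv]
  change _ • (fromBlocks _ 0 0 0).map _ = _
  rw [fromBlocks_map, fromBlocks_smul]
  simp

end

theorem eq_fromBlocks_of_OCS {M : Matrix (ι ⊕ Fin 2) (ι ⊕ Fin 2) ℝ} (hM : M ∈ OCS (ι ⊕ Fin 2))
    (h : M *ᵥ Pi.single (Sum.inr 0) 1 = Pi.single (Sum.inr 1) 1) :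
    M = fromBlocks M.toBlocks₁₁ 0 0 !![0, -1; 1, 0] ∧ M.toBlocks₁₁ ∈ OCS ι := by
  obtain ⟨h1, h2⟩ := mem_OCS.1 hM
  have h3 : M *ᵥ Pi.single (Sum.inr 1) 1 = -Pi.single (Sum.inr 0) 1 := by
    rw [← h, mulVec_mulVec, h2, neg_mulVec, one_mulVec]
  rw [mulVec_single_one] at h h3
  have c0 : ∀ x, M x (Sum.inr 0) = (Pi.single (Sum.inr 1) 1 : ι ⊕ Fin 2 → ℝ) x := fun x => congrFun h x
  have c1 : ∀ x, M x (Sum.inr 1) = (-Pi.single (Sum.inr 0) 1 : ι ⊕ Fin 2 → ℝ) x := fun x => congrFun h3 x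
  have hs : ∀ x y, M x y = -M y x := fun x y => congrFun (congrFun h1 y) x
  have h12 : ∀ x (y : Fin 2), M (Sum.inl x) (Sum.inr y) = 0 := fun x y => by
    fin_cases y
    · exact (c0 _).trans (by simp)
    · exact (c1 _).trans (by simp)
  have hb : M = fromBlocks M.toBlocks₁₁ 0 0 !![0, -1; 1, 0] := by
    ext (x | x) (y | y)
    · rfl
    · exact h12 x y
    · rw [hs, h12]; simp
    · fin_cases x <;> fin_cases y
      · exact (c0 _).trans (by simp)
      · exact (c1 _).trans (by simp)
      · exact (c0 _).trans (by simp)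
      · exact (c1 _).trans (by simp)
  refine ⟨hb, mem_OCS.2 ⟨?_, ?_⟩⟩
  · ext x y; exact congrFun (congrFun h1 (Sum.inl x)) (Sum.inl y)
  · rw [hb, fromBlocks_multiply, ← fromBlocks_one, fromBlocks_neg, fromBlocks_inj] at h2
    simpa using h2.1

theorem OCS_mulVec_dotProduct {M : Matrix ι ι ℝ} (hM : M ∈ OCS ι) (x : ι → ℝ) :
    (M *ᵥ x) ⬝ᵥ (M *ᵥ x) = x ⬝ᵥ x := by
  rw [dotProduct_mulVec, vecMul_mulVec, hM.1, vecMul_one]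

theorem OCS_mulVec_orthogonal {M : Matrix ι ι ℝ} (hM : M ∈ OCS ι) (x : ι → ℝ) :
    (M *ᵥ x) ⬝ᵥ x = 0 := by
  have h1 : (M *ᵥ x) ⬝ᵥ x = -((M *ᵥ x) ⬝ᵥ x) := by
    conv_lhs => rw [dotProduct_comm, dotProduct_mulVec, ← mulVec_transpose, (mem_OCS.1 hM).1,
      neg_mulVec, neg_dotProduct]
  linarith

section
variable {V : Type} [NormedAddCommGroup V] [NormedSpace ℝ V] [FiniteDimensional ℝ V]

theorem exists_unit_avoiding {v : V → ι → ℝ} (hv : ContDiff ℝ ∞ v) {f : ι → ℝ} (hf : f ⬝ᵥ f = 1)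
    (hd : Module.finrank ℝ V + 2 < Fintype.card ι) (hvf : ∀ x, v x ⬝ᵥ f = 0) :
    ∃ q : ι → ℝ, q ⬝ᵥ q = 1 ∧ q ⬝ᵥ f = 0 ∧ ∀ x, v x ≠ q := by
  let F : (ℝ × ℝ) × V → ι → ℝ := fun y => y.1.1 • v y.2 + y.1.2 • f
  have hF : ContDiff ℝ 1 F := by
    refine ContDiff.add ?_ ?_
    · exact (contDiff_fst.comp contDiff_fst).smul ((hv.of_le (by simp)).comp contDiff_snd)
    · exact (contDiff_snd.comp contDiff_fst).smul contDiff_const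
  obtain ⟨p, hp⟩ := (hF.dense_compl_range_of_finrank_lt_finrank (by simp; omega)).nonempty
  have hp' : ∀ a b x, a • v x + b • f ≠ p := fun a b x h => hp ⟨((a, b), x), h⟩
  set y := p - (p ⬝ᵥ f) • f with hy
  have hyf : y ⬝ᵥ f = 0 := by simp [hy, sub_dotProduct, hf]
  have hy0 : y ≠ 0 := fun h => hp' 0 (p ⬝ᵥ f) 0 (by
    rw [zero_smul, zero_add]; exact (sub_eq_zero.1 h).symm)
  have hyy : 0 < y ⬝ᵥ y := lt_of_le_of_ne (Finset.sum_nonneg fun j _ => mul_self_nonneg (y j))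
    fun h => hy0 (dotProduct_self_eq_zero.1 h.symm)
  have hs := Real.mul_self_sqrt hyy.le
  have hs0 := (Real.sqrt_pos.2 hyy).ne'
  refine ⟨(√(y ⬝ᵥ y))⁻¹ • y, ?_, by simp [hyf], fun x hx => hp' (√(y ⬝ᵥ y)) (p ⬝ᵥ f) x ?_⟩
  · rw [smul_dotProduct, dotProduct_smul, smul_eq_mul, smul_eq_mul]
    nth_rw 3 [← hs]
    field_simp
  · rw [hx, smul_smul, mul_inv_cancel₀ hs0, one_smul, hy, sub_add_cancel]

variable [MeasurableSpace V] [BorelSpace V]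
  {i : ℕ} {e : Option κ → 𝔸} {zz : Option κ → Option κ → Z} {b : κ → V}
  {μ : Measure V} [μ.IsAddHaarMeasure] {ℓ : 𝔸 →ₗ[ℂ] ℂ}

theorem Charged.conj (h : Charged μ ℓ e zz b i ι) {S : Matrix ι' ι ℝ} (h1 : Sᵀ * S = 1) (h2 : S * Sᵀ = 1) :
    Charged μ ℓ e zz b i ι' := by
  obtain ⟨α, ha, hO, ⟨K, hK, J, hJ⟩, hc⟩ := h
  let L : Matrix ι ι ℝ →L[ℝ] Matrix ι' ι' ℝ := LinearMap.toContinuousLinearMap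
    { toFun := fun N => S * N * Sᵀ
      map_add' := fun M N => by rw [Matrix.mul_add, Matrix.add_mul]
      map_smul' := fun r N => by simp }
  refine ⟨fun v => S * α v * Sᵀ, L.contDiff.comp ha, fun v => conj_mem_OCS h1 h2 (hO v),
    ⟨K, hK, S * J * Sᵀ, fun v hv => congrArg (fun N => S * N * Sᵀ) (hJ v hv)⟩, ?_⟩
  simpa only [chernForm_conj h1 h2 ha] using hc

theorem OddGen.charged_compress (h : OddGen e zz) (hi : i ≠ 0) (hd : Module.finrank ℝ V < Fintype.card ι)
    (hc : Charged μ ℓ e zz b i (ι ⊕ Fin 2)) : Charged μ ℓ e zz b i ι := by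
  obtain ⟨α, ha, hO, ⟨K, hK, J, hJ⟩, hc⟩ := hc
  set f : ι ⊕ Fin 2 → ℝ := Pi.single (Sum.inr 0) 1 with hf
  set f' : ι ⊕ Fin 2 → ℝ := Pi.single (Sum.inr 1) 1 with hf'
  have hff : f ⬝ᵥ f = 1 := by simp [hf]
  have hff' : f' ⬝ᵥ f' = 1 := by simp [hf']
  have hfo : f' ⬝ᵥ f = 0 := by simp [hf, hf']
  let E : Matrix (ι ⊕ Fin 2) (ι ⊕ Fin 2) ℝ →L[ℝ] (ι ⊕ Fin 2 → ℝ) := LinearMap.toContinuousLinearMap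
    { toFun := fun N => N *ᵥ f
      map_add' := fun M N => by rw [Matrix.add_mulVec]
      map_smul' := fun r N => by rw [Matrix.smul_mulVec, RingHom.id_apply] }
  set v : V → ι ⊕ Fin 2 → ℝ := fun x => α x *ᵥ f with hv
  have hvs : ContDiff ℝ ∞ v := E.contDiff.comp ha
  have hvv : ∀ x, v x ⬝ᵥ v x = 1 := fun x => (OCS_mulVec_dotProduct (hO x) f).trans hff
  have hvf : ∀ x, v x ⬝ᵥ f = 0 := fun x => OCS_mulVec_orthogonal (hO x) f
  obtain ⟨q, hqq, hqf, hqv⟩ := exists_unit_avoiding hvs hff (by simpa using hd) hvf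
  set w : V × ℝ → ι ⊕ Fin 2 → ℝ := fun y => v y.1 - smoothTransition y.2 • q with hw
  have hws : ContDiff ℝ ∞ w := (hvs.comp contDiff_fst).sub
    (((smoothTransition.contDiff (n := ⊤)).comp contDiff_snd).smul contDiff_const)
  have hw0 : ∀ y, w y ⬝ᵥ w y ≠ 0 := fun y h0 => by
    have h1 := sub_eq_zero.1 (dotProduct_self_eq_zero.1 h0)
    have h2 := hvv y.1
    rw [h1, smul_dotProduct, dotProduct_smul, hqq, smul_eq_mul, smul_eq_mul, mul_one] at h2
    have h3 : smoothTransition y.2 = 1 := by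
      nlinarith [smoothTransition.nonneg y.2]
    rw [h3, one_smul] at h1
    exact hqv _ h1
  have hwf : ∀ y, w y ⬝ᵥ f = 0 := fun y => by simp [hw, sub_dotProduct, hvf, hqf]
  set G : V × ℝ → Matrix (ι ⊕ Fin 2) (ι ⊕ Fin 2) ℝ := fun y => reflection (w y) * reflection (v y.1) with hG
  have hGs : ContDiff ℝ ∞ G := (contDiff_reflection hws hw0).mul
    (contDiff_reflection (hvs.comp contDiff_fst) fun x => by simp [hvv])
  have hGt : ∀ y, (G y)ᵀ = reflection (v y.1) * reflection (w y) := fun y => by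
    rw [hG]; simp only [transpose_mul, reflection_transpose]
  have hG1 : ∀ y, (G y)ᵀ * G y = 1 := fun y => by
    rw [hGt, hG]
    simp only [mul_assoc]
    rw [← mul_assoc (reflection (w y)), reflection_mul_self, one_mul, reflection_mul_self]
  have hG2 : ∀ y, G y * (G y)ᵀ = 1 := fun y => mul_eq_one_comm.1 (hG1 y)
  set A : V × ℝ → Matrix (ι ⊕ Fin 2) (ι ⊕ Fin 2) ℝ := fun y => G y * α y.1 * (G y)ᵀ with hA
  have hAs : ContDiff ℝ ∞ A := by
    have h1 : A = fun y => G y * α y.1 * (reflection (v y.1) * reflection (w y)) := by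
      funext y; rw [hA]; simp only [hGt]
    rw [h1]
    exact (hGs.mul (ha.comp contDiff_fst)).mul ((contDiff_reflection (hvs.comp contDiff_fst)
      fun x => by simp [hvv]).mul (contDiff_reflection hws hw0))
  have hAO : ∀ y, A y ∈ OCS (ι ⊕ Fin 2) := fun y => conj_mem_OCS (hG1 y) (hG2 y) (hO y.1)
  have hA0 : ∀ x, A (x, 0) = α x := fun x => by
    have : G (x, 0) = 1 := by simp [hG, hw, reflection_mul_self]
    simp [hA, this]
  have hAf : ∀ x, A (x, 1) *ᵥ f = -q := fun x => by
    have h1 : reflection (w (x, 1)) *ᵥ v x = q := by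
      rw [hw]; simp only [smoothTransition.one, one_smul]
      exact reflection_sub ((hvv x).trans hqq.symm)
    rw [hA]
    simp only [hGt, ← mulVec_mulVec]
    rw [reflection_of_orthogonal (hwf _), reflection_of_orthogonal (hvf _)]
    change G (x, 1) *ᵥ v x = _
    rw [hG]
    simp only [← mulVec_mulVec]
    rw [reflection_self (by simp [hvv]), mulVec_neg, h1]
  have hAK : ∀ t, ∀ x ∉ K, ∀ y ∉ K, A (x, t) = A (y, t) := fun t x hx y hy => by
    simp only [hA, hG, hw, hv, hJ x hx, hJ y hy]
  have hI := h.formInt_newton_homotopy (μ := μ) (ℓ := ℓ) (b := b) (α := Unit)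
    (P := fun _ y => eigenProj (A y)) (fun _ => contDiff_eigenProj hAs)
    (fun _ y => eigenProj_mul_self (hAO y)) hK (fun _ x hx s => by
      have h1 : (fun x => eigenProj (A (x, s))) =ᶠ[𝓝 x] fun _ => eigenProj (A (x, s)) := by
        filter_upwards [hK.isClosed.isOpen_compl.mem_nhds hx] with y hy
        rw [hAK s y hy x hx]
      rw [h1.fderiv_eq]; simp) hi 0 1
  simp only [Finset.univ_unique, Finset.sum_singleton, hA0] at hI
  rw [hI] at hc
  set C := reflection (-q - f') with hC
  have hC1 : Cᵀ * C = 1 := by rw [hC, reflection_transpose, reflection_mul_self]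
  have hC2 : C * Cᵀ = 1 := by rw [hC, reflection_transpose, reflection_mul_self]
  have hAs1 : ContDiff ℝ ∞ fun x => A (x, 1) := hAs.comp (contDiff_id.prodMk contDiff_const)
  let L : Matrix (ι ⊕ Fin 2) (ι ⊕ Fin 2) ℝ →L[ℝ] Matrix ι ι ℝ := LinearMap.toContinuousLinearMap
    { toFun := fun N => (C * N * Cᵀ).toBlocks₁₁
      map_add' := fun M N => by rw [Matrix.mul_add, Matrix.add_mul]; rfl
      map_smul' := fun r N => by rw [Matrix.mul_smul, Matrix.smul_mul]; rfl }
  have hB := fun x => eq_fromBlocks_of_OCS (conj_mem_OCS hC1 hC2 (hAO (x, 1))) (by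
    rw [← mulVec_mulVec, hC, reflection_transpose, reflection_of_orthogonal (by
      rw [sub_dotProduct, neg_dotProduct, hqf, hfo]; simp), ← mulVec_mulVec, hAf]
    exact reflection_sub (by simp [hqq, hff']))
  have hLs : ContDiff ℝ ∞ fun x => L (A (x, 1)) := L.contDiff.comp hAs1
  refine ⟨fun x => L (A (x, 1)), hLs, fun x => (hB x).2, ⟨K, hK, ?_⟩, ?_⟩
  · by_cases hK : ∃ y, y ∉ K
    · obtain ⟨y, hy⟩ := hK
      exact ⟨L (A (y, 1)), fun x hx => congrArg L (hAK 1 x hx y hy)⟩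
    · push Not at hK
      exact ⟨0, fun x hx => absurd (hK x) hx⟩
  · have h1 : ∀ k, k ≠ 0 → ∀ x, chernForm zz (vDir b) (fun x => eigenProj (A (x, 1))) k x =
        chernForm zz (vDir b) (fun x => eigenProj (L (A (x, 1)))) k x := fun k hk x => by
      rw [← chernForm_conj hC1 hC2 hAs1, ← chernForm_fromBlocks hLs !![0, -1; 1, 0] hk]
      congr 1
      funext x
      exact congrArg _ (hB x).1
    have h2 : ∀ x, newton (fun k => chernForm zz (vDir b) (fun x => eigenProj (A (x, 1))) k x) i =
        newton (fun k => chernForm zz (vDir b) (fun x => eigenProj (L (A (x, 1)))) k x) i := fun x =>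
      newton_congr _ _ _ fun k hk _ => h1 k (by omega) x
    simpa only [h2] using hc

theorem Charged.reindex (h : Charged μ ℓ e zz b i ι) (σ : ι ≃ ι') : Charged μ ℓ e zz b i ι' := by
  refine h.conj (S := (1 : Matrix ι' ι' ℝ).submatrix id σ) ?_ ?_
  · rw [transpose_submatrix, transpose_one, ← submatrix_mul _ _ _ _ _ Function.bijective_id, one_mul,
      submatrix_one_equiv]
  · rw [transpose_submatrix, transpose_one, submatrix_mul_equiv, one_mul, submatrix_id_id]

theorem OddGen.charged_descend (h : OddGen e zz) (hi : i ≠ 0) {d : ℕ} (hd : Module.finrank ℝ V < d) (k : ℕ)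
    (hc : Charged μ ℓ e zz b i (Fin (d + 2 * k))) : Charged μ ℓ e zz b i (Fin d) := by
  induction k with
  | zero => exact hc
  | succ k ih => exact ih (h.charged_compress hi (by simp; omega) (hc.reindex ((finCongr (by ring)).trans
      (finSumFinEquiv (m := d + 2 * k) (n := 2)).symm)))

end

section
variable {i : ℕ} {e : Option κ → 𝔸} {zz : Option κ → Option κ → Z} {b : κ → Fin i × Bool → ℝ}
  {μ : Measure (Fin i × Bool → ℝ)} [μ.IsAddHaarMeasure] {ℓ : 𝔸 →ₗ[ℂ] ℂ} {g : Fin i × Bool → κ}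

theorem exists_conj_J0 {m : ℕ} {J : OCMat m} (hJ : J ∈ OCS (Fin m ⊕ Fin m)) :
    ∃ S : OCMat m, Sᵀ * S = 1 ∧ S * Sᵀ = 1 ∧ S * J * Sᵀ = J0 m := by
  have hP := eigenProj_mul_self hJ
  obtain ⟨t, A, B, hAB, hBA⟩ := exists_factor_of_idempotent hP
  have ht : t = m := by
    have h1 : trace (A * B) = trace (B * A) := trace_mul_comm A B
    rw [hAB, hBA, trace_eigenProj hJ] at h1
    simpa using h1.symm
  subst ht
  obtain ⟨g, -, hg, hgJ⟩ := exists_orthogonal_of_trivial (Y := Unit) (J := fun _ => J) (fun _ => hJ)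
    ⟨fun _ => hP, fun _ => one_mul _, fun _ => A, fun _ => B, continuous_const, continuous_const, fun _ => hAB,
      fun _ => hBA⟩
  have h1 := hg ()
  have h2 := mul_eq_one_comm.1 h1
  refine ⟨(g ())ᵀ, by rw [transpose_transpose, h2], by rw [transpose_transpose, h1], ?_⟩
  rw [transpose_transpose, hgJ (), mul_assoc, mul_assoc, mul_assoc, h1, mul_one,
    ← mul_assoc, h1, one_mul]
  rfl

theorem OddGen.exists_charged (h : OddGen e zz) (hi : Odd i) (hg : Function.Injective g)
    (hb : ∀ c, b (g c) = Pi.single c 1) (hb0 : ∀ a ∉ Set.range g, b a = 0)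
    (hℓ : ℓ (e none * algebraMap Z 𝔸 (∏ l, zz (some (g (l, false))) (some (g (l, true))))) ≠ 0)
    {m : ℕ} (hm : i < m) : ∃ α : (Fin i × Bool → ℝ) → OCMat m,
      ContDiff ℝ ∞ α ∧ (∀ v, α v ∈ OCS (Fin m ⊕ Fin m)) ∧ (∃ K, IsCompact K ∧ ∀ v ∉ K, α v = J0 m) ∧
      formInt μ ℓ e (fun v => newton (fun k => chernForm zz (vDir b) (fun v => eigenProj (α v)) k v) i) ≠ 0 := by
  have hi0 := hi.pos
  obtain ⟨ι, _, _, E, hcard, ht, hsq, hE⟩ := exists_clifford (2 * m) (i * 2)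
  let τ : Fin i × Bool ≃ Fin (i * 2) := ((Equiv.refl _).prodCongr finTwoEquiv.symm).trans finProdFinEquiv
  obtain ⟨k, hk⟩ : ∃ k, 2 ^ (i * 2) * (2 * m) = m + m + 2 * k :=
    ⟨(2 ^ (i * 2) - 1) * m, by
      obtain ⟨c, hc⟩ := Nat.exists_eq_add_of_le' (Nat.one_le_two_pow (n := i * 2))
      rw [hc, Nat.add_sub_cancel]; ring⟩
  have : Nonempty ι := Fintype.card_pos_iff.1 (by rw [hcard, hk]; omega)
  have h1 : Charged μ ℓ e zz b i ι := h.charged_clifford hi hg hb hb0 hℓ (E := fun c => E (τ c))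
    (fun c d => by simpa using hE (τ c) (τ d)) (fun c => hsq _) fun c => ht _
  have h2 := h.charged_descend hi0.ne' (d := m + m) (by simp; omega) k
    (h1.reindex (Fintype.equivFinOfCardEq (hcard.trans hk)))
  obtain ⟨α, ha, hO, ⟨K, hK, J, hJ⟩, hc⟩ := h2.reindex finSumFinEquiv.symm
  have : Nonempty (Fin i × Bool) := ⟨(⟨0, hi0⟩, false)⟩
  obtain ⟨v, hv⟩ : ∃ v, v ∉ K := by
    by_contra! h3
    exact noncompact_univ (Fin i × Bool → ℝ) (by rwa [← Set.eq_univ_of_forall h3])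
  obtain ⟨S, h3, h4, h5⟩ := exists_conj_J0 (hJ v hv ▸ hO v)
  let L : OCMat m →L[ℝ] OCMat m :=
    LinearMap.toContinuousLinearMap
    { toFun := fun N => S * N * Sᵀ
      map_add' := fun M N => by rw [Matrix.mul_add, Matrix.add_mul]
      map_smul' := fun r N => by simp }
  refine ⟨fun v => S * α v * Sᵀ, L.contDiff.comp ha, fun v => conj_mem_OCS h3 h4 (hO v),
    ⟨K, hK, fun v hv => (congrArg (fun N => S * N * Sᵀ) (hJ v hv)).trans h5⟩, ?_⟩
  simpa only [chernForm_conj h3 h4 ha] using hc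

end

variable {X : Type} [NormedAddCommGroup X] [NormedSpace ℝ X] {zz : κ → κ → Z} {β : κ → X}

theorem chernForm_congr {P P' : X → Matrix ι ι ℂ} {x : X} (h : P =ᶠ[𝓝 x] P') (k : ℕ) :
    chernForm zz β P k x = chernForm zz β P' k x := by
  have h1 : partials P β x = partials P' β x := by
    funext a; rw [partials, partials, h.fderiv_eq]
  rw [chernForm, chernForm, h.eq_of_nhds, h1]

/-- `A` is locally constant at `x`, with value `J`. -/
def LocEq (A : X → Matrix ι ι ℝ) (J : Matrix ι ι ℝ) (x : X) : Prop := A =ᶠ[𝓝 x] fun _ => J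

theorem LocEq.comp {Y : Type} [TopologicalSpace Y] {A : X → Matrix ι ι ℝ} {J : Matrix ι ι ℝ} {T : Y → X} {y : Y}
    (h : LocEq A J (T y)) (hT : ContinuousAt T y) : (fun y => A (T y)) =ᶠ[𝓝 y] fun _ => J :=
  hT.eventually h

theorem LocEq.chernForm_eq_zero {A : X → Matrix ι ι ℝ} {J : Matrix ι ι ℝ} {x : X} (h : LocEq A J x) {k : ℕ}
    (hk : k ≠ 0) : chernForm zz β (fun x => eigenProj (A x)) k x = 0 := by
  rw [chernForm_congr (h.mono fun y hy => congrArg eigenProj hy : _ =ᶠ[𝓝 x] fun _ => eigenProj J)]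
  have h1 : partials (fun _ : X => eigenProj J) β x = 0 := by funext a; simp [partials]
  rw [chernForm, h1, chern]
  have h2 : curv zz (0 : κ → Matrix ι ι ℂ) = 0 := by simp [curv]
  rw [h2, zero_pow hk, Matrix.mul_zero, trace_zero]

theorem chernForm_add_sub {A B : X → Matrix ι ι ℝ} {J : Matrix ι ι ℝ} {x : X} (h : LocEq A J x ∨ LocEq B J x)
    {k : ℕ} (hk : k ≠ 0) : chernForm zz β (fun x => eigenProj (A x + B x - J)) k x =
      chernForm zz β (fun x => eigenProj (A x)) k x + chernForm zz β (fun x => eigenProj (B x)) k x := by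
  rcases h with h | h
  · rw [h.chernForm_eq_zero hk, zero_add]
    exact chernForm_congr (h.mono fun y hy => by rw [hy, add_sub_cancel_left]) k
  · rw [h.chernForm_eq_zero hk, add_zero]
    exact chernForm_congr (h.mono fun y hy => by rw [hy, add_sub_cancel_right]) k

theorem add_sub_mem_OCS {A B J : Matrix ι ι ℝ} (hA : A ∈ OCS ι) (hB : B ∈ OCS ι) (h : A = J ∨ B = J) :
    A + B - J ∈ OCS ι := by
  rcases h with rfl | rfl
  · rwa [add_sub_cancel_left]
  · rwa [add_sub_cancel_right]

variable {m : ℕ}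

theorem newton_eigenProj_eq_zero {A : X → OCMat m} (hA : ContDiff ℝ ∞ A)
    (hO : ∀ x, A x ∈ OCS (Fin m ⊕ Fin m)) {r : ℕ} (hr : m < r) (x : X) :
    newton (fun k => chernForm zz β (fun x => eigenProj (A x)) k x) r = 0 := by
  have hP := eigenProj_mul_self (hO x)
  obtain ⟨t, F, G, hFG, hGF⟩ := exists_factor_of_idempotent hP
  have ht : t = m := by
    have h1 : trace (F * G) = trace (G * F) := trace_mul_comm F G
    rw [hFG, hGF, trace_eigenProj (hO x)] at h1
    simpa using h1.symm
  exact newton_chern_eq_zero (isTangent (contDiff_eigenProj hA) (fun x => eigenProj_mul_self (hO x)) x) F G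
    hFG hGF r (by simpa [ht] using hr)

theorem newton_sum_eq_zero_of_locEq {A : Fin 2 → X → Matrix ι ι ℝ} {J : Matrix ι ι ℝ} {x : X}
    (h : ∀ a, LocEq (A a) J x) {r : ℕ} (hr : r ≠ 0) :
    newton (fun k => ∑ a, chernForm zz β (fun x => eigenProj (A a x)) k x) r = 0 :=
  newton_zero_of_pos hr fun k hk _ => sum_eq_zero fun a _ => (h a).chernForm_eq_zero (by omega)

theorem newton_sum_eq_zero_of_or {A : Fin 2 → X → OCMat m}
    (hA : ∀ a, ContDiff ℝ ∞ (A a)) (hO : ∀ a x, A a x ∈ OCS (Fin m ⊕ Fin m))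
    {J : OCMat m} {x : X}
    (h : LocEq (A 0) J x ∨ LocEq (A 1) J x) {r : ℕ} (hr : m < r) :
    newton (fun k => ∑ a, chernForm zz β (fun x => eigenProj (A a x)) k x) r = 0 := by
  rcases h with h | h
  · rw [← newton_eigenProj_eq_zero (zz := zz) (β := β) (hA 1) (hO 1) hr x]
    refine newton_congr _ _ _ fun k hk _ => ?_
    rw [Fin.sum_univ_two, h.chernForm_eq_zero (by omega), zero_add]
  · rw [← newton_eigenProj_eq_zero (zz := zz) (β := β) (hA 0) (hO 0) hr x]
    refine newton_congr _ _ _ fun k hk _ => ?_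
    rw [Fin.sum_univ_two, h.chernForm_eq_zero (by omega), add_zero]

end

/-- The open unit cube. -/
def cube : Set (Fin 6 → ℝ) := {v | ∀ i, 0 < v i ∧ v i < 1}

/-- The affine stretching of the first coordinate by the factor `1 + σ`, fixing `c`. -/
def slide (c σ : ℝ) (v : Fin 6 → ℝ) : Fin 6 → ℝ := v + (σ * (v 0 - c)) • Pi.single 0 1

theorem slide_zero (c σ : ℝ) (v : Fin 6 → ℝ) : slide c σ v 0 = v 0 + σ * (v 0 - c) := by simp [slide]

theorem slide_of_ne (c σ : ℝ) (v : Fin 6 → ℝ) {i : Fin 6} (hi : i ≠ 0) : slide c σ v i = v i := by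
  simp [slide, hi]

theorem mem_cube_of_slide {c σ : ℝ} (hc : 0 ≤ c) (hc1 : c ≤ 1) (hσ : 0 ≤ σ) {v : Fin 6 → ℝ}
    (h : slide c σ v ∈ cube) : v ∈ cube := fun i => by
  by_cases hi : i = 0
  · subst hi
    have h1 := h 0
    rw [slide_zero] at h1
    constructor <;> by_contra! h2 <;> nlinarith [mul_nonneg hσ hc, mul_nonneg hσ (sub_nonneg.2 hc1)]
  · have h1 := h i
    rwa [slide_of_ne c σ v hi] at h1

theorem slide_disjoint {v : Fin 6 → ℝ} (h : slide 0 1 v ∈ cube) : slide 1 1 v ∉ cube := fun h' => by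
  have h1 := (h 0).2
  have h2 := (h' 0).1
  rw [slide_zero] at h1 h2
  linarith

section
variable {Z 𝔸 κ V W : Type} [NormedCommRing Z] [NormedAlgebra ℂ Z] [FiniteDimensional ℂ Z]
  [Algebra ℚ Z] [Ring 𝔸] [Algebra Z 𝔸] [Algebra ℂ 𝔸] [IsScalarTower ℂ Z 𝔸] [Fintype κ]
  [NormedAddCommGroup V] [NormedSpace ℝ V] [NormedAddCommGroup W] [NormedSpace ℝ W] {m : ℕ}
  [FiniteDimensional ℝ V] [MeasurableSpace V] [BorelSpace V] {μ : Measure V}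
  [μ.IsAddHaarMeasure] {ℓ : 𝔸 →ₗ[ℂ] ℂ} {e : Option κ → 𝔸} {zz : Option κ → Option κ → Z} {b : κ → V}
  {Φ : V ≃L[ℝ] (Fin 6 → ℝ) × W} {D : Set W} {Y : Type} [TopologicalSpace Y] {f : C(Y, GammaPlus m)}
  {T : Set Y} {w : Y → W} {g : Y → OCMat m} {r : ℕ} {z z' : π_ 6 C(Y, GammaPlus m) f} {Q Q' : Fin 2 → V → OCMat m}

/-- Pairs of smooth families of orthogonal complex structures parametrized by `V ≃ ℝ⁶ × W` that are standard
outside the unit cube of `ℝ⁶`, and such that one of them is standard over `D`. -/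
structure IsData (Φ : V ≃L[ℝ] (Fin 6 → ℝ) × W) (D : Set W)
    (Q : Fin 2 → V → OCMat m) : Prop where
  smooth : ∀ a, ContDiff ℝ ∞ (Q a)
  mem : ∀ a x, Q a x ∈ OCS (Fin m ⊕ Fin m)
  supp : ∃ K, IsClosed K ∧ K ⊆ cube ∧ ∀ a x, (Φ x).1 ∉ K → Q a x = J0 m
  disj : ∀ x, (Φ x).2 ∈ D → LocEq (Q 0) (J0 m) x ∨ LocEq (Q 1) (J0 m) x

theorem IsData.locEq (h : IsData Φ D Q) {x : V} (hx : (Φ x).1 ∉ cube) (a : Fin 2) : LocEq (Q a) (J0 m) x := by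
  obtain ⟨K, hK, hKc, hQ⟩ := h.supp
  have h1 : Continuous fun x => (Φ x).1 := by fun_prop
  filter_upwards [(hK.isOpen_compl.preimage h1).mem_nhds fun h => hx (hKc h)] with y hy
  exact hQ a y hy

variable (Φ) in
/-- The stretching of the first coordinate on `V`. -/
noncomputable def stretch (c : ℝ) (y : V × ℝ) : V :=
  Φ.symm (slide c (smoothTransition y.2) (Φ y.1).1, (Φ y.1).2)

theorem contDiff_stretch (c : ℝ) : ContDiff ℝ ∞ (stretch Φ c) := by
  have h1 : ContDiff ℝ ∞ fun y : V × ℝ => smoothTransition y.2 :=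
    (smoothTransition.contDiff (n := ⊤)).comp contDiff_snd
  have h2 : ContDiff ℝ ∞ fun y : V × ℝ => (Φ y.1).1 := contDiff_fst.comp (Φ.contDiff.comp contDiff_fst)
  have h3 : ContDiff ℝ ∞ fun y : V × ℝ => (Φ y.1).2 := contDiff_snd.comp (Φ.contDiff.comp contDiff_fst)
  have h4 : ContDiff ℝ ∞ fun y : V × ℝ => (Φ y.1).1 0 := contDiff_pi.1 h2 0
  exact Φ.symm.contDiff.comp ((h2.add ((h1.mul (h4.sub contDiff_const)).smul contDiff_const)).prodMk h3)

theorem apply_stretch (c : ℝ) (y : V × ℝ) :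
    Φ (stretch Φ c y) = (slide c (smoothTransition y.2) (Φ y.1).1, (Φ y.1).2) := by simp [stretch]

theorem stretch_zero (c : ℝ) (x : V) : stretch Φ c (x, 0) = x := by simp [stretch, slide]

variable (Φ) in
/-- The doubling of the first coordinate on `V`. -/
noncomputable def double (c : ℝ) (x : V) : V := stretch Φ c (x, 1)

theorem apply_double (c : ℝ) (x : V) : Φ (double Φ c x) = (slide c 1 (Φ x).1, (Φ x).2) := by
  rw [double, apply_stretch]; simp

theorem contDiff_double (c : ℝ) : ContDiff ℝ ∞ (double Φ c) :=
  (contDiff_stretch c).comp (contDiff_id.prodMk contDiff_const)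

theorem IsData.locEq_double_or (h : IsData Φ D Q) (h' : IsData Φ D Q') (x : V) :
    (∀ a, LocEq (fun x => Q a (double Φ 0 x)) (J0 m) x) ∨ ∀ a, LocEq (fun x => Q' a (double Φ 1 x)) (J0 m) x := by
  by_cases hx : (Φ (double Φ 0 x)).1 ∈ cube
  · refine .inr fun a => LocEq.comp (h'.locEq ?_ a) (contDiff_double 1).continuous.continuousAt
    rw [apply_double] at hx ⊢
    exact slide_disjoint hx
  · exact .inl fun a => LocEq.comp (h.locEq hx a) (contDiff_double 0).continuous.continuousAt

theorem LocEq.add_sub {A B : V → OCMat m} {J} {x : V} (hA : LocEq A J x)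
    (hB : LocEq B J x) : LocEq (fun x => A x + B x - J) J x := by
  filter_upwards [hA, hB] with y h1 h2
  rw [h1, h2, add_sub_cancel_right]

theorem IsData.glue (h : IsData Φ D Q) (h' : IsData Φ D Q') :
    IsData Φ D fun a x => Q a (double Φ 0 x) + Q' a (double Φ 1 x) - J0 m where
  smooth a := (((h.smooth a).comp (contDiff_double 0)).add ((h'.smooth a).comp (contDiff_double 1))).sub
    contDiff_const
  mem a x := add_sub_mem_OCS (h.mem a _) (h'.mem a _)
    ((h.locEq_double_or h' x).imp (fun h => (h a).self_of_nhds) fun h => (h a).self_of_nhds)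
  supp := by
    obtain ⟨K, hK, hKc, hQ⟩ := h.supp
    obtain ⟨K', hK', hKc', hQ'⟩ := h'.supp
    have hs : ∀ c, Continuous (slide c 1) := fun c => by unfold slide; fun_prop
    refine ⟨slide 0 1 ⁻¹' K ∪ slide 1 1 ⁻¹' K', (hK.preimage (hs 0)).union (hK'.preimage (hs 1)), ?_, ?_⟩
    · rintro v (hv | hv)
      · exact mem_cube_of_slide le_rfl zero_le_one zero_le_one (hKc hv)
      · exact mem_cube_of_slide zero_le_one le_rfl zero_le_one (hKc' hv)
    · intro a x hx
      rw [Set.mem_union, not_or] at hx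
      rw [hQ a _ (by rw [apply_double]; exact hx.1), hQ' a _ (by rw [apply_double]; exact hx.2),
        add_sub_cancel_right]
  disj x hx := by
    rcases h.locEq_double_or h' x with h1 | h1
    · refine (h'.disj (double Φ 1 x) (by rwa [apply_double])).imp (fun h2 => ?_) fun h2 => ?_
      · exact (h1 0).add_sub (LocEq.comp h2 (contDiff_double 1).continuous.continuousAt)
      · exact (h1 1).add_sub (LocEq.comp h2 (contDiff_double 1).continuous.continuousAt)
    · refine (h.disj (double Φ 0 x) (by rwa [apply_double])).imp (fun h2 => ?_) fun h2 => ?_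
      · exact LocEq.add_sub (LocEq.comp h2 (contDiff_double 0).continuous.continuousAt) (h1 0)
      · exact LocEq.add_sub (LocEq.comp h2 (contDiff_double 0).continuous.continuousAt) (h1 1)

variable (μ ℓ e zz b r) in
/-- The integral of the `r`-th characteristic class of the sum of a pair of families. -/
noncomputable def charge (Q : Fin 2 → V → OCMat m) : ℂ :=
  formInt μ ℓ e fun x => newton (fun k => ∑ a, chernForm zz (vDir b) (fun x => eigenProj (Q a x)) k x) r

variable (Φ) in
/-- The region over which the characteristic class of a pair of families can be nonzero. -/
def region (C : Set W) : Set V := Φ.symm '' (Set.Icc 0 1 ×ˢ C)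

theorem isCompact_region {C : Set W} (hC : IsCompact C) : IsCompact (region Φ C) :=
  (isCompact_Icc.prod hC).image Φ.symm.continuous

theorem of_notMem_region {C : Set W} {x : V} (hx : x ∉ region Φ C) : (Φ x).1 ∉ cube ∨ (Φ x).2 ∉ C := by
  by_contra! h
  exact hx ⟨Φ x, ⟨⟨fun i => (h.1 i).1.le, fun i => (h.1 i).2.le⟩, h.2⟩, Φ.symm_apply_apply x⟩

theorem IsData.newton_eq_zero (h : IsData Φ D Q) {C : Set W} (hC : ∀ w ∉ C, w ∈ D ∧ m < r) (hr : r ≠ 0)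
    {X : Type} [NormedAddCommGroup X] [NormedSpace ℝ X] {T : X → V} (hT : ContDiff ℝ ∞ T) {β : κ → X} {zz : κ → κ → Z}
    {x : X} (hx : (Φ (T x)).1 ∉ cube ∨ (Φ (T x)).2 ∉ C) :
    newton (fun k => ∑ a, chernForm zz β (fun x => eigenProj (Q a (T x))) k x) r = 0 := by
  have hc := hT.continuous.continuousAt (x := x)
  rcases hx with hx | hx
  · exact newton_sum_eq_zero_of_locEq (A := fun a x => Q a (T x)) (fun a => (h.locEq hx a).comp hc) hr
  · exact newton_sum_eq_zero_of_or (A := fun a x => Q a (T x)) (fun a => (h.smooth a).comp hT)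
      (fun a x => h.mem a _) ((h.disj _ (hC _ hx).1).imp (·.comp hc) (·.comp hc)) (hC _ hx).2

theorem IsData.charge_double (h : IsData Φ D Q) (ho : OddGen e zz) {C : Set W} (hCc : IsCompact C)
    (hC : ∀ w ∉ C, w ∈ D ∧ m < r) (hr : r ≠ 0) {c : ℝ} (h0 : 0 ≤ c) (h1 : c ≤ 1) :
    charge μ ℓ e zz b r (fun a x => Q a (double Φ c x)) = charge μ ℓ e zz b r Q := by
  have key := ho.formInt_newton_homotopy_of_vanish (μ := μ) (ℓ := ℓ) (b := b) (r := r)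
    (P := fun a y => eigenProj (Q a (stretch Φ c y)))
    (fun a => contDiff_eigenProj ((h.smooth a).comp (contDiff_stretch c)))
    (fun a y => eigenProj_mul_self (h.mem a _)) (isCompact_region (Φ := Φ) hCc)
    (fun x hx s => h.newton_eq_zero hC hr (contDiff_stretch c) <| by
      rw [apply_stretch]
      exact (of_notMem_region hx).imp
        (fun h2 h3 => h2 (mem_cube_of_slide h0 h1 (smoothTransition.nonneg _) h3)) id) 1 0
  simp only [stretch_zero] at key
  exact key

theorem IsData.charge_glue (h : IsData Φ D Q) (h' : IsData Φ D Q') (ho : OddGen e zz) {C : Set W}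
    (hCc : IsCompact C) (hC : ∀ w ∉ C, w ∈ D ∧ m < r) (hr : r ≠ 0) :
    charge μ ℓ e zz b r (fun a x => Q a (double Φ 0 x) + Q' a (double Φ 1 x) - J0 m) =
      charge μ ℓ e zz b r Q + charge μ ℓ e zz b r Q' := by
  rw [← h.charge_double ho hCc hC hr le_rfl zero_le_one, ← h'.charge_double ho hCc hC hr zero_le_one le_rfl]
  have hsm : ∀ {Q : Fin 2 → V → OCMat m}, IsData Φ D Q → ∀ c : ℝ, ContDiff ℝ ∞
      (fun x => newton (fun k => ∑ a, chernForm zz (vDir b) (fun x => eigenProj (Q a (double Φ c x))) k x) r) :=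
    fun h c => (SmoothClosed.newton (e := e) (fun k => .sum _ fun a => .chernForm ho
      (contDiff_eigenProj ((h.smooth a).comp (contDiff_double c)))
      (fun x => eigenProj_mul_self (h.mem a _)) k) r).smooth
  have hcs : ∀ {Q : Fin 2 → V → OCMat m}, IsData Φ D Q → ∀ c : ℝ, 0 ≤ c → c ≤ 1 →
      HasCompactSupport
      (fun x => newton (fun k => ∑ a, chernForm zz (vDir b) (fun x => eigenProj (Q a (double Φ c x))) k x) r) :=
    fun h c h0 h1 => HasCompactSupport.intro (isCompact_region (Φ := Φ) hCc) fun x hx =>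
      h.newton_eq_zero hC hr (contDiff_double c) <| by
      rw [apply_double]
      exact (of_notMem_region hx).imp (fun h2 h3 => h2 (mem_cube_of_slide h0 h1 zero_le_one h3)) id
  refine Eq.trans ?_ (formInt_add (hsm h 0) (hsm h' 1) (hcs h 0 le_rfl zero_le_one) (hcs h' 1 zero_le_one le_rfl))
  refine congrArg (formInt μ ℓ e) (funext fun x => ?_)
  have hl := h.locEq_double_or h' x
  have h2 : newton (fun k => ∑ a, chernForm zz (vDir b)
      (fun x => eigenProj (Q a (double Φ 0 x) + Q' a (double Φ 1 x) - J0 m)) k x) r = newton (fun k =>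
      ∑ a, chernForm zz (vDir b) (fun x => eigenProj (Q a (double Φ 0 x))) k x +
      ∑ a, chernForm zz (vDir b) (fun x => eigenProj (Q' a (double Φ 1 x))) k x) r := by
    refine newton_congr _ _ _ fun k hk _ => ?_
    rw [← sum_add_distrib]
    exact sum_congr rfl fun a _ => chernForm_add_sub (hl.imp (· a) (· a)) (by omega)
  rw [h2]
  rcases hl with hl | hl
  · rw [newton_sum_eq_zero_of_locEq hl hr, zero_add]
    exact newton_congr _ _ _ fun k hk _ => by
      rw [sum_eq_zero fun a _ => (hl a).chernForm_eq_zero (by omega), zero_add]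
  · rw [newton_sum_eq_zero_of_locEq hl hr, add_zero]
    exact newton_congr _ _ _ fun k hk _ => by
      rw [sum_eq_zero (s := Finset.univ) (f := fun a => chernForm zz (vDir b)
        (fun x => eigenProj (Q' a (double Φ 1 x))) k x) fun a _ => (hl a).chernForm_eq_zero (by omega), add_zero]

theorem IsData.const : IsData Φ D (fun _ _ => J0 m) where
  smooth _ := contDiff_const
  mem _ _ := J0_mem m
  supp := ⟨∅, isClosed_empty, Set.empty_subset _, fun _ _ _ => rfl⟩
  disj _ _ := .inl Filter.EventuallyEq.rfl

theorem charge_const (hr : r ≠ 0) : charge μ ℓ e zz b r (fun _ _ => J0 m) = 0 := by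
  have h1 : ∀ x, newton (fun k => ∑ a : Fin 2, chernForm zz (vDir b) (fun _ => eigenProj (J0 m)) k x) r = 0 :=
    fun x => newton_sum_eq_zero_of_locEq (A := fun _ _ => J0 m) (fun a => Filter.EventuallyEq.rfl) hr
  rw [charge, formInt]
  simp only [h1, mulFun, map_zero, mul_zero, integral_zero]

variable (Φ D T w g) in
/-- The element `z` is represented over `T` by the pair of families `Q`, twisted by `g`. -/
def IsRep (Q : Fin 2 → V → OCMat m) (z : π_ 6 C(Y, GammaPlus m) f) : Prop :=
  IsData Φ D Q ∧ ∃ Z : GenLoop (Fin 6) C(Y, GammaPlus m) f, (Quotient.mk _ Z : π_ 6 C(Y, GammaPlus m) f) = z ∧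
    ∀ u, ∀ t ∈ T, ((Z u t : Gamma m) : OCMat m) =
      g t * (Q 0 (Φ.symm (fun i => u i, w t)) + Q 1 (Φ.symm (fun i => u i, w t)) - J0 m) * (g t)ᵀ

theorem IsRep.mul (h : IsRep Φ D T w g Q z) (h' : IsRep Φ D T w g Q' z') :
    IsRep Φ D T w g (fun a x => Q a (double Φ 0 x) + Q' a (double Φ 1 x) - J0 m) (z' * z) := by
  obtain ⟨hQ, L, rfl, hL⟩ := h
  obtain ⟨hQ', L', rfl, hL'⟩ := h'
  refine ⟨hQ.glue hQ', GenLoop.transAt 0 L L', HomotopyGroup.mul_spec.symm, fun u t ht => ?_⟩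
  have hd : ∀ c : ℝ, ∀ y : unitInterval, (y : ℝ) = 2 * u 0 - c →
      double Φ c (Φ.symm (fun i => (u i : ℝ), w t)) = Φ.symm (fun i => (Function.update u 0 y i : ℝ), w t) := by
    intro c y hy
    apply Φ.injective
    rw [apply_double]
    simp only [ContinuousLinearEquiv.apply_symm_apply, Prod.mk.injEq, and_true]
    funext i
    by_cases hi : i = 0
    · subst hi; rw [slide_zero, Function.update_self, hy]; ring
    · rw [slide_of_ne _ _ _ hi, Function.update_of_ne hi]
  have hJ : ∀ {Q}, IsData Φ D Q → ∀ c : ℝ, (2 * u 0 - c ≤ 0 ∨ 1 ≤ 2 * (u 0 : ℝ) - c) → ∀ a,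
      Q a (double Φ c (Φ.symm (fun i => (u i : ℝ), w t))) = J0 m := by
    intro Q hQ c hc a
    refine (hQ.locEq (fun h => ?_) a).self_of_nhds
    have h1 := h 0
    rw [apply_double] at h1
    simp only [ContinuousLinearEquiv.apply_symm_apply] at h1
    rw [slide_zero] at h1
    rcases hc with hc | hc <;> linarith [h1.1, h1.2]
  have hu0 := (u 0).2.1
  have hu1 := (u 0).2.2
  by_cases hu : (u 0 : ℝ) ≤ 1 / 2
  · have h1 : GenLoop.transAt 0 L L' u = L (Function.update u 0 (Set.projIcc 0 1 zero_le_one (2 * (u 0 : ℝ)))) :=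
      if_pos hu
    rw [h1, hL _ t ht, ← hd 0 (Set.projIcc 0 1 zero_le_one (2 * (u 0 : ℝ))) (by
      rw [Set.projIcc_of_mem _ ⟨by linarith, by linarith⟩]; simp)]
    simp only [hJ hQ' 1 (.inl (by linarith)), add_sub_cancel_right]
  · have h1 : GenLoop.transAt 0 L L' u =
      L' (Function.update u 0 (Set.projIcc 0 1 zero_le_one (2 * (u 0 : ℝ) - 1))) := if_neg hu
    rw [h1, hL' _ t ht, ← hd 1 (Set.projIcc 0 1 zero_le_one (2 * (u 0 : ℝ) - 1)) (by
      rw [Set.projIcc_of_mem _ ⟨by linarith, by linarith⟩])]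
    simp only [hJ hQ 0 (.inr (by linarith)), add_sub_cancel_left]

theorem IsRep.one (hf : ∀ t ∈ T, ((f t : Gamma m) : OCMat m) = g t * J0 m * (g t)ᵀ) :
    IsRep Φ D T w g (fun _ _ => J0 m) (1 : π_ 6 C(Y, GammaPlus m) f) :=
  ⟨.const, GenLoop.const, rfl, fun u t ht => (hf t ht).trans (by rw [add_sub_cancel_right])⟩

variable (μ ℓ e zz b Φ D T w g r) in
/-- The element `z` is represented by a pair of families with charge `c`. -/
def HasCharge (z : π_ 6 C(Y, GammaPlus m) f) (c : ℂ) : Prop :=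
  ∃ Q, IsRep Φ D T w g Q z ∧ charge μ ℓ e zz b r Q = c

theorem HasCharge.mul (ho : OddGen e zz) {C : Set W} (hCc : IsCompact C)
    (hC : ∀ w ∉ C, w ∈ D ∧ m < r) (hr : r ≠ 0) {c c' : ℂ} (h : HasCharge μ ℓ e zz b Φ D T w g r z c)
    (h' : HasCharge μ ℓ e zz b Φ D T w g r z' c') : HasCharge μ ℓ e zz b Φ D T w g r (z * z') (c + c') := by
  obtain ⟨Q, hQ, rfl⟩ := h
  obtain ⟨Q', hQ', rfl⟩ := h'
  exact ⟨_, hQ'.mul hQ, by rw [hQ'.1.charge_glue hQ.1 ho hCc hC hr, add_comm]⟩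

theorem HasCharge.pow (ho : OddGen e zz) {C : Set W} (hCc : IsCompact C) (hC : ∀ w ∉ C, w ∈ D ∧ m < r)
    (hr : r ≠ 0) {c : ℂ} (hf : ∀ t ∈ T, ((f t : Gamma m) : OCMat m) = g t * J0 m * (g t)ᵀ)
    (h : HasCharge μ ℓ e zz b Φ D T w g r z c) (p : ℕ) : HasCharge μ ℓ e zz b Φ D T w g r (z ^ p) (p * c) := by
  induction p with
  | zero => exact ⟨_, by rw [pow_zero]; exact .one hf, by rw [charge_const hr]; simp⟩
  | succ p ih =>
    rw [pow_succ, Nat.cast_succ, add_mul, one_mul]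
    exact ih.mul ho hCc hC hr h

theorem IsRep.exists_homotopy [LocallyCompactSpace Y] (hg : Continuous g) (hgg : ∀ t, (g t)ᵀ * g t = 1)
    (hf : ∀ t, ((f t : Gamma m) : OCMat m) = g t * J0 m * (g t)ᵀ)
    (h : IsRep Φ D T w g Q (1 : π_ 6 C(Y, GammaPlus m) f)) :
    ∃ H : (Fin 6 → ℝ) × ℝ × Y → OCMat m, Continuous H ∧
      (∀ y, H y ∈ OCS (Fin m ⊕ Fin m)) ∧ (∀ v s t, s ≤ 0 → H (v, s, t) = J0 m) ∧
      (∀ v s t, v ∉ cube → H (v, s, t) = J0 m) ∧ ∀ v s, ∀ t ∈ T, 1 ≤ s →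
        H (v, s, t) = Q 0 (Φ.symm (v, w t)) + Q 1 (Φ.symm (v, w t)) - J0 m := by
  obtain ⟨hQ, L, hL1, hL⟩ := h
  obtain ⟨H⟩ : GenLoop.Homotopic (GenLoop.const : GenLoop (Fin 6) C(Y, GammaPlus m) f) L :=
    Quotient.exact (s := GenLoop.Homotopic.setoid (Fin 6) f) hL1.symm
  let cl : (Fin 6 → ℝ) → Fin 6 → unitInterval := fun v i => Set.projIcc 0 1 zero_le_one (v i)
  have hcl : Continuous cl := continuous_pi fun i => continuous_projIcc.comp (continuous_apply i)
  let coe : Y → C(Y, GammaPlus m) → OCMat m := fun t N => (N t : Gamma m)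
  have hconj : ∀ t (A : OCMat m), (g t)ᵀ * (g t * A * (g t)ᵀ) * g t = A := by
    intro t A
    rw [← mul_assoc, ← mul_assoc, hgg, one_mul, mul_assoc, hgg, mul_one]
  have hcube : ∀ v s t, v ∉ cube → (g t)ᵀ * ((H (Set.projIcc 0 1 zero_le_one s, cl v) t : Gamma m) :
      OCMat m) * g t = J0 m := by
    intro v s t hv
    have h1 : cl v ∈ Cube.boundary (Fin 6) := by
      simp only [cube, Set.mem_setOf_eq, not_forall, not_and_or, not_lt] at hv
      obtain ⟨i, hi | hi⟩ := hv
      · exact ⟨i, .inl (Set.projIcc_of_le_left _ hi)⟩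
      · exact ⟨i, .inr (Set.projIcc_of_right_le _ hi)⟩
    rw [H.eq_fst _ h1]
    exact (congrArg (fun N => (g t)ᵀ * N * g t) (hf t)).trans (hconj t _)
  refine ⟨fun y => (g y.2.2)ᵀ * ((H (Set.projIcc 0 1 zero_le_one y.2.1, cl y.1) y.2.2 : Gamma m) :
      OCMat m) * g y.2.2, ?_, ?_, ?_, hcube, ?_⟩
  · have h1 : Continuous fun y : (Fin 6 → ℝ) × ℝ × Y => g y.2.2 := hg.comp (by fun_prop)
    have h2 : Continuous fun y : (Fin 6 → ℝ) × ℝ × Y => H (Set.projIcc 0 1 zero_le_one y.2.1, cl y.1) :=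
      (map_continuous H).comp ((continuous_projIcc.comp (by fun_prop)).prodMk (hcl.comp continuous_fst))
    have h3 : Continuous fun y : (Fin 6 → ℝ) × ℝ × Y => H (Set.projIcc 0 1 zero_le_one y.2.1, cl y.1) y.2.2 :=
      continuous_eval.comp (h2.prodMk (by fun_prop))
    exact (h1.matrix_transpose.mul (continuous_subtype_val.comp (continuous_subtype_val.comp h3))).mul h1
  · intro y
    have h1 := conj_mem_OCS (S := (g y.2.2)ᵀ) (by rw [transpose_transpose, mul_eq_one_comm, hgg])
      (by rw [transpose_transpose, hgg]) (J := ((H (Set.projIcc 0 1 zero_le_one y.2.1, cl y.1) y.2.2 : Gamma m) :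
        OCMat m)) (Subtype.property _)
    rwa [transpose_transpose] at h1
  · intro v s t hs
    dsimp only
    rw [Set.projIcc_of_le_left _ hs]
    have h2 : ((H (0, cl v) t : Gamma m) : OCMat m) = g t * J0 m * (g t)ᵀ :=
      (congrArg (coe t) (H.apply_zero (cl v))).trans (hf t)
    exact (congrArg (fun N => (g t)ᵀ * N * g t) h2).trans (hconj t _)
  · intro v s t ht hs
    by_cases hv : v ∈ cube
    · have h1 : (fun i => ((cl v i : unitInterval) : ℝ)) = v := by
        funext i
        exact congrArg Subtype.val (Set.projIcc_of_mem zero_le_one ⟨(hv i).1.le, (hv i).2.le⟩)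
      dsimp only
      rw [Set.projIcc_of_right_le _ hs]
      have h2 := hL (cl v) t ht
      rw [h1] at h2
      have h3 : ((H (1, cl v) t : Gamma m) : OCMat m) = _ :=
        (congrArg (coe t) (H.apply_one (cl v))).trans h2
      exact (congrArg (fun N => (g t)ᵀ * N * g t) h3).trans (hconj t _)
    · refine (hcube v s t hv).trans ?_
      have h1 : ∀ a, Q a (Φ.symm (v, w t)) = J0 m := fun a => (hQ.locEq (by simpa using hv) a).self_of_nhds
      rw [h1, h1, add_sub_cancel_right]

theorem IsData.contDiff_add_sub (h : IsData Φ D Q) : ContDiff ℝ ∞ fun x => Q 0 x + Q 1 x - J0 m :=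
  ((h.smooth 0).add (h.smooth 1)).sub contDiff_const

theorem isClosed_cubeBox {X : Type} [TopologicalSpace X] {p : X → Fin 6 → ℝ} (hp : Continuous p) :
    IsClosed {x | p x ∉ Set.univ.pi fun _ => Set.Ioo (-1 : ℝ) 2} :=
  ((isOpen_set_pi Set.finite_univ fun _ _ => isOpen_Ioo).preimage hp).isClosed_compl

theorem isOpen_cubeBox {X : Type} [TopologicalSpace X] {p : X → Fin 6 → ℝ} (hp : Continuous p) :
    IsOpen {x | p x ∉ Set.Icc (0 : Fin 6 → ℝ) 1} :=
  (isClosed_Icc.preimage hp).isOpen_compl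

theorem notMem_Icc_of_notMem_box {v : Fin 6 → ℝ} (hv : v ∉ Set.univ.pi fun _ => Set.Ioo (-1 : ℝ) 2) :
    v ∉ Set.Icc (0 : Fin 6 → ℝ) 1 := fun h => hv fun i _ => by
  have h1 := h.1 i
  have h2 := h.2 i
  simp only [Pi.zero_apply, Pi.one_apply] at h1 h2
  constructor <;> linarith

theorem notMem_cube {v : Fin 6 → ℝ} (hv : v ∉ Set.Icc (0 : Fin 6 → ℝ) 1) : v ∉ cube :=
  fun h => hv ⟨fun i => (h i).1.le, fun i => (h i).2.le⟩

theorem isOpen_box {X : Type} [TopologicalSpace X] {p : X → Fin 6 → ℝ} (hp : Continuous p) :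
    IsOpen {x | p x ∉ Set.Icc (fun _ => (-1) : Fin 6 → ℝ) fun _ => 2} :=
  (isClosed_Icc.preimage hp).isOpen_compl

theorem notMem_box {v : Fin 6 → ℝ} (hv : v ∉ Set.Icc (fun _ => (-1) : Fin 6 → ℝ) fun _ => 2) :
    v ∉ Set.univ.pi fun _ => Set.Ioo (-1 : ℝ) 2 :=
  fun h => hv ⟨fun i => (h i trivial).1.le, fun i => (h i trivial).2.le⟩

theorem HasCharge.eq_zero_of_subsingleton [LocallyCompactSpace Y] [Subsingleton W] (ho : OddGen e zz) (hr : r ≠ 0) (hg : Continuous g)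
    (hgg : ∀ t, (g t)ᵀ * g t = 1)
    (hf : ∀ t, ((f t : Gamma m) : OCMat m) = g t * J0 m * (g t)ᵀ) {t₀ : Y} {c : ℂ}
    (h : HasCharge μ ℓ e zz b Φ Set.univ {t₀} (fun _ => 0) g r (1 : π_ 6 C(Y, GammaPlus m) f) c) : c = 0 := by
  obtain ⟨Q, hQ, rfl⟩ := h
  obtain ⟨H, hHc, hHm, hH0, hHJ, hH1⟩ := hQ.exists_homotopy hg hgg hf
  have hp : Continuous fun x : V × ℝ => (Φ x.1).1 := by fun_prop
  obtain ⟨F, hFs, hFm, hFe⟩ := exists_smooth_OCS (G := fun x : V × ℝ => H ((Φ x.1).1, x.2, t₀))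
    (hHc.comp (by fun_prop)) (fun _ => hHm _)
    (C := ({x | x.2 ≤ -1} ∪ {x | 2 ≤ x.2}) ∪ {x | (Φ x.1).1 ∉ Set.univ.pi fun _ => Set.Ioo (-1 : ℝ) 2})
    (((isClosed_le continuous_snd continuous_const).union (isClosed_le continuous_const continuous_snd)).union
      (isClosed_cubeBox hp))
    (U := ({x | x.2 < 0} ∪ {x | 1 < x.2}) ∪ {x | (Φ x.1).1 ∉ Set.Icc 0 1})
    ((((isOpen_lt continuous_snd continuous_const).union (isOpen_lt continuous_const continuous_snd)).union
      (isOpen_cubeBox hp)).mem_nhdsSet.2 (by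
        rintro x ((hx | hx) | hx)
        · exact .inl (.inl (lt_of_le_of_lt hx (by norm_num : (-1 : ℝ) < 0)))
        · exact .inl (.inr (show (1 : ℝ) < x.2 from lt_of_lt_of_le (one_lt_two : (1 : ℝ) < 2) hx))
        · exact .inr (notMem_Icc_of_notMem_box hx)))
    (by
      have hJ : ∀ x : V × ℝ, (x.2 ≤ 0 ∨ (Φ x.1).1 ∉ cube) → H ((Φ x.1).1, x.2, t₀) = J0 m :=
        fun x hx => hx.elim (hH0 _ _ _) (hHJ _ _ _)
      intro x hx
      apply ContDiffAt.contDiffWithinAt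
      rcases hx with (hx | hx) | hx
      · exact (contDiffAt_const (c := J0 m)).congr_of_eventuallyEq (by
          filter_upwards [(isOpen_lt continuous_snd continuous_const).mem_nhds hx] with y hy
          exact hJ y (.inl (le_of_lt hy)))
      · refine ((hQ.1.contDiff_add_sub).comp contDiff_fst).contDiffAt.congr_of_eventuallyEq ?_
        filter_upwards [(isOpen_lt continuous_const continuous_snd).mem_nhds hx] with y hy
        rw [hH1 _ _ _ rfl (le_of_lt hy)]
        have h1 : Φ.symm ((Φ y.1).1, 0) = y.1 := by
          apply Φ.injective
          rw [ContinuousLinearEquiv.apply_symm_apply]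
          exact Prod.ext rfl (Subsingleton.elim _ _)
        rw [h1]; rfl
      · exact (contDiffAt_const (c := J0 m)).congr_of_eventuallyEq (by
          filter_upwards [(isOpen_cubeBox hp).mem_nhds hx] with y hy
          exact hJ y (.inr (notMem_cube hy))))
  have key := ho.formInt_newton_homotopy_of_vanish (μ := μ) (ℓ := ℓ) (b := b) (r := r)
    (P := fun (_ : Unit) y => eigenProj (F y)) (fun _ => contDiff_eigenProj hFs)
    (fun _ y => eigenProj_mul_self (hFm y))
    (((isCompact_Icc (a := (fun _ => (-1) : Fin 6 → ℝ)) (b := fun _ => 2)).prod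
      (Set.subsingleton_univ (α := W)).isCompact).image Φ.symm.continuous)
    (fun x hx s => newton_zero_of_pos hr fun k hk _ => sum_eq_zero fun _ _ => by
      refine LocEq.chernForm_eq_zero (J := J0 m) ?_ (by omega)
      have hx1 : (Φ x).1 ∉ Set.Icc (fun _ => (-1) : Fin 6 → ℝ) fun _ => 2 :=
        fun h => hx ⟨Φ x, ⟨h, trivial⟩, Φ.symm_apply_apply x⟩
      filter_upwards [(isOpen_box hp).mem_nhds (show (x, s) ∈ {x : V × ℝ | _} from hx1)] with y hy
      exact (hFe (.inr (notMem_box hy))).trans (hHJ _ _ _ (notMem_cube (notMem_Icc_of_notMem_box (notMem_box hy)))))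
    2 (-1)
  have h2 : (fun x => F (x, 2)) = fun x => Q 0 x + Q 1 x - J0 m := funext fun x => by
    rw [hFe (.inl (.inr (le_refl (2 : ℝ))))]
    dsimp only
    rw [hH1 _ _ _ rfl one_le_two]
    have h1 : Φ.symm ((Φ x).1, 0) = x := by
      apply Φ.injective
      rw [ContinuousLinearEquiv.apply_symm_apply]
      exact Prod.ext rfl (Subsingleton.elim _ _)
    rw [h1]
  have h3 : (fun x => F (x, -1)) = fun _ => J0 m := funext fun x =>
    (hFe (.inl (.inl (le_refl (-1 : ℝ))))).trans (hH0 _ _ _ (by norm_num))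
  have h4 : ∀ x, newton (fun k => ∑ a, chernForm zz (vDir b) (fun x => eigenProj (Q a x)) k x) r =
      newton (fun k => ∑ _a : Unit, chernForm zz (vDir b) (fun x => eigenProj (F (x, 2))) k x) r := fun x => by
    refine newton_congr _ _ _ fun k hk _ => ?_
    rw [Fin.sum_univ_two, Fintype.sum_unique]
    simp only [congrFun h2]
    exact (chernForm_add_sub (hQ.1.disj x trivial) (by omega)).symm
  have h5 : ∀ x, newton (fun k => ∑ _a : Unit, chernForm zz (vDir b) (fun x => eigenProj (F (x, -1))) k x) r = 0 :=
    fun x => newton_zero_of_pos hr fun k hk _ => sum_eq_zero fun _ _ =>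
      LocEq.chernForm_eq_zero (A := fun x => F (x, -1)) (J := J0 m) (by rw [h3]; exact Filter.EventuallyEq.rfl) (by omega)
  rw [charge]
  simp only [h4]
  refine key.trans ?_
  rw [formInt]
  simp only [h5, map_zero, integral_zero]

theorem HasCharge.eq_zero_of_sphere {n : ℕ} {Φ : V ≃L[ℝ] (Fin 6 → ℝ) × EuclideanSpace ℝ (Fin (n + 1))}
    {f : C(Sph n, GammaPlus m)} {g : Sph n → OCMat m}
    (ho : OddGen e zz) (hr : m < r) (hr2 : Even r) (hg : Continuous g) (hgg : ∀ t, (g t)ᵀ * g t = 1)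
    (hf : ∀ t, ((f t : Gamma m) : OCMat m) = g t * J0 m * (g t)ᵀ) {c : ℂ}
    (h : HasCharge μ ℓ e zz b Φ {w | 1 / 2 < ‖w‖} Set.univ Subtype.val g r (1 : π_ 6 C(Sph n, GammaPlus m) f) c) :
    c = 0 := by
  have : CompactSpace (Sph n) := isCompact_iff_compactSpace.1 (isCompact_sphere _ _)
  obtain ⟨Q, hQ, rfl⟩ := h
  obtain ⟨H, hHc, hHm, hH0, hHJ, hH1⟩ := hQ.exists_homotopy hg hgg hf
  have hp : Continuous fun x : V => (Φ x).1 := by fun_prop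
  have hq : Continuous fun x : V => (Φ x).2 := by fun_prop
  let nrm : EuclideanSpace ℝ (Fin (n + 1)) → Sph n := fun w =>
    if hw : w = 0 then northPole n else ⟨‖w‖⁻¹ • w, by
      rw [Sph, mem_sphere_zero_iff_norm, norm_smul, norm_inv, norm_norm, inv_mul_cancel₀ (norm_ne_zero_iff.2 hw)]⟩
  have hnrm : ∀ w, w ≠ 0 → ((nrm w : Sph n) : EuclideanSpace ℝ (Fin (n + 1))) = ‖w‖⁻¹ • w := fun w hw => by
    simp only [nrm, dif_neg hw]
  have hnc : ∀ w, w ≠ 0 → ContinuousAt nrm w := fun w hw => by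
    rw [Topology.IsInducing.subtypeVal.continuousAt_iff]
    refine ContinuousAt.congr (f := fun w => ‖w‖⁻¹ • w)
      ((continuousAt_id.norm.inv₀ (by simpa using hw)).smul continuousAt_id) ?_
    filter_upwards [isOpen_ne.mem_nhds hw] with y hy
    exact (hnrm y hy).symm
  let F₀ : V → OCMat m := fun x =>
    H ((Φ x).1, 2 * ‖(Φ x).2‖ - 1, nrm (Φ x).2)
  have hF₀ : Continuous F₀ := continuous_iff_continuousAt.2 fun x => by
    by_cases hx : (Φ x).2 = 0
    · refine continuousAt_const.congr (f := fun _ => J0 m) ?_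
      filter_upwards [(isOpen_lt hq.norm continuous_const).mem_nhds
        (show x ∈ {x : V | ‖(Φ x).2‖ < 1 / 2} by simp [hx])] with y hy
      exact (hH0 _ _ _ (by linarith [show ‖(Φ y).2‖ < 1 / 2 from hy])).symm
    · exact hHc.continuousAt.comp (hp.continuousAt.prodMk (((hq.norm.const_mul 2).sub continuous_const).continuousAt.prodMk
        ((hnc _ hx).comp (f := fun x : V => (Φ x).2) hq.continuousAt)))
  have hFQ : ∀ x, ‖(Φ x).2‖ = 1 → F₀ x = Q 0 x + Q 1 x - J0 m := fun x hx => by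
    have h0 : (Φ x).2 ≠ 0 := fun h => by simp [h] at hx
    have h1 : Φ.symm ((Φ x).1, ((nrm (Φ x).2 : Sph n) : EuclideanSpace ℝ (Fin (n + 1)))) = x := by
      rw [hnrm _ h0, hx, inv_one, one_smul]
      exact Φ.symm_apply_apply x
    dsimp only [F₀]
    rw [hH1 _ _ _ trivial (by rw [hx]; norm_num), h1]
  have hJ : ∀ x, (Φ x).1 ∉ cube → F₀ x = J0 m ∧ Q 0 x + Q 1 x - J0 m = J0 m := fun x hx =>
    ⟨hHJ _ _ _ hx, by rw [(hQ.1.locEq hx 0).self_of_nhds, (hQ.1.locEq hx 1).self_of_nhds, add_sub_cancel_right]⟩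
  obtain ⟨F, hFs, hFm, hFe⟩ := exists_smooth_OCS
    (G := fun x : V => if ‖(Φ x).2‖ ≤ 1 then F₀ x else Q 0 x + Q 1 x - J0 m)
    (Continuous.if_le hF₀ hQ.1.contDiff_add_sub.continuous hq.norm continuous_const hFQ)
    (fun x => by
      split_ifs with hx
      · exact hHm _
      · exact add_sub_mem_OCS (hQ.1.mem 0 x) (hQ.1.mem 1 x) ((hQ.1.disj x (by
          rw [Set.mem_setOf_eq]; linarith)).imp (·.self_of_nhds) (·.self_of_nhds)))
    (C := {x | 2 ≤ ‖(Φ x).2‖} ∪ {x | (Φ x).1 ∉ Set.univ.pi fun _ => Set.Ioo (-1 : ℝ) 2})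
    ((isClosed_le continuous_const hq.norm).union (isClosed_cubeBox hp))
    (U := {x | 1 < ‖(Φ x).2‖} ∪ {x | (Φ x).1 ∉ Set.Icc 0 1})
    (((isOpen_lt continuous_const hq.norm).union (isOpen_cubeBox hp)).mem_nhdsSet.2 (by
        rintro x (hx | hx)
        · exact .inl (lt_of_lt_of_le (one_lt_two : (1 : ℝ) < 2) hx)
        · exact .inr (notMem_Icc_of_notMem_box hx)))
    (by
      intro x hx
      apply ContDiffAt.contDiffWithinAt
      rcases hx with hx | hx
      · refine hQ.1.contDiff_add_sub.contDiffAt.congr_of_eventuallyEq ?_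
        filter_upwards [(isOpen_lt continuous_const hq.norm).mem_nhds hx] with y hy
        exact if_neg (not_le.2 hy)
      · exact (contDiffAt_const (c := J0 m)).congr_of_eventuallyEq (by
          filter_upwards [(isOpen_cubeBox hp).mem_nhds hx] with y hy
          rw [(hJ y (notMem_cube hy)).1, (hJ y (notMem_cube hy)).2, ite_self]))
  have hP : ∀ a, ContDiff ℝ ∞ ((![F, Q 0, Q 1] : Fin 3 → _) a) := fun a => by
    fin_cases a
    exacts [hFs, hQ.1.smooth 0, hQ.1.smooth 1]
  have hPm : ∀ a x, (![F, Q 0, Q 1] : Fin 3 → _) a x ∈ OCS (Fin m ⊕ Fin m) := fun a => by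
    fin_cases a
    exacts [hFm, hQ.1.mem 0, hQ.1.mem 1]
  have key := ho.formInt_newton_eq_zero (μ := μ) (ℓ := ℓ) (b := b) (r := r)
    (P := fun a x => eigenProj ((![F, Q 0, Q 1] : Fin 3 → _) a x)) (fun a => contDiff_eigenProj (hP a))
    (fun a x => eigenProj_mul_self (hPm a x)) (fun a x => transpose_eigenProj (hPm a x))
    (((isCompact_Icc (a := (fun _ => (-1) : Fin 6 → ℝ)) (b := fun _ => 2)).prod
      (isCompact_closedBall (0 : EuclideanSpace ℝ (Fin (n + 1))) 2)).image Φ.symm.continuous)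
    (fun x hx k hk => by
      have hx1 : (Φ x).1 ∉ Set.Icc (fun _ => (-1) : Fin 6 → ℝ) (fun _ => 2) ∨ 2 < ‖(Φ x).2‖ := by
        by_contra! h
        exact hx ⟨Φ x, ⟨h.1, by simpa using h.2⟩, Φ.symm_apply_apply x⟩
      have h2 : F =ᶠ[𝓝 x] fun x => Q 0 x + Q 1 x - J0 m := by
        rcases hx1 with hx1 | hx1
        · filter_upwards [(isOpen_box hp).mem_nhds hx1] with y hy
          have h3 := hJ y (notMem_cube (notMem_Icc_of_notMem_box (notMem_box hy)))
          refine (hFe (.inr (notMem_box hy))).trans ?_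
          dsimp only
          rw [h3.1, h3.2, ite_self]
        · filter_upwards [(isOpen_lt continuous_const hq.norm).mem_nhds hx1] with y hy
          exact (hFe (.inl (le_of_lt hy))).trans (if_neg (not_le.2 (lt_trans one_lt_two hy)))
      refine (chernForm_congr (h2.mono fun y hy => congrArg eigenProj hy) k).trans (chernForm_add_sub ?_ hk)
      rcases hx1 with hx1 | hx1
      · exact .inl (hQ.1.locEq (notMem_cube (notMem_Icc_of_notMem_box (notMem_box hx1))) 0)
      · exact hQ.1.disj x (show (1 : ℝ) / 2 < _ by linarith))
    (by omega) hr2 (fun x => newton_eigenProj_eq_zero hFs hFm hr x)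
  rw [charge]
  simp only [Fin.sum_univ_two]
  exact key

theorem IsData.exists_isRep (h : IsData Φ D Q) (hg : Continuous g) (hgg : ∀ t, (g t)ᵀ * g t = 1)
    (hf : ∀ t, ((f t : Gamma m) : OCMat m) = g t * J0 m * (g t)ᵀ)
    (hw : Continuous w) (hD : ∀ t, w t ∈ D) :
    ∃ z : π_ 6 C(Y, GammaPlus m) f, IsRep Φ D Set.univ w g Q z := by
  let q : (Fin 6 → ℝ) × Y → OCMat m := fun y =>
    Q 0 (Φ.symm (y.1, w y.2)) + Q 1 (Φ.symm (y.1, w y.2)) - J0 m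
  have hq : Continuous q := h.contDiff_add_sub.continuous.comp (Φ.symm.continuous.comp
    (continuous_fst.prodMk (hw.comp continuous_snd)))
  have hqm : ∀ y, q y ∈ OCS (Fin m ⊕ Fin m) := fun y => add_sub_mem_OCS (h.mem _ _) (h.mem _ _)
    ((h.disj (Φ.symm (y.1, w y.2)) (by simpa using hD _)).imp (·.self_of_nhds) (·.self_of_nhds))
  have hq0 : ∀ v t, v ∉ cube → q (v, t) = J0 m := fun v t hv => by
    have h1 : ∀ a, Q a (Φ.symm (v, w t)) = J0 m := fun a => (h.locEq (by simpa using hv) a).self_of_nhds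
    simp only [q, h1, add_sub_cancel_right]
  let M : (Fin 6 → ℝ) × Y → Gamma m := fun y => ⟨g y.2 * q y * (g y.2)ᵀ,
    conj_mem_OCS (hgg _) (mul_eq_one_comm.1 (hgg _)) (hqm y)⟩
  have hM : Continuous M := Continuous.subtype_mk
    (((hg.comp continuous_snd).mul hq).mul (hg.comp continuous_snd).matrix_transpose) _
  have hMf : ∀ v t, v ∉ cube → M (v, t) = f t := fun v t hv => Subtype.ext <| by
    rw [hf]
    exact congrArg (fun N => g t * N * (g t)ᵀ) (hq0 v t hv)
  have hMp : ∀ y, M y ∈ GammaPlus m := fun y => by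
    have h1 : M (0, y.2) ∈ GammaPlus m := by
      rw [hMf 0 y.2 fun h => lt_irrefl _ (h 0).1]
      exact (f y.2).2
    refine Joined.trans h1 ⟨⟨⟨fun s => M ((s : ℝ) • y.1, y.2), hM.comp (by fun_prop)⟩, ?_, ?_⟩⟩
    · simp
    · simp
  let N : C((Fin 6 → unitInterval) × Y, GammaPlus m) :=
    ⟨fun y => ⟨M (fun i => (y.1 i : ℝ), y.2), hMp _⟩, Continuous.subtype_mk (hM.comp (by fun_prop)) _⟩
  refine ⟨Quotient.mk _ ⟨N.curry, fun u hu => ?_⟩, h, _, rfl, fun u t _ => rfl⟩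
  ext1 t
  refine Subtype.ext (hMf _ t fun hc => ?_)
  obtain ⟨i, hi | hi⟩ := hu
  · exact absurd (hc i).1 (by simp [hi])
  · exact absurd (hc i).2 (by simp [hi])

/-- Pairs of smooth families of orthogonal complex structures whose `r`-th characteristic class vanishes for
elementary reasons outside the ball of radius `M`. -/
structure IsSeed (r : ℕ) (M : ℝ) (R : Fin 2 → V → OCMat m) : Prop where
  smooth : ∀ a, ContDiff ℝ ∞ (R a)
  mem : ∀ a y, R a y ∈ OCS (Fin m ⊕ Fin m)
  locEq : ∀ y, M < ‖y‖ → (∀ a, LocEq (R a) (J0 m) y) ∨ m < r ∧ (LocEq (R 0) (J0 m) y ∨ LocEq (R 1) (J0 m) y)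

variable {M : ℝ} {R : Fin 2 → V → OCMat m}

theorem IsSeed.newton_eq_zero (h : IsSeed r M R) (hr : r ≠ 0) {X : Type} [NormedAddCommGroup X] [NormedSpace ℝ X]
    {T : X → V} (hT : ContDiff ℝ ∞ T) {β : κ → X} {zz : κ → κ → Z} {x : X} (hx : M < ‖T x‖) :
    newton (fun k => ∑ a, chernForm zz β (fun x => eigenProj (R a (T x))) k x) r = 0 := by
  have hc := hT.continuous.continuousAt (x := x)
  rcases h.locEq _ hx with hx | ⟨hm, hx⟩
  · exact newton_sum_eq_zero_of_locEq (A := fun a x => R a (T x)) (fun a => (hx a).comp hc) hr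
  · exact newton_sum_eq_zero_of_or (A := fun a x => R a (T x)) (fun a => (h.smooth a).comp hT)
      (fun a x => h.mem a _) (hx.imp (·.comp hc) (·.comp hc)) hm

theorem IsSeed.charge_rescale (h : IsSeed r M R) (ho : OddGen e zz) (hr : r ≠ 0) (c : V) {s : ℝ} (hs : 1 ≤ s) :
    charge μ ℓ e zz b r (fun a x => R a (s • (x - c))) = charge μ ℓ e zz b r R := by
  let T : V × ℝ → V := fun y => (1 + smoothTransition y.2 * (s - 1)) • (y.1 - smoothTransition y.2 • c)
  have h1 : ContDiff ℝ ∞ fun y : V × ℝ => smoothTransition y.2 :=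
    (smoothTransition.contDiff (n := ⊤)).comp contDiff_snd
  have hT : ContDiff ℝ ∞ T :=
    (contDiff_const.add (h1.mul contDiff_const)).smul (contDiff_fst.sub (h1.smul contDiff_const))
  have key := ho.formInt_newton_homotopy_of_vanish (μ := μ) (ℓ := ℓ) (b := b) (r := r)
    (P := fun a y => eigenProj (R a (T y))) (fun a => contDiff_eigenProj ((h.smooth a).comp hT))
    (fun a y => eigenProj_mul_self (h.mem a _)) (isCompact_closedBall (0 : V) (M + ‖c‖))
    (fun x hx t => h.newton_eq_zero hr hT (by
      have h2 : M + ‖c‖ < ‖x‖ := by simpa using hx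
      have h3 := norm_sub_norm_le x (smoothTransition t • c)
      have h4 : ‖smoothTransition t • c‖ ≤ ‖c‖ := by
        rw [norm_smul, Real.norm_of_nonneg (smoothTransition.nonneg t)]
        exact mul_le_of_le_one_left (norm_nonneg c) (smoothTransition.le_one t)
      have h5 : 1 ≤ 1 + smoothTransition t * (s - 1) := by
        linarith [mul_nonneg (smoothTransition.nonneg t) (sub_nonneg.2 hs)]
      calc M < ‖x - smoothTransition t • c‖ := by linarith
        _ ≤ ‖T (x, t)‖ := by
          rw [norm_smul, Real.norm_of_nonneg (by linarith)]
          exact le_mul_of_one_le_left (norm_nonneg _) h5)) 1 0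
  simpa [T, charge] using key

/-- A cutoff function near the center of the unit cube. -/
noncomputable def bump : ContDiffBump (0 : Fin 6 → ℝ) := ⟨1 / 6, 1 / 3, by norm_num, by norm_num⟩

variable (Φ) in
/-- The map centering `V` and collapsing the `W`-direction away from the center of the unit cube. -/
noncomputable def collapse (s : ℝ) (x : V) : V :=
  s • Φ.symm ((Φ x).1 - fun _ => 1 / 2, bump ((Φ x).1 - fun _ => 1 / 2) • (Φ x).2)

theorem contDiff_collapse (s : ℝ) : ContDiff ℝ ∞ (collapse Φ s) := by
  have h2 : ContDiff ℝ ∞ fun x : V => (Φ x).1 - fun _ => (1 / 2 : ℝ) :=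
    (contDiff_fst.comp Φ.contDiff).sub contDiff_const
  have h3 : ContDiff ℝ ∞ fun x : V => (Φ x).2 := contDiff_snd.comp Φ.contDiff
  exact contDiff_const.smul (Φ.symm.contDiff.comp (h2.prodMk ((bump.contDiff.comp h2).smul h3)))

theorem bump_eq_one {v : Fin 6 → ℝ} (hv : ‖v‖ ≤ 1 / 6) : bump v = 1 :=
  bump.one_of_mem_closedBall (by simpa [bump] using hv)

theorem bump_eq_zero {v : Fin 6 → ℝ} (hv : 1 / 3 ≤ ‖v‖) : bump v = 0 :=
  bump.zero_of_le_dist (by simpa [bump] using hv)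

theorem exists_lt_norm_smul_symm (M : ℝ) : ∃ S : ℝ, ∀ s ≥ S, ∀ v w, (1 / 6 ≤ ‖v‖ ∨ 1 / 6 ≤ ‖w‖) →
    M < ‖s • Φ.symm (v, w)‖ := by
  set N := ‖(Φ : V →L[ℝ] (Fin 6 → ℝ) × W)‖ + 1
  have hN : 0 < N := by positivity
  refine ⟨6 * N * (|M| + 1), fun s hs v w hvw => ?_⟩
  have hs0 : 0 ≤ s := le_trans (by positivity) hs
  have h1 : 1 / 6 ≤ ‖((v, w) : (Fin 6 → ℝ) × W)‖ := by rw [Prod.norm_mk]; exact le_max_iff.2 hvw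
  have h2 := (Φ : V →L[ℝ] (Fin 6 → ℝ) × W).le_opNorm (Φ.symm (v, w))
  rw [ContinuousLinearEquiv.coe_coe, ContinuousLinearEquiv.apply_symm_apply] at h2
  have h3 : 1 / 6 ≤ N * ‖Φ.symm (v, w)‖ := (h1.trans h2).trans
    (mul_le_mul_of_nonneg_right (by simp [N]) (norm_nonneg _))
  rw [norm_smul, Real.norm_of_nonneg hs0]
  calc M < |M| + 1 := by linarith [le_abs_self M]
    _ = 6 * (|M| + 1) * (1 / 6) := by ring
    _ ≤ 6 * (|M| + 1) * (N * ‖Φ.symm (v, w)‖) := by gcongr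
    _ = 6 * N * (|M| + 1) * ‖Φ.symm (v, w)‖ := by ring
    _ ≤ _ := by gcongr

theorem IsSeed.exists_isData (h : IsSeed r M R) (ho : OddGen e zz) (hr : r ≠ 0) {D : Set W}
    (hN : ∀ a v, M < ‖v‖ → R a (Φ.symm (v, 0)) = J0 m)
    (hD : (∀ w ∈ D, 1 / 2 < ‖w‖) ∨ ∀ y, LocEq (R 1) (J0 m) y) :
    ∃ S : ℝ, ∀ s ≥ S, IsData Φ D (fun a x => R a (collapse Φ s x)) ∧
      charge μ ℓ e zz b r (fun a x => R a (collapse Φ s x)) = charge μ ℓ e zz b r R := by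
  obtain ⟨S, hS⟩ := exists_lt_norm_smul_symm (Φ := Φ) M
  refine ⟨max (max S 1) (3 * M), fun s hs => ⟨⟨fun a => (h.smooth a).comp (contDiff_collapse s), fun a x => h.mem a _,
    ⟨{v | ‖v - fun _ => 1 / 2‖ ≤ 1 / 3}, isClosed_le (by fun_prop) continuous_const, fun v hv i => ?_, fun a x hx => ?_⟩,
    fun x hx => ?_⟩, ?_⟩⟩
  · have h1 := (norm_le_pi_norm (v - fun _ => (1 / 2 : ℝ)) i).trans hv
    rw [Pi.sub_apply, Real.norm_eq_abs, abs_le] at h1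
    constructor <;> linarith [h1.1, h1.2]
  · rw [Set.mem_setOf_eq, not_le] at hx
    rw [collapse, bump_eq_zero hx.le, zero_smul, ← map_smul, Prod.smul_mk, smul_zero]
    refine hN a _ ?_
    have h2 : 1 ≤ s := ((le_max_right _ _).trans (le_max_left _ _)).trans hs
    have h3 : 3 * M ≤ s := (le_max_right _ _).trans hs
    rw [norm_smul, Real.norm_of_nonneg (by linarith)]
    nlinarith
  · rcases hD with hD | hD
    · have h1 : M < ‖collapse Φ s x‖ := hS s (((le_max_left _ _).trans (le_max_left _ _)).trans hs) _ _ (by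
        by_contra! h1
        have h2 := hD _ hx
        rw [bump_eq_one h1.1.le, one_smul] at h1
        linarith [h1.2])
      have hc := (contDiff_collapse (Φ := Φ) s).continuous.continuousAt (x := x)
      rcases h.locEq _ h1 with h2 | h2
      · exact .inl ((h2 0).comp hc)
      · exact h2.2.imp (·.comp hc) (·.comp hc)
    · exact .inr ((hD _).comp (contDiff_collapse s).continuous.continuousAt)
  · set c : V := Φ.symm (fun _ => 1 / 2, 0)
    have hs1 : 1 ≤ s := ((le_max_right _ _).trans (le_max_left _ _)).trans hs
    have hsS : S ≤ s := ((le_max_left _ _).trans (le_max_left _ _)).trans hs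
    have hc : ∀ x, x - c = Φ.symm ((Φ x).1 - fun _ => 1 / 2, (Φ x).2) := fun x => by
      apply Φ.injective
      rw [map_sub, ContinuousLinearEquiv.apply_symm_apply, ContinuousLinearEquiv.apply_symm_apply]
      simp [Prod.ext_iff]
    rw [← h.charge_rescale ho hr c hs1]
    refine congrArg (formInt μ ℓ e) (funext fun x => ?_)
    by_cases hx : ‖(Φ x).1 - fun _ => (1 / 2 : ℝ)‖ < 1 / 6
    · refine newton_congr _ _ _ fun k _ _ => sum_congr rfl fun a _ => chernForm_congr ?_ k
      have h1 : Continuous fun x : V => ‖(Φ x).1 - fun _ => (1 / 2 : ℝ)‖ := by fun_prop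
      filter_upwards [(isOpen_lt h1 continuous_const).mem_nhds hx] with y hy
      rw [collapse, bump_eq_one (le_of_lt hy), one_smul, hc]
    · rw [not_lt] at hx
      rw [h.newton_eq_zero hr (contDiff_collapse s) (hS s hsS _ _ (.inl hx)),
        h.newton_eq_zero hr (T := fun x => s • (x - c)) (contDiff_const.smul (contDiff_id.sub contDiff_const))
          (by rw [hc]; exact hS s hsS _ _ (.inl hx))]

theorem chernForm_comp_clm {Z κ ι X X' : Type} [NormedCommRing Z] [NormedAlgebra ℂ Z] [Fintype κ] [Fintype ι]
    [DecidableEq ι] [NormedAddCommGroup X] [NormedSpace ℝ X] [NormedAddCommGroup X'] [NormedSpace ℝ X']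
    {zz : κ → κ → Z} {β : κ → X} {P : X' → Matrix ι ι ℂ} (hP : ContDiff ℝ ∞ P) (T : X →L[ℝ] X') (k : ℕ) (x : X) :
    chernForm zz β (fun x => P (T x)) k x = chernForm zz (fun a => T (β a)) P k (T x) := by
  have h1 : partials (fun x => P (T x)) β x = partials P (fun a => T (β a)) (T x) := by
    funext a
    have h2 := ((hP.differentiable (by simp) (T x)).hasFDerivAt.comp x T.hasFDerivAt).fderiv
    exact congrArg (fun L : X →L[ℝ] _ => L (β a)) h2
  rw [chernForm, h1, chernForm]

theorem exists_single_seed (hm : 3 < m) : ∃ (ℓ : GrA (Fin 3) →ₗ[ℂ] ℂ) (M : ℝ)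
    (R : Fin 2 → (Fin 3 × Bool → ℝ) → OCMat m), IsSeed 3 M R ∧
    (∀ y, LocEq (R 1) (J0 m) y) ∧ charge MeasureTheory.volume ℓ grE grZZ (fun c => Pi.single c 1) 3 R ≠ 0 := by
  obtain ⟨ℓ, hℓ⟩ := exists_gr_functional (L := Fin 3)
  obtain ⟨α, hα, hαm, ⟨K, hK, hαK⟩, hc⟩ := oddGen_gr.exists_charged (μ := MeasureTheory.volume) (ℓ := ℓ) (i := 3) (g := id)
    (b := fun c => Pi.single c 1) (by decide) Function.injective_id (fun _ => rfl) (fun a ha => absurd ⟨a, rfl⟩ ha)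
    (by rw [top] at hℓ; simpa using hℓ ▸ one_ne_zero) hm
  obtain ⟨M, hM⟩ := hK.isBounded.exists_norm_le
  have h1 : ∀ y, LocEq (fun _ => J0 m) (J0 m) y := fun (y : Fin 3 × Bool → ℝ) => .rfl
  refine ⟨ℓ, M, ![α, fun _ => J0 m], ⟨fun a => ?_, fun a y => ?_, fun y hy => .inl fun a => ?_⟩, h1, ?_⟩
  · fin_cases a
    exacts [hα, contDiff_const]
  · fin_cases a
    exacts [hαm y, J0_mem m]
  · fin_cases a
    · filter_upwards [hK.isClosed.isOpen_compl.mem_nhds fun h => hy.not_ge (hM y h)] with x hx using hαK x hx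
    · exact h1 y
  · convert hc using 1
    refine congrArg (formInt _ ℓ grE) (funext fun v => newton_congr _ _ _ fun k hk _ => ?_)
    rw [Fin.sum_univ_two]
    exact (congrArg _ ((h1 v).chernForm_eq_zero (by omega))).trans (add_zero _)

theorem exists_double_seed {i j : ℕ} (hi : Odd i) (hj : Odd j) (him : i < m) (hjm : j < m) (hr : m < i + j) :
    ∃ (ℓ : GrA (Fin i ⊕ Fin j) →ₗ[ℂ] ℂ) (b : (Fin i ⊕ Fin j) × Bool → (Fin i × Bool → ℝ) × (Fin j × Bool → ℝ)) (M : ℝ)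
    (R : Fin 2 → (Fin i × Bool → ℝ) × (Fin j × Bool → ℝ) → OCMat m),
    IsSeed (i + j) M R ∧ (∀ y, M < ‖y.1‖ → R 0 y = J0 m) ∧ (∀ y, M < ‖y.2‖ → R 1 y = J0 m) ∧
    charge MeasureTheory.volume ℓ grE grZZ b (i + j) R ≠ 0 := by
  obtain ⟨ℓ, hℓ⟩ := exists_gr_functional (L := Fin i ⊕ Fin j)
  let b : (Fin i ⊕ Fin j) × Bool → (Fin i × Bool → ℝ) × (Fin j × Bool → ℝ) := fun a =>
    a.1.elim (fun l => (Pi.single (l, a.2) 1, 0)) (fun l => (0, Pi.single (l, a.2) 1))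
  let S₁ : Finset (Fin i ⊕ Fin j) := Finset.univ.map .inl
  let S₂ : Finset (Fin i ⊕ Fin j) := Finset.univ.map .inr
  have hS : top grZZ S₁ * top grZZ S₂ = top grZZ (Finset.univ : Finset (Fin i ⊕ Fin j)) := by
    simp only [top, S₁, S₂, Finset.prod_map, Fintype.prod_sum_type]; rfl
  let ℓ₁ := ℓ ∘ₗ LinearMap.mulRight ℂ (algebraMap (GrZ (Fin i ⊕ Fin j)) _ (top grZZ S₂))
  let ℓ₂ := ℓ ∘ₗ LinearMap.mulRight ℂ (algebraMap (GrZ (Fin i ⊕ Fin j)) _ (top grZZ S₁))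
  have h₁ : ℓ₁ (grE none * algebraMap _ _ (top grZZ S₁)) = 1 := by
    rw [← hℓ, ← hS, RingHom.map_mul, ← mul_assoc]; rfl
  have h₂ : ℓ₂ (grE none * algebraMap _ _ (top grZZ S₂)) = 1 := by
    rw [← hℓ, ← hS, mul_comm, RingHom.map_mul, ← mul_assoc]; rfl
  obtain ⟨α, hα, hαm, ⟨K, hK, hαK⟩, hαc⟩ := oddGen_gr.exists_charged (μ := MeasureTheory.volume) (ℓ := ℓ₁)
    (g := fun c => (Sum.inl c.1, c.2)) (b := fun a => (b a).1) hi (fun c d h => by simpa [Prod.ext_iff] using h)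
    (fun _ => rfl) (by rintro ⟨l | l, c⟩ ha; exacts [absurd ⟨(l, c), rfl⟩ ha, rfl])
    (by rw [top, Finset.prod_map] at h₁; exact h₁ ▸ one_ne_zero) him
  obtain ⟨β, hβ, hβm, ⟨K', hK', hβK⟩, hβc⟩ := oddGen_gr.exists_charged (μ := MeasureTheory.volume) (ℓ := ℓ₂)
    (g := fun c => (Sum.inr c.1, c.2)) (b := fun a => (b a).2) hj (fun c d h => by simpa [Prod.ext_iff] using h)
    (fun _ => rfl) (by rintro ⟨l | l, c⟩ ha; exacts [rfl, absurd ⟨(l, c), rfl⟩ ha])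
    (by rw [top, Finset.prod_map] at h₂; exact h₂ ▸ one_ne_zero) hjm
  obtain ⟨M, hM⟩ := hK.isBounded.exists_norm_le
  obtain ⟨M', hM'⟩ := hK'.isBounded.exists_norm_le
  have hl₁ : ∀ y : (Fin i × Bool → ℝ) × (Fin j × Bool → ℝ), max M M' < ‖y.1‖ → LocEq (fun y => α y.1) (J0 m) y :=
    fun y hy => (hK.isClosed.isOpen_compl.preimage continuous_fst).eventually_mem
      (show y ∈ Prod.fst ⁻¹' Kᶜ from fun h => hy.not_ge ((hM _ h).trans (le_max_left _ _))) |>.mono fun x hx => hαK _ hx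
  have hl₂ : ∀ y : (Fin i × Bool → ℝ) × (Fin j × Bool → ℝ), max M M' < ‖y.2‖ → LocEq (fun y => β y.2) (J0 m) y :=
    fun y hy => (hK'.isClosed.isOpen_compl.preimage continuous_snd).eventually_mem
      (show y ∈ Prod.snd ⁻¹' K'ᶜ from fun h => hy.not_ge ((hM' _ h).trans (le_max_right _ _))) |>.mono fun x hx => hβK _ hx
  refine ⟨ℓ, b, max M M', ![fun y => α y.1, fun y => β y.2], ⟨fun a => ?_, fun a y => ?_, fun y hy => .inr ⟨hr, ?_⟩⟩,
    fun y hy => (hl₁ y hy).self_of_nhds, fun y hy => (hl₂ y hy).self_of_nhds, ?_⟩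
  · fin_cases a
    exacts [hα.comp contDiff_fst, hβ.comp contDiff_snd]
  · fin_cases a
    exacts [hαm _, hβm _]
  · exact (lt_max_iff.1 hy).imp (hl₁ y) (hl₂ y)
  · let p : ℕ → (Fin i × Bool → ℝ) → GrZ (Fin i ⊕ Fin j) := fun k v =>
      chernForm grZZ (vDir fun a => (b a).1) (fun v => eigenProj (α v)) k v
    let q : ℕ → (Fin j × Bool → ℝ) → GrZ (Fin i ⊕ Fin j) := fun k v =>
      chernForm grZZ (vDir fun a => (b a).2) (fun v => eigenProj (β v)) k v
    have hp : ∀ v k, newton (fun k => p k v) k ∈ gr _ grE (gens S₁) k := fun v => newton_mem_gr fun k =>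
      oddGen_gr.chern_mem_gr (fun a ha => by
        rcases a with _ | ⟨l | l, c⟩
        · exact map_zero _
        · exact absurd (by simp [gens, S₁]) ha
        · exact map_zero _) k
    have hq : ∀ v k, newton (fun k => q k v) k ∈ gr _ grE (gens S₂) k := fun v => newton_mem_gr fun k =>
      oddGen_gr.chern_mem_gr (fun a ha => by
        rcases a with _ | ⟨l | l, c⟩
        · exact map_zero _
        · exact map_zero _
        · exact absurd (by simp [gens, S₂]) ha) k
    have hc₁ : S₁.card = i := by simp [S₁]
    have hc₂ : S₂.card = j := by simp [S₂]
    have key : ∀ y : (Fin i × Bool → ℝ) × (Fin j × Bool → ℝ), mulFun ℓ (grE none) (newton (fun k => ∑ a,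
        chernForm grZZ (vDir b) (fun x => eigenProj ((![fun y => α y.1, fun y => β y.2] : Fin 2 → _ → _) a x)) k y)
          (i + j)) = mulFun ℓ₁ (grE none) (newton (fun k => p k y.1) i) *
        mulFun ℓ₂ (grE none) (newton (fun k => q k y.2) j) := fun y => by
      have e1 : (fun k => ∑ a, chernForm grZZ (vDir b)
          (fun x => eigenProj ((![fun y => α y.1, fun y => β y.2] : Fin 2 → _ → _) a x)) k y) =
          (fun k => p k y.1) + fun k => q k y.2 := by
        funext k
        rw [Fin.sum_univ_two]
        have d1 : (fun a => (vDir b a).1) = vDir fun a => (b a).1 := by funext a; cases a <;> rfl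
        have d2 : (fun a => (vDir b a).2) = vDir fun a => (b a).2 := by funext a; cases a <;> rfl
        have e2 := chernForm_comp_clm (zz := grZZ) (β := vDir b) (contDiff_eigenProj hα)
          (ContinuousLinearMap.fst ℝ _ (Fin j × Bool → ℝ)) k y
        have e3 := chernForm_comp_clm (zz := grZZ) (β := vDir b) (contDiff_eigenProj hβ)
          (ContinuousLinearMap.snd ℝ (Fin i × Bool → ℝ) _) k y
        simp only [ContinuousLinearMap.coe_fst', ContinuousLinearMap.coe_snd', d1, d2] at e2 e3
        exact congrArg₂ (· + ·) e2 e3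
      rw [e1, newton_add, sum_eq_single (i, j) (fun ab hab hne => ?_) (fun h => absurd (by simp) h)]
      · obtain ⟨c, hc⟩ := oddGen_gr.gr_top (S := S₁) (by rw [hc₁]; exact hp y.1 i)
        obtain ⟨d, hd⟩ := oddGen_gr.gr_top (S := S₂) (by rw [hc₂]; exact hq y.2 j)
        rw [hc, hd, smul_mul_smul_comm, hS, map_smul, map_smul, map_smul, mulFun_apply, mulFun_apply, mulFun_apply,
          h₁, h₂, hℓ]
        simp
      · rw [Finset.HasAntidiagonal.mem_antidiagonal] at hab
        by_cases h : i < ab.1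
        · rw [oddGen_gr.gr_eq_zero (by rw [hc₁]; exact h) (hp y.1 ab.1), zero_mul]
        · have : j < ab.2 := by
            rcases ab with ⟨a, b⟩
            simp only [ne_eq, Prod.mk.injEq] at *
            omega
          rw [oddGen_gr.gr_eq_zero (by rw [hc₂]; exact this) (hq y.2 ab.2), mul_zero]
    rw [charge, formInt]
    simp only [key]
    exact (integral_prod_mul (fun v => mulFun ℓ₁ (grE none) (newton (fun k => p k v) i))
      fun v => mulFun ℓ₂ (grE none) (newton (fun k => q k v) j)).trans_ne (mul_ne_zero hαc hβc)

theorem exists_splitting {A B W : Type} [NormedAddCommGroup A] [NormedSpace ℝ A] [FiniteDimensional ℝ A]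
    [NormedAddCommGroup B] [NormedSpace ℝ B] [FiniteDimensional ℝ B]
    [NormedAddCommGroup W] [NormedSpace ℝ W] [FiniteDimensional ℝ W]
    (hA : 7 ≤ Module.finrank ℝ A) (hB : 7 ≤ Module.finrank ℝ B)
    (hW : Module.finrank ℝ A + Module.finrank ℝ B = 6 + Module.finrank ℝ W) :
    ∃ (Φ : (A × B) ≃L[ℝ] (Fin 6 → ℝ) × W) (w₀ : W) (δ : ℝ), ‖w₀‖ = 1 ∧ 0 < δ ∧ ∀ v c,
      δ * max ‖v‖ |c| ≤ ‖(Φ.symm (v, c • w₀)).1‖ ∧ δ * max ‖v‖ |c| ≤ ‖(Φ.symm (v, c • w₀)).2‖ := by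
  have h7 : Module.finrank ℝ ((Fin 6 → ℝ) × ℝ) = 7 := by simp
  have hex : ∀ {X : Type} [NormedAddCommGroup X] [NormedSpace ℝ X] [FiniteDimensional ℝ X],
      7 ≤ Module.finrank ℝ X → ∃ ψ : (Fin 6 → ℝ) × ℝ →ₗ[ℝ] X, Function.Injective ψ ∧
        ∃ δ > (0 : ℝ), ∀ x, δ * ‖x‖ ≤ ‖ψ x‖ := by
    intro X _ _ _ hX
    obtain ⟨ψ, hψ⟩ := finrank_le_iff_exists_linearMap.1 (h7.trans_le hX)
    obtain ⟨K, hK, hKψ⟩ := ψ.exists_antilipschitzWith (LinearMap.ker_eq_bot.2 hψ)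
    refine ⟨ψ, hψ, (K : ℝ)⁻¹, by positivity, fun x => ?_⟩
    rw [inv_mul_le_iff₀ (by positivity)]
    exact hKψ.le_mul_norm (map_zero ψ) x
  obtain ⟨ψ, hψ, δ, hδ, hψδ⟩ := hex hA
  obtain ⟨ψ', -, δ', hδ', hψδ'⟩ := hex hB
  let χ := ψ.prod ψ'
  have hχ : Function.Injective χ := fun x y h => hψ (Prod.ext_iff.1 h).1
  obtain ⟨p, hp⟩ := Submodule.exists_isCompl (LinearMap.range χ)
  let η : (((Fin 6 → ℝ) × ℝ) × p) ≃ₗ[ℝ] A × B :=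
    ((LinearEquiv.ofInjective χ hχ).prodCongr (.refl ℝ p)).trans (Submodule.prodEquivOfIsCompl _ _ hp)
  have hd : Module.finrank ℝ (ℝ × p) = Module.finrank ℝ W := by
    have h1 := η.finrank_eq
    rw [Module.finrank_prod, h7, Module.finrank_prod] at h1
    rw [Module.finrank_prod, Module.finrank_self]
    omega
  let θ := LinearEquiv.ofFinrankEq (ℝ × p) W hd
  let Φ : (A × B) ≃ₗ[ℝ] (Fin 6 → ℝ) × W :=
    η.symm.trans ((LinearEquiv.prodAssoc ℝ _ _ _).trans ((LinearEquiv.refl ℝ _).prodCongr θ))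
  set N := ‖θ (1, 0)‖
  have hN : 0 < N := norm_pos_iff.2 fun h => by simpa using (map_eq_zero_iff θ θ.injective).1 h
  have hs : ∀ v c, Φ.symm (v, c • N⁻¹ • θ (1, 0)) = χ (v, c * N⁻¹) := fun v c => by
    have h1 : Φ.symm (v, c • N⁻¹ • θ (1, 0)) = η ((v, (θ.symm (c • N⁻¹ • θ (1, 0))).1), (θ.symm (c • N⁻¹ • θ (1, 0))).2) := rfl
    rw [h1, map_smul, map_smul, θ.symm_apply_apply]
    simp [η]
  refine ⟨Φ.toContinuousLinearEquiv, N⁻¹ • θ (1, 0), min δ δ' * min 1 N⁻¹, ?_, by positivity, fun v c => ?_⟩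
  · rw [norm_smul, norm_inv, norm_norm, inv_mul_cancel₀ hN.ne']
  · have h1 : min 1 N⁻¹ * max ‖v‖ |c| ≤ ‖((v, c * N⁻¹) : (Fin 6 → ℝ) × ℝ)‖ := by
      rw [Prod.norm_mk, mul_max_of_nonneg _ _ (by positivity), norm_mul, Real.norm_eq_abs, Real.norm_of_nonneg (by positivity), mul_comm |c|]
      gcongr
      · exact mul_le_of_le_one_left (norm_nonneg v) (min_le_left _ _)
      · exact min_le_right _ _
    have h2 := mul_le_mul_of_nonneg_left h1 (by positivity : 0 ≤ min δ δ')
    rw [← mul_assoc] at h2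
    have h3 : Φ.toContinuousLinearEquiv.symm (v, c • N⁻¹ • θ (1, 0)) = χ (v, c * N⁻¹) := hs v c
    rw [h3]
    exact ⟨(h2.trans (by gcongr; exact min_le_left _ _)).trans (hψδ _),
      (h2.trans (by gcongr; exact min_le_right _ _)).trans (hψδ' _)⟩

theorem exists_subgroup_of_independent {G : Type} [Group G] {x y : G} (hxy : Commute x y)
    (h : ∀ a b : ℤ, x ^ a * y ^ b = 1 → a = 0 ∧ b = 0) :
    ∃ H : Subgroup G, Nonempty (H ≃* Multiplicative ℤ × Multiplicative ℤ) := by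
  let F := (zpowersHom G x).noncommCoprod (zpowersHom G y) fun a b => hxy.zpow_zpow _ _
  have hF : Function.Injective F := (injective_iff_map_eq_one F).2 fun ab hab => by
    have h1 := h ab.1.toAdd ab.2.toAdd hab
    exact Prod.ext h1.1 h1.2
  exact ⟨F.range, ⟨(MonoidHom.ofInjective hF).symm⟩⟩

theorem IsSeed.mono {M' : ℝ} (h : IsSeed r M R) (hM : M ≤ M') : IsSeed r M' R :=
  ⟨h.smooth, h.mem, fun y hy => h.locEq y (hM.trans_lt hy)⟩

/-- The element `z` is represented by a loop which is constant at the point `t`. -/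
def IsConstAt (t : Y) (z : π_ 6 C(Y, GammaPlus m) f) : Prop :=
  ∃ Z : GenLoop (Fin 6) C(Y, GammaPlus m) f, (Quotient.mk _ Z : π_ 6 C(Y, GammaPlus m) f) = z ∧ ∀ u, Z u t = f t

theorem IsConstAt.inv {t : Y} (h : IsConstAt t z) : IsConstAt t z⁻¹ := by
  obtain ⟨Z, rfl, hZ⟩ := h
  exact ⟨GenLoop.symmAt 0 Z, HomotopyGroup.inv_spec.symm, fun u => hZ _⟩

theorem IsConstAt.hasCharge {t : Y} (h : IsConstAt t z) (hr : r ≠ 0)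
    (hf : ∀ t, ((f t : Gamma m) : OCMat m) = g t * J0 m * (g t)ᵀ) :
    HasCharge μ ℓ e zz b Φ D {t} w g r z 0 := by
  obtain ⟨Z, hz, hZ⟩ := h
  refine ⟨fun _ _ => J0 m, ⟨.const, Z, hz, fun u s hs => ?_⟩, charge_const hr⟩
  rw [Set.mem_singleton_iff.1 hs, hZ, hf, add_sub_cancel_right]

/-- Two elements detected by two charges, the second one having zero charge with respect to the first, are
independent. -/
theorem independent [Subsingleton W] [CompactSpace Y] [LocallyCompactSpace Y]
    (ho : OddGen e zz) (hr : r ≠ 0) (hg : Continuous g) (hgg : ∀ t, (g t)ᵀ * g t = 1)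
    (hf : ∀ t, ((f t : Gamma m) : OCMat m) = g t * J0 m * (g t)ᵀ)
    {x y : π_ 6 C(Y, GammaPlus m) f} {t₀ : Y} {c : ℂ} (hc : c ≠ 0)
    (hx : HasCharge μ ℓ e zz b Φ Set.univ {t₀} (fun _ => 0) g r x c) (hy : IsConstAt t₀ y)
    (hy' : ∀ p : ℕ, y ^ p = 1 → p = 0) (i j : ℤ) (hij : x ^ i * y ^ j = 1) : i = 0 ∧ j = 0 := by
  have hC : ∀ w ∉ (Set.univ : Set W), w ∈ (Set.univ : Set W) ∧ m < r := fun w hw => absurd trivial hw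
  have hCc : IsCompact (Set.univ : Set W) := Set.subsingleton_univ.isCompact
  have key : ∀ (p q : ℕ) (y), IsConstAt t₀ y → x ^ p * y ^ q = 1 → p = 0 := fun p q y hy h => by
    have h1 := (hx.pow ho hCc hC hr (fun t _ => hf t) p).mul ho hCc hC hr
      ((hy.hasCharge (μ := μ) (ℓ := ℓ) (b := b) hr hf).pow ho hCc hC hr (fun t _ => hf t) q)
    rw [h] at h1
    simpa [hc] using h1.eq_zero_of_subsingleton ho hr hg hgg hf
  have hi : i = 0 := by
    obtain ⟨p, rfl | rfl⟩ := i.eq_nat_or_neg <;> obtain ⟨q, rfl | rfl⟩ := j.eq_nat_or_neg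
    · rw [key p q y hy (by simpa using hij), Nat.cast_zero]
    · rw [key p q y⁻¹ hy.inv (by simpa using hij), Nat.cast_zero]
    · rw [key p q y⁻¹ hy.inv (by rw [inv_pow, mul_comm, ← inv_eq_one]; simpa using hij), Nat.cast_zero, neg_zero]
    · rw [key p q y hy (by rw [mul_comm, ← inv_eq_one]; simpa using hij), Nat.cast_zero, neg_zero]
  subst hi
  refine ⟨rfl, ?_⟩
  obtain ⟨q, rfl | rfl⟩ := j.eq_nat_or_neg
  · rw [hy' q (by simpa using hij), Nat.cast_zero]
  · rw [hy' q (by simpa using hij), Nat.cast_zero, neg_zero]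

theorem exists_single_charge (hm : 3 < m) (hg : Continuous g) (hgg : ∀ t, (g t)ᵀ * g t = 1)
    (hf : ∀ t, ((f t : Gamma m) : OCMat m) = g t * J0 m * (g t)ᵀ) :
    ∃ (ℓ : GrA (Fin 3) →ₗ[ℂ] ℂ) (Φ : (Fin 3 × Bool → ℝ) ≃L[ℝ] (Fin 6 → ℝ) × (Fin 0 → ℝ))
      (x : π_ 6 C(Y, GammaPlus m) f) (c : ℂ), c ≠ 0 ∧ ∀ t, HasCharge MeasureTheory.volume ℓ grE grZZ
        (fun a => Pi.single a 1) Φ Set.univ {t} (fun _ => 0) g 3 x c := by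
  obtain ⟨ℓ, M, R, hR, hR1, hc⟩ := exists_single_seed hm
  let Φ : (Fin 3 × Bool → ℝ) ≃L[ℝ] (Fin 6 → ℝ) × (Fin 0 → ℝ) := .ofFinrankEq (by simp)
  obtain ⟨S, hS⟩ := exists_lt_norm_smul_symm (Φ := Φ) M
  have hN : ∀ a v, max M (max S 1) < ‖v‖ → R a (Φ.symm (v, 0)) = J0 m := fun a v hv => by
    have hv1 : ‖v‖ ≠ 0 := by linarith [(le_max_right S 1).trans (le_max_right M _)]
    have h1 := hS ‖v‖ (((le_max_left S 1).trans (le_max_right M _)).trans hv.le) (‖v‖⁻¹ • v) 0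
      (.inl (by rw [norm_smul, norm_inv, norm_norm, inv_mul_cancel₀ hv1]; norm_num))
    rw [← map_smul, Prod.smul_mk, smul_inv_smul₀ hv1, smul_zero] at h1
    exact ((hR.locEq _ h1).resolve_right fun h => hm.not_gt h.1) a |>.self_of_nhds
  obtain ⟨S', hS'⟩ := (hR.mono (le_max_left M (max S 1))).exists_isData (μ := MeasureTheory.volume) (ℓ := ℓ)
    (b := fun a => Pi.single a 1) (D := Set.univ) oddGen_gr (by norm_num) hN (.inr hR1)
  obtain ⟨h1, h2⟩ := hS' S' le_rfl
  obtain ⟨x, hx, Z, hZ, hZu⟩ := h1.exists_isRep hg hgg hf continuous_const fun _ => Set.mem_univ _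
  exact ⟨ℓ, Φ, x, _, hc, fun t => ⟨_, ⟨hx, Z, hZ, fun u s _ => hZu u s trivial⟩, h2⟩⟩

instance {i j : ℕ} : (MeasureTheory.volume : Measure ((Fin i × Bool → ℝ) × (Fin j × Bool → ℝ))).IsAddHaarMeasure := by
  rw [Measure.volume_eq_prod]
  exact Measure.prod.instIsAddHaarMeasure _ _

theorem exists_double_charge {i j n : ℕ} (hi : Odd i) (hj : Odd j) (him : i < m) (hjm : j < m) (hr : m < i + j)
    (hi4 : 4 ≤ i) (hj4 : 4 ≤ j) (hn : i * 2 + j * 2 = 6 + (n + 1)) {f : C(Sph n, GammaPlus m)}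
    {g : Sph n → OCMat m}
    (hg : Continuous g) (hgg : ∀ t, (g t)ᵀ * g t = 1)
    (hf : ∀ t, ((f t : Gamma m) : OCMat m) = g t * J0 m * (g t)ᵀ) :
    ∃ (ℓ : GrA (Fin i ⊕ Fin j) →ₗ[ℂ] ℂ) (b : (Fin i ⊕ Fin j) × Bool → (Fin i × Bool → ℝ) × (Fin j × Bool → ℝ))
      (Φ : ((Fin i × Bool → ℝ) × (Fin j × Bool → ℝ)) ≃L[ℝ] (Fin 6 → ℝ) × EuclideanSpace ℝ (Fin (n + 1)))
      (y : π_ 6 C(Sph n, GammaPlus m) f) (c : ℂ) (t : Sph n), c ≠ 0 ∧ IsConstAt t y ∧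
        HasCharge MeasureTheory.volume ℓ grE grZZ b Φ {w | 1 / 2 < ‖w‖} Set.univ Subtype.val g (i + j) y c := by
  obtain ⟨ℓ, b, M, R, hR, hR0, hR1, hc⟩ := exists_double_seed hi hj him hjm hr
  obtain ⟨Φ, w₀, δ, hw₀, hδ, hΦ⟩ := exists_splitting (A := Fin i × Bool → ℝ) (B := Fin j × Bool → ℝ)
    (W := EuclideanSpace ℝ (Fin (n + 1))) (by simp; omega) (by simp; omega) (by simpa using hn)
  have hRJ : ∀ a v (c : ℝ), M < ‖(Φ.symm (v, c • w₀)).1‖ → M < ‖(Φ.symm (v, c • w₀)).2‖ →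
      R a (Φ.symm (v, c • w₀)) = J0 m := fun a v (c : ℝ) h1 h2 => by
    fin_cases a
    exacts [hR0 _ h1, hR1 _ h2]
  have hN : ∀ a v, max M (M / δ) < ‖v‖ → R a (Φ.symm (v, 0)) = J0 m := fun a v hv => by
    have h1 := (div_lt_iff₀' hδ).1 ((le_max_right _ _).trans_lt hv)
    have h2 := hΦ v 0
    rw [abs_zero, max_eq_left (norm_nonneg v)] at h2
    simpa using hRJ a v 0 (h1.trans_le h2.1) (h1.trans_le h2.2)
  obtain ⟨S, hS⟩ := (hR.mono (le_max_left M (M / δ))).exists_isData (μ := MeasureTheory.volume) (ℓ := ℓ)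
    (b := b) (D := {w | 1 / 2 < ‖w‖}) oddGen_gr (by omega) hN (.inl fun w hw => hw)
  set s := max S (6 * (|M| + 1) / δ)
  obtain ⟨h1, h2⟩ := hS s (le_max_left _ _)
  have hs : 6 * (|M| + 1) ≤ s * δ := (div_le_iff₀ hδ).1 (le_max_right _ _)
  have hs0 : 0 ≤ s := le_trans (by positivity) (le_max_right S _)
  obtain ⟨y, hy, Z, hZ, hZu⟩ := h1.exists_isRep hg hgg hf continuous_subtype_val fun t => by
    rw [Set.mem_setOf_eq, mem_sphere_zero_iff_norm.1 t.2]; norm_num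
  refine ⟨ℓ, b, Φ, y, _, ⟨w₀, mem_sphere_zero_iff_norm.2 hw₀⟩, hc, ⟨Z, hZ, fun u => ?_⟩, _, ⟨hy, Z, hZ, hZu⟩, h2⟩
  have h3 : ∀ a, R a (collapse Φ s (Φ.symm (fun i => (u i : ℝ), w₀))) = J0 m := fun a => by
    rw [collapse, ContinuousLinearEquiv.apply_symm_apply]
    dsimp only
    set v : Fin 6 → ℝ := (fun i => (u i : ℝ)) - fun _ => 1 / 2
    have h4 : 1 / 6 ≤ max ‖v‖ |bump v| := by
      rw [le_max_iff]
      refine (le_total (1 / 6) ‖v‖).imp_right fun h => ?_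
      rw [bump_eq_one h]
      norm_num
    have h5 : M < s * (δ * max ‖v‖ |bump v|) := by
      rw [← mul_assoc]
      nlinarith [le_abs_self M, abs_nonneg M]
    have h6 := hΦ (s • v) (s * bump v)
    have h7 : max ‖s • v‖ |s * bump v| = s * max ‖v‖ |bump v| := by
      rw [norm_smul, abs_mul, Real.norm_eq_abs, abs_of_nonneg hs0, mul_max_of_nonneg _ _ hs0]
    rw [h7, mul_left_comm] at h6
    rw [← map_smul, Prod.smul_mk, smul_smul]
    exact hRJ a _ _ (h5.trans_le h6.1) (h5.trans_le h6.2)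
  refine Subtype.ext (Subtype.ext ?_)
  rw [hZu u _ trivial, hf]
  dsimp only
  rw [h3, h3, add_sub_cancel_right]

end

end

end ACS

open ACS

/-- For `n ≥ 6` and every `f ∈ C(S^{4n+1}, Γ_{2n+1}⁺)`, the homotopy group
`π₆(C(S^{4n+1}, Γ_{2n+1}⁺), f)` contains a subgroup isomorphic to `ℤ × ℤ`. -/
theorem stmt12 (n : ℕ) (hn : 6 ≤ n) (f : C(Sph (4 * n + 1), GammaPlus (2 * n + 1))) :
    ∃ H : Subgroup (π_ 6 C(Sph (4 * n + 1), GammaPlus (2 * n + 1)) f),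
      Nonempty (H ≃* Multiplicative ℤ × Multiplicative ℤ) := by
  have : CompactSpace (Sph (4 * n + 1)) := isCompact_iff_compactSpace.1 (isCompact_sphere _ _)
  obtain ⟨g, hg, hgg, hf⟩ := exists_lift n f
  obtain ⟨j, hj⟩ : ∃ j, j + 1 = 2 * n := ⟨2 * n - 1, by omega⟩
  obtain ⟨ℓ, Φ, x, c, hc, hx⟩ := exists_single_charge (m := 2 * n + 1) (by omega) hg hgg hf
  have hodd : Odd j := ⟨n - 1, by omega⟩
  obtain ⟨ℓ', b', Φ', y, c', t, hc', hyt, hy⟩ := exists_double_charge (i := 5) (j := j) (by decide) hodd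
    (by omega) (by omega) (by omega) (by omega) (by omega) (by omega) hg hgg hf
  refine exists_subgroup_of_independent (mul_comm x y)
    (independent oddGen_gr three_ne_zero hg hgg hf hc (hx t) hyt fun p hp => ?_)
  have h1 := hy.pow oddGen_gr (isCompact_closedBall 0 (1 / 2)) (fun w hw => ⟨by simpa using hw, by omega⟩)
    (by omega) (fun t _ => hf t) p
  rw [hp] at h1
  simpa [hc'] using h1.eq_zero_of_sphere oddGen_gr (by omega) ((by decide : Odd 5).add_odd hodd) hg hgg hf
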